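/- (LAN property.) Fix θ₀ = (σ₀,δ₀,α₀) with σ₀ > 0, δ₀ > 0 and α₀ ∈ (0,2), and set Δ_n(θ₀) = u_n(θ₀)ᵀ G_n(θ₀). Then for every compact set K ⊂ ℝ³: (i) for n large enough θ₀ + u_n(θ₀)h lies in the parameter domain (0,∞)×(0,∞)×(0,2) for all h ∈ K, and for every ε > 0, ℙ_n( sup_{h ∈ K} | ln L_n(θ₀ + u_n(θ₀)h) − ln L_n(θ₀) − hᵀ Δ_n(θ₀) + ½ hᵀ I(θ₀) h | > ε ) → 0 as n → ∞; (ii) the law of Δ_n(θ₀) under ℙ_n converges weakly to the centered Gaussian distribution on ℝ³ with covariance matrix I(θ₀), and I(θ₀) is symmetric positive definite. -/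

import Mathlib

open MeasureTheory Filter Set Topology Matrix

noncomputable section

namespace LevyLAN

/-- Standard Gaussian density `φ`. -/
def gauss (y : ℝ) : ℝ := (Real.sqrt (2 * Real.pi))⁻¹ * Real.exp (-(y ^ 2) / 2)

/-- Symmetric `α`-stable density `φ_α`, defined by Fourier inversion. -/
def stableDensity (α z : ℝ) : ℝ :=
  (2 * Real.pi)⁻¹ * ∫ u : ℝ, Real.cos (z * u) * Real.exp (-(|u| ^ α))

/-- `∂_α φ_α`. -/
def stableDensityDalpha (α z : ℝ) : ℝ :=
  -(2 * Real.pi)⁻¹ * ∫ u : ℝ, Real.cos (z * u) * |u| ^ α * Real.log |u| * Real.exp (-(|u| ^ α))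

/-- The operator `(D f) y = (y * f y)' = f y + y * f' y`. -/
def Dop (f : ℝ → ℝ) (y : ℝ) : ℝ := f y + y * deriv f y

/-- `f_α(y, w)`. -/
def fFun (α y w : ℝ) : ℝ := ∫ z : ℝ, gauss (y - w * z) * stableDensity α z

/-- `g_α(y, w)`. -/
def gFun (α y w : ℝ) : ℝ := ∫ z : ℝ, Dop gauss (y - w * z) * stableDensity α z

/-- `h_α(y, w)`. -/
def hFun (α y w : ℝ) : ℝ := ∫ z : ℝ, gauss (y - w * z) * Dop (stableDensity α) z

/-- `k_α(y, w)`. -/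
def kFun (α y w : ℝ) : ℝ := ∫ z : ℝ, gauss (y - w * z) * stableDensityDalpha α z

/-- `c_α`. -/
def cAlpha (α : ℝ) : ℝ :=
  if α = 1 then 1 / Real.pi
  else -(α * (α - 1)) / (2 * Real.Gamma (2 - α) * Real.cos (Real.pi * α / 2))

/-- `w_n(θ) = n^{1/2 - 1/α} δ / σ`. -/
def wn (n : ℕ) (σ δ α : ℝ) : ℝ := (n : ℝ) ^ ((1 : ℝ) / 2 - 1 / α) * δ / σ

/-- `l_α(y, w)` (it depends on `n`). -/
def lFun (n : ℕ) (α y w : ℝ) : ℝ :=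
  ((Real.log n - Real.log (Real.log n)) / (2 * α) - Real.log n / α ^ 2) * hFun α y w
    + kFun α y w

def kappa0 (σ δ α : ℝ) : ℝ := 2 * cAlpha α / (α * (2 - α) ^ (α / 2)) * (δ / σ) ^ α

def kappa1 (σ δ α : ℝ) : ℝ :=
  Real.log (δ / σ) + deriv cAlpha α / cAlpha α - Real.log (2 - α) / 2 - 1 / α

/-- The density `p_{1/n}(y, θ)`, with parameter `θ = (σ, δ, α) : Fin 3 → ℝ`. -/
def pdens (n : ℕ) (θ : Fin 3 → ℝ) (y : ℝ) : ℝ :=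
  Real.sqrt n / θ 0 * fFun (θ 2) (Real.sqrt n * y / θ 0) (wn n (θ 0) (θ 1) (θ 2))

/-- The log-likelihood `ln L_n(θ)`. -/
def logLik (n : ℕ) (θ : Fin 3 → ℝ) (x : Fin n → ℝ) : ℝ :=
  ∑ i, Real.log (pdens n θ (x i))

/-- Partial derivative in the `j`-th parameter coordinate. -/
def pderiv (j : Fin 3) (F : (Fin 3 → ℝ) → ℝ) (θ : Fin 3 → ℝ) : ℝ :=
  deriv (fun t => F (Function.update θ j t)) (θ j)

/-- The score `G_n(θ) = ∇_θ ln L_n(θ)`. -/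
def scoreVec (n : ℕ) (θ : Fin 3 → ℝ) (x : Fin n → ℝ) : Fin 3 → ℝ :=
  fun j => pderiv j (fun θ' => logLik n θ' x) θ

/-- The Hessian matrix `J_n(θ)` of the log-likelihood. -/
def hessMat (n : ℕ) (θ : Fin 3 → ℝ) (x : Fin n → ℝ) : Matrix (Fin 3) (Fin 3) ℝ :=
  Matrix.of fun i j => pderiv i (fun θ' => pderiv j (fun θ'' => logLik n θ'' x) θ') θ

def rate (n : ℕ) (α : ℝ) : ℝ := Real.log n ^ (α / 4) / (n : ℝ) ^ (α / 4)

/-- The rate matrix `u_n(θ)`. -/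
def un (n : ℕ) (θ : Fin 3 → ℝ) : Matrix (Fin 3) (Fin 3) ℝ :=
  !![1 / Real.sqrt n, 0, 0;
     0, rate n (θ 2), -(rate n (θ 2) * (θ 1 / (2 * θ 2)) * (Real.log n - Real.log (Real.log n)));
     0, 0, rate n (θ 2)]

/-- The information matrix `I(θ)`. -/
def Imat (θ : Fin 3 → ℝ) : Matrix (Fin 3) (Fin 3) ℝ :=
  !![2 / θ 0 ^ 2, 0, 0;
     0, θ 2 ^ 2 / θ 1 ^ 2 * kappa0 (θ 0) (θ 1) (θ 2),
        θ 2 / θ 1 * kappa0 (θ 0) (θ 1) (θ 2) * kappa1 (θ 0) (θ 1) (θ 2);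
     0, θ 2 / θ 1 * kappa0 (θ 0) (θ 1) (θ 2) * kappa1 (θ 0) (θ 1) (θ 2),
        kappa0 (θ 0) (θ 1) (θ 2) * (kappa1 (θ 0) (θ 1) (θ 2) ^ 2 + 1 / θ 2 ^ 2)]

/-- `ℙ_n`, the `n`-fold product of the law with Lebesgue density `p_{1/n}(·, θ)`. -/
def Pn (n : ℕ) (θ : Fin 3 → ℝ) : Measure (Fin n → ℝ) :=
  Measure.pi fun _ => MeasureTheory.volume.withDensity fun y => ENNReal.ofReal (pdens n θ y)

/-- The standard Gaussian measure on `ℝ³`. -/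
def stdGauss3 : Measure (Fin 3 → ℝ) :=
  Measure.pi fun _ => ProbabilityTheory.gaussianReal 0 1

/-- Euclidean (Frobenius) norm of a real 3×3 matrix. -/
def frobNorm (M : Matrix (Fin 3) (Fin 3) ℝ) : ℝ := Real.sqrt (∑ i, ∑ j, M i j ^ 2)

/-- Euclidean norm of a vector of `ℝ³`. -/
def vecNorm (v : Fin 3 → ℝ) : ℝ := Real.sqrt (∑ j, v j ^ 2)

/-- The admissible families of functions `ψ_α^{(p)}`. -/
structure IsPsiFamily (ψ : ℝ → ℕ → ℝ → ℝ) : Prop where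
  contDiff : ∀ α ∈ Set.Ioo (0 : ℝ) 2, ∀ p : ℕ, ContDiff ℝ 2 (ψ α p)
  pos : ∀ α ∈ Set.Ioo (0 : ℝ) 2, ∀ p : ℕ, ∀ y : ℝ, 0 < ψ α p y
  even : ∀ α ∈ Set.Ioo (0 : ℝ) 2, ∀ p : ℕ, ∀ y : ℝ, ψ α p (-y) = ψ α p y
  eq_one : ∀ α ∈ Set.Ioo (0 : ℝ) 2, ∀ p : ℕ, ∀ y : ℝ, |y| ≤ 1 → ψ α p y = 1
  eq_tail : ∀ α ∈ Set.Ioo (0 : ℝ) 2, ∀ p : ℕ, ∀ y : ℝ, 3 ≤ |y| →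
    ψ α p y = Real.log |y| ^ p / |y| ^ (α + 1)
  unifBound : ∀ K : Set ℝ, K ⊆ Set.Ioo (0 : ℝ) 2 → IsCompact K → ∀ p : ℕ,
    ∃ c > (0 : ℝ), ∃ C : ℝ, ∀ α ∈ K, ∀ y : ℝ, 1 ≤ |y| → |y| ≤ 3 →
      c ≤ ψ α p y ∧ ψ α p y ≤ C

/-- `𝓘_α^{(k,l)}`. -/
def Ical (ψ : ℝ → ℕ → ℝ → ℝ) (α : ℝ) (k l : ℕ) (y : ℝ) : ℝ :=
  ∫ z in {z : ℝ | 1 < |z|}, Dop^[k] gauss (y - z) * ψ α l z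

/-- `f_α^{(k,l,m)}`. -/
def fklm (α : ℝ) (k l m : ℕ) (y w : ℝ) : ℝ :=
  ∫ z : ℝ, Dop^[k] gauss (y - w * z)
    * Dop^[l] (fun z' => iteratedDeriv m (fun a => stableDensity a z') α) z

def Gamman (n : ℕ) (α : ℝ) : ℝ := Real.sqrt ((1 - α / 2) * Real.log n)

def Mn (n : ℕ) (α : ℝ) : ℝ := Real.sqrt ((2 - α) * Real.log n)

def Kconst (σ δ α : ℝ) : ℝ := deriv cAlpha α + cAlpha α * Real.log (δ / σ)

section PartA1
/-! ### Probability part -/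

lemma pi_integral_eval {ν : Measure ℝ} [IsProbabilityMeasure ν] {n : ℕ} (i : Fin n) (g : ℝ → ℝ)
    (hg : AEStronglyMeasurable g ν) :
    ∫ x, g (x i) ∂(Measure.pi fun _ : Fin n => ν) = ∫ y, g y ∂ν := by
  have h := measurePreserving_eval (fun _ : Fin n => ν) i
  have h2 := integral_map (μ := Measure.pi fun _ : Fin n => ν) (f := g) h.measurable.aemeasurable
    (by rw [h.map_eq]; exact hg)
  rw [h.map_eq] at h2
  exact h2.symm

lemma pi_integrable_eval {ν : Measure ℝ} [IsProbabilityMeasure ν] {n : ℕ} (i : Fin n) (g : ℝ → ℝ)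
    (hg : Integrable g ν) :
    Integrable (fun x : Fin n → ℝ => g (x i)) (Measure.pi fun _ : Fin n => ν) :=
  (measurePreserving_eval (fun _ : Fin n => ν) i).integrable_comp_of_integrable hg

lemma pi_markov {ν : Measure ℝ} [IsProbabilityMeasure ν] (n : ℕ) (g : ℝ → ℝ)
    (hg : Integrable g ν) (h0 : ∀ y, 0 ≤ g y) {ε : ℝ} (hε : 0 < ε) :
    (Measure.pi fun _ : Fin n => ν) {x | ε ≤ ∑ i, g (x i)}
      ≤ ENNReal.ofReal (n * (∫ y, g y ∂ν) / ε) := by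
  have hIntg : Integrable (fun x : Fin n → ℝ => ∑ i, g (x i)) (Measure.pi fun _ : Fin n => ν) :=
    integrable_finsetSum _ fun i _ => pi_integrable_eval i g hg
  have h := mul_meas_ge_le_integral_of_nonneg (μ := Measure.pi fun _ : Fin n => ν)
    (f := fun x : Fin n → ℝ => ∑ i, g (x i))
    (ae_of_all _ fun x => Finset.sum_nonneg fun i _ => h0 _) hIntg ε
  rw [integral_finsetSum _ fun i _ => pi_integrable_eval i g hg] at h
  simp_rw [pi_integral_eval _ g hg.aestronglyMeasurable] at h
  simp only [Finset.sum_const, Finset.card_univ, Fintype.card_fin, nsmul_eq_mul] at h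
  rw [← ofReal_measureReal (by finiteness)]
  apply ENNReal.ofReal_le_ofReal
  rw [le_div_iff₀ hε, mul_comm]
  exact h

lemma pi_cheb {ν : Measure ℝ} [IsProbabilityMeasure ν] (n : ℕ) (g : ℝ → ℝ)
    (hg : Measurable g) (h2 : Integrable (fun y => g y ^ 2) ν) (h0 : ∫ y, g y ∂ν = 0)
    {ε : ℝ} (hε : 0 < ε) :
    (Measure.pi fun _ : Fin n => ν) {x | ε ≤ |∑ i, g (x i)|}
      ≤ ENNReal.ofReal (n * (∫ y, g y ^ 2 ∂ν) / ε ^ 2) := by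
  have hL : MemLp g 2 ν := (memLp_two_iff_integrable_sq hg.aestronglyMeasurable).2 h2
  have hLi : ∀ i : Fin n, MemLp (fun x : Fin n → ℝ => g (x i)) 2 (Measure.pi fun _ : Fin n => ν) :=
    fun i => hL.comp_measurePreserving (measurePreserving_eval (fun _ : Fin n => ν) i)
  have hv := ProbabilityTheory.variance_sum_pi (μ := fun _ : Fin n => ν) (X := fun _ => g)
    (fun _ => hL)
  have hLs : MemLp (∑ i, fun x : Fin n → ℝ => g (x i)) 2 (Measure.pi fun _ : Fin n => ν) :=
    memLp_finsetSum' _ fun i _ => hLi i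
  have hm : ∫ x, (∑ i, fun x : Fin n → ℝ => g (x i)) x ∂(Measure.pi fun _ : Fin n => ν) = 0 := by
    simp only [Finset.sum_apply]
    rw [integral_finsetSum _ fun i _ => (hLi i).integrable (by norm_num)]
    simp_rw [pi_integral_eval _ g hg.aestronglyMeasurable, h0]; simp
  have h := ProbabilityTheory.meas_ge_le_variance_div_sq hLs hε
  rw [hm, hv] at h
  have hvar : ProbabilityTheory.variance g ν = ∫ y, g y ^ 2 ∂ν := by
    rw [ProbabilityTheory.variance_of_integral_eq_zero hg.aemeasurable h0]
  simp only [Finset.sum_apply, sub_zero, Finset.sum_const, Finset.card_univ, Fintype.card_fin,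
    nsmul_eq_mul, hvar] at h
  exact h

/-- Convergence in probability to zero along the rows. -/
def TP (μ : ℕ → Measure ℝ) (A : ∀ n : ℕ, Set (Fin n → ℝ)) : Prop :=
  Tendsto (fun n => (Measure.pi fun _ : Fin n => μ n) (A n)) atTop (𝓝 0)

lemma TP.of_le {μ : ℕ → Measure ℝ} {A : ∀ n : ℕ, Set (Fin n → ℝ)} (b : ℕ → ℝ)
    (hb : Tendsto b atTop (𝓝 0))
    (h : ∀ᶠ n in atTop, (Measure.pi fun _ : Fin n => μ n) (A n) ≤ ENNReal.ofReal (b n)) :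
    TP μ A := by
  have h1 : Tendsto (fun n => ENNReal.ofReal (b n)) atTop (𝓝 0) := by
    simpa using ENNReal.tendsto_ofReal hb
  exact tendsto_of_tendsto_of_tendsto_of_le_of_le' tendsto_const_nhds h1
    (Eventually.of_forall fun _ => zero_le) h

lemma TP.mono {μ : ℕ → Measure ℝ} {A B : ∀ n : ℕ, Set (Fin n → ℝ)} (hB : TP μ B)
    (h : ∀ᶠ n in atTop, A n ⊆ B n) : TP μ A :=
  tendsto_of_tendsto_of_tendsto_of_le_of_le' tendsto_const_nhds hB
    (Eventually.of_forall fun _ => zero_le) (h.mono fun _ hn => measure_mono hn)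

lemma TP.union {μ : ℕ → Measure ℝ} {A B : ∀ n : ℕ, Set (Fin n → ℝ)} (hA : TP μ A)
    (hB : TP μ B) : TP μ (fun n => A n ∪ B n) := by
  have h := Tendsto.add hA hB
  rw [add_zero] at h
  exact tendsto_of_tendsto_of_tendsto_of_le_of_le tendsto_const_nhds h
    (fun _ => zero_le) (fun n => measure_union_le _ _)

lemma TP.iUnion {ι : Type} [Fintype ι] {μ : ℕ → Measure ℝ} {A : ι → ∀ n : ℕ, Set (Fin n → ℝ)}
    (hA : ∀ i, TP μ (A i)) : TP μ (fun n => ⋃ i, A i n) := by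
  have h : Tendsto (fun n => ∑ i, (Measure.pi fun _ : Fin n => μ n) (A i n)) atTop (𝓝 0) := by
    have := tendsto_finsetSum (f := fun i n => (Measure.pi fun _ : Fin n => μ n) (A i n))
      (Finset.univ : Finset ι) (fun i _ => hA i)
    simpa using this
  exact tendsto_of_tendsto_of_tendsto_of_le_of_le tendsto_const_nhds h
    (fun _ => zero_le) (fun n => measure_iUnion_fintype_le _ _)

end PartA1

section PartA2
lemma log_taylor {r : ℝ} (hr : |r| ≤ 1 / 2) :
    |Real.log (1 + r) - r + r ^ 2 / 2| ≤ 2 * |r| ^ 3 := by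
  have h := Real.abs_log_sub_add_sum_range_le (x := -r) (by rw [abs_neg]; linarith) 2
  rw [abs_neg] at h
  simp only [Finset.sum_range_succ, Finset.sum_range_zero] at h
  norm_num at h
  have h2 : |r| ^ 3 / (1 - |r|) ≤ 2 * |r| ^ 3 := by
    rw [div_le_iff₀ (by linarith)]
    nlinarith [pow_nonneg (abs_nonneg r) 3]
  refine le_trans (le_of_eq ?_) (h.trans h2)
  congr 1; ring

set_option maxHeartbeats 2000000 in
lemma det_step {n : ℕ} (s : Fin n → Fin 3 → ℝ) (E B : Fin n → ℝ) (h : Fin 3 → ℝ)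
    (J : Matrix (Fin 3) (Fin 3) ℝ) {R η : ℝ} (hR : 1 ≤ R) (hη : 0 < η) (hη1 : 8 * R * η ≤ 1)
    (hh : ∀ j, |h j| ≤ R) (hE : ∀ i, |E i| ≤ R * B i) (hB0 : ∀ i, 0 ≤ B i)
    (hB : ∑ i, B i ^ 2 ≤ η ^ 2)
    (hs : ∀ j k, |∑ i, s i j * s i k - J j k| ≤ η) (hs1 : ∀ i j, |s i j| ≤ η)
    (hEs : |∑ i, E i| ≤ η) :
    |∑ i, Real.log (1 + (∑ j, h j * s i j + E i)) - ∑ j, h j * ∑ i, s i j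
      + 1 / 2 * ∑ j, ∑ k, h j * J j k * h k|
      ≤ (16 * R ^ 3 * (∑ j, ∑ k, |J j k| + 10) + 1
          + R ^ 2 * (∑ j, ∑ k, |J j k| + 11) + 9 * R ^ 2) * η := by
  set D := ∑ j, ∑ k, |J j k| with hD
  have hD0 : 0 ≤ D := Finset.sum_nonneg fun j _ => Finset.sum_nonneg fun k _ => abs_nonneg _
  have hη2 : η ≤ 1 := by nlinarith
  set a : Fin n → ℝ := fun i => ∑ j, h j * s i j with ha
  set r : Fin n → ℝ := fun i => a i + E i with hr
  have hR0 : 0 ≤ R := by linarith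
  have ha1 : ∀ i, |a i| ≤ 3 * R * η := by
    intro i
    refine (Finset.abs_sum_le_sum_abs _ _).trans ?_
    have : ∀ j ∈ Finset.univ, |h j * s i j| ≤ R * η := fun j _ => by
      rw [abs_mul]; exact mul_le_mul (hh j) (hs1 i j) (abs_nonneg _) hR0
    refine (Finset.sum_le_sum this).trans ?_
    simp; linarith
  have hB1 : ∀ i, B i ≤ η := by
    intro i
    have h1 : B i ^ 2 ≤ ∑ i, B i ^ 2 :=
      Finset.single_le_sum (f := fun i => B i ^ 2) (fun i _ => sq_nonneg _) (Finset.mem_univ i)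
    exact le_of_sq_le_sq (h1.trans hB) hη.le
  have hE1 : ∀ i, |E i| ≤ R * η := fun i =>
    (hE i).trans (mul_le_mul_of_nonneg_left (hB1 i) hR0)
  have hr1 : ∀ i, |r i| ≤ 4 * R * η := fun i => by
    have := abs_add_le (a i) (E i)
    have := ha1 i; have := hE1 i
    simp only [hr]; linarith
  have hE2 : ∑ i, E i ^ 2 ≤ R ^ 2 * η ^ 2 := by
    have : ∀ i ∈ Finset.univ, E i ^ 2 ≤ R ^ 2 * B i ^ 2 := fun i _ => by
      rw [← mul_pow, ← sq_abs]; exact pow_le_pow_left₀ (abs_nonneg _) (hE i) 2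
    refine (Finset.sum_le_sum this).trans ?_
    rw [← Finset.mul_sum]; exact mul_le_mul_of_nonneg_left hB (sq_nonneg _)
  -- quadratic form
  have hq : ∑ i, a i ^ 2 - ∑ j, ∑ k, h j * J j k * h k
      = ∑ j, ∑ k, h j * h k * (∑ i, s i j * s i k - J j k) := by
    have e1 : ∑ i, a i ^ 2 = ∑ j, ∑ k, h j * h k * ∑ i, s i j * s i k := by
      simp only [ha, sq, Finset.sum_mul_sum]
      rw [Finset.sum_comm]
      refine Finset.sum_congr rfl fun j _ => ?_
      rw [Finset.sum_comm]
      refine Finset.sum_congr rfl fun k _ => ?_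
      rw [Finset.mul_sum]
      exact Finset.sum_congr rfl fun i _ => by ring
    rw [e1, ← Finset.sum_sub_distrib]
    refine Finset.sum_congr rfl fun j _ => ?_
    rw [← Finset.sum_sub_distrib]
    exact Finset.sum_congr rfl fun k _ => by ring
  have hhjk : ∀ j k, |h j * h k| ≤ R ^ 2 := fun j k => by
    rw [abs_mul, sq]; exact mul_le_mul (hh j) (hh k) (abs_nonneg _) hR0
  have hq1 : |∑ i, a i ^ 2 - ∑ j, ∑ k, h j * J j k * h k| ≤ 9 * R ^ 2 * η := by
    rw [hq]
    refine (Finset.abs_sum_le_sum_abs _ _).trans ?_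
    have : ∀ j ∈ Finset.univ, |∑ k, h j * h k * (∑ i, s i j * s i k - J j k)| ≤ 3 * R ^ 2 * η := by
      intro j _
      refine (Finset.abs_sum_le_sum_abs _ _).trans ?_
      have : ∀ k ∈ Finset.univ, |h j * h k * (∑ i, s i j * s i k - J j k)| ≤ R ^ 2 * η :=
        fun k _ => by
          rw [abs_mul]; exact mul_le_mul (hhjk j k) (hs j k) (abs_nonneg _) (sq_nonneg _)
      refine (Finset.sum_le_sum this).trans ?_
      simp; linarith
    refine (Finset.sum_le_sum this).trans ?_
    simp; linarith
  have hI1 : |∑ j, ∑ k, h j * J j k * h k| ≤ R ^ 2 * D := by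
    refine (Finset.abs_sum_le_sum_abs _ _).trans ?_
    rw [hD, Finset.mul_sum]
    refine Finset.sum_le_sum fun j _ => ?_
    refine (Finset.abs_sum_le_sum_abs _ _).trans ?_
    rw [Finset.mul_sum]
    refine Finset.sum_le_sum fun k _ => ?_
    have : h j * J j k * h k = h j * h k * J j k := by ring
    rw [this, abs_mul]
    exact mul_le_mul_of_nonneg_right (hhjk j k) (abs_nonneg _)
  set A := ∑ i, a i ^ 2 with hA
  have hA1 : A ≤ R ^ 2 * (D + 9) := by
    have := abs_le.1 hq1; have := abs_le.1 hI1
    nlinarith [mul_nonneg (sq_nonneg R) hη.le, sq_nonneg R]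
  have hA0 : 0 ≤ A := Finset.sum_nonneg fun i _ => sq_nonneg _
  set S2 := ∑ i, E i ^ 2 with hS2
  have hS20 : 0 ≤ S2 := Finset.sum_nonneg fun i _ => sq_nonneg _
  -- sum of r^2
  have hrr : |∑ i, r i ^ 2 - A| ≤ η * A + S2 / η + S2 := by
    rw [hA, hS2, ← Finset.sum_sub_distrib, Finset.mul_sum, Finset.sum_div,
      ← Finset.sum_add_distrib, ← Finset.sum_add_distrib]
    refine (Finset.abs_sum_le_sum_abs _ _).trans (Finset.sum_le_sum fun i _ => ?_)
    have e : r i ^ 2 - a i ^ 2 = 2 * a i * E i + E i ^ 2 := by simp only [hr]; ring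
    have k : |2 * a i * E i| ≤ η * a i ^ 2 + E i ^ 2 / η := by
      have e2 : E i ^ 2 / η = η * (E i / η) ^ 2 := by field_simp
      have e3 : 2 * a i * E i = η * (2 * a i * (E i / η)) := by field_simp
      rw [e2, e3, abs_le]
      constructor
      · nlinarith [sq_nonneg (a i + E i / η)]
      · nlinarith [sq_nonneg (a i - E i / η)]
    rw [e]
    refine (abs_add_le _ _).trans ?_
    rw [abs_of_nonneg (sq_nonneg (E i))]
    linarith
  have hS2η : S2 / η ≤ R ^ 2 * η := by
    rw [div_le_iff₀ hη]; nlinarith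
  have hS2' : S2 ≤ R ^ 2 * η := by nlinarith [sq_nonneg R]
  have hrr2 : |∑ i, r i ^ 2 - A| ≤ R ^ 2 * (D + 11) * η := by
    nlinarith
  have hr2 : ∑ i, r i ^ 2 ≤ 2 * R ^ 2 * (D + 10) := by
    have := (abs_le.1 hrr2).2
    have h3 : ∑ i, r i ^ 2 ≤ ∑ i, (2 * a i ^ 2 + 2 * E i ^ 2) :=
      Finset.sum_le_sum fun i _ => by simp only [hr]; nlinarith [sq_nonneg (a i - E i)]
    rw [Finset.sum_add_distrib, ← Finset.mul_sum, ← Finset.mul_sum] at h3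
    nlinarith [sq_nonneg R]
  have hlog : |∑ i, (Real.log (1 + r i) - r i + r i ^ 2 / 2)| ≤ 16 * R ^ 3 * (D + 10) * η := by
    have : ∀ i ∈ Finset.univ, |Real.log (1 + r i) - r i + r i ^ 2 / 2| ≤ 8 * R * η * r i ^ 2 := by
      intro i _
      refine (log_taylor (by have := hr1 i; linarith)).trans ?_
      rw [pow_succ, sq_abs]
      nlinarith [hr1 i, sq_nonneg (r i)]
    refine (Finset.abs_sum_le_sum_abs _ _).trans ((Finset.sum_le_sum this).trans ?_)
    rw [← Finset.mul_sum]
    have : 0 ≤ 8 * R * η := by positivity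
    calc 8 * R * η * ∑ i, r i ^ 2 ≤ 8 * R * η * (2 * R ^ 2 * (D + 10)) :=
          mul_le_mul_of_nonneg_left hr2 this
      _ = _ := by ring
  have key : ∑ i, Real.log (1 + (∑ j, h j * s i j + E i)) - ∑ j, h j * ∑ i, s i j
      + 1 / 2 * ∑ j, ∑ k, h j * J j k * h k
      = ∑ i, (Real.log (1 + r i) - r i + r i ^ 2 / 2) + ∑ i, E i
        - 1 / 2 * (∑ i, r i ^ 2 - A) - 1 / 2 * (A - ∑ j, ∑ k, h j * J j k * h k) := by
    have e1 : ∑ j, h j * ∑ i, s i j = ∑ i, a i := by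
      simp only [ha, Finset.mul_sum]; rw [Finset.sum_comm]
    have e2 : ∑ i, (Real.log (1 + r i) - r i + r i ^ 2 / 2)
        = ∑ i, Real.log (1 + r i) - (∑ i, a i + ∑ i, E i) + (∑ i, r i ^ 2) / 2 := by
      rw [Finset.sum_add_distrib, Finset.sum_sub_distrib, Finset.sum_div]
      simp only [hr, Finset.sum_add_distrib]
    rw [e1, e2]
    simp only [hr, ha]
    ring
  rw [key]
  have hRη : 0 ≤ R ^ 2 * η := by positivity
  have h1 := abs_le.1 hlog; have h2 := abs_le.1 hEs
  have h3 := abs_le.1 hrr2; have h4 := abs_le.1 hq1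
  have h5 : 0 ≤ R ^ 2 * (D + 11) * η := by positivity
  rw [abs_le]
  constructor <;> nlinarith

/-- covering -/
lemma grid_exists {R : ℝ} (hR : 0 < R) {m : ℕ} (hm : 0 < m) {h : ℝ} (hh : |h| ≤ R) :
    ∃ k : Fin (m + 1), |h - (-R + 2 * R * (k : ℝ) / m)| ≤ 2 * R / m := by
  have hm' : (0 : ℝ) < m := by exact_mod_cast hm
  have h0 := abs_le.1 hh
  set z : ℝ := (h + R) / (2 * R) * m with hz
  have hz0 : 0 ≤ z := by
    apply mul_nonneg _ hm'.le; apply div_nonneg <;> linarith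
  have hz1 : z ≤ m := by
    have : (h + R) / (2 * R) ≤ 1 := by rw [div_le_one (by linarith)]; linarith
    nlinarith
  have hfl : ⌊z⌋₊ ≤ m := Nat.floor_le_of_le hz1
  refine ⟨⟨⌊z⌋₊, Nat.lt_succ_of_le hfl⟩, ?_⟩
  have h1 := Nat.floor_le hz0
  have h2 := Nat.lt_floor_add_one z
  have e : h = -R + 2 * R * z / m := by rw [hz]; field_simp; ring
  have e2 : h - (-R + 2 * R * (⌊z⌋₊ : ℝ) / m) = 2 * R / m * (z - ⌊z⌋₊) := by
    conv_lhs => rw [e]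
    field_simp; ring
  simp only
  rw [e2, abs_mul, abs_of_pos (by positivity : 0 < 2 * R / m), abs_of_nonneg (by linarith)]
  have : 0 < 2 * R / m := by positivity
  nlinarith

lemma sup_bound {ν : Measure ℝ} [IsProbabilityMeasure ν] (n : ℕ) {R : ℝ} (hR : 0 < R)
    (E : (Fin 3 → ℝ) → ℝ → ℝ) (B : ℝ → ℝ)
    (hEm : ∀ h, Measurable (E h)) (hE0 : ∀ y, E 0 y = 0)
    (hmean : ∀ h, ‖h‖ ≤ R → ∫ y, E h y ∂ν = 0)
    (hlip : ∀ h h', ‖h‖ ≤ R → ‖h'‖ ≤ R → ∀ y, |E h y - E h' y| ≤ ‖h - h'‖ * B y)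
    (hB0 : ∀ y, 0 ≤ B y) (hB : Integrable B ν) (hB2 : Integrable (fun y => B y ^ 2) ν)
    {η : ℝ} (hη : 0 < η) {m : ℕ} (hm : 0 < m) :
    (Measure.pi fun _ : Fin n => ν) {x | ∃ h, ‖h‖ ≤ R ∧ η ≤ |∑ i, E h (x i)|} ≤
      ENNReal.ofReal ((m + 1) ^ 3 * (n * (R ^ 2 * ∫ y, B y ^ 2 ∂ν) / (η / 2) ^ 2)
        + n * (2 * R / m * ∫ y, B y ∂ν) / (η / 2)) := by
  have hm' : (0 : ℝ) < m := by exact_mod_cast hm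
  set g : (Fin 3 → Fin (m + 1)) → (Fin 3 → ℝ) := fun k j => -R + 2 * R * (k j : ℝ) / m with hg
  have hgR : ∀ k, ‖g k‖ ≤ R := by
    intro k
    rw [pi_norm_le_iff_of_nonneg hR.le]
    intro j
    have hk : ((k j : ℕ) : ℝ) ≤ m := by exact_mod_cast Nat.lt_succ_iff.1 (k j).2
    have hk0 : (0 : ℝ) ≤ ((k j : ℕ) : ℝ) := Nat.cast_nonneg _
    have h1 : 2 * R * ((k j : ℕ) : ℝ) / m ≤ 2 * R := by
      rw [div_le_iff₀ hm']; nlinarith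
    have h2 : 0 ≤ 2 * R * ((k j : ℕ) : ℝ) / m := by positivity
    rw [Real.norm_eq_abs, abs_le]; simp only [hg]; constructor <;> linarith
  have hEB : ∀ h, ‖h‖ ≤ R → ∀ y, |E h y| ≤ R * B y := by
    intro h hh y
    have := hlip h 0 hh (by simpa using hR.le) y
    rw [hE0, sub_zero, sub_zero] at this
    exact this.trans (mul_le_mul_of_nonneg_right hh (hB0 y))
  have hsub : {x : Fin n → ℝ | ∃ h, ‖h‖ ≤ R ∧ η ≤ |∑ i, E h (x i)|} ⊆
      (⋃ k, {x | η / 2 ≤ |∑ i, E (g k) (x i)|}) ∪ {x | η / 2 ≤ ∑ i, 2 * R / m * B (x i)} := by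
    rintro x ⟨h, hh, hx⟩
    by_contra hcon
    simp only [mem_union, mem_iUnion, mem_setOf_eq, not_or, not_exists, not_le] at hcon
    have hk : ∀ j, ∃ k : Fin (m + 1), |h j - (-R + 2 * R * (k : ℝ) / m)| ≤ 2 * R / m := fun j =>
      grid_exists hR hm ((norm_le_pi_norm h j).trans hh)
    choose k hk using hk
    have hd : ‖h - g k‖ ≤ 2 * R / m := by
      rw [pi_norm_le_iff_of_nonneg (by positivity)]
      intro j; exact hk j
    have h1 : |∑ i, E h (x i) - ∑ i, E (g k) (x i)| ≤ ∑ i, 2 * R / m * B (x i) := by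
      rw [← Finset.sum_sub_distrib]
      refine (Finset.abs_sum_le_sum_abs _ _).trans (Finset.sum_le_sum fun i _ => ?_)
      exact (hlip h (g k) hh (hgR k) (x i)).trans (mul_le_mul_of_nonneg_right hd (hB0 _))
    have h2 := hcon.1 k
    have h3 := abs_sub_abs_le_abs_sub (∑ i, E h (x i)) (∑ i, E (g k) (x i))
    linarith [hcon.2]
  refine (measure_mono hsub).trans ((measure_union_le _ _).trans ?_)
  have hEi2 : ∀ h, ‖h‖ ≤ R → Integrable (fun y => E h y ^ 2) ν := fun h hh => by
    refine (hB2.const_mul (R ^ 2)).mono' ((hEm h).pow_const 2).aestronglyMeasurable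
      (ae_of_all _ fun y => ?_)
    rw [Real.norm_eq_abs, abs_of_nonneg (sq_nonneg _), ← mul_pow, ← sq_abs]
    exact pow_le_pow_left₀ (abs_nonneg _) (hEB h hh y) 2
  have hI2 : 0 ≤ ∫ y, B y ^ 2 ∂ν := integral_nonneg fun y => sq_nonneg _
  have hI1 : 0 ≤ ∫ y, B y ∂ν := integral_nonneg hB0
  rw [ENNReal.ofReal_add (by positivity) (by positivity)]
  refine add_le_add ?_ ?_
  · refine (measure_iUnion_fintype_le _ _).trans ?_
    have : ∀ k ∈ Finset.univ, (Measure.pi fun _ : Fin n => ν) {x | η / 2 ≤ |∑ i, E (g k) (x i)|}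
        ≤ ENNReal.ofReal (n * (R ^ 2 * ∫ y, B y ^ 2 ∂ν) / (η / 2) ^ 2) := by
      intro k _
      refine (pi_cheb n (E (g k)) (hEm _) (hEi2 _ (hgR k)) (hmean _ (hgR k))
        (half_pos hη)).trans (ENNReal.ofReal_le_ofReal ?_)
      gcongr
      rw [← integral_const_mul]
      refine integral_mono (hEi2 _ (hgR k)) (hB2.const_mul _) fun y => ?_
      show E (g k) y ^ 2 ≤ R ^ 2 * B y ^ 2
      rw [← mul_pow, ← sq_abs]
      exact pow_le_pow_left₀ (abs_nonneg _) (hEB _ (hgR k) y) 2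
    refine (Finset.sum_le_sum this).trans (le_of_eq ?_)
    rw [Finset.sum_const, nsmul_eq_mul, ENNReal.ofReal_mul (by positivity)]
    congr 1
    simp [Finset.card_univ]
    rw [ENNReal.ofReal_pow (by positivity), ENNReal.ofReal_add (by positivity) (by positivity)]
    simp
  · refine (pi_markov n (fun y => 2 * R / m * B y) (hB.const_mul _)
      (fun y => mul_nonneg (by positivity) (hB0 y)) (half_pos hη)).trans (le_of_eq ?_)
    rw [integral_const_mul]

end PartA2

section PartA3
structure Row (μ : Measure ℝ) (s : Fin 3 → ℝ → ℝ) : Prop where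
  prob : IsProbabilityMeasure μ
  meas : ∀ j, Measurable (s j)
  int4 : ∀ j, Integrable (fun y => s j y ^ 4) μ
  mean : ∀ j, ∫ y, s j y ∂μ = 0

structure RowE (R : ℝ) (μ : Measure ℝ) (E : (Fin 3 → ℝ) → ℝ → ℝ) (B : ℝ → ℝ) : Prop where
  meas : ∀ h, Measurable (E h)
  zero : ∀ y, E 0 y = 0
  mean : ∀ h, ‖h‖ ≤ R → ∫ y, E h y ∂μ = 0
  lip : ∀ h h', ‖h‖ ≤ R → ‖h'‖ ≤ R → ∀ y, |E h y - E h' y| ≤ ‖h - h'‖ * B y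
  nonneg : ∀ y, 0 ≤ B y
  int : Integrable B μ
  int2 : Integrable (fun y => B y ^ 2) μ

lemma Row.int22 {μ : Measure ℝ} {s : Fin 3 → ℝ → ℝ} (H : Row μ s) (j k : Fin 3) :
    Integrable (fun y => (s j y * s k y) ^ 2) μ := by
  have := H.prob
  refine ((H.int4 j).add (H.int4 k)).mono' (((H.meas j).mul (H.meas k)).pow_const 2).aestronglyMeasurable
    (ae_of_all _ fun y => ?_)
  rw [Real.norm_eq_abs, abs_of_nonneg (sq_nonneg _)]
  show _ ≤ s j y ^ 4 + s k y ^ 4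
  nlinarith [sq_nonneg (s j y ^ 2 - s k y ^ 2), sq_nonneg (s j y ^ 2), sq_nonneg (s k y ^ 2)]

lemma Row.int11 {μ : Measure ℝ} {s : Fin 3 → ℝ → ℝ} (H : Row μ s) (j k : Fin 3) :
    Integrable (fun y => s j y * s k y) μ := by
  have := H.prob
  refine ((H.int22 j k).add (integrable_const 1)).mono'
    ((H.meas j).mul (H.meas k)).aestronglyMeasurable (ae_of_all _ fun y => ?_)
  rw [Real.norm_eq_abs]
  show _ ≤ (s j y * s k y) ^ 2 + 1
  rw [← sq_abs]; nlinarith [sq_nonneg (|s j y * s k y| - 1)]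

lemma Row.int1 {μ : Measure ℝ} {s : Fin 3 → ℝ → ℝ} (H : Row μ s) (j : Fin 3) :
    Integrable (fun y => s j y) μ := by
  have := H.prob
  refine ((H.int11 j j).add (integrable_const 1)).mono'
    ((H.meas j)).aestronglyMeasurable (ae_of_all _ fun y => ?_)
  rw [Real.norm_eq_abs]
  show _ ≤ (s j y * s j y) + 1
  rw [← abs_mul_abs_self]; nlinarith [sq_nonneg (|s j y| - 1)]

lemma Row.cheb {μ : Measure ℝ} {s : Fin 3 → ℝ → ℝ} (H : Row μ s) (j k : Fin 3) (n : ℕ)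
    {ε : ℝ} (hε : 0 < ε) :
    (Measure.pi fun _ : Fin n => μ)
      {x | ε ≤ |∑ i, s j (x i) * s k (x i) - n * ∫ y, s j y * s k y ∂μ|}
      ≤ ENNReal.ofReal ((n * (∫ y, s j y ^ 4 ∂μ) + n * (∫ y, s k y ^ 4 ∂μ)) / ε ^ 2) := by
  have := H.prob
  set c := ∫ y, s j y * s k y ∂μ with hc
  have hsq : Integrable (fun y => (s j y * s k y - c) ^ 2) μ := by
    have := ((H.int22 j k).sub ((H.int11 j k).const_mul (2 * c))).add (integrable_const (c ^ 2))
    refine this.congr (ae_of_all _ fun y => ?_)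
    simp only [Pi.add_apply, Pi.sub_apply]; ring
  have h := pi_cheb n (fun y => s j y * s k y - c) (((H.meas j).mul (H.meas k)).sub_const c) hsq
    (by rw [integral_sub (H.int11 j k) (integrable_const _)]; simp [hc]) hε
  have hset : {x : Fin n → ℝ | ε ≤ |∑ i, s j (x i) * s k (x i) - n * c|}
      = {x | ε ≤ |∑ i, (s j (x i) * s k (x i) - c)|} := by
    ext x; simp [Finset.sum_sub_distrib]
  rw [hset]
  refine h.trans (ENNReal.ofReal_le_ofReal ?_)
  rw [← mul_add, ← integral_add (H.int4 j) (H.int4 k)]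
  have e : ∫ y, (s j y * s k y - c) ^ 2 ∂μ ≤ ∫ y, (s j y ^ 4 + s k y ^ 4) ∂μ := by
    have e1 : ∫ y, (s j y * s k y - c) ^ 2 ∂μ = ∫ y, (s j y * s k y) ^ 2 ∂μ - c ^ 2 := by
      have : (fun y => (s j y * s k y - c) ^ 2)
          = fun y => (s j y * s k y) ^ 2 - (2 * c * (s j y * s k y) - c ^ 2) := by
        ext y; ring
      have hI : Integrable (fun y => 2 * c * (s j y * s k y) - c ^ 2) μ :=
        ((H.int11 j k).const_mul _).sub (integrable_const _)
      rw [this, integral_sub (H.int22 j k) hI,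
        integral_sub ((H.int11 j k).const_mul _) (integrable_const _), integral_const_mul, ← hc]
      simp; ring
    rw [e1]
    have : ∫ y, (s j y * s k y) ^ 2 ∂μ ≤ ∫ y, (s j y ^ 4 + s k y ^ 4) ∂μ := by
      refine integral_mono (H.int22 j k) ((H.int4 j).add (H.int4 k)) fun y => ?_
      show _ ≤ s j y ^ 4 + s k y ^ 4
      nlinarith [sq_nonneg (s j y ^ 2 - s k y ^ 2), sq_nonneg (s j y ^ 2), sq_nonneg (s k y ^ 2)]
    nlinarith [sq_nonneg c]
  gcongr

theorem lan_prob {μ : ℕ → Measure ℝ} {s : ℕ → Fin 3 → ℝ → ℝ} {J : Matrix (Fin 3) (Fin 3) ℝ}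
    {E : ℕ → (Fin 3 → ℝ) → ℝ → ℝ} {B : ℕ → ℝ → ℝ} {R : ℝ} (hR : 1 ≤ R)
    (hrow : ∀ᶠ n in atTop, Row (μ n) (s n))
    (hcov : ∀ j k, Tendsto (fun n : ℕ => n * ∫ y, s n j y * s n k y ∂μ n) atTop (𝓝 (J j k)))
    (hm4 : ∀ j, Tendsto (fun n : ℕ => n * ∫ y, s n j y ^ 4 ∂μ n) atTop (𝓝 0))
    (hrowE : ∀ᶠ n in atTop, RowE R (μ n) (E n) (B n))
    {m : ℕ → ℕ} (hm : ∀ n, 0 < m n)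
    (hB2 : Tendsto (fun n : ℕ => ((m n : ℝ) + 1) ^ 3 * (n * ∫ y, B n y ^ 2 ∂μ n)) atTop (𝓝 0))
    (hB1 : Tendsto (fun n : ℕ => (n * ∫ y, B n y ∂μ n) / m n) atTop (𝓝 0))
    {ε : ℝ} (hε : 0 < ε) :
    TP μ (fun n => {x | ∃ h : Fin 3 → ℝ, ‖h‖ ≤ R ∧ ε ≤
      |∑ i, Real.log (1 + (∑ j, h j * s n j (x i) + E n h (x i))) - ∑ j, h j * ∑ i, s n j (x i)
      + 1 / 2 * ∑ j, ∑ k, h j * J j k * h k|}) := by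
  set C := (16 * R ^ 3 * (∑ j, ∑ k, |J j k| + 10) + 1
          + R ^ 2 * (∑ j, ∑ k, |J j k| + 11) + 9 * R ^ 2) with hC
  have hD0 : 0 ≤ ∑ j, ∑ k, |J j k| :=
    Finset.sum_nonneg fun j _ => Finset.sum_nonneg fun k _ => abs_nonneg _
  have hC0 : 0 < C := by positivity
  have hR0 : 0 < R := by linarith
  obtain ⟨η, hη, hη1, hη2⟩ : ∃ η : ℝ, 0 < η ∧ 8 * R * η ≤ 1 ∧ C * η < ε := by
    refine ⟨min (1 / (8 * R)) (ε / (2 * C)), by positivity, ?_, ?_⟩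
    · calc 8 * R * _ ≤ 8 * R * (1 / (8 * R)) := by gcongr; exact min_le_left _ _
        _ = 1 := by field_simp
    · calc C * _ ≤ C * (ε / (2 * C)) := by gcongr; exact min_le_right _ _
        _ = ε / 2 := by field_simp
        _ < ε := by linarith
  have T1 : TP μ (fun n => {x | η ^ 2 ≤ ∑ i, B n (x i) ^ 2}) := by
    refine TP.of_le (fun n => (((m n : ℝ) + 1) ^ 3 * (n * ∫ y, B n y ^ 2 ∂μ n)) / η ^ 2)
      (by simpa using hB2.div_const (η ^ 2)) ?_
    filter_upwards [hrow, hrowE] with n h1 h2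
    have := h1.prob
    refine (pi_markov n (fun y => B n y ^ 2) h2.int2 (fun y => sq_nonneg _) (by positivity)).trans
      (ENNReal.ofReal_le_ofReal ?_)
    refine div_le_div_of_nonneg_right ?_ (by positivity)
    have h3 : 0 ≤ n * ∫ y, B n y ^ 2 ∂μ n :=
      mul_nonneg (Nat.cast_nonneg _) (integral_nonneg fun y => sq_nonneg _)
    have h4 : (1 : ℝ) ≤ ((m n : ℝ) + 1) ^ 3 := one_le_pow₀ (by linarith [Nat.cast_nonneg (α := ℝ) (m n)])
    exact le_mul_of_one_le_left h3 h4
  have T2 : ∀ jk : Fin 3 × Fin 3, TP μ (fun n => {x | η ≤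
      |∑ i, s n jk.1 (x i) * s n jk.2 (x i) - J jk.1 jk.2|}) := by
    rintro ⟨j, k⟩
    have hTP : TP μ (fun n => {x | η / 2 ≤ |∑ i, s n j (x i) * s n k (x i)
        - n * ∫ y, s n j y * s n k y ∂μ n|}) := by
      refine TP.of_le (fun n => (n * (∫ y, s n j y ^ 4 ∂μ n) + n * (∫ y, s n k y ^ 4 ∂μ n))
        / (η / 2) ^ 2) (by simpa using ((hm4 j).add (hm4 k)).div_const ((η / 2) ^ 2)) ?_
      filter_upwards [hrow] with n h1
      exact h1.cheb j k n (half_pos hη)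
    refine hTP.mono ?_
    have := (tendsto_iff_dist_tendsto_zero.1 (hcov j k)).eventually (gt_mem_nhds (half_pos hη))
    filter_upwards [this] with n hn x hx
    rw [Real.dist_eq] at hn
    simp only [mem_setOf_eq] at hx ⊢
    have := abs_sub_le (∑ i, s n j (x i) * s n k (x i)) (n * ∫ y, s n j y * s n k y ∂μ n) (J j k)
    linarith
  have T3 : ∀ j : Fin 3, TP μ (fun n => {x | η ^ 4 ≤ ∑ i, s n j (x i) ^ 4}) := by
    intro j
    refine TP.of_le (fun n => n * (∫ y, s n j y ^ 4 ∂μ n) / η ^ 4)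
      (by simpa using (hm4 j).div_const (η ^ 4)) ?_
    filter_upwards [hrow] with n h1
    have := h1.prob
    exact pi_markov n (fun y => s n j y ^ 4) (h1.int4 j) (fun y => by positivity) (by positivity)
  have T4 : TP μ (fun n => {x | ∃ h, ‖h‖ ≤ R ∧ η ≤ |∑ i, E n h (x i)|}) := by
    refine TP.of_le (fun n => (R ^ 2 / (η / 2) ^ 2) * (((m n : ℝ) + 1) ^ 3 * (n * ∫ y, B n y ^ 2 ∂μ n))
      + (2 * R / (η / 2)) * ((n * ∫ y, B n y ∂μ n) / m n))
      (by simpa using (hB2.const_mul (R ^ 2 / (η / 2) ^ 2)).add (hB1.const_mul (2 * R / (η / 2)))) ?_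
    filter_upwards [hrow, hrowE] with n h1 h2
    have := h1.prob
    refine (sup_bound n hR0 (E n) (B n) h2.meas h2.zero h2.mean h2.lip h2.nonneg h2.int h2.int2
      hη (hm n)).trans (le_of_eq ?_)
    congr 1
    ring
  refine ((T1.union (TP.iUnion T2)).union ((TP.iUnion T3).union T4)).mono ?_
  filter_upwards [hrow, hrowE] with n h1 h2 x hx
  by_contra hcon
  simp only [mem_union, mem_iUnion, mem_setOf_eq, not_or, not_exists, not_le, not_and] at hcon
  obtain ⟨⟨c1, c2⟩, c3, c4⟩ := hcon
  obtain ⟨h, hh, hx⟩ := hx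
  have hd := det_step (n := n) (fun i j => s n j (x i)) (fun i => E n h (x i)) (fun i => B n (x i)) h
    J hR hη hη1 (fun j => (norm_le_pi_norm h j).trans hh) (fun i => by
      have := h2.lip h 0 hh (by simpa using hR0.le) (x i)
      rw [h2.zero, sub_zero, sub_zero] at this
      exact this.trans (mul_le_mul_of_nonneg_right hh (h2.nonneg _)))
    (fun i => h2.nonneg _) c1.le (fun j k => (c2 (j, k)).le) (fun i j => by
      have h5 : s n j (x i) ^ 4 ≤ ∑ i, s n j (x i) ^ 4 :=
        Finset.single_le_sum (f := fun i => s n j (x i) ^ 4) (fun i _ => by positivity)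
          (Finset.mem_univ i)
      have h6 : |s n j (x i)| ^ 4 ≤ η ^ 4 := by
        rw [Even.pow_abs (by decide)]; exact h5.trans (c3 j).le
      exact le_of_pow_le_pow_left₀ (by norm_num) hη.le h6) (c4 h hh).le
  linarith

end PartA3

section PartA4
lemma cexp_taylor (z : ℝ) :
    ‖Complex.exp (z * Complex.I) - 1 - z * Complex.I + z ^ 2 / 2‖ ≤ 4 * |z| ^ 3 := by
  have hn : ‖(z : ℂ) * Complex.I‖ = |z| := by simp
  rcases le_or_gt |z| 1 with h | h
  · have h1 := Complex.exp_bound (x := z * Complex.I) (by rw [hn]; exact h) (n := 3) (by norm_num)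
    simp only [Finset.sum_range_succ, Finset.sum_range_zero, hn] at h1
    have e : Complex.exp (z * Complex.I) - 1 - z * Complex.I + z ^ 2 / 2
        = Complex.exp (z * Complex.I) - (0 + (z * Complex.I) ^ 0 / (Nat.factorial 0 : ℂ)
          + (z * Complex.I) ^ 1 / (Nat.factorial 1 : ℂ) + (z * Complex.I) ^ 2 / (Nat.factorial 2 : ℂ)) := by
      simp [Nat.factorial, mul_pow]; ring
    rw [e]
    refine h1.trans ?_
    norm_num [Nat.factorial]
    nlinarith [pow_nonneg (abs_nonneg z) 3]
  · have h1 : ‖Complex.exp (z * Complex.I)‖ = 1 := Complex.norm_exp_ofReal_mul_I z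
    have h2 : ‖(z : ℂ) ^ 2 / 2‖ = |z| ^ 2 / 2 := by simp
    refine (norm_add_le _ _).trans ?_
    refine (add_le_add_left ((norm_sub_le _ _).trans (add_le_add_left (norm_sub_le _ _) _)) _).trans ?_
    rw [h1, h2, hn]; simp only [norm_one]
    nlinarith [pow_nonneg (abs_nonneg z) 3, mul_pos (lt_trans one_pos h) (lt_trans one_pos h)]

lemma clt_scalar {μ : ℕ → Measure ℝ} {Z : ℕ → ℝ → ℝ} {v : ℝ}
    (hp : ∀ᶠ n in atTop, IsProbabilityMeasure (μ n) ∧ Measurable (Z n) ∧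
      Integrable (fun y => Z n y ^ 4) (μ n) ∧ Integrable (fun y => Z n y ^ 2) (μ n) ∧
      Integrable (Z n) (μ n) ∧ ∫ y, Z n y ∂μ n = 0)
    (h2 : Tendsto (fun n : ℕ => n * ∫ y, Z n y ^ 2 ∂μ n) atTop (𝓝 v))
    (h4 : Tendsto (fun n : ℕ => n * ∫ y, Z n y ^ 4 ∂μ n) atTop (𝓝 0)) :
    Tendsto (fun n : ℕ => (∫ y, Complex.exp (Z n y * Complex.I) ∂μ n) ^ n) atTop
      (𝓝 (Complex.exp (-(v / 2 : ℝ)))) := by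
  set g : ℕ → ℂ := fun n => ∫ y, Complex.exp (Z n y * Complex.I) ∂μ n - 1 with hg
  have key : Tendsto (fun n : ℕ => n * g n) atTop (𝓝 (-(v / 2 : ℝ) : ℂ)) := by
    have h2' : Tendsto (fun n : ℕ => (-((n * ∫ y, Z n y ^ 2 ∂μ n) / 2 : ℝ) : ℂ)) atTop
        (𝓝 (-(v / 2 : ℝ) : ℂ)) :=
      (Complex.continuous_ofReal.tendsto _ |>.comp (h2.div_const 2)).neg
    have hdiff : Tendsto (fun n : ℕ => (n : ℂ) * g n - (-((n * ∫ y, Z n y ^ 2 ∂μ n) / 2 : ℝ) : ℂ))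
        atTop (𝓝 0) := by
      have hbound : ∀ e : ℝ, 0 < e → ∀ᶠ n : ℕ in atTop,
          ‖(n : ℂ) * g n - (-((n * ∫ y, Z n y ^ 2 ∂μ n) / 2 : ℝ) : ℂ)‖ ≤
            2 * e * (n * ∫ y, Z n y ^ 2 ∂μ n) + 2 / e * (n * ∫ y, Z n y ^ 4 ∂μ n) := by
        intro e he
        filter_upwards [hp] with n ⟨hP, hm, i4, i2, i1, m0⟩
        have hmc : Measurable fun y => Complex.exp (Z n y * Complex.I) :=
          Complex.measurable_exp.comp
            ((Complex.measurable_ofReal.comp hm).mul_const Complex.I)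
        have ie : Integrable (fun y => Complex.exp (Z n y * Complex.I)) (μ n) :=
          (integrable_const (1 : ℝ)).mono' hmc.aestronglyMeasurable
            (ae_of_all _ fun y => (Complex.norm_exp_ofReal_mul_I _).le)
        have i1c : Integrable (fun y => (Z n y : ℂ) * Complex.I) (μ n) :=
          (i1.ofReal (𝕜 := ℂ)).mul_const _
        have i2c : Integrable (fun y => ((Z n y : ℂ)) ^ 2 / 2) (μ n) := by
          have := (i2.ofReal (𝕜 := ℂ)).div_const 2
          simpa using this
        have e1 : (n : ℂ) * g n - (-((n * ∫ y, Z n y ^ 2 ∂μ n) / 2 : ℝ) : ℂ)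
            = n * ∫ y, (Complex.exp (Z n y * Complex.I) - 1 - Z n y * Complex.I + Z n y ^ 2 / 2)
              ∂μ n := by
          have j1 : Integrable (fun y => Complex.exp (Z n y * Complex.I) - 1) (μ n) :=
            ie.sub (integrable_const _)
          have j2 : Integrable (fun y => Complex.exp (Z n y * Complex.I) - 1 - Z n y * Complex.I)
            (μ n) := j1.sub i1c
          rw [integral_add j2 i2c, integral_sub j1 i1c, integral_sub ie (integrable_const _)]
          have a1 : ∫ y, (Z n y : ℂ) * Complex.I ∂μ n = 0 := by
            have := integral_ofReal (μ := μ n) (f := Z n) (𝕜 := ℂ)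
            rw [m0] at this
            rw [integral_mul_const]
            erw [this]; simp
          have a2 : ∫ y, (Z n y : ℂ) ^ 2 / 2 ∂μ n = (((∫ y, Z n y ^ 2 ∂μ n) / 2 : ℝ) : ℂ) := by
            have := integral_ofReal (μ := μ n) (f := fun y => Z n y ^ 2) (𝕜 := ℂ)
            rw [integral_div]
            push_cast at this ⊢
            erw [this]; rfl
          rw [a1, a2]; simp [hg]; ring
        rw [e1, norm_mul, Complex.norm_natCast]
        have e2 : ‖∫ y, (Complex.exp (Z n y * Complex.I) - 1 - Z n y * Complex.I + Z n y ^ 2 / 2)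
              ∂μ n‖ ≤ ∫ y, (2 * e * Z n y ^ 2 + 2 / e * Z n y ^ 4) ∂μ n := by
          refine norm_integral_le_of_norm_le ((i2.const_mul _).add (i4.const_mul _))
            (ae_of_all _ fun y => (cexp_taylor _).trans ?_)
          have : 2 * e * Z n y ^ 2 + 2 / e * Z n y ^ 4 - 4 * |Z n y| ^ 3
              = 2 * e * |Z n y| ^ 2 * (1 - |Z n y| / e) ^ 2 := by
            rw [← Even.pow_abs (n := 4) (by decide), ← sq_abs]; field_simp; ring
          have h0 : 0 ≤ 2 * e * |Z n y| ^ 2 * (1 - |Z n y| / e) ^ 2 := by positivity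
          show _ ≤ 2 * e * Z n y ^ 2 + 2 / e * Z n y ^ 4
          linarith
        rw [integral_add (i2.const_mul _) (i4.const_mul _), integral_const_mul,
          integral_const_mul] at e2
        calc (n : ℝ) * _ ≤ n * _ := mul_le_mul_of_nonneg_left e2 (Nat.cast_nonneg _)
          _ = _ := by ring
      rw [tendsto_zero_iff_norm_tendsto_zero, Metric.tendsto_atTop']
      have hlim : ∀ e : ℝ, 0 < e → Tendsto (fun n : ℕ => 2 * e * (n * ∫ y, Z n y ^ 2 ∂μ n)
          + 2 / e * (n * ∫ y, Z n y ^ 4 ∂μ n)) atTop (𝓝 (2 * e * v + 2 / e * 0)) := fun e _ =>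
        (h2.const_mul _).add (h4.const_mul _)
      intro ε hε
      have hv : 0 < 4 * (|v| + 1) := by positivity
      set e := ε / (4 * (|v| + 1)) with hedef
      have he : 0 < e := by positivity
      have hlt : 2 * e * v + 2 / e * 0 < ε := by
        have h9 : e * (4 * (|v| + 1)) = ε := by rw [hedef]; field_simp
        nlinarith [le_abs_self v, mul_le_mul_of_nonneg_left (le_abs_self v) he.le, abs_nonneg v]
      obtain ⟨N, hN⟩ := eventually_atTop.1
        ((hbound e he).and ((hlim e he).eventually (gt_mem_nhds hlt)))
      refine ⟨N, fun n hn => ?_⟩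
      have := hN n hn.le
      rw [Real.dist_eq, sub_zero, abs_of_nonneg (norm_nonneg _)]
      exact this.1.trans_lt this.2
    have := hdiff.add h2'
    simpa using this
  have := Complex.tendsto_one_add_pow_exp_of_tendsto key
  refine this.congr fun n => ?_
  simp [hg]

lemma sum_pow4_le (a b c : ℝ) : (a + b + c) ^ 4 ≤ 27 * (a ^ 4 + b ^ 4 + c ^ 4) := by
  have h1 : (a + b + c) ^ 2 ≤ 3 * (a ^ 2 + b ^ 2 + c ^ 2) := by
    nlinarith [sq_nonneg (a - b), sq_nonneg (b - c), sq_nonneg (a - c)]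
  have h2 : (a ^ 2 + b ^ 2 + c ^ 2) ^ 2 ≤ 3 * (a ^ 4 + b ^ 4 + c ^ 4) := by
    nlinarith [sq_nonneg (a ^ 2 - b ^ 2), sq_nonneg (b ^ 2 - c ^ 2), sq_nonneg (a ^ 2 - c ^ 2)]
  calc (a + b + c) ^ 4 = ((a + b + c) ^ 2) ^ 2 := by ring
    _ ≤ (3 * (a ^ 2 + b ^ 2 + c ^ 2)) ^ 2 := pow_le_pow_left₀ (sq_nonneg _) h1 2
    _ ≤ _ := by nlinarith

lemma clt_char {μ : ℕ → Measure ℝ} {s : ℕ → Fin 3 → ℝ → ℝ} {J : Matrix (Fin 3) (Fin 3) ℝ}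
    (hrow : ∀ᶠ n in atTop, Row (μ n) (s n))
    (hcov : ∀ j k, Tendsto (fun n : ℕ => n * ∫ y, s n j y * s n k y ∂μ n) atTop (𝓝 (J j k)))
    (hm4 : ∀ j, Tendsto (fun n : ℕ => n * ∫ y, s n j y ^ 4 ∂μ n) atTop (𝓝 0)) (t : Fin 3 → ℝ) :
    Tendsto (fun n : ℕ => (∫ y, Complex.exp ((∑ j, t j * s n j y : ℝ) * Complex.I) ∂μ n) ^ n) atTop
      (𝓝 (Complex.exp (-((∑ j, ∑ k, t j * J j k * t k) / 2 : ℝ)))) := by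
  have int2 : ∀ n, Row (μ n) (s n) → ∀ j ∈ Finset.univ, Integrable (fun y => ∑ k,
      t j * t k * (s n j y * s n k y)) (μ n) := fun n h j _ =>
    integrable_finsetSum _ fun k _ => (h.int11 j k).const_mul _
  have e2 : ∀ n, (fun y => (∑ j, t j * s n j y) ^ 2)
      = fun y => ∑ j, ∑ k, t j * t k * (s n j y * s n k y) := by
    intro n; ext y
    rw [sq, Finset.sum_mul_sum]
    exact Finset.sum_congr rfl fun j _ => Finset.sum_congr rfl fun k _ => by ring
  have int4 : ∀ n, Row (μ n) (s n) → Integrable (fun y => 27 * ∑ j, t j ^ 4 * s n j y ^ 4) (μ n) :=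
    fun n h => (integrable_finsetSum _ fun j _ => (h.int4 j).const_mul _).const_mul _
  have bd4 : ∀ n y, (∑ j, t j * s n j y) ^ 4 ≤ 27 * ∑ j, t j ^ 4 * s n j y ^ 4 := by
    intro n y
    simp only [Fin.sum_univ_three, ← mul_pow]
    exact sum_pow4_le _ _ _
  have meas : ∀ n, Row (μ n) (s n) → Measurable fun y => ∑ j, t j * s n j y := fun n h =>
    Finset.measurable_sum _ fun j _ => (h.meas j).const_mul _
  have int4' : ∀ n, Row (μ n) (s n) → Integrable (fun y => (∑ j, t j * s n j y) ^ 4) (μ n) :=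
    fun n h => (int4 n h).mono' ((meas n h).pow_const 4).aestronglyMeasurable
      (ae_of_all _ fun y => by
        rw [Real.norm_eq_abs, abs_of_nonneg (by positivity)]; exact bd4 n y)
  refine clt_scalar (Z := fun n y => ∑ j, t j * s n j y) ?_ ?_ ?_
  · filter_upwards [hrow] with n h
    refine ⟨h.prob, meas n h, int4' n h, ?_, ?_, ?_⟩
    · rw [e2]; exact integrable_finsetSum _ (int2 n h)
    · exact integrable_finsetSum _ fun j _ => (h.int1 j).const_mul _
    · rw [integral_finsetSum _ fun j _ => (h.int1 j).const_mul _]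
      simp [integral_const_mul, h.mean]
  · have : Tendsto (fun n : ℕ => ∑ j, ∑ k, t j * t k * (n * ∫ y, s n j y * s n k y ∂μ n)) atTop
        (𝓝 (∑ j, ∑ k, t j * t k * J j k)) :=
      tendsto_finsetSum _ fun j _ => tendsto_finsetSum _ fun k _ => (hcov j k).const_mul _
    have e : ∑ j, ∑ k, t j * J j k * t k = ∑ j, ∑ k, t j * t k * J j k :=
      Finset.sum_congr rfl fun j _ => Finset.sum_congr rfl fun k _ => by ring
    rw [e]
    refine this.congr' ?_
    filter_upwards [hrow] with n h
    rw [e2, integral_finsetSum _ (int2 n h), Finset.mul_sum]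
    refine Finset.sum_congr rfl fun j _ => ?_
    rw [integral_finsetSum _ fun k _ => (h.int11 j k).const_mul _, Finset.mul_sum]
    refine Finset.sum_congr rfl fun k _ => ?_
    rw [integral_const_mul]; ring
  · have : Tendsto (fun n : ℕ => 27 * ∑ j, t j ^ 4 * (n * ∫ y, s n j y ^ 4 ∂μ n)) atTop
        (𝓝 (27 * ∑ j, t j ^ 4 * 0)) :=
      (tendsto_finsetSum _ fun j _ => (hm4 j).const_mul _).const_mul _
    simp only [mul_zero, Finset.sum_const_zero] at this
    refine tendsto_of_tendsto_of_tendsto_of_le_of_le' tendsto_const_nhds this ?_ ?_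
    · exact Eventually.of_forall fun n => mul_nonneg (Nat.cast_nonneg _)
        (integral_nonneg fun y => by positivity)
    · filter_upwards [hrow] with n h
      have : ∫ y, (∑ j, t j * s n j y) ^ 4 ∂μ n ≤ ∫ y, 27 * ∑ j, t j ^ 4 * s n j y ^ 4 ∂μ n :=
        integral_mono (int4' n h) (int4 n h) (bd4 n)
      rw [integral_const_mul, integral_finsetSum _ fun j _ => (h.int4 j).const_mul _] at this
      simp only [integral_const_mul] at this
      calc _ ≤ (n : ℝ) * _ := mul_le_mul_of_nonneg_left this (Nat.cast_nonneg _)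
        _ = _ := by
          rw [mul_left_comm, Finset.mul_sum]
          congr 1
          exact Finset.sum_congr rfl fun j _ => by ring

theorem clt_main {μ : ℕ → Measure ℝ} {s : ℕ → Fin 3 → ℝ → ℝ} {J : Matrix (Fin 3) (Fin 3) ℝ}
    (hrow : ∀ᶠ n in atTop, Row (μ n) (s n))
    (hcov : ∀ j k, Tendsto (fun n : ℕ => n * ∫ y, s n j y * s n k y ∂μ n) atTop (𝓝 (J j k)))
    (hm4 : ∀ j, Tendsto (fun n : ℕ => n * ∫ y, s n j y ^ 4 ∂μ n) atTop (𝓝 0))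
    (B : Matrix (Fin 3) (Fin 3) ℝ) (hB : B * Bᵀ = J)
    (F : BoundedContinuousFunction (Fin 3 → ℝ) ℝ) :
    Tendsto (fun n : ℕ => ∫ x, F (fun j => ∑ i, s n j (x i)) ∂(Measure.pi fun _ : Fin n => μ n))
      atTop (𝓝 (∫ v, F v ∂ stdGauss3.map B.mulVec)) := by
  let T : (Fin 3 → ℝ) → EuclideanSpace ℝ (Fin 3) := WithLp.toLp 2
  have hTc : Continuous T := PiLp.continuous_toLp 2 _
  have hTm : Measurable T := hTc.measurable
  have hinner : ∀ (a : Fin 3 → ℝ) (t : EuclideanSpace ℝ (Fin 3)),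
      inner ℝ (T a) t = ∑ j, t j * a j := by
    intro a t; simp [T, PiLp.inner_apply]
  have hBm : Measurable B.mulVec := (Continuous.matrix_mulVec continuous_const continuous_id).measurable
  have hSm : ∀ n, Row (μ n) (s n) → Measurable (fun x : Fin n → ℝ => fun j => ∑ i, s n j (x i)) :=
    fun n h => measurable_pi_lambda _ fun j =>
      Finset.measurable_sum _ fun i _ => (h.meas j).comp (measurable_pi_apply i)
  have : IsProbabilityMeasure stdGauss3 := by unfold stdGauss3; infer_instance
  let Q : ProbabilityMeasure (EuclideanSpace ℝ (Fin 3)) :=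
    ⟨(stdGauss3.map B.mulVec).map T, by
      have := Measure.isProbabilityMeasure_map (μ := stdGauss3) hBm.aemeasurable
      exact Measure.isProbabilityMeasure_map hTm.aemeasurable⟩
  let P : ℕ → ProbabilityMeasure (EuclideanSpace ℝ (Fin 3)) := fun n => by
    classical
    exact if h : Row (μ n) (s n) then
      ⟨((Measure.pi fun _ : Fin n => μ n).map (fun x : Fin n → ℝ => fun j => ∑ i, s n j (x i))).map T, by
        have := h.prob
        have := Measure.isProbabilityMeasure_map (μ := Measure.pi fun _ : Fin n => μ n) (hSm n h).aemeasurable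
        exact Measure.isProbabilityMeasure_map hTm.aemeasurable⟩ else ⟨Measure.dirac 0, inferInstance⟩
  have hP : ∀ n, Row (μ n) (s n) → (P n : Measure (EuclideanSpace ℝ (Fin 3))) =
      ((Measure.pi fun _ : Fin n => μ n).map (fun x : Fin n → ℝ => fun j => ∑ i, s n j (x i))).map T := by
    intro n h
    have : P n = ⟨((Measure.pi fun _ : Fin n => μ n).map (fun x : Fin n → ℝ => fun j => ∑ i, s n j (x i))).map T, by
        have := h.prob
        have := Measure.isProbabilityMeasure_map (μ := Measure.pi fun _ : Fin n => μ n) (hSm n h).aemeasurable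
        exact Measure.isProbabilityMeasure_map hTm.aemeasurable⟩ := dif_pos h
    rw [this]; rfl
  have hconv : Tendsto P atTop (𝓝 Q) := by
    rw [ProbabilityMeasure.tendsto_iff_tendsto_charFun]
    intro t
    have hlim := clt_char hrow hcov hm4 (fun j => t j)
    have hQ : charFun (Q : Measure (EuclideanSpace ℝ (Fin 3))) t
        = Complex.exp (-((∑ j, ∑ k, t j * J j k * t k) / 2 : ℝ)) := by
      show charFun ((stdGauss3.map B.mulVec).map T) t = _
      have hc : Continuous fun x : EuclideanSpace ℝ (Fin 3) => Complex.exp ((inner ℝ x t : ℝ) * Complex.I) := by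
        fun_prop
      have hc2 : Continuous fun x : Fin 3 → ℝ => Complex.exp ((inner ℝ (T x) t : ℝ) * Complex.I) :=
        hc.comp hTc
      rw [charFun_apply, integral_map hTm.aemeasurable hc.aestronglyMeasurable,
        integral_map hBm.aemeasurable hc2.aestronglyMeasurable]
      set c : Fin 3 → ℝ := fun k => ∑ j, t j * B j k with hcdef
      have e1 : ∀ v : Fin 3 → ℝ, Complex.exp ((inner ℝ (T (B.mulVec v)) t : ℝ) * Complex.I)
          = ∏ k, Complex.exp (c k * v k * Complex.I) := by
        intro v
        rw [hinner, ← Complex.exp_sum]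
        congr 1
        simp only [Matrix.mulVec, dotProduct, hcdef]
        push_cast
        simp only [Finset.sum_mul, Finset.mul_sum]
        rw [Finset.sum_comm]
        exact Finset.sum_congr rfl fun j _ => Finset.sum_congr rfl fun k _ => by ring
      simp_rw [e1]
      unfold stdGauss3
      rw [integral_fintype_prod_eq_prod (fun k (x : ℝ) => Complex.exp (c k * x * Complex.I))]
      have e2 : ∀ k, ∫ x : ℝ, Complex.exp (c k * x * Complex.I) ∂(ProbabilityTheory.gaussianReal 0 1)
          = Complex.exp (-(c k ^ 2 / 2 : ℝ)) := by
        intro k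
        rw [← charFun_apply_real, ProbabilityTheory.charFun_gaussianReal]
        congr 1; simp
      simp_rw [e2]
      rw [← Complex.exp_sum]
      congr 1
      rw [← hB]
      have e3 : ∑ j, ∑ k, t j * (B * Bᵀ) j k * t k = ∑ k, c k ^ 2 := by
        simp only [Matrix.mul_apply, Matrix.transpose_apply, hcdef, sq, Fin.sum_univ_three]
        ring
      rw [e3, Finset.sum_div]
      push_cast
      rw [← Finset.sum_neg_distrib]
    rw [hQ]
    refine hlim.congr' ?_
    filter_upwards [hrow] with n h
    have := h.prob
    rw [hP n h]
    have hc : Continuous fun x : EuclideanSpace ℝ (Fin 3) => Complex.exp ((inner ℝ x t : ℝ) * Complex.I) := by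
      fun_prop
    have hc2 : Continuous fun x : Fin 3 → ℝ => Complex.exp ((inner ℝ (T x) t : ℝ) * Complex.I) :=
      hc.comp hTc
    rw [charFun_apply, integral_map hTm.aemeasurable hc.aestronglyMeasurable,
        integral_map (hSm n h).aemeasurable hc2.aestronglyMeasurable]
    have e1 : ∀ x : Fin n → ℝ, Complex.exp ((inner ℝ (T (fun j => ∑ i, s n j (x i))) t : ℝ) * Complex.I)
          = ∏ i, Complex.exp ((∑ j, t j * s n j (x i) : ℝ) * Complex.I) := by
      intro x
      rw [hinner, ← Complex.exp_sum]
      congr 1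
      push_cast
      simp only [Finset.sum_mul, Finset.mul_sum]
      rw [Finset.sum_comm]
    simp_rw [e1]
    rw [integral_fintype_prod_eq_pow (fun y : ℝ => Complex.exp ((∑ j, t j * s n j y : ℝ) * Complex.I))]
    simp
  have hTinv : Continuous (WithLp.ofLp : EuclideanSpace ℝ (Fin 3) → (Fin 3 → ℝ)) :=
    PiLp.continuous_ofLp 2 _
  have hfin := ProbabilityMeasure.tendsto_iff_forall_integral_tendsto.1 hconv
    (F.compContinuous ⟨_, hTinv⟩)
  have hGc : Continuous fun x : EuclideanSpace ℝ (Fin 3) => F (WithLp.ofLp x) := F.continuous.comp hTinv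
  have hQ2 : ∫ x, (F.compContinuous ⟨_, hTinv⟩) x ∂(Q : Measure (EuclideanSpace ℝ (Fin 3)))
      = ∫ v, F v ∂ stdGauss3.map B.mulVec := by
    show ∫ x, F (WithLp.ofLp x) ∂((stdGauss3.map B.mulVec).map T) = _
    rw [integral_map hTm.aemeasurable hGc.aestronglyMeasurable]
  rw [hQ2] at hfin
  refine hfin.congr' ?_
  filter_upwards [hrow] with n h
  rw [hP n h]
  show ∫ x, F (WithLp.ofLp x) ∂_ = _
  rw [integral_map hTm.aemeasurable hGc.aestronglyMeasurable]
  exact integral_map (hSm n h).aemeasurable F.continuous.aestronglyMeasurable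

end PartA4

section PartB1
/-- Fourier representation of the rescaled density. -/
def qf (σ lam α x : ℝ) : ℝ :=
  (2 * Real.pi)⁻¹ * ∫ v : ℝ, Real.cos (x * v) * Real.exp (-(σ ^ 2 / 2 * v ^ 2) - lam * |v| ^ α)

lemma gauss_eq (y : ℝ) : gauss y = ProbabilityTheory.gaussianPDFReal 0 1 y := by
  simp [gauss, ProbabilityTheory.gaussianPDFReal]

lemma gauss_integrable : Integrable gauss := by
  have := ProbabilityTheory.integrable_gaussianPDFReal 0 1
  exact this.congr (Eventually.of_forall fun y => (gauss_eq y).symm)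

lemma gauss_cont : Continuous gauss := by unfold gauss; fun_prop

lemma gauss_nonneg (y : ℝ) : 0 ≤ gauss y := by unfold gauss; positivity

lemma gauss_cexp (t : ℝ) : ∫ x, (gauss x : ℂ) * Complex.exp (t * x * Complex.I) =
    Complex.exp (-(t ^ 2 / 2)) := by
  have h := ProbabilityTheory.charFun_gaussianReal (μ := 0) (v := 1) t
  rw [charFun_apply_real, ProbabilityTheory.integral_gaussianReal_eq_integral_smul (by norm_num)] at h
  simp only [← gauss_eq] at h
  rw [show (∫ x, (gauss x : ℂ) * Complex.exp (t * x * Complex.I)) =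
    ∫ x, gauss x • Complex.exp (t * x * Complex.I) by simp]
  rw [h]; congr 1; push_cast; ring

lemma gauss_cos (y t : ℝ) : ∫ x, gauss x * Real.cos ((y - x) * t) =
    Real.cos (y * t) * Real.exp (-(t ^ 2 / 2)) := by
  have h := gauss_cexp (-t)
  have h1 : ∫ x, (gauss x : ℂ) * Complex.exp (((y - x) * t : ℝ) * Complex.I) =
      Complex.exp ((y * t : ℝ) * Complex.I) * Complex.exp (-(t ^ 2 / 2)) := by
    have : ∀ x : ℝ, (gauss x : ℂ) * Complex.exp (((y - x) * t : ℝ) * Complex.I) =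
        Complex.exp ((y * t : ℝ) * Complex.I) *
          ((gauss x : ℂ) * Complex.exp ((-t : ℝ) * x * Complex.I)) := by
      intro x
      rw [mul_left_comm, ← Complex.exp_add]; congr 2; push_cast; ring
    simp_rw [this]
    rw [integral_const_mul, h]; congr 2; push_cast; ring
  have hi : Integrable (fun x : ℝ => (gauss x : ℂ) * Complex.exp (((y - x) * t : ℝ) * Complex.I)) := by
    refine gauss_integrable.ofReal.mul_bdd (c := 1) ?_ ?_
    · apply Continuous.aestronglyMeasurable; fun_prop
    · exact Eventually.of_forall fun x => by rw [Complex.norm_exp_ofReal_mul_I]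
  have h2 := congrArg Complex.re h1
  have h3 : (∫ x, (gauss x : ℂ) * Complex.exp (((y - x) * t : ℝ) * Complex.I)).re =
      ∫ x, ((gauss x : ℂ) * Complex.exp (((y - x) * t : ℝ) * Complex.I)).re :=
    (integral_re hi).symm
  rw [h3] at h2
  have h4 : ∀ x : ℝ, ((gauss x : ℂ) * Complex.exp (((y - x) * t : ℝ) * Complex.I)).re =
      gauss x * Real.cos ((y - x) * t) := by
    intro x; rw [Complex.re_ofReal_mul, Complex.exp_ofReal_mul_I_re]
  simp_rw [h4] at h2
  rw [h2, show (-((t:ℂ) ^ 2 / 2)) = ((-(t ^ 2 / 2) : ℝ) : ℂ) by push_cast; ring,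
    ← Complex.ofReal_exp, Complex.re_mul_ofReal, Complex.exp_ofReal_mul_I_re]

lemma integrable_comp_abs_of {f : ℝ → ℝ} (h : IntegrableOn f (Ioi 0)) :
    Integrable (fun x => f |x|) := by
  have hf : IntegrableOn (fun x => f |x|) (Ioi 0) :=
    h.congr_fun (fun x hx => by rw [abs_of_pos (by exact hx)]) measurableSet_Ioi
  have int_Iic : IntegrableOn (fun x ↦ f |x|) (Iic 0) := by
    rw [← Measure.map_neg_eq_self (volume : Measure ℝ)]
    let m : MeasurableEmbedding fun x : ℝ => -x := (Homeomorph.neg ℝ).measurableEmbedding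
    rw [m.integrableOn_map_iff]
    simp_rw [Function.comp_def, abs_neg, neg_preimage, neg_Iic, neg_zero]
    exact Iff.mpr integrableOn_Ici_iff_integrableOn_Ioi hf
  have := int_Iic.union hf
  rwa [Iic_union_Ioi, integrableOn_univ] at this

lemma integrable_exp_abs_rpow {α : ℝ} (hα : 0 < α) :
    Integrable (fun u : ℝ => Real.exp (-(|u| ^ α))) := by
  have h : IntegrableOn (fun u : ℝ => Real.exp (-(u ^ α))) (Ioi 0) := by
    have := integrableOn_rpow_mul_exp_neg_rpow (s := 0) (by norm_num) hα
    simpa using this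
  exact integrable_comp_abs_of (f := fun u : ℝ => Real.exp (-(u ^ α))) h

lemma fFun_eq {α w : ℝ} (hα : 0 < α) (hw : 0 < w) (y : ℝ) :
    fFun α y w = (2 * Real.pi)⁻¹ * ∫ v : ℝ, Real.cos (y * v) *
      Real.exp (-(v ^ 2 / 2) - w ^ α * |v| ^ α) := by
  unfold fFun stableDensity
  have h1 : ∀ z, gauss (y - w * z) * ((2 * Real.pi)⁻¹ * ∫ u : ℝ, Real.cos (z * u) * Real.exp (-(|u| ^ α)))
     = (2 * Real.pi)⁻¹ * ∫ u : ℝ, gauss (y - w * z) * (Real.cos (z * u) * Real.exp (-(|u| ^ α))) := by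
    intro z; rw [integral_const_mul]; ring
  simp_rw [h1]
  rw [integral_const_mul]; congr 1
  have hg : Integrable (fun z : ℝ => gauss (y - w * z)) := by
    have h := (gauss_integrable.comp_sub_left y).comp_mul_left' hw.ne'
    exact h
  rw [integral_integral_swap]
  · have h2 : ∀ u : ℝ, ∫ z, gauss (y - w * z) * (Real.cos (z * u) * Real.exp (-(|u| ^ α))) =
       w⁻¹ * (fun v : ℝ => Real.cos (y * v) * Real.exp (-(v ^ 2 / 2) - w ^ α * |v| ^ α)) (w⁻¹ * u) := by
      intro u
      have e1 : ∀ z, gauss (y - w * z) * (Real.cos (z * u) * Real.exp (-(|u| ^ α))) =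
        Real.exp (-(|u| ^ α)) * ((fun x => gauss (y - x) * Real.cos (x * (w⁻¹ * u))) (w * z)) := by
        intro z
        simp only
        rw [show w * z * (w⁻¹ * u) = z * u by field_simp]; ring
      rw [integral_congr_ae (Eventually.of_forall e1), integral_const_mul,
        Measure.integral_comp_mul_left (fun x => gauss (y - x) * Real.cos (x * (w⁻¹ * u)))]
      have e2 : ∫ x, gauss (y - x) * Real.cos (x * (w⁻¹ * u)) =
         ∫ x, gauss x * Real.cos ((y - x) * (w⁻¹ * u)) := by
        rw [← integral_sub_left_eq_self _ _ y]; simp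
      rw [e2, gauss_cos, abs_of_pos (inv_pos.2 hw), smul_eq_mul]
      have e3 : w ^ α * |w⁻¹ * u| ^ α = |u| ^ α := by
        rw [← Real.mul_rpow hw.le (abs_nonneg _), abs_mul, abs_of_pos (inv_pos.2 hw)]
        congr 1; field_simp
      beta_reduce
      rw [e3, sub_eq_add_neg, Real.exp_add]; ring
    rw [integral_congr_ae (Eventually.of_forall h2), integral_const_mul,
      Measure.integral_comp_mul_left (fun v : ℝ => Real.cos (y * v) * Real.exp (-(v ^ 2 / 2) - w ^ α * |v| ^ α)), inv_inv, abs_of_pos hw, smul_eq_mul,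
      ← mul_assoc, inv_mul_cancel₀ hw.ne', one_mul]
  · have hp := hg.mul_prod (integrable_exp_abs_rpow hα)
    have : (Function.uncurry fun z u => gauss (y - w * z) * (Real.cos (z * u) * Real.exp (-(|u| ^ α)))) =
      fun p : ℝ × ℝ => Real.cos (p.1 * p.2) * (gauss (y - w * p.1) * Real.exp (-(|p.2| ^ α))) := by
      ext ⟨a, b⟩; simp [Function.uncurry]; ring
    rw [this]
    refine hp.bdd_mul (c := 1) ?_ ?_
    · apply Continuous.aestronglyMeasurable; fun_prop
    · exact Eventually.of_forall fun x => by simpa using Real.abs_cos_le_one _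

lemma pdens_eq {n : ℕ} (hn : 0 < n) {θ : Fin 3 → ℝ} (h0 : 0 < θ 0) (h1 : 0 < θ 1) (h2 : 0 < θ 2)
    (y : ℝ) : pdens n θ y = Real.sqrt n * qf (θ 0) (θ 1 ^ (θ 2) * (n:ℝ) ^ (θ 2 / 2 - 1)) (θ 2)
      (Real.sqrt n * y) := by
  have hn' : (0:ℝ) < n := by exact_mod_cast hn
  have hw : 0 < wn n (θ 0) (θ 1) (θ 2) := by unfold wn; positivity
  unfold pdens qf
  rw [fFun_eq h2 hw]
  have e : ∀ u : ℝ, Real.cos (Real.sqrt n * y * u) *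
        Real.exp (-(θ 0 ^ 2 / 2 * u ^ 2) - θ 1 ^ (θ 2) * (n:ℝ) ^ (θ 2 / 2 - 1) * |u| ^ θ 2) =
      (fun v => Real.cos (Real.sqrt n * y / θ 0 * v) *
      Real.exp (-(v ^ 2 / 2) - wn n (θ 0) (θ 1) (θ 2) ^ θ 2 * |v| ^ θ 2)) (θ 0 * u) := by
    intro u
    simp only
    rw [show Real.sqrt n * y / θ 0 * (θ 0 * u) = Real.sqrt n * y * u by field_simp]
    congr 3
    · ring
    · rw [abs_mul, abs_of_pos h0, Real.mul_rpow h0.le (abs_nonneg _), ← mul_assoc]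
      congr 1
      rw [← Real.mul_rpow hw.le h0.le, wn, div_mul_cancel₀ _ h0.ne', Real.mul_rpow (by positivity) h1.le,
        ← Real.rpow_mul hn'.le, mul_comm]
      congr 2; field_simp
  rw [integral_congr_ae (Eventually.of_forall e), Measure.integral_comp_mul_left (fun v => Real.cos (Real.sqrt n * y / θ 0 * v) *
      Real.exp (-(v ^ 2 / 2) - wn n (θ 0) (θ 1) (θ 2) ^ θ 2 * |v| ^ θ 2)), abs_of_pos (inv_pos.2 h0), smul_eq_mul]
  field_simp

lemma qf_neg (σ lam α x : ℝ) : qf σ lam α (-x) = qf σ lam α x := by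
  unfold qf; simp only [neg_mul, Real.cos_neg]

lemma qf_abs (σ lam α x : ℝ) : qf σ lam α |x| = qf σ lam α x := by
  rcases abs_choice x with h | h <;> rw [h]
  exact qf_neg _ _ _ _

lemma qg_cont {σ lam α : ℝ} (hα : 0 < α) : Continuous (fun v : ℝ =>
    Real.exp (-(σ ^ 2 / 2 * v ^ 2) - lam * |v| ^ α)) := by
  have : Continuous fun v : ℝ => |v| ^ α := continuous_abs.rpow_const fun _ => Or.inr hα.le
  fun_prop

lemma qg_int {σ lam α : ℝ} (hσ : 0 < σ) (hlam : 0 ≤ lam) (hα : 0 < α) : Integrable (fun v : ℝ =>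
    Real.exp (-(σ ^ 2 / 2 * v ^ 2) - lam * |v| ^ α)) := by
  have h := integrable_exp_neg_mul_sq (b := σ ^ 2 / 2) (by positivity)
  refine h.mono' (qg_cont hα).aestronglyMeasurable (Eventually.of_forall fun v => ?_)
  rw [Real.norm_eq_abs, Real.abs_exp]
  apply Real.exp_le_exp.2
  have : 0 ≤ lam * |v| ^ α := by positivity
  nlinarith

lemma qf_integral_one {σ lam α : ℝ} (hσ : 0 < σ) (hlam : 0 ≤ lam) (hα : 0 < α)
    (hq : Integrable (qf σ lam α)) : ∫ x, qf σ lam α x = 1 := by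
  set g : ℝ → ℝ := fun v => Real.exp (-(σ ^ 2 / 2 * v ^ 2) - lam * |v| ^ α) with hg
  have gc : Continuous g := qg_cont hα
  have gi : Integrable g := qg_int hσ hlam hα
  let f : ℝ → ℂ := fun v => (g v : ℂ)
  have fc : Continuous f := Complex.continuous_ofReal.comp gc
  have fi : Integrable f := gi.ofReal
  have hF : ∀ ξ : ℝ, FourierTransform.fourier f ξ = ((2 * Real.pi * qf σ lam α (2 * Real.pi * ξ) : ℝ) : ℂ) := by
    intro ξ
    rw [Real.fourier_eq']
    have hsum : ∀ v : ℝ, Complex.exp (((-2 * Real.pi * inner ℝ v ξ : ℝ) : ℂ) * Complex.I) • f v =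
        ((Real.cos (2 * Real.pi * ξ * v) * g v : ℝ) : ℂ) -
          ((Real.sin (2 * Real.pi * ξ * v) * g v : ℝ) : ℂ) * Complex.I := by
      intro v
      have : (-2 * Real.pi * inner ℝ v ξ : ℝ) = -(2 * Real.pi * ξ * v) := by
        simp [inner]; ring
      rw [this, Complex.exp_mul_I, smul_eq_mul, ← Complex.ofReal_cos, ← Complex.ofReal_sin,
        Real.cos_neg, Real.sin_neg]
      simp only [f]; push_cast; ring
    simp_rw [hsum]
    have i1 : Integrable (fun v => Real.cos (2 * Real.pi * ξ * v) * g v) := by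
      refine gi.bdd_mul (c := 1) (Continuous.aestronglyMeasurable (by fun_prop)) ?_
      exact Eventually.of_forall fun x => by simpa using Real.abs_cos_le_one _
    have i2 : Integrable (fun v => Real.sin (2 * Real.pi * ξ * v) * g v) := by
      refine gi.bdd_mul (c := 1) (Continuous.aestronglyMeasurable (by fun_prop)) ?_
      exact Eventually.of_forall fun x => by simpa using Real.abs_sin_le_one _
    have j1 : Integrable (fun v => ((Real.cos (2 * Real.pi * ξ * v) * g v : ℝ) : ℂ)) := i1.ofReal
    have j2 : Integrable (fun v => ((Real.sin (2 * Real.pi * ξ * v) * g v : ℝ) : ℂ) * Complex.I) :=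
      i2.ofReal.mul_const _
    rw [integral_sub j1 j2, integral_mul_const, integral_complex_ofReal, integral_complex_ofReal]
    have hodd : ∫ v, Real.sin (2 * Real.pi * ξ * v) * g v = 0 := by
      have := integral_neg_eq_self (fun v => Real.sin (2 * Real.pi * ξ * v) * g v) volume
      simp only [mul_neg, Real.sin_neg, neg_mul, hg, even_two.neg_pow, abs_neg] at this
      rw [integral_neg] at this
      simp only [hg]
      linarith
    rw [hodd]
    simp only [Complex.ofReal_zero, zero_mul, sub_zero, qf]
    congr 1
    rw [← mul_assoc, mul_inv_cancel₀ (by positivity), one_mul]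
  have Fi : Integrable (FourierTransform.fourier f) := by
    have : Integrable (fun ξ : ℝ => 2 * Real.pi * qf σ lam α (2 * Real.pi * ξ)) :=
      (hq.comp_mul_left' (by positivity)).const_mul _
    exact this.ofReal.congr (Eventually.of_forall fun ξ => (hF ξ).symm)
  have hinv := fc.fourierInv_fourier_eq fi Fi
  have h0 := congrFun hinv 0
  rw [Real.fourierInv_eq'] at h0
  simp only [inner_zero_right, mul_zero, Complex.ofReal_zero, zero_mul, Complex.exp_zero, one_smul] at h0
  simp_rw [hF] at h0
  rw [integral_complex_ofReal] at h0
  have : f 0 = ((1:ℝ):ℂ) := by simp [f, hg, Real.zero_rpow hα.ne']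
  rw [this] at h0
  have h1 := Complex.ofReal_injective h0
  rw [integral_const_mul, Measure.integral_comp_mul_left, abs_of_pos (by positivity), smul_eq_mul,
    ← mul_assoc, mul_inv_cancel₀ (by positivity), one_mul] at h1
  exact h1

end PartB1

section PartC1
lemma contour_shift {f : ℂ → ℂ} (hf : Differentiable ℂ f) {a b : ℝ} (hab : a ≤ b) {M : ℝ → ℝ}
    (hM : ∀ t : ℝ, ∀ y ∈ Icc a b, ‖f (t + y * Complex.I)‖ ≤ M t) (Mi : Integrable M)
    (Mtop : Tendsto M atTop (𝓝 0)) (Mbot : Tendsto M atBot (𝓝 0)) :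
    ∫ t : ℝ, f (t + a * Complex.I) = ∫ t : ℝ, f (t + b * Complex.I) := by
  have fc := hf.continuous
  have hi : ∀ y ∈ Icc a b, Integrable (fun t : ℝ => f (t + y * Complex.I)) := by
    intro y hy
    refine Mi.mono' (Continuous.aestronglyMeasurable (by fun_prop)) (Eventually.of_forall fun t => hM t y hy)
  have hR : ∀ R : ℝ, (∫ t in (-R)..R, f (t + a * Complex.I)) - (∫ t in (-R)..R, f (t + b * Complex.I)) =
     - (Complex.I • ∫ y in a..b, f (((R:ℝ):ℂ) + y * Complex.I)) + Complex.I • ∫ y in a..b, f (((-R:ℝ):ℂ) + y * Complex.I) := by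
    intro R
    have := Complex.integral_boundary_rect_eq_zero_of_differentiableOn f (⟨-R, a⟩ : ℂ) (⟨R, b⟩ : ℂ)
      hf.differentiableOn
    simp only at this
    linear_combination this
  have hbd : ∀ R : ℝ, ‖∫ y in a..b, f ((R:ℂ) + y * Complex.I)‖ ≤ M R * |b - a| := by
    intro R
    refine intervalIntegral.norm_integral_le_of_norm_le_const fun y hy => hM R y ?_
    rw [uIoc_of_le hab] at hy
    exact ⟨hy.1.le, hy.2⟩
  have t1 : Tendsto (fun R : ℝ => ∫ y in a..b, f (((R:ℝ):ℂ) + y * Complex.I)) atTop (𝓝 0) :=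
    squeeze_zero_norm hbd (by simpa using Mtop.mul_const |b - a|)
  have t2 : Tendsto (fun R : ℝ => ∫ y in a..b, f (((-R:ℝ):ℂ) + y * Complex.I)) atTop (𝓝 0) :=
    squeeze_zero_norm (fun R => hbd (-R))
      (by simpa using (Mbot.comp tendsto_neg_atTop_atBot).mul_const |b - a|)
  have t3 := intervalIntegral_tendsto_integral (hi a ⟨le_rfl, hab⟩) tendsto_neg_atTop_atBot tendsto_id
  have t4 := intervalIntegral_tendsto_integral (hi b ⟨hab, le_rfl⟩) tendsto_neg_atTop_atBot tendsto_id
  have t5 := t3.sub t4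
  have t6 : Tendsto (fun R : ℝ => - (Complex.I • ∫ y in a..b, f (((R:ℝ):ℂ) + y * Complex.I)) +
      Complex.I • ∫ y in a..b, f (((-R:ℝ):ℂ) + y * Complex.I)) atTop (𝓝 0) := by
    simpa using ((t1.const_smul Complex.I).neg).add (t2.const_smul Complex.I)
  have t7 := tendsto_nhds_unique (t5.congr fun R => by simpa using hR R) t6
  exact sub_eq_zero.1 t7

lemma integral_exp_sub {E : Type*} [NormedAddCommGroup E] [NormedSpace ℝ E] (g : ℝ → E) :
    ∫ x, Real.exp x • g (Real.exp x) = ∫ y in Ioi (0:ℝ), g y := by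
  symm
  have := integral_image_eq_integral_abs_deriv_smul
      (MeasurableSet.univ) (fun x _ ↦ (Real.hasDerivAt_exp x).hasDerivWithinAt)
      (fun x _ y _ hxy ↦ Real.exp_injective hxy) g
  rw [image_univ, Real.range_exp] at this
  simpa [abs_of_pos (Real.exp_pos _)] using this

lemma integrable_exp_sub {E : Type*} [NormedAddCommGroup E] [NormedSpace ℝ E] (g : ℝ → E) :
    Integrable (fun x => Real.exp x • g (Real.exp x)) ↔ IntegrableOn g (Ioi (0:ℝ)) := by
  symm
  have := integrableOn_image_iff_integrableOn_abs_deriv_smul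
      (MeasurableSet.univ) (fun x _ ↦ (Real.hasDerivAt_exp x).hasDerivWithinAt)
      (fun x _ y _ hxy ↦ Real.exp_injective hxy) g
  rw [image_univ, Real.range_exp] at this
  simpa [abs_of_pos (Real.exp_pos _)] using this

/-- Rotation of a ray of integration, in logarithmic coordinates. -/
lemma ray_rotate {F : ℂ → ℂ} (hF : Differentiable ℂ F) {a b : ℝ} (hab : a ≤ b) {C p c : ℝ}
    (hp : -1 < p) (hc : 0 < c)
    (hb : ∀ r : ℝ, 0 < r → ∀ y ∈ Icc a b, ‖F (Real.log r + y * Complex.I)‖ ≤ C * (r ^ p * Real.exp (-c * r))) :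
    ∫ r in Ioi (0:ℝ), Complex.exp (a * Complex.I) * F (Real.log r + a * Complex.I) =
    ∫ r in Ioi (0:ℝ), Complex.exp (b * Complex.I) * F (Real.log r + b * Complex.I) := by
  let f : ℂ → ℂ := fun ζ => Complex.exp ζ * F ζ
  have hf : Differentiable ℂ f := Complex.differentiable_exp.mul hF
  let N : ℝ → ℝ := fun r => C * (r ^ p * Real.exp (-c * r))
  let M : ℝ → ℝ := fun t => Real.exp t • N (Real.exp t)
  have hM : ∀ t : ℝ, ∀ y ∈ Icc a b, ‖f (t + y * Complex.I)‖ ≤ M t := by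
    intro t y hy
    have := hb (Real.exp t) (Real.exp_pos t) y hy
    rw [Real.log_exp] at this
    simp only [f, M, norm_mul, smul_eq_mul]
    rw [Complex.norm_exp]
    simp only [Complex.add_re, Complex.ofReal_re, Complex.mul_re, Complex.I_re, mul_zero, Complex.ofReal_im,
      Complex.I_im, mul_one, sub_self, add_zero]
    exact mul_le_mul_of_nonneg_left this (Real.exp_pos _).le
  have Mi : Integrable M := by
    refine (integrable_exp_sub N).2 ?_
    have := integrableOn_rpow_mul_exp_neg_mul_rpow hp (one_pos) hc
    simp only [Real.rpow_one] at this
    exact this.const_mul C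
  have Meq : ∀ t, M t = C * ((Real.exp t) ^ (p + 1) * Real.exp (-c * Real.exp t)) := by
    intro t
    simp only [M, N, smul_eq_mul]
    rw [Real.rpow_add (Real.exp_pos _), Real.rpow_one]; ring
  have Mtop : Tendsto M atTop (𝓝 0) := by
    have h := (tendsto_rpow_mul_exp_neg_mul_atTop_nhds_zero (p + 1) c hc).comp Real.tendsto_exp_atTop
    have h2 := h.const_mul C
    rw [mul_zero] at h2
    exact h2.congr fun t => (Meq t).symm
  have Mbot : Tendsto M atBot (𝓝 0) := by
    have h1 : Tendsto (fun r : ℝ => C * (r ^ (p + 1) * Real.exp (-c * r))) (𝓝 0) (𝓝 (C * ((0:ℝ) ^ (p+1) * Real.exp (-c * 0)))) := by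
      refine Tendsto.const_mul _ (Tendsto.mul ?_ ?_)
      · exact (Real.continuousAt_rpow_const 0 (p+1) (Or.inr (by linarith))).tendsto
      · exact Continuous.tendsto (by fun_prop) _
    rw [Real.zero_rpow (by linarith), zero_mul, mul_zero] at h1
    exact (h1.comp Real.tendsto_exp_atBot).congr fun t => (Meq t).symm
  have key := contour_shift hf hab hM Mi Mtop Mbot
  have conv : ∀ y : ℝ, ∫ r in Ioi (0:ℝ), Complex.exp (y * Complex.I) * F (Real.log r + y * Complex.I) =
      ∫ t : ℝ, f (t + y * Complex.I) := by
    intro y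
    rw [← integral_exp_sub]
    refine integral_congr_ae (Eventually.of_forall fun t => ?_)
    simp only [f, Real.log_exp, Complex.exp_add, Complex.real_smul, Complex.ofReal_exp]
    ring
  rw [conv, conv, key]

def om : ℂ := Complex.exp ((Real.pi / 6 : ℝ) * Complex.I)
def lg (r : ℝ) : ℂ := Real.log r + (Real.pi / 6 : ℝ) * Complex.I

/-- The rotated Fourier transform. -/
def TT (K : ℝ → ℂ) (x : ℝ) : ℝ :=
  (1 / Real.pi) * (∫ r in Ioi (0:ℝ), om * Complex.exp (Complex.I * |x| * (om * r)) * K r).re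

def AA (σ : ℂ) (r : ℝ) : ℂ := σ ^ 2 / 2 * (om * r) ^ 2

lemma om_norm : ‖om‖ = 1 := by unfold om; exact Complex.norm_exp_ofReal_mul_I _

lemma om_re : om.re = √3 / 2 := by
  unfold om; rw [Complex.exp_ofReal_mul_I_re, Real.cos_pi_div_six]

lemma om_im : om.im = 1 / 2 := by
  unfold om; rw [Complex.exp_ofReal_mul_I_im, Real.sin_pi_div_six]

lemma om_sq : om ^ 2 = ⟨1 / 2, √3 / 2⟩ := by
  have h3 : √3 * √3 = 3 := Real.mul_self_sqrt (by norm_num)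
  rw [sq]
  apply Complex.ext <;> simp only [Complex.mul_re, Complex.mul_im, om_re, om_im] <;> nlinarith

lemma exp_lg {r : ℝ} (hr : 0 < r) : Complex.exp (lg r) = om * r := by
  unfold lg om
  rw [Complex.exp_add, ← Complex.ofReal_exp, Real.exp_log hr, mul_comm]

lemma AA_re (σ r : ℝ) : (AA σ r).re = σ ^ 2 * r ^ 2 / 4 := by
  unfold AA
  rw [mul_pow, om_sq]
  have : (σ:ℂ) ^ 2 / 2 * (⟨1 / 2, √3 / 2⟩ * (r:ℂ) ^ 2) = ((σ ^ 2 * r ^ 2 / 2 : ℝ) : ℂ) * ⟨1 / 2, √3 / 2⟩ := by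
    push_cast; ring
  rw [this, Complex.re_ofReal_mul]
  ring

lemma norm_exp_xom (x r : ℝ) : ‖Complex.exp (Complex.I * |x| * (om * r))‖ = Real.exp (-(|x| * r) / 2) := by
  rw [Complex.norm_exp]
  congr 1
  simp [om_re, om_im]; ring

lemma exp_alg_re {α r : ℝ} (hr : 0 < r) : (Complex.exp (α * lg r)).re = r ^ α * Real.cos (α * (Real.pi / 6)) := by
  rw [Complex.exp_re]
  congr 1
  · simp [lg]; rw [Real.rpow_def_of_pos hr, mul_comm]
  · simp [lg]

lemma norm_exp_alg {α r : ℝ} (hr : 0 < r) : ‖Complex.exp (α * lg r)‖ = r ^ α := by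
  rw [Complex.norm_exp]
  simp [lg]; rw [Real.rpow_def_of_pos hr, mul_comm]

lemma cos_alg_nonneg {α : ℝ} (h0 : 0 < α) (h2 : α < 2) : 0 ≤ Real.cos (α * (Real.pi / 6)) := by
  apply Real.cos_nonneg_of_mem_Icc
  constructor <;> nlinarith [Real.pi_pos]

lemma qf_eq_TT {σ lam α : ℝ} (hσ : 0 < σ) (hlam : 0 ≤ lam) (h0 : 0 < α) (h2 : α < 2) (x : ℝ) :
    qf σ lam α x = TT (fun r => Complex.exp (-(AA σ r) - lam * Complex.exp (α * lg r))) x := by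
  let F : ℂ → ℂ := fun ζ => Complex.exp (Complex.I * |x| * Complex.exp ζ - σ ^ 2 / 2 * Complex.exp ζ ^ 2
    - lam * Complex.exp (α * ζ))
  have hF : Differentiable ℂ F := by fun_prop
  have hs : 0 < σ ^ 2 := by positivity
  have hbound : ∀ r : ℝ, 0 < r → ∀ y ∈ Icc 0 (Real.pi / 6), ‖F (Real.log r + y * Complex.I)‖ ≤
      Real.exp (σ ^ 2 / 4) * (r ^ (0:ℝ) * Real.exp (-(σ ^ 2 / 2) * r)) := by
    intro r hr y hy
    rw [Real.rpow_zero, one_mul, ← Real.exp_add]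
    simp only [F]
    rw [Complex.norm_exp]
    apply Real.exp_le_exp.2
    have e1 : Complex.exp (Real.log r + y * Complex.I) = r * (⟨Real.cos y, Real.sin y⟩ : ℂ) := by
      rw [Complex.exp_add, ← Complex.ofReal_exp, Real.exp_log hr]
      congr 1
      apply Complex.ext
      · rw [Complex.exp_ofReal_mul_I_re]
      · rw [Complex.exp_ofReal_mul_I_im]
    have e2 : (Complex.exp (α * (Real.log r + y * Complex.I))).re = r ^ α * Real.cos (α * y) := by
      rw [Complex.exp_re]
      congr 1
      · simp; rw [Real.rpow_def_of_pos hr, mul_comm]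
      · simp
    have e3 : (σ:ℂ) ^ 2 / 2 * (r * (⟨Real.cos y, Real.sin y⟩ : ℂ)) ^ 2 =
       ((σ ^ 2 / 2 * r ^ 2 : ℝ) : ℂ) * (⟨Real.cos y, Real.sin y⟩ : ℂ) ^ 2 := by push_cast; ring
    have e4 : Complex.I * ((|x| : ℝ) : ℂ) * (r * (⟨Real.cos y, Real.sin y⟩ : ℂ)) =
       ((|x| * r : ℝ) : ℂ) * (Complex.I * (⟨Real.cos y, Real.sin y⟩ : ℂ)) := by push_cast; ring
    rw [e1, Complex.sub_re, Complex.sub_re, Complex.re_ofReal_mul, e2, e3, e4, Complex.re_ofReal_mul,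
      Complex.re_ofReal_mul, sq (⟨Real.cos y, Real.sin y⟩ : ℂ)]
    simp only [Complex.mul_re, Complex.I_re, Complex.I_im]
    have hpi := Real.pi_pos
    have c1 : 0 ≤ Real.cos (α * y) := by
      apply Real.cos_nonneg_of_mem_Icc
      constructor
      · have : 0 ≤ α * y := mul_nonneg h0.le hy.1
        linarith
      · have : α * y ≤ 2 * (Real.pi / 6) := mul_le_mul h2.le hy.2 hy.1 (by norm_num)
        linarith
    have c2 : 0 ≤ Real.sin y := Real.sin_nonneg_of_mem_Icc ⟨hy.1, by linarith [hy.2]⟩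
    have c3 : Real.sin y ≤ 1 / 2 := by
      rw [← Real.sin_pi_div_six]
      exact Real.sin_le_sin_of_le_of_le_pi_div_two (by linarith [hy.1]) (by linarith) hy.2
    have c4 := Real.sin_sq_add_cos_sq y
    have c5 : 1 / 2 ≤ Real.cos y * Real.cos y - Real.sin y * Real.sin y := by nlinarith
    have d1 : 0 ≤ lam * (r ^ α * Real.cos (α * y)) := by positivity
    have d2 : 0 ≤ |x| * r * Real.sin y := by positivity
    have d3 : σ ^ 2 / 2 * r ^ 2 * (1/2) ≤ σ ^ 2 / 2 * r ^ 2 * (Real.cos y * Real.cos y - Real.sin y * Real.sin y) :=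
      mul_le_mul_of_nonneg_left c5 (by positivity)
    have d4 : 0 ≤ σ ^ 2 / 4 * (r - 1) ^ 2 := by positivity
    nlinarith
  have rot := ray_rotate hF (by positivity : (0:ℝ) ≤ Real.pi / 6) (by norm_num : (-1:ℝ) < 0)
    (by positivity : 0 < σ ^ 2 / 2) hbound
  have hL : ∀ r ∈ Ioi (0:ℝ), Complex.exp ((0:ℝ) * Complex.I) * F (Real.log r + (0:ℝ) * Complex.I) =
     Complex.exp ((|x| * r : ℝ) * Complex.I) * ((Real.exp (-(σ ^ 2 / 2 * r ^ 2) - lam * r ^ α) : ℝ) : ℂ) := by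
    intro r hr
    have hr : 0 < r := hr
    simp only [F, Complex.ofReal_zero, zero_mul, Complex.exp_zero, one_mul, add_zero]
    rw [← Complex.ofReal_exp, Real.exp_log hr]
    rw [← Complex.ofReal_mul α, ← Complex.ofReal_exp, mul_comm α, ← Real.rpow_def_of_pos hr,
      Complex.ofReal_exp, ← Complex.exp_add]
    congr 1; push_cast; ring
  have hR : ∀ r ∈ Ioi (0:ℝ), Complex.exp ((Real.pi / 6:ℝ) * Complex.I) * F (Real.log r + (Real.pi / 6:ℝ) * Complex.I) =
     om * Complex.exp (Complex.I * |x| * (om * r)) * Complex.exp (-(AA σ r) - lam * Complex.exp (α * lg r)) := by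
    intro r hr
    have hr : 0 < r := hr
    change om * F (lg r) = _
    simp only [F, AA]
    rw [exp_lg hr, mul_assoc om, ← Complex.exp_add]
    congr 2; ring
  rw [setIntegral_congr_fun measurableSet_Ioi hL, setIntegral_congr_fun measurableSet_Ioi hR] at rot
  unfold TT
  rw [← rot]
  have hi : IntegrableOn (fun r : ℝ => Complex.exp ((|x| * r : ℝ) * Complex.I) *
      ((Real.exp (-(σ ^ 2 / 2 * r ^ 2) - lam * |r| ^ α) : ℝ) : ℂ)) (Ioi 0) := by
    refine Integrable.integrableOn ?_
    refine (qg_int hσ hlam h0).ofReal.bdd_mul (c := 1) (Continuous.aestronglyMeasurable (by fun_prop)) ?_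
    exact Eventually.of_forall fun x => by rw [Complex.norm_exp_ofReal_mul_I]
  have hi' : IntegrableOn (fun r : ℝ => Complex.exp ((|x| * r : ℝ) * Complex.I) *
      ((Real.exp (-(σ ^ 2 / 2 * r ^ 2) - lam * r ^ α) : ℝ) : ℂ)) (Ioi 0) :=
    hi.congr_fun (fun r hr => by simp only [abs_of_pos (show 0 < r from hr)]) measurableSet_Ioi
  have hre : (∫ r in Ioi (0:ℝ), Complex.exp ((|x| * r : ℝ) * Complex.I) *
      ((Real.exp (-(σ ^ 2 / 2 * r ^ 2) - lam * r ^ α) : ℝ) : ℂ)).re =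
      ∫ r in Ioi (0:ℝ), (Complex.exp ((|x| * r : ℝ) * Complex.I) *
      ((Real.exp (-(σ ^ 2 / 2 * r ^ 2) - lam * r ^ α) : ℝ) : ℂ)).re := (integral_re hi').symm
  rw [hre]
  simp_rw [Complex.re_mul_ofReal, Complex.exp_ofReal_mul_I_re]
  unfold qf
  have ea := integral_comp_abs (f := fun r => Real.cos (|x| * r) * Real.exp (-(σ ^ 2 / 2 * r ^ 2) - lam * r ^ α))
  have eb : ∀ v : ℝ, Real.cos (|x| * |v|) * Real.exp (-(σ ^ 2 / 2 * |v| ^ 2) - lam * |v| ^ α) =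
      Real.cos (x * v) * Real.exp (-(σ ^ 2 / 2 * v ^ 2) - lam * |v| ^ α) := by
    intro v
    rw [← abs_mul, Real.cos_abs, sq_abs]
  simp_rw [eb] at ea
  rw [ea, ← mul_assoc]
  congr 1
  field_simp

end PartC1

section PartC2
lemma TT_int {K : ℝ → ℂ} (hK : IntegrableOn K (Ioi 0)) (x : ℝ) :
    IntegrableOn (fun r : ℝ => om * Complex.exp (Complex.I * |x| * (om * r)) * K r) (Ioi 0) := by
  refine Integrable.bdd_mul (c := 1) hK (Continuous.aestronglyMeasurable (by fun_prop)) ?_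
  refine (ae_restrict_iff' measurableSet_Ioi).2 (Eventually.of_forall fun r hr => ?_)
  rw [norm_mul, om_norm, norm_exp_xom, one_mul]
  apply Real.exp_le_one_iff.2
  have : 0 < r := hr
  have : 0 ≤ |x| * r := by positivity
  linarith

lemma TT_add {K K' : ℝ → ℂ} (hK : IntegrableOn K (Ioi 0)) (hK' : IntegrableOn K' (Ioi 0)) (x : ℝ) :
    TT (fun r => K r + K' r) x = TT K x + TT K' x := by
  unfold TT
  simp_rw [mul_add]
  rw [integral_add (TT_int hK x) (TT_int hK' x), Complex.add_re, mul_add]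

lemma TT_sub {K K' : ℝ → ℂ} (hK : IntegrableOn K (Ioi 0)) (hK' : IntegrableOn K' (Ioi 0)) (x : ℝ) :
    TT (fun r => K r - K' r) x = TT K x - TT K' x := by
  unfold TT
  simp_rw [mul_sub]
  rw [integral_sub (TT_int hK x) (TT_int hK' x), Complex.sub_re, mul_sub]

lemma TT_smul (c : ℝ) (K : ℝ → ℂ) (x : ℝ) :
    TT (fun r => (c:ℂ) * K r) x = c * TT K x := by
  unfold TT
  have : ∀ r : ℝ, om * Complex.exp (Complex.I * |x| * (om * r)) * ((c:ℂ) * K r) =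
    (c:ℂ) * (om * Complex.exp (Complex.I * |x| * (om * r)) * K r) := fun r => by ring
  simp_rw [this]
  rw [integral_const_mul, Complex.re_ofReal_mul]; ring

lemma TT_congr {K K' : ℝ → ℂ} (h : ∀ r : ℝ, 0 < r → K r = K' r) (x : ℝ) : TT K x = TT K' x := by
  unfold TT
  rw [setIntegral_congr_fun (g := fun r : ℝ => om * Complex.exp (Complex.I * |x| * (om * r)) * K' r)
    measurableSet_Ioi (fun r hr => by simp only [h r hr])]

lemma TT_cont {K : ℝ → ℂ} (hK : IntegrableOn K (Ioi 0)) : Continuous (TT K) := by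
  have : Continuous fun x : ℝ => ∫ r in Ioi (0:ℝ), om * Complex.exp (Complex.I * |x| * (om * r)) * K r := by
    refine continuous_of_dominated (bound := fun r => ‖K r‖) (fun x => (TT_int hK x).aestronglyMeasurable)
      ?_ hK.norm ?_
    · intro x
      refine (ae_restrict_iff' measurableSet_Ioi).2 (Eventually.of_forall fun r hr => ?_)
      rw [norm_mul, norm_mul, om_norm, norm_exp_xom, one_mul]
      have : 0 < r := hr
      have : 0 ≤ |x| * r := by positivity
      exact mul_le_of_le_one_left (norm_nonneg _) (Real.exp_le_one_iff.2 (by linarith))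
    · refine Eventually.of_forall fun r => ?_
      have : Continuous fun x : ℝ => ((|x| : ℝ) : ℂ) := Complex.continuous_ofReal.comp continuous_abs
      fun_prop
  unfold TT
  exact continuous_const.mul (Complex.continuous_re.comp this)

lemma TT_abs_le (K : ℝ → ℂ) {g : ℝ → ℝ} {x : ℝ} (hg : IntegrableOn g (Ioi 0))
    (h : ∀ r : ℝ, 0 < r → Real.exp (-(|x| * r) / 2) * ‖K r‖ ≤ g r) :
    |TT K x| ≤ (1 / Real.pi) * ∫ r in Ioi (0:ℝ), g r := by
  unfold TT
  rw [abs_mul, abs_of_pos (by positivity : 0 < 1 / Real.pi)]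
  refine mul_le_mul_of_nonneg_left ?_ (by positivity)
  refine (Complex.abs_re_le_norm _).trans ?_
  refine norm_integral_le_of_norm_le hg ?_
  refine (ae_restrict_iff' measurableSet_Ioi).2 (Eventually.of_forall fun r hr => ?_)
  rw [norm_mul, norm_mul, om_norm, norm_exp_xom, one_mul]
  exact h r hr

/-- constant in the generic bound -/
def CT (a : ℝ) : ℝ := (1 / Real.pi) * (Real.Gamma (a + 1) * 2 ^ (a + 1))

lemma CT_pos {a : ℝ} (ha : -1 < a) : 0 < CT a := by
  have := Real.Gamma_pos_of_pos (by linarith : 0 < a + 1)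
  unfold CT; positivity

lemma rexp_int {a c : ℝ} (ha : -1 < a) (hc : 0 < c) :
    IntegrableOn (fun r : ℝ => r ^ a * Real.exp (-c * r)) (Ioi 0) := by
  have := integrableOn_rpow_mul_exp_neg_mul_rpow ha one_pos hc
  simpa only [Real.rpow_one] using this

lemma TT_bound {K : ℝ → ℂ} {C a : ℝ} (ha : -1 < a)
    (h : ∀ r : ℝ, 0 < r → ‖K r‖ ≤ C * (r ^ a * Real.exp (-r / 2))) (x : ℝ) :
    |TT K x| ≤ CT a * C * (1 + |x|) ^ (-(1 + a)) := by
  have hx : 0 < 1 + |x| := by positivity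
  have hg := (rexp_int ha (by positivity : 0 < (1 + |x|) / 2)).const_mul C
  refine (TT_abs_le K hg ?_).trans (le_of_eq ?_)
  · intro r hr
    have := mul_le_mul_of_nonneg_left (h r hr) (Real.exp_pos (-(|x| * r) / 2)).le
    refine this.trans (le_of_eq ?_)
    have : Real.exp (-((1 + |x|) / 2) * r) = Real.exp (-(|x| * r) / 2) * Real.exp (-r / 2) := by
      rw [← Real.exp_add]; congr 1; ring
    rw [this]; ring
  · rw [integral_const_mul]
    have e := Real.integral_rpow_mul_exp_neg_mul_Ioi (by linarith : 0 < a + 1) (by positivity : 0 < (1 + |x|) / 2)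
    simp only [add_sub_cancel_right, ← neg_mul] at e
    rw [e]
    unfold CT
    have : (1 / ((1 + |x|) / 2)) ^ (a + 1) = 2 ^ (a + 1) * (1 + |x|) ^ (-(1 + a)) := by
      rw [Real.rpow_neg hx.le, one_div_div, Real.div_rpow (by norm_num) hx.le, div_eq_mul_inv, add_comm 1 a]
    rw [this]; ring

lemma KI_of_bound {K : ℝ → ℂ} {C a : ℝ} (ha : -1 < a) (hm : AEStronglyMeasurable K (volume.restrict (Ioi 0)))
    (h : ∀ r : ℝ, 0 < r → ‖K r‖ ≤ C * (r ^ a * Real.exp (-r / 2))) : IntegrableOn K (Ioi 0) := by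
  have hg := (rexp_int ha (by norm_num : (0:ℝ) < 1 / 2)).const_mul C
  refine Integrable.mono' hg hm ((ae_restrict_iff' measurableSet_Ioi).2 (Eventually.of_forall fun r hr => ?_))
  refine (h r hr).trans (le_of_eq ?_)
  congr 3; ring

/-- Centered Gaussian density with variance `σ²`. -/
def phiS (σ x : ℝ) : ℝ := (Real.sqrt (2 * Real.pi) * σ)⁻¹ * Real.exp (-(x ^ 2 / (2 * σ ^ 2)))

lemma phiS_pos {σ : ℝ} (hσ : 0 < σ) (x : ℝ) : 0 < phiS σ x := by unfold phiS; positivity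

lemma qf_zero {σ : ℝ} (hσ : 0 < σ) (α x : ℝ) : qf σ 0 α x = phiS σ x := by
  have h := gauss_cos 0 (x / σ)
  simp only [zero_sub, zero_mul, Real.cos_zero, one_mul, neg_mul, Real.cos_neg] at h
  unfold gauss at h
  have e : ∀ v : ℝ, (Real.sqrt (2 * Real.pi))⁻¹ * Real.exp (-(v ^ 2) / 2) * Real.cos (v * (x / σ)) =
     (Real.sqrt (2 * Real.pi))⁻¹ * (Real.cos (x * (σ⁻¹ * v)) * Real.exp (-(σ ^ 2 / 2 * (σ⁻¹ * v) ^ 2))) := by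
    intro v
    rw [show x * (σ⁻¹ * v) = v * (x / σ) by ring, show -(σ ^ 2 / 2 * (σ⁻¹ * v) ^ 2) = -(v ^ 2) / 2 by field_simp]
    ring
  rw [integral_congr_ae (Eventually.of_forall e), integral_const_mul,
    Measure.integral_comp_mul_left (fun v => Real.cos (x * v) * Real.exp (-(σ ^ 2 / 2 * v ^ 2))),
    inv_inv, abs_of_pos hσ, smul_eq_mul] at h
  unfold qf phiS
  simp only [zero_mul, sub_zero]
  have hp : Real.sqrt (2 * Real.pi) ^ 2 = 2 * Real.pi := Real.sq_sqrt (by positivity)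
  have hp0 : 0 < Real.sqrt (2 * Real.pi) := by positivity
  have e2 : Real.exp (-(x ^ 2 / (2 * σ ^ 2))) = Real.exp (-((x / σ) ^ 2 / 2)) := by
    congr 1; field_simp
  rw [e2, ← h]
  generalize (∫ v : ℝ, Real.cos (x * v) * Real.exp (-(σ ^ 2 / 2 * v ^ 2))) = Y
  generalize Real.sqrt (2 * Real.pi) = s at *
  rw [← hp]
  field_simp

lemma exp_alg_meas (c : ℂ) : Measurable (fun r : ℝ => Complex.exp (c * lg r)) := by
  unfold lg
  have : Measurable fun r : ℝ => ((Real.log r : ℝ) : ℂ) := Complex.measurable_ofReal.comp Real.measurable_log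
  fun_prop

lemma AA_cont (σ : ℂ) : Continuous (AA σ) := by unfold AA; fun_prop

lemma gauss_exp_bound {c : ℝ} (hc : 0 < c) (r : ℝ) :
    Real.exp (-(c * r ^ 2)) ≤ Real.exp (1 / (16 * c)) * Real.exp (-r / 2) := by
  rw [← Real.exp_add]
  apply Real.exp_le_exp.2
  have : 0 ≤ (c * r - 1 / 4) ^ 2 / c := by positivity
  have e : (c * r - 1 / 4) ^ 2 / c = c * r ^ 2 - r / 2 + 1 / (16 * c) := by field_simp; ring
  linarith

lemma norm_exp_neg_sub_one_le {z : ℂ} (hz : 0 ≤ z.re) : ‖Complex.exp (-z) - 1‖ ≤ ‖z‖ := by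
  have hconv : Convex ℝ {w : ℂ | 0 ≤ w.re} := convex_halfSpace_re_ge 0
  have h := Convex.norm_image_sub_le_of_norm_hasDerivWithin_le (𝕜 := ℂ) (f := fun w => Complex.exp (-w))
    (f' := fun w => -Complex.exp (-w)) (s := {w : ℂ | 0 ≤ w.re}) (x := 0) (y := z) (C := 1)
    (fun w _ => by
      have := ((hasDerivAt_id w).neg).cexp
      simpa using this.hasDerivWithinAt)
    (fun w hw => by
      rw [norm_neg, Complex.norm_exp]
      apply Real.exp_le_one_iff.2
      have : 0 ≤ w.re := hw
      simpa using this) hconv (by simp) hz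
  simpa using h

lemma V_re_nonneg {lam α r : ℝ} (hlam : 0 ≤ lam) (h0 : 0 < α) (h2 : α < 2) (hr : 0 < r) :
    0 ≤ ((lam : ℂ) * Complex.exp (α * lg r)).re := by
  rw [Complex.re_ofReal_mul, exp_alg_re hr]
  have := cos_alg_nonneg h0 h2
  positivity

/-- Kernel of the difference between density and Gaussian density. -/
def KD (σ lam α : ℝ) (r : ℝ) : ℂ :=
  Complex.exp (-(AA σ r)) * (Complex.exp (-(lam * Complex.exp (α * lg r))) - 1)

lemma KD_meas (σ lam α : ℝ) : Measurable (KD σ lam α) := by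
  unfold KD
  have := exp_alg_meas α
  have h := (AA_cont σ).measurable
  fun_prop

lemma norm_exp_AA (σ r : ℝ) : ‖Complex.exp (-(AA σ r))‖ = Real.exp (-(σ ^ 2 / 4 * r ^ 2)) := by
  rw [Complex.norm_exp, Complex.neg_re, AA_re]; congr 1; ring

lemma KD_bound {σ lam α : ℝ} (hσ : 0 < σ) (hlam : 0 ≤ lam) (h0 : 0 < α) (h2 : α < 2) {r : ℝ} (hr : 0 < r) :
    ‖KD σ lam α r‖ ≤ (Real.exp (1 / (4 * σ ^ 2)) * lam) * (r ^ α * Real.exp (-r / 2)) := by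
  unfold KD
  rw [norm_mul, norm_exp_AA]
  have h1 := norm_exp_neg_sub_one_le (V_re_nonneg hlam h0 h2 hr)
  rw [norm_mul, norm_exp_alg hr, Complex.norm_real, Real.norm_eq_abs, abs_of_nonneg hlam] at h1
  have h3 := gauss_exp_bound (by positivity : 0 < σ ^ 2 / 4) r
  rw [show 16 * (σ ^ 2 / 4) = 4 * σ ^ 2 by ring] at h3
  calc _ ≤ (Real.exp (1 / (4 * σ ^ 2)) * Real.exp (-r / 2)) * (lam * r ^ α) := by gcongr
    _ = _ := by ring

lemma KA_int {σ : ℝ} (hσ : 0 < σ) : IntegrableOn (fun r => Complex.exp (-(AA σ r))) (Ioi 0) := by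
  refine KI_of_bound (C := Real.exp (1 / (4 * σ ^ 2))) (a := 0) (by norm_num)
    ?_ fun r hr => ?_
  · have h := (AA_cont σ)
    exact Continuous.aestronglyMeasurable (by fun_prop)
  · rw [norm_exp_AA, Real.rpow_zero, one_mul]
    have h3 := gauss_exp_bound (by positivity : 0 < σ ^ 2 / 4) r
    rwa [show 16 * (σ ^ 2 / 4) = 4 * σ ^ 2 by ring] at h3

lemma KD_int {σ lam α : ℝ} (hσ : 0 < σ) (hlam : 0 ≤ lam) (h0 : 0 < α) (h2 : α < 2) :
    IntegrableOn (KD σ lam α) (Ioi 0) :=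
  KI_of_bound (by linarith) (KD_meas _ _ _).aestronglyMeasurable fun _ hr => KD_bound hσ hlam h0 h2 hr

lemma qf_eq {σ lam α : ℝ} (hσ : 0 < σ) (hlam : 0 ≤ lam) (h0 : 0 < α) (h2 : α < 2) (x : ℝ) :
    qf σ lam α x = phiS σ x + TT (KD σ lam α) x := by
  have e0 := qf_eq_TT hσ le_rfl h0 h2 x
  simp only [Complex.ofReal_zero, zero_mul, sub_zero] at e0
  rw [← qf_zero hσ α x, e0, ← TT_add (KA_int hσ) (KD_int hσ hlam h0 h2), qf_eq_TT hσ hlam h0 h2]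
  refine TT_congr (fun r hr => ?_) x
  unfold KD
  rw [sub_eq_add_neg, Complex.exp_add]; ring

lemma phiS_cont (σ : ℝ) : Continuous (phiS σ) := by unfold phiS; fun_prop

lemma exp_sq_int {c : ℝ} (hc : 0 < c) : Integrable (fun x : ℝ => Real.exp (-(x ^ 2 / c))) := by
  have := integrable_exp_neg_mul_sq (b := 1 / c) (by positivity)
  refine this.congr (Eventually.of_forall fun x => ?_)
  simp only; congr 1; ring

lemma phiS_int {σ : ℝ} (hσ : 0 < σ) : Integrable (phiS σ) := by
  unfold phiS
  exact (exp_sq_int (by positivity)).const_mul _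

lemma pw_int {a : ℝ} (ha : 1 < a) : Integrable (fun x : ℝ => (1 + |x|) ^ (-a)) := by
  have := integrable_one_add_norm (E := ℝ) (μ := volume) (r := a) (by simpa using ha)
  simpa using this

lemma TT_integrable {K : ℝ → ℂ} {C a : ℝ} (ha : 0 < a) (hm : AEStronglyMeasurable K (volume.restrict (Ioi 0)))
    (h : ∀ r : ℝ, 0 < r → ‖K r‖ ≤ C * (r ^ a * Real.exp (-r / 2))) : Integrable (TT K) := by
  refine ((pw_int (a := 1 + a) (by linarith)).const_mul (CT a * C)).mono'
    (TT_cont (KI_of_bound (by linarith) hm h)).aestronglyMeasurable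
    (Eventually.of_forall fun x => TT_bound (by linarith) h x)

lemma qf_cont {σ lam α : ℝ} (hσ : 0 < σ) (hlam : 0 ≤ lam) (h0 : 0 < α) (h2 : α < 2) :
    Continuous (qf σ lam α) := by
  have : qf σ lam α = fun x => phiS σ x + TT (KD σ lam α) x := funext fun x => qf_eq hσ hlam h0 h2 x
  rw [this]
  exact (phiS_cont σ).add (TT_cont (KD_int hσ hlam h0 h2))

lemma qf_int {σ lam α : ℝ} (hσ : 0 < σ) (hlam : 0 ≤ lam) (h0 : 0 < α) (h2 : α < 2) :
    Integrable (qf σ lam α) := by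
  have : qf σ lam α = fun x => phiS σ x + TT (KD σ lam α) x := funext fun x => qf_eq hσ hlam h0 h2 x
  rw [this]
  exact (phiS_int hσ).add (TT_integrable h0 (KD_meas _ _ _).aestronglyMeasurable
    fun _ hr => KD_bound hσ hlam h0 h2 hr)

lemma qf_integral {σ lam α : ℝ} (hσ : 0 < σ) (hlam : 0 ≤ lam) (h0 : 0 < α) (h2 : α < 2) :
    ∫ x, qf σ lam α x = 1 := qf_integral_one hσ hlam h0 (qf_int hσ hlam h0 h2)

end PartC2

section PartD1
lemma cauchy_fderiv {E : Type*} [NormedAddCommGroup E] [NormedSpace ℂ E] {f : E → ℂ} {c : E} {R M : ℝ}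
    (hd : DifferentiableOn ℂ f (Metric.ball c R)) (hM : ∀ z ∈ Metric.ball c R, ‖f z‖ ≤ M) (hR : 0 < R) :
    ‖fderiv ℂ f c‖ ≤ 2 * M / R := by
  refine Complex.norm_fderiv_le_div_of_mapsTo_ball hd (fun z hz => ?_) hR
  rw [Metric.mem_closedBall, dist_eq_norm]
  have h1 := hM z hz
  have h2 := hM c (Metric.mem_ball_self hR)
  linarith [norm_sub_le (f z) (f c)]

lemma second_order {E : Type*} [NormedAddCommGroup E] [NormedSpace ℂ E] {f : E → ℂ} {T M s : ℝ}
    (hT : 0 < T) (hd : DifferentiableOn ℂ f (Metric.ball 0 T)) (hM : ∀ z ∈ Metric.ball 0 T, ‖f z‖ ≤ M)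
    (hs : s ≤ T / 4) {z z' : E} (hz : ‖z‖ ≤ s) (hz' : ‖z'‖ ≤ s) :
    ‖f z - f z' - fderiv ℂ f 0 (z - z')‖ ≤ 32 * M * s / T ^ 2 * ‖z - z'‖ := by
  letI : NormedSpace ℝ E := NormedSpace.restrictScalars ℝ ℂ E
  have hs0 : 0 ≤ s := (norm_nonneg z).trans hz
  have hM0 : 0 ≤ M := (norm_nonneg _).trans (hM 0 (Metric.mem_ball_self hT))
  have hdiff : ∀ p ∈ Metric.ball (0:E) T, DifferentiableAt ℂ f p := fun p hp =>
    (hd p hp).differentiableAt (Metric.isOpen_ball.mem_nhds hp)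
  have step1 : ∀ p : E, ‖p‖ < 3 * T / 4 → ‖fderiv ℂ f p‖ ≤ 8 * M / T := by
    intro p hp
    have hsub : Metric.ball p (T / 4) ⊆ Metric.ball 0 T := by
      intro v hv
      rw [mem_ball_zero_iff]
      rw [Metric.mem_ball, dist_eq_norm] at hv
      have : ‖v‖ ≤ ‖v - p‖ + ‖p‖ := by simpa using norm_add_le (v - p) p
      linarith
    have := cauchy_fderiv (hd.mono hsub) (fun v hv => hM v (hsub hv)) (by linarith)
    refine this.trans (le_of_eq ?_)
    field_simp; ring
  have step2 : ∀ w v : E, ‖w‖ ≤ T / 4 → ‖v‖ < T / 2 → ‖f (w + v) - f v‖ ≤ 8 * M / T * ‖w‖ := by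
    intro w v hw hv
    have hc : Convex ℝ (Metric.ball (0:E) (3 * T / 4)) := convex_ball _ _
    have := hc.norm_image_sub_le_of_norm_hasFDerivWithin_le (𝕜 := ℂ) (f := f) (f' := fderiv ℂ f)
      (C := 8 * M / T) (x := v) (y := w + v)
      (fun x hx => ((hdiff x (by
        rw [mem_ball_zero_iff] at hx ⊢; linarith)).hasFDerivAt).hasFDerivWithinAt)
      (fun x hx => step1 x (by simpa using hx))
      (by rw [mem_ball_zero_iff]; linarith)
      (by rw [mem_ball_zero_iff]; linarith [norm_add_le w v])
    simpa using this
  have step3 : ∀ w : E, ‖w‖ ≤ T / 4 → ‖fderiv ℂ f w - fderiv ℂ f 0‖ ≤ 32 * M / T ^ 2 * ‖w‖ := by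
    intro w hw
    have d1 : ∀ v ∈ Metric.ball (0:E) (T / 2), DifferentiableAt ℂ (fun v => f (w + v)) v := by
      intro v hv
      have : DifferentiableAt ℂ f (w + v) := hdiff _ (by
        rw [mem_ball_zero_iff] at hv ⊢; linarith [norm_add_le w v])
      exact this.comp v ((differentiableAt_const w).add differentiableAt_id)
    have d2 : ∀ v ∈ Metric.ball (0:E) (T / 2), DifferentiableAt ℂ f v := by
      intro v hv
      exact hdiff _ (by rw [mem_ball_zero_iff] at hv ⊢; linarith)
    have := cauchy_fderiv (f := fun v => f (w + v) - f v) (c := 0) (R := T / 2) (M := 8 * M / T * ‖w‖)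
      (fun v hv => ((d1 v hv).sub (d2 v hv)).differentiableWithinAt)
      (fun v hv => step2 w v hw (by simpa using hv)) (by linarith)
    have h0 : (0:E) ∈ Metric.ball (0:E) (T / 2) := Metric.mem_ball_self (by linarith)
    rw [fderiv_fun_sub (d1 0 h0) (d2 0 h0), fderiv_comp_add_left, add_zero] at this
    refine this.trans (le_of_eq ?_)
    field_simp; ring
  have hc : Convex ℝ (Metric.closedBall (0:E) s) := convex_closedBall _ _
  have hmem : ∀ x ∈ Metric.closedBall (0:E) s, ‖x‖ ≤ T / 4 := fun x hx => by
    rw [mem_closedBall_zero_iff] at hx; linarith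
  have := hc.norm_image_sub_le_of_norm_hasFDerivWithin_le (𝕜 := ℂ) (f := fun x => f x - fderiv ℂ f 0 x)
      (f' := fun x => fderiv ℂ f x - fderiv ℂ f 0)
      (C := 32 * M * s / T ^ 2) (x := z') (y := z)
      (fun x hx => (((hdiff x (by
        rw [mem_ball_zero_iff]; linarith [hmem x hx])).hasFDerivAt).sub
          (fderiv ℂ f 0).hasFDerivAt).hasFDerivWithinAt)
      (fun x hx => (step3 x (hmem x hx)).trans (by
        rw [mem_closedBall_zero_iff] at hx
        rw [show 32 * M * s / T ^ 2 = 32 * M / T ^ 2 * s by ring]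
        exact mul_le_mul_of_nonneg_left hx (by positivity)))
      (by rwa [mem_closedBall_zero_iff]) (by rwa [mem_closedBall_zero_iff])
  have e : f z - f z' - fderiv ℂ f 0 (z - z') = f z - fderiv ℂ f 0 z - (f z' - fderiv ℂ f 0 z') := by
    rw [map_sub]; ring
  rw [e]; exact this

lemma pow_young {b ε : ℝ} (hb0 : 0 ≤ b) (hb : b < 2) (hε : 0 < ε) :
    ∃ C : ℝ, 0 ≤ C ∧ ∀ r : ℝ, 0 < r → r ^ b ≤ ε * r ^ 2 + C := by
  set R : ℝ := ε ^ (-(1 / (2 - b))) with hR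
  have hRpos : 0 < R := by positivity
  refine ⟨R ^ b, by positivity, fun r hr => ?_⟩
  rcases le_total r R with h | h
  · have := Real.rpow_le_rpow hr.le h hb0
    have : 0 ≤ ε * r ^ 2 := by positivity
    linarith
  · have h1 : r ^ (b - 2) ≤ ε := by
      have := Real.rpow_le_rpow_of_nonpos hRpos h (by linarith : b - 2 ≤ 0)
      refine this.trans (le_of_eq ?_)
      rw [hR, ← Real.rpow_mul hε.le]
      have : (2:ℝ) - b ≠ 0 := by linarith
      rw [show -(1 / (2 - b)) * (b - 2) = 1 by field_simp; ring, Real.rpow_one]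
    have h2 : r ^ b = r ^ (b - 2) * r ^ 2 := by
      rw [← Real.rpow_natCast r 2, ← Real.rpow_add hr]; congr 1; push_cast; ring
    rw [h2]
    have h3 : 0 ≤ R ^ b := by positivity
    have := mul_le_mul_of_nonneg_right h1 (sq_nonneg r)
    linarith

lemma norm_exp_sub_one_le' (z : ℂ) : ‖Complex.exp z - 1‖ ≤ ‖z‖ * Real.exp ‖z‖ := by
  simpa using Complex.norm_exp_sub_sum_le_norm_mul_exp z 1

lemma exp_abs_log_le {η r : ℝ} (hr : 0 < r) : Real.exp (η * |Real.log r|) ≤ r ^ η + r ^ (-η) := by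
  rcases abs_choice (Real.log r) with h | h <;> rw [h]
  · rw [Real.rpow_def_of_pos hr, mul_comm]
    linarith [Real.rpow_pos_of_pos hr (-η)]
  · rw [Real.rpow_def_of_pos hr (-η), show η * -Real.log r = Real.log r * -η by ring]
    linarith [Real.rpow_pos_of_pos hr η]

/-- complex version of the perturbation -/
def Vc (L : ℝ) (δ α : ℂ) (r : ℝ) : ℂ := Complex.exp (α * (Complex.log δ + L / 2 + lg r) - L)

def Kc (L : ℝ) (σ δ α : ℂ) (r : ℝ) : ℂ :=
  Complex.exp (-(AA σ r)) * (Complex.exp (-(Vc L δ α r)) - 1)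

def lamL (L δ α : ℝ) : ℝ := Real.exp (α * (Real.log δ + L / 2) - L)

lemma lamL_pos (L δ α : ℝ) : 0 < lamL L δ α := Real.exp_pos _

lemma Vc_real {L δ α : ℝ} (hδ : 0 < δ) (r : ℝ) :
    Vc L δ α r = lamL L δ α * Complex.exp (α * lg r) := by
  unfold Vc lamL
  rw [← Complex.ofReal_log hδ.le, Complex.ofReal_exp, ← Complex.exp_add]
  congr 1; push_cast; ring

lemma Kc_real {L σ δ α : ℝ} (hδ : 0 < δ) (r : ℝ) :
    Kc L σ δ α r = KD σ (lamL L δ α) α r := by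
  unfold Kc KD
  rw [Vc_real hδ]

lemma lamL_eq {n : ℕ} (hn : 0 < n) {δ α : ℝ} (hδ : 0 < δ) :
    lamL (Real.log n) δ α = δ ^ α * (n:ℝ) ^ (α / 2 - 1) := by
  have hn' : (0:ℝ) < n := by exact_mod_cast hn
  rw [lamL, Real.rpow_def_of_pos hδ, Real.rpow_def_of_pos hn', ← Real.exp_add]
  congr 1; ring

lemma lamL_le {L δ α : ℝ} (hL : 0 ≤ L) (hα : α < 2) : lamL L δ α ≤ Real.exp (α * Real.log δ) := by
  unfold lamL
  apply Real.exp_le_exp.2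
  nlinarith

lemma Kc_meas (L : ℝ) (σ δ α : ℂ) : Measurable (Kc L σ δ α) := by
  unfold Kc Vc lg
  have h := (AA_cont σ).measurable
  have : Measurable fun r : ℝ => ((Real.log r : ℝ) : ℂ) := Complex.measurable_ofReal.comp Real.measurable_log
  fun_prop

/-- loss in exponents -/
def eta (α : ℝ) : ℝ := α * (2 - α) / 16

lemma eta_pos {α : ℝ} (h0 : 0 < α) (h2 : α < 2) : 0 < eta α := by
  unfold eta; have : 0 < 2 - α := by linarith
  positivity

lemma eta_le {α : ℝ} (h0 : 0 < α) : eta α ≤ α / 8 := by unfold eta; nlinarith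
lemma eta_le' {α : ℝ} (h2 : α < 2) : eta α ≤ (2 - α) / 8 := by unfold eta; nlinarith

/-- Uniform bound on the complexified kernel. -/
lemma Kc_bound {σ₀ δ₀ α₀ : ℝ} (hσ : 0 < σ₀) (hδ : 0 < δ₀) (h0 : 0 < α₀) (h2 : α₀ < 2) :
    ∃ κ C : ℝ, 0 < κ ∧ κ < δ₀ ∧ 0 < C ∧ ∀ L : ℝ, 1 ≤ L → ∀ σ δ α : ℂ, ‖σ - σ₀‖ ≤ κ → ‖δ - δ₀‖ ≤ κ →
      ‖α - α₀‖ ≤ κ / L → ∀ r : ℝ, 0 < r →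
      ‖Kc L σ δ α r‖ ≤ (C * lamL L δ₀ α₀) * (r ^ (α₀ - eta α₀) * Real.exp (-r / 2)) := by
  set η := eta α₀ with hη
  have hη0 : 0 < η := eta_pos h0 h2
  have hη1 : η ≤ α₀ / 8 := eta_le h0
  have hη2 : η ≤ (2 - α₀) / 8 := eta_le' h2
  -- κ from continuity
  have c1 : ∃ κ₁ > 0, ∀ σ : ℂ, ‖σ - σ₀‖ < κ₁ → σ₀ ^ 2 / 4 < (σ ^ 2 * om ^ 2).re := by
    have hc : ContinuousAt (fun σ : ℂ => (σ ^ 2 * om ^ 2).re) (σ₀ : ℂ) := by fun_prop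
    have hv : ((σ₀ : ℂ) ^ 2 * om ^ 2).re = σ₀ ^ 2 / 2 := by
      rw [← Complex.ofReal_pow, Complex.re_ofReal_mul, om_sq]; ring
    have hlt : σ₀ ^ 2 / 4 < ((σ₀ : ℂ) ^ 2 * om ^ 2).re := by rw [hv]; nlinarith [sq_pos_of_pos hσ]
    have := hc.eventually_const_lt hlt
    obtain ⟨κ₁, hκ₁, h⟩ := Metric.eventually_nhds_iff.1 this
    exact ⟨κ₁, hκ₁, fun σ hs => h (by rwa [dist_eq_norm])⟩
  have c2 : ∃ κ₂ > 0, ∀ δ : ℂ, ‖δ - δ₀‖ < κ₂ → ‖Complex.log δ - Complex.log δ₀‖ < 1 := by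
    have hc : ContinuousAt Complex.log (δ₀ : ℂ) := continuousAt_clog (by simp [hδ])
    obtain ⟨κ₁, hκ₁, h⟩ := Metric.continuousAt_iff.1 hc 1 one_pos
    exact ⟨κ₁, hκ₁, fun σ hs => by rw [← dist_eq_norm]; exact h (by rwa [dist_eq_norm])⟩
  obtain ⟨κ₁, hκ₁, hc1⟩ := c1
  obtain ⟨κ₂, hκ₂, hc2⟩ := c2
  obtain ⟨κ, hκ0, hκ⟩ : ∃ κ : ℝ, 0 < κ ∧ κ < κ₁ ∧ κ < κ₂ ∧ κ < δ₀ ∧ κ ≤ η := by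
    refine ⟨min (min κ₁ κ₂) (min δ₀ η) / 2, by positivity, ?_⟩
    have hm : 0 < min (min κ₁ κ₂) (min δ₀ η) := by positivity
    have a1 : min (min κ₁ κ₂) (min δ₀ η) ≤ κ₁ := (min_le_left _ _).trans (min_le_left _ _)
    have a2 : min (min κ₁ κ₂) (min δ₀ η) ≤ κ₂ := (min_le_left _ _).trans (min_le_right _ _)
    have a3 : min (min κ₁ κ₂) (min δ₀ η) ≤ δ₀ := (min_le_right _ _).trans (min_le_left _ _)
    have a4 : min (min κ₁ κ₂) (min δ₀ η) ≤ η := (min_le_right _ _).trans (min_le_right _ _)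
    refine ⟨?_, ?_, ?_, ?_⟩ <;> linarith
  obtain ⟨k1, k2, k3, k4⟩ := hκ
  -- constants
  set C1 : ℝ := Real.exp (α₀ + η * (|Real.log δ₀| + 3)) with hC1
  set C2 : ℝ := C1 * Real.exp (α₀ * Real.log δ₀) with hC2
  have hC1p : 0 < C1 := Real.exp_pos _
  have hC2p : 0 < C2 := by positivity
  set ε : ℝ := σ₀ ^ 2 / 8 / (2 * C2 + 2) with hε
  have hεp : 0 < ε := by positivity
  obtain ⟨D1, hD1, hy1⟩ := pow_young (b := α₀ + η) (by linarith) (by linarith) hεp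
  obtain ⟨D2, hD2, hy2⟩ := pow_young (b := α₀ - η) (by linarith) (by linarith) hεp
  obtain ⟨D3, hD3, hy3⟩ := pow_young (b := 2 * η) (by linarith) (by linarith) hεp
  obtain ⟨D4, hD4, hy4⟩ := pow_young (b := 1) (by linarith) (by linarith) hεp
  refine ⟨κ, C1 * Real.exp (C2 * D1 + C2 * D2 + D3 + D4), hκ0, k3, by positivity, ?_⟩
  intro L hL σ δ α hs hd ha r hr
  -- bound on V
  have hL0 : 0 < L := by linarith
  have hV : ‖Vc L δ α r‖ ≤ C1 * lamL L δ₀ α₀ * (r ^ (α₀ - η) * (1 + r ^ (2 * η))) := by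
    unfold Vc
    rw [Complex.norm_exp]
    have hlogd := hc2 δ (by linarith)
    have e1 : α * (Complex.log δ + L / 2 + lg r) - L = α₀ * (Complex.log δ₀ + L / 2 + lg r) - L +
       (α₀ * (Complex.log δ - Complex.log δ₀) + (α - α₀) * (Complex.log δ + L / 2 + lg r)) := by ring
    have e2 : ((α₀:ℂ) * (Complex.log δ₀ + L / 2 + lg r) - L).re = α₀ * (Real.log δ₀ + L / 2 + Real.log r) - L := by
      rw [← Complex.ofReal_log hδ.le, Complex.sub_re, Complex.re_ofReal_mul]
      simp [lg]
    have b1 : ‖(α₀:ℂ) * (Complex.log δ - Complex.log δ₀)‖ ≤ α₀ := by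
      rw [norm_mul, Complex.norm_real, Real.norm_eq_abs, abs_of_pos h0]
      exact mul_le_of_le_one_right h0.le hlogd.le
    have b2 : ‖lg r‖ ≤ |Real.log r| + 1 := by
      unfold lg
      refine (norm_add_le _ _).trans ?_
      rw [Complex.norm_real, norm_mul, Complex.norm_I, mul_one, Complex.norm_real, Real.norm_eq_abs,
        Real.norm_eq_abs, abs_of_pos (by positivity : 0 < Real.pi / 6)]
      linarith [Real.pi_le_four]
    have b3 : ‖Complex.log δ‖ ≤ |Real.log δ₀| + 1 := by
      have : ‖Complex.log δ‖ ≤ ‖Complex.log δ - Complex.log δ₀‖ + ‖Complex.log (δ₀:ℂ)‖ := by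
        simpa using norm_add_le (Complex.log δ - Complex.log δ₀) (Complex.log (δ₀:ℂ))
      rw [← Complex.ofReal_log hδ.le, Complex.norm_real, Real.norm_eq_abs, Complex.ofReal_log hδ.le] at this
      linarith
    have b4 : ‖(α - α₀) * (Complex.log δ + L / 2 + lg r)‖ ≤ η * (|Real.log δ₀| + 3) + η * |Real.log r| := by
      have hn : ‖Complex.log δ + L / 2 + lg r‖ ≤ (|Real.log δ₀| + 1) + L / 2 + (|Real.log r| + 1) := by
        refine (norm_add_le _ _).trans (add_le_add ((norm_add_le _ _).trans (add_le_add b3 ?_)) b2)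
        rw [norm_div, Complex.norm_real, Real.norm_eq_abs, abs_of_pos hL0]; simp
      rw [norm_mul]
      have q1 : ‖α - α₀‖ ≤ η := ha.trans ((div_le_self hκ0.le hL).trans k4)
      have q2 : ‖α - α₀‖ * L ≤ η := by
        have := mul_le_mul_of_nonneg_right ha hL0.le
        rw [div_mul_cancel₀ _ hL0.ne'] at this
        linarith
      have q3 := mul_le_mul_of_nonneg_left hn (norm_nonneg (α - α₀))
      have q4 := mul_le_mul_of_nonneg_right q1 (by positivity : 0 ≤ |Real.log δ₀| + 2 + |Real.log r|)
      nlinarith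
    have hre : (α * (Complex.log δ + L / 2 + lg r) - L).re ≤
        (α₀ * (Real.log δ₀ + L / 2) - L) + α₀ * Real.log r + (α₀ + η * (|Real.log δ₀| + 3)) + η * |Real.log r| := by
      rw [e1, Complex.add_re, e2]
      have := (Complex.re_le_norm ((α₀:ℂ) * (Complex.log δ - Complex.log δ₀) + (α - α₀) * (Complex.log δ + L / 2 + lg r))).trans
        ((norm_add_le _ _).trans (add_le_add b1 b4))
      linarith
    refine (Real.exp_le_exp.2 hre).trans ?_
    rw [Real.exp_add, Real.exp_add, Real.exp_add, ← hC1]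
    have e3 : Real.exp (α₀ * Real.log r) = r ^ α₀ := by rw [Real.rpow_def_of_pos hr, mul_comm]
    rw [e3]
    have e4 : r ^ α₀ * (r ^ η + r ^ (-η)) = r ^ (α₀ - η) * (1 + r ^ (2 * η)) := by
      rw [mul_add, mul_add, ← Real.rpow_add hr, ← Real.rpow_add hr, ← Real.rpow_add hr, mul_one, add_comm]
      congr 2; ring
    change lamL L δ₀ α₀ * _ * _ * _ ≤ _
    have := lamL_pos L δ₀ α₀
    calc _ ≤ lamL L δ₀ α₀ * r ^ α₀ * C1 * (r ^ η + r ^ (-η)) := by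
            gcongr; exact exp_abs_log_le hr
      _ = C1 * lamL L δ₀ α₀ * (r ^ α₀ * (r ^ η + r ^ (-η))) := by ring
      _ = _ := by rw [e4]
  have hV2 : ‖Vc L δ α r‖ ≤ C2 * (r ^ (α₀ + η) + r ^ (α₀ - η)) := by
    refine hV.trans ?_
    have h1 := lamL_le (δ := δ₀) hL0.le h2
    have e4 : r ^ (α₀ - η) * (1 + r ^ (2 * η)) = r ^ (α₀ + η) + r ^ (α₀ - η) := by
      rw [mul_add, ← Real.rpow_add hr, mul_one, add_comm]
      congr 2; ring
    rw [e4, hC2]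
    gcongr
  have hA : ‖Complex.exp (-(AA σ r))‖ ≤ Real.exp (-(σ₀ ^ 2 / 8 * r ^ 2)) := by
    rw [Complex.norm_exp]
    apply Real.exp_le_exp.2
    have h1 := hc1 σ (by linarith)
    have e : AA σ r = ((r ^ 2 / 2 : ℝ) : ℂ) * (σ ^ 2 * om ^ 2) := by unfold AA; push_cast; ring
    rw [Complex.neg_re, e, Complex.re_ofReal_mul]
    have : 0 ≤ r ^ 2 / 2 := by positivity
    nlinarith [mul_le_mul_of_nonneg_left h1.le this]
  have hE : ‖Complex.exp (-(Vc L δ α r)) - 1‖ ≤ C1 * lamL L δ₀ α₀ * (r ^ (α₀ - η) * (1 + r ^ (2 * η))) *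
      Real.exp (C2 * (r ^ (α₀ + η) + r ^ (α₀ - η))) := by
    refine (norm_exp_sub_one_le' _).trans ?_
    rw [norm_neg]
    have := lamL_pos L δ₀ α₀
    gcongr
  unfold Kc
  rw [norm_mul]
  have hl := lamL_pos L δ₀ α₀
  have h1r : 1 + r ^ (2 * η) ≤ Real.exp (r ^ (2 * η)) := by
    rw [add_comm]; exact Real.add_one_le_exp _
  have hfin : Real.exp (-(σ₀ ^ 2 / 8 * r ^ 2)) * (Real.exp (r ^ (2 * η)) * Real.exp (C2 * (r ^ (α₀ + η) + r ^ (α₀ - η))))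
      ≤ Real.exp (C2 * D1 + C2 * D2 + D3 + D4) * Real.exp (-r / 2) := by
    rw [← Real.exp_add, ← Real.exp_add, ← Real.exp_add]
    apply Real.exp_le_exp.2
    have y1 := mul_le_mul_of_nonneg_left (hy1 r hr) hC2p.le
    have y2 := mul_le_mul_of_nonneg_left (hy2 r hr) hC2p.le
    have y3 := hy3 r hr
    have y4 := hy4 r hr
    rw [Real.rpow_one] at y4
    have e : (2 * C2 + 2) * ε = σ₀ ^ 2 / 8 := by rw [hε]; field_simp
    rw [← e]
    nlinarith
  calc _ ≤ Real.exp (-(σ₀ ^ 2 / 8 * r ^ 2)) * (C1 * lamL L δ₀ α₀ * (r ^ (α₀ - η) * Real.exp (r ^ (2 * η))) *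
      Real.exp (C2 * (r ^ (α₀ + η) + r ^ (α₀ - η)))) := by
        refine mul_le_mul hA (hE.trans ?_) (norm_nonneg _) (Real.exp_pos _).le
        gcongr
    _ = C1 * lamL L δ₀ α₀ * r ^ (α₀ - η) * (Real.exp (-(σ₀ ^ 2 / 8 * r ^ 2)) * (Real.exp (r ^ (2 * η)) * Real.exp (C2 * (r ^ (α₀ + η) + r ^ (α₀ - η))))) := by ring
    _ ≤ C1 * lamL L δ₀ α₀ * r ^ (α₀ - η) * (Real.exp (C2 * D1 + C2 * D2 + D3 + D4) * Real.exp (-r / 2)) := by gcongr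
    _ = _ := by ring

end PartD1

section PartD2
def sgC (σ₀ ν : ℝ) (h : Fin 3 → ℂ) : ℂ := σ₀ + ν * h 0
def dlC (δ₀ α₀ ρ m : ℝ) (h : Fin 3 → ℂ) : ℂ := δ₀ + ρ * (h 1 - (δ₀ / (2 * α₀) : ℝ) * m * h 2)
def alC (α₀ ρ : ℝ) (h : Fin 3 → ℂ) : ℂ := α₀ + ρ * h 2

def FC (σ₀ δ₀ α₀ L ν ρ m : ℝ) (r : ℝ) (h : Fin 3 → ℂ) : ℂ :=
  Kc L (sgC σ₀ ν h) (dlC δ₀ α₀ ρ m h) (alC α₀ ρ h) r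

/-- derivative of `FC` at 0 -/
def DFC (σ₀ δ₀ α₀ L ν ρ m : ℝ) (r : ℝ) (d : Fin 3 → ℂ) : ℂ :=
  -(ν * d 0 * (σ₀ * (om * r) ^ 2) * (Complex.exp (-(AA σ₀ r)) * (Complex.exp (-(Vc L δ₀ α₀ r)) - 1)))
  - Complex.exp (-(AA σ₀ r)) * Complex.exp (-(Vc L δ₀ α₀ r)) * Vc L δ₀ α₀ r *
    (ρ * d 2 * (Real.log δ₀ + L / 2 - m / 2 + lg r) + ρ * (α₀ / δ₀) * d 1)

lemma FC_diffAt {σ₀ δ₀ α₀ L ν ρ m r : ℝ} {h : Fin 3 → ℂ} (hd : 0 < (dlC δ₀ α₀ ρ m h).re) :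
    DifferentiableAt ℂ (FC σ₀ δ₀ α₀ L ν ρ m r) h := by
  have d1 : DifferentiableAt ℂ (dlC δ₀ α₀ ρ m) h := by unfold dlC; fun_prop
  have d2 : DifferentiableAt ℂ (sgC σ₀ ν) h := by unfold sgC; fun_prop
  have d3 : DifferentiableAt ℂ (alC α₀ ρ) h := by unfold alC; fun_prop
  have d4 := d1.clog (Or.inl hd)
  unfold FC Kc Vc AA
  fun_prop

lemma FC_fderiv {σ₀ δ₀ α₀ L ν ρ m r : ℝ} (hδ : 0 < δ₀) (hα : 0 < α₀) (d : Fin 3 → ℂ) :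
    fderiv ℂ (FC σ₀ δ₀ α₀ L ν ρ m r) 0 d = DFC σ₀ δ₀ α₀ L ν ρ m r d := by
  have hdiff : DifferentiableAt ℂ (FC σ₀ δ₀ α₀ L ν ρ m r) 0 := FC_diffAt (by simp [dlC, hδ])
  have hline : HasDerivAt (fun s : ℂ => s • d) d 0 := by
    simpa using (hasDerivAt_id (0:ℂ)).smul_const d
  have hdiff' : HasFDerivAt (FC σ₀ δ₀ α₀ L ν ρ m r) (fderiv ℂ (FC σ₀ δ₀ α₀ L ν ρ m r) 0) ((0:ℂ) • d) := by
    rw [zero_smul]; exact hdiff.hasFDerivAt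
  have h1 := hdiff'.comp_hasDerivAt (0:ℂ) hline
  have hsg : HasDerivAt (fun s : ℂ => sgC σ₀ ν (s • d)) (ν * d 0) 0 := by
    unfold sgC
    have := ((hasDerivAt_id (0:ℂ)).mul_const (d 0)).const_mul (ν:ℂ) |>.const_add (σ₀:ℂ)
    simpa using this
  have hdl : HasDerivAt (fun s : ℂ => dlC δ₀ α₀ ρ m (s • d))
      (ρ * (d 1 - (δ₀ / (2 * α₀) : ℝ) * m * d 2)) 0 := by
    unfold dlC
    have := (((hasDerivAt_id (0:ℂ)).mul_const (d 1 - (δ₀ / (2 * α₀) : ℝ) * m * d 2)).const_mul (ρ:ℂ)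
      |>.const_add (δ₀:ℂ))
    simp only [one_mul] at this
    refine this.congr_of_eventuallyEq (Eventually.of_forall fun s => ?_)
    simp only [id, Pi.smul_apply, smul_eq_mul]; ring
  have hal : HasDerivAt (fun s : ℂ => alC α₀ ρ (s • d)) (ρ * d 2) 0 := by
    unfold alC
    have := ((hasDerivAt_id (0:ℂ)).mul_const (d 2)).const_mul (ρ:ℂ) |>.const_add (α₀:ℂ)
    simpa using this
  have v1 : sgC σ₀ ν ((0:ℂ) • d) = σ₀ := by simp [sgC]
  have v2 : dlC δ₀ α₀ ρ m ((0:ℂ) • d) = δ₀ := by simp [dlC]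
  have v3 : alC α₀ ρ ((0:ℂ) • d) = α₀ := by simp [alC]
  have hlog := hdl.clog (by rw [v2]; simp [hδ])
  have hV := ((hal.mul ((hlog.add_const ((L:ℂ) / 2)).add_const (lg r))).sub_const (L:ℂ)).cexp
  have hA := ((((hsg.pow 2).div_const 2).mul_const ((om * r) ^ 2)).neg).cexp
  have hK := hA.mul ((hV.neg.cexp).sub_const 1)
  have h2 : HasDerivAt (FC σ₀ δ₀ α₀ L ν ρ m r ∘ fun s : ℂ => s • d) (DFC σ₀ δ₀ α₀ L ν ρ m r d) 0 := by
    refine (hK.congr_deriv ?_).congr_of_eventuallyEq (Eventually.of_forall fun s => ?_)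
    · simp only [Pi.pow_apply, Pi.mul_apply, Pi.add_apply, Pi.neg_apply] at *
      simp only [v1, v2, v3, DFC, Vc, AA, Complex.ofReal_log hδ.le]
      have hδ' : (δ₀:ℂ) ≠ 0 := by exact_mod_cast hδ.ne'
      have hα' : (α₀:ℂ) ≠ 0 := by exact_mod_cast hα.ne'
      have e : (ρ:ℂ) * d 2 * (Complex.log δ₀ + L / 2 + lg r) +
          α₀ * (ρ * (d 1 - (δ₀ / (2 * α₀) : ℝ) * m * d 2) / δ₀) =
          ρ * d 2 * (Complex.log δ₀ + L / 2 - m / 2 + lg r) + ρ * (α₀ / δ₀) * d 1 := by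
        push_cast; field_simp; ring
      rw [e]
      push_cast
      ring
    · rfl
  exact h1.unique h2

lemma FC_main {σ₀ δ₀ α₀ : ℝ} (hσ : 0 < σ₀) (hδ : 0 < δ₀) (h0 : 0 < α₀) (h2 : α₀ < 2) :
    ∃ κ C : ℝ, 0 < κ ∧ 0 < C ∧ ∀ L ν ρ m : ℝ, 1 ≤ L → 0 ≤ ν → 0 < ρ → 0 ≤ m → m ≤ L → ν ≤ ρ * L →
      (∀ h : Fin 3 → ℂ, ‖h‖ < κ / (ρ * L) → ∀ r : ℝ, 0 < r → ‖FC σ₀ δ₀ α₀ L ν ρ m r h‖ ≤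
        (C * lamL L δ₀ α₀) * (r ^ (α₀ - eta α₀) * Real.exp (-r / 2))) ∧
      (∀ d : Fin 3 → ℂ, ∀ r : ℝ, 0 < r → ‖DFC σ₀ δ₀ α₀ L ν ρ m r d‖ ≤
        (C * lamL L δ₀ α₀ * (ρ * L) * ‖d‖) * (r ^ (α₀ - eta α₀) * Real.exp (-r / 2))) ∧
      (∀ s : ℝ, s ≤ κ / (ρ * L) / 4 → ∀ h h' : Fin 3 → ℂ, ‖h‖ ≤ s → ‖h'‖ ≤ s → ∀ r : ℝ, 0 < r →
        ‖FC σ₀ δ₀ α₀ L ν ρ m r h - FC σ₀ δ₀ α₀ L ν ρ m r h' - DFC σ₀ δ₀ α₀ L ν ρ m r (h - h')‖ ≤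
          (C * lamL L δ₀ α₀ * (ρ * L) ^ 2 * s * ‖h - h'‖) * (r ^ (α₀ - eta α₀) * Real.exp (-r / 2))) := by
  obtain ⟨κ, C, hκ, hκδ, hC, hb⟩ := Kc_bound hσ hδ h0 h2
  set q : ℝ := 1 + δ₀ / (2 * α₀) with hq
  have hq1 : 1 < q := by have : 0 < δ₀ / (2 * α₀) := by positivity
                         linarith
  set κ' : ℝ := κ / q with hκ'
  have hκ'0 : 0 < κ' := by positivity
  have hκ'1 : κ' ≤ κ := div_le_self hκ.le hq1.le
  refine ⟨κ', C * (1 + 2 / κ' + 32 / κ' ^ 2), hκ'0, by positivity, ?_⟩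
  intro L ν ρ m hL hν hρ hm hmL hνρ
  have hL0 : 0 < L := by linarith
  set T : ℝ := κ' / (ρ * L) with hT
  have hT0 : 0 < T := by positivity
  have hρT : ρ * T = κ' / L := by rw [hT]; field_simp
  have hl := lamL_pos L δ₀ α₀
  have near : ∀ h : Fin 3 → ℂ, ‖h‖ < T → ‖sgC σ₀ ν h - σ₀‖ ≤ κ ∧ ‖dlC δ₀ α₀ ρ m h - δ₀‖ ≤ κ ∧
      ‖alC α₀ ρ h - α₀‖ ≤ κ / L := by
    intro h hh
    have c0 : ‖h 0‖ ≤ T := (norm_le_pi_norm h 0).trans hh.le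
    have c1 : ‖h 1‖ ≤ T := (norm_le_pi_norm h 1).trans hh.le
    have c2 : ‖h 2‖ ≤ T := (norm_le_pi_norm h 2).trans hh.le
    refine ⟨?_, ?_, ?_⟩
    · simp only [sgC, add_sub_cancel_left, norm_mul, Complex.norm_real, Real.norm_eq_abs, abs_of_nonneg hν]
      have : ν * ‖h 0‖ ≤ (ρ * L) * T := mul_le_mul hνρ c0 (norm_nonneg _) (by positivity)
      have e : (ρ * L) * T = κ' := by rw [hT]; field_simp
      linarith
    · simp only [dlC, add_sub_cancel_left, norm_mul, Complex.norm_real, Real.norm_eq_abs, abs_of_pos hρ]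
      have hn : ‖h 1 - (δ₀ / (2 * α₀) : ℝ) * m * h 2‖ ≤ T + δ₀ / (2 * α₀) * L * T := by
        refine (norm_sub_le _ _).trans (add_le_add c1 ?_)
        simp only [norm_mul, Complex.norm_real, Real.norm_eq_abs, abs_of_nonneg hm]
        rw [abs_of_pos (by positivity : 0 < δ₀ / (2 * α₀))]
        gcongr
      have h3 := mul_le_mul_of_nonneg_left hn hρ.le
      have e : ρ * (T + δ₀ / (2 * α₀) * L * T) = κ' / L + δ₀ / (2 * α₀) * κ' := by
        have : ρ * (T + δ₀ / (2 * α₀) * L * T) = ρ * T + δ₀ / (2 * α₀) * L * (ρ * T) := by ring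
        rw [this, hρT]; field_simp
      have e2 : κ' / L ≤ κ' := div_le_self hκ'0.le hL
      have e3 : κ' * q = κ := by rw [hκ']; field_simp
      rw [hq] at e3
      nlinarith
    · simp only [alC, add_sub_cancel_left, norm_mul, Complex.norm_real, Real.norm_eq_abs, abs_of_pos hρ]
      calc ρ * ‖h 2‖ ≤ ρ * T := by gcongr
        _ = κ' / L := hρT
        _ ≤ κ / L := by gcongr
  have bd : ∀ h : Fin 3 → ℂ, ‖h‖ < T → ∀ r : ℝ, 0 < r → ‖FC σ₀ δ₀ α₀ L ν ρ m r h‖ ≤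
        (C * lamL L δ₀ α₀) * (r ^ (α₀ - eta α₀) * Real.exp (-r / 2)) := by
    intro h hh r hr
    obtain ⟨a, b, c⟩ := near h hh
    exact hb L hL _ _ _ a b c r hr
  have df : ∀ r : ℝ, DifferentiableOn ℂ (FC σ₀ δ₀ α₀ L ν ρ m r) (Metric.ball 0 T) := by
    intro r h hh
    refine (FC_diffAt ?_).differentiableWithinAt
    obtain ⟨-, b, -⟩ := near h (by simpa using hh)
    have := (Complex.abs_re_le_norm _).trans b
    simp only [Complex.sub_re, Complex.ofReal_re] at this
    linarith [(abs_le.1 this).1]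
  have Ke : ∀ {A B : ℝ} (x : ℝ), 0 ≤ x → A ≤ B → A * x ≤ B * x := fun x hx h => mul_le_mul_of_nonneg_right h hx
  have C1 : C ≤ C * (1 + 2 / κ' + 32 / κ' ^ 2) := by
    apply le_mul_of_one_le_right hC.le
    have : 0 ≤ 2 / κ' + 32 / κ' ^ 2 := by positivity
    linarith
  refine ⟨fun h hh r hr => (bd h hh r hr).trans ?_, fun d r hr => ?_, fun s hs h h' hh hh' r hr => ?_⟩
  · gcongr
  · rw [← FC_fderiv hδ h0]
    refine (ContinuousLinearMap.le_opNorm _ _).trans ?_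
    have := cauchy_fderiv (df r) (fun z hz => bd z (by simpa using hz) r hr) hT0
    refine (mul_le_mul_of_nonneg_right this (norm_nonneg d)).trans ?_
    have e : 2 * (C * lamL L δ₀ α₀ * (r ^ (α₀ - eta α₀) * Real.exp (-r / 2))) / T * ‖d‖ =
      (C * (2 / κ')) * lamL L δ₀ α₀ * (ρ * L) * ‖d‖ * (r ^ (α₀ - eta α₀) * Real.exp (-r / 2)) := by
      rw [hT]; field_simp
    rw [e]
    have : C * (2 / κ') ≤ C * (1 + 2 / κ' + 32 / κ' ^ 2) := by
      apply mul_le_mul_of_nonneg_left _ hC.le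
      have : 0 ≤ 32 / κ' ^ 2 := by positivity
      linarith
    gcongr
  · have hs0 : 0 ≤ s := (norm_nonneg h).trans hh
    have := second_order hT0 (df r) (fun z hz => bd z (by simpa using hz) r hr) hs hh hh'
    rw [FC_fderiv hδ h0] at this
    refine this.trans ?_
    have e : 32 * (C * lamL L δ₀ α₀ * (r ^ (α₀ - eta α₀) * Real.exp (-r / 2))) * s / T ^ 2 * ‖h - h'‖ =
      (C * (32 / κ' ^ 2)) * lamL L δ₀ α₀ * (ρ * L) ^ 2 * s * ‖h - h'‖ * (r ^ (α₀ - eta α₀) * Real.exp (-r / 2)) := by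
      rw [hT]; field_simp
    rw [e]
    have : C * (32 / κ' ^ 2) ≤ C * (1 + 2 / κ' + 32 / κ' ^ 2) := by
      apply mul_le_mul_of_nonneg_left _ hC.le
      have : 0 ≤ 2 / κ' := by positivity
      linarith
    gcongr

end PartD2

section PartD3
def dphi (σ x : ℝ) : ℝ := phiS σ x * (x ^ 2 / σ ^ 2 - 1) / σ
def GG (σ x : ℝ) : ℝ := Real.exp (-(3 * x ^ 2 / (8 * σ ^ 2)))

def phiC (σ x : ℝ) (t : ℂ) : ℂ :=
  ((Real.sqrt (2 * Real.pi) : ℝ) * (σ + t))⁻¹ * Complex.exp (-(x ^ 2 / (2 * (σ + t) ^ 2)))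

lemma phiC_real (σ x t : ℝ) : phiC σ x t = phiS (σ + t) x := by
  unfold phiC phiS; push_cast; rfl

lemma phiC_bound {σ : ℝ} (hσ : 0 < σ) {t : ℂ} (ht : ‖t‖ < σ / 32) (x : ℝ) :
    (σ + t : ℂ) ≠ 0 ∧ ‖phiC σ x t‖ ≤ 2 / σ * GG σ x := by
  have hre := (Complex.abs_re_le_norm t).trans ht.le
  have him := (Complex.abs_im_le_norm t).trans ht.le
  set w : ℂ := σ + t with hw
  have hwre : w.re = σ + t.re := by simp [hw]
  have hwim : w.im = t.im := by simp [hw]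
  rw [abs_le] at hre him
  have hwpos : 31 / 32 * σ ≤ w.re := by rw [hwre]; linarith [hre.1]
  have hw0 : w ≠ 0 := by
    intro h; rw [h] at hwpos; simp at hwpos; nlinarith
  refine ⟨hw0, ?_⟩
  have hnw : 31 / 32 * σ ≤ ‖w‖ := hwpos.trans (Complex.re_le_norm w)
  unfold phiC
  rw [norm_mul, norm_inv, norm_mul, Complex.norm_exp, Complex.norm_real]
  have hpi : 1 ≤ √(2 * Real.pi) := by
    rw [Real.one_le_sqrt]; nlinarith [Real.pi_gt_three]
  have h1 : (‖√(2 * Real.pi)‖ * ‖w‖)⁻¹ ≤ 2 / σ := by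
    rw [Real.norm_of_nonneg (by positivity), inv_le_comm₀ (by positivity) (by positivity), inv_div]
    nlinarith [norm_nonneg w]
  refine mul_le_mul h1 (Real.exp_le_exp.2 ?_) (Real.exp_pos _).le (by positivity)
  have e : ((-((x:ℂ) ^ 2 / (2 * w ^ 2)))).re = -(x ^ 2 / 2 * ((w.re ^ 2 - w.im ^ 2) / (w.re ^ 2 + w.im ^ 2) ^ 2)) := by
    have : (x:ℂ) ^ 2 / (2 * w ^ 2) = ((x ^ 2 / 2 : ℝ) : ℂ) * (w ^ 2)⁻¹ := by
      push_cast; field_simp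
    rw [this, Complex.neg_re, Complex.re_ofReal_mul, Complex.inv_re]
    have a1 : (w ^ 2).re = w.re ^ 2 - w.im ^ 2 := by simp [pow_two]
    have a2 : Complex.normSq (w ^ 2) = (w.re ^ 2 + w.im ^ 2) ^ 2 := by
      rw [map_pow, Complex.normSq_apply]; ring
    rw [a1, a2]
  rw [e]
  apply neg_le_neg
  have hS : 0 < σ ^ 2 := by positivity
  have b1 : 961 / 1024 * σ ^ 2 ≤ w.re ^ 2 := by nlinarith
  have b2 : w.re ^ 2 ≤ 1089 / 1024 * σ ^ 2 := by rw [hwre]; nlinarith [hre.2, hre.1]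
  have b3 : w.im ^ 2 ≤ 1 / 1024 * σ ^ 2 := by rw [hwim]; nlinarith [him.1, him.2]
  have b4 : 0 ≤ w.im ^ 2 := sq_nonneg _
  have key : 3 / (4 * σ ^ 2) ≤ (w.re ^ 2 - w.im ^ 2) / (w.re ^ 2 + w.im ^ 2) ^ 2 := by
    generalize w.re ^ 2 = A at *
    generalize w.im ^ 2 = B at *
    generalize σ ^ 2 = S at *
    rw [div_le_div_iff₀ (by positivity) (by apply pow_pos; nlinarith)]
    have c1 : A + B ≤ 1090 / 1024 * S := by linarith
    have c2 : (A + B) ^ 2 ≤ (1090 / 1024 * S) ^ 2 := by gcongr; linarith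
    have c3 : 960 / 1024 * S ≤ A - B := by linarith
    nlinarith
  calc 3 * x ^ 2 / (8 * σ ^ 2) = x ^ 2 / 2 * (3 / (4 * σ ^ 2)) := by field_simp; ring
    _ ≤ _ := by gcongr

lemma phiC_hasDeriv {σ : ℝ} (hσ : 0 < σ) (x : ℝ) : HasDerivAt (phiC σ x) (dphi σ x) 0 := by
  have hs : (σ:ℂ) ≠ 0 := by exact_mod_cast hσ.ne'
  have hpi : ((√(2 * Real.pi) : ℝ) : ℂ) ≠ 0 := by
    have : 0 < √(2 * Real.pi) := by positivity
    exact_mod_cast this.ne'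
  have h1 : HasDerivAt (fun t : ℂ => (σ:ℂ) + t) 1 0 := by simpa using (hasDerivAt_id (0:ℂ)).const_add (σ:ℂ)
  have h2 := (h1.const_mul ((√(2 * Real.pi) : ℝ) : ℂ)).inv (by rw [add_zero]; exact mul_ne_zero hpi hs)
  have h3 := (((h1.pow 2).const_mul (2:ℂ)).inv (by simp [hs])).const_mul ((x:ℂ) ^ 2) |>.neg.cexp
  have h4 := h2.mul h3
  refine (h4.congr_deriv ?_).congr_of_eventuallyEq (Eventually.of_forall fun t => ?_)
  · simp only [Pi.inv_apply, Pi.pow_apply, Pi.neg_apply, add_zero, Pi.mul_apply]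
    unfold dphi phiS
    push_cast
    rw [← div_eq_mul_inv]
    generalize Complex.exp (-((x:ℂ) ^ 2 / (2 * (σ:ℂ) ^ 2))) = e
    field_simp
    ring
  · simp [phiC, div_eq_mul_inv]

lemma phi_second {σ : ℝ} (hσ : 0 < σ) (x : ℝ) {s t t' : ℝ} (hs : s ≤ σ / 128) (ht : |t| ≤ s) (ht' : |t'| ≤ s) :
    |phiS (σ + t) x - phiS (σ + t') x - dphi σ x * (t - t')| ≤ (65536 / σ ^ 3) * GG σ x * s * |t - t'| := by
  have hd : DifferentiableOn ℂ (phiC σ x) (Metric.ball 0 (σ / 32)) := by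
    intro t ht
    have h0 := (phiC_bound hσ (by simpa using ht) x).1
    have hpi : ((√(2 * Real.pi) : ℝ) : ℂ) ≠ 0 := by
      have : 0 < √(2 * Real.pi) := by positivity
      exact_mod_cast this.ne'
    unfold phiC
    refine DifferentiableAt.differentiableWithinAt ?_
    refine DifferentiableAt.mul (DifferentiableAt.inv (by fun_prop) (mul_ne_zero hpi h0)) ?_
    refine DifferentiableAt.cexp (DifferentiableAt.neg (DifferentiableAt.div (by fun_prop) (by fun_prop) ?_))
    exact mul_ne_zero two_ne_zero (pow_ne_zero 2 h0)
  have := second_order (by positivity : 0 < σ / 32) hd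
    (fun z hz => (phiC_bound hσ (by simpa using hz) x).2) (s := s) (by linarith) (z := (t:ℂ)) (z' := (t':ℂ))
    (by simpa using ht) (by simpa using ht')
  have hf : fderiv ℂ (phiC σ x) 0 ((t:ℂ) - t') = dphi σ x * (t - t') := by
    rw [(phiC_hasDeriv hσ x).hasFDerivAt.fderiv]; simp [mul_comm]
  rw [hf, phiC_real, phiC_real] at this
  norm_cast at this
  simp only [Complex.norm_real, Real.norm_eq_abs] at this
  refine this.trans (le_of_eq ?_)
  field_simp
  ring

/-- real perturbed parameters -/
def sgR (σ₀ ν : ℝ) (h : Fin 3 → ℝ) : ℝ := σ₀ + ν * h 0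
def dlR (δ₀ α₀ ρ m : ℝ) (h : Fin 3 → ℝ) : ℝ := δ₀ + ρ * (h 1 - (δ₀ / (2 * α₀)) * m * h 2)
def alR (α₀ ρ : ℝ) (h : Fin 3 → ℝ) : ℝ := α₀ + ρ * h 2

def qh (σ₀ δ₀ α₀ L ν ρ m : ℝ) (h : Fin 3 → ℝ) (x : ℝ) : ℝ :=
  qf (sgR σ₀ ν h) (lamL L (dlR δ₀ α₀ ρ m h) (alR α₀ ρ h)) (alR α₀ ρ h) x

def SS (σ₀ δ₀ α₀ L ν ρ m : ℝ) (d : Fin 3 → ℝ) (x : ℝ) : ℝ :=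
  dphi σ₀ x * (ν * d 0) + TT (fun r => DFC σ₀ δ₀ α₀ L ν ρ m r (fun j => (d j : ℂ))) x

def bb (σ₀ δ₀ α₀ L ν ρ : ℝ) (x : ℝ) : ℝ :=
  ν ^ 2 * GG σ₀ x + lamL L δ₀ α₀ * (ρ * L) ^ 2 * (1 + |x|) ^ (-(1 + (α₀ - eta α₀)))

lemma norm_ofReal_vec (h : Fin 3 → ℝ) : ‖(fun j => (h j : ℂ))‖ = ‖h‖ := by
  simp only [Pi.norm_def]
  congr 1
  apply Finset.sup_congr rfl
  intro j _
  ext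
  simp

lemma FC_meas (σ₀ δ₀ α₀ L ν ρ m : ℝ) (h : Fin 3 → ℂ) : Measurable (fun r => FC σ₀ δ₀ α₀ L ν ρ m r h) := by
  unfold FC; exact Kc_meas _ _ _ _

lemma lg_meas : Measurable lg := by unfold lg; fun_prop

lemma DFC_meas (σ₀ δ₀ α₀ L ν ρ m : ℝ) (d : Fin 3 → ℂ) : Measurable (fun r => DFC σ₀ δ₀ α₀ L ν ρ m r d) := by
  have := lg_meas
  unfold DFC Vc AA
  fun_prop

lemma dom_lemma {σ₀ δ₀ α₀ : ℝ} (hσ : 0 < σ₀) (hδ : 0 < δ₀) (h0 : 0 < α₀) (h2 : α₀ < 2) :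
    ∃ κ : ℝ, 0 < κ ∧ ∀ L ν ρ m : ℝ, 1 ≤ L → 0 ≤ ν → 0 < ρ → 0 ≤ m → m ≤ L → ν ≤ ρ * L →
      ∀ h : Fin 3 → ℝ, ‖h‖ ≤ κ / (ρ * L) → 0 < sgR σ₀ ν h ∧ 0 < dlR δ₀ α₀ ρ m h ∧
        0 < alR α₀ ρ h ∧ alR α₀ ρ h < 2 := by
  set q : ℝ := 1 + δ₀ / (2 * α₀) with hq
  have hq1 : 0 < δ₀ / (2 * α₀) := by positivity
  refine ⟨min (min (σ₀ / 2) (δ₀ / 2 / q)) (min (α₀ / 2) ((2 - α₀) / 2)), ?_, ?_⟩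
  · have : 0 < 2 - α₀ := by linarith
    positivity
  intro L ν ρ m hL hν hρ hm hmL hνρ h hh
  set κ := min (min (σ₀ / 2) (δ₀ / 2 / q)) (min (α₀ / 2) ((2 - α₀) / 2)) with hκ
  have k1 : κ ≤ σ₀ / 2 := (min_le_left _ _).trans (min_le_left _ _)
  have k2 : κ ≤ δ₀ / 2 / q := (min_le_left _ _).trans (min_le_right _ _)
  have k3 : κ ≤ α₀ / 2 := (min_le_right _ _).trans (min_le_left _ _)
  have k4 : κ ≤ (2 - α₀) / 2 := (min_le_right _ _).trans (min_le_right _ _)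
  have hL0 : 0 < L := by linarith
  have hk : ρ * L * ‖h‖ ≤ κ := by rw [le_div_iff₀ (by positivity)] at hh; linarith
  have c (j) : |h j| ≤ ‖h‖ := norm_le_pi_norm h j
  have hN := norm_nonneg h
  have hρh : ρ * ‖h‖ ≤ ρ * L * ‖h‖ := by
    have : ρ * ‖h‖ * 1 ≤ ρ * ‖h‖ * L := by gcongr
    linarith
  have A0 : |ν * h 0| ≤ κ := by
    rw [abs_mul, abs_of_nonneg hν]
    exact (mul_le_mul hνρ (c 0) (abs_nonneg _) (by positivity)).trans hk
  have A2 : |ρ * h 2| ≤ κ := by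
    rw [abs_mul, abs_of_pos hρ]
    exact (mul_le_mul_of_nonneg_left (c 2) hρ.le).trans (hρh.trans hk)
  have A1 : |ρ * (h 1 - (δ₀ / (2 * α₀)) * m * h 2)| ≤ δ₀ / 2 := by
    rw [abs_mul, abs_of_pos hρ]
    have : |h 1 - (δ₀ / (2 * α₀)) * m * h 2| ≤ ‖h‖ + (δ₀ / (2 * α₀)) * L * ‖h‖ := by
      refine (abs_sub _ _).trans (add_le_add (c 1) ?_)
      rw [abs_mul, abs_mul, abs_of_pos hq1, abs_of_nonneg hm]
      have := c 2
      gcongr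
    have h3 := mul_le_mul_of_nonneg_left this hρ.le
    have h4 : κ * q ≤ δ₀ / 2 := by rwa [le_div_iff₀ (by positivity)] at k2
    have h5 : ρ * (‖h‖ + (δ₀ / (2 * α₀)) * L * ‖h‖) = ρ * ‖h‖ + (δ₀ / (2 * α₀)) * (ρ * L * ‖h‖) := by ring
    rw [hq] at h4
    nlinarith
  rw [abs_le] at A0 A1 A2
  unfold sgR dlR alR
  refine ⟨by linarith [A0.1], by linarith [A1.1], by linarith [A2.1], by linarith [A2.2]⟩

lemma qh_eq {σ₀ δ₀ α₀ L ν ρ m : ℝ} {h : Fin 3 → ℝ} (a : 0 < sgR σ₀ ν h) (b : 0 < dlR δ₀ α₀ ρ m h)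
    (c : 0 < alR α₀ ρ h) (d : alR α₀ ρ h < 2) (x : ℝ) :
    qh σ₀ δ₀ α₀ L ν ρ m h x = phiS (sgR σ₀ ν h) x +
      TT (fun r => FC σ₀ δ₀ α₀ L ν ρ m r (fun j => (h j : ℂ))) x := by
  unfold qh
  rw [qf_eq a (lamL_pos _ _ _).le c d]
  congr 1
  apply TT_congr
  intro r hr
  rw [← Kc_real b]
  unfold FC
  congr 1
  · simp [sgR, sgC]
  · simp [dlR, dlC]
  · simp [alR, alC]

lemma q_main {σ₀ δ₀ α₀ : ℝ} (hσ : 0 < σ₀) (hδ : 0 < δ₀) (h0 : 0 < α₀) (h2 : α₀ < 2) :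
    ∃ κ C : ℝ, 0 < κ ∧ 0 < C ∧ ∀ L ν ρ m : ℝ, 1 ≤ L → 0 ≤ ν → 0 < ρ → 0 ≤ m → m ≤ L → ν ≤ ρ * L →
      (∀ h : Fin 3 → ℝ, ‖h‖ ≤ κ / (ρ * L) → 0 < sgR σ₀ ν h ∧ 0 < dlR δ₀ α₀ ρ m h ∧
        0 < alR α₀ ρ h ∧ alR α₀ ρ h < 2) ∧
      (∀ (d : Fin 3 → ℝ) (x : ℝ), |TT (fun r => DFC σ₀ δ₀ α₀ L ν ρ m r (fun j => ((d j : ℝ) : ℂ))) x| ≤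
        C * lamL L δ₀ α₀ * (ρ * L) * ‖d‖ * (1 + |x|) ^ (-(1 + (α₀ - eta α₀)))) ∧
      (∀ d : Fin 3 → ℂ, IntegrableOn (fun r => DFC σ₀ δ₀ α₀ L ν ρ m r d) (Ioi 0)) ∧
      (∀ d : Fin 3 → ℂ, Integrable (TT (fun r => DFC σ₀ δ₀ α₀ L ν ρ m r d))) ∧
      (∀ s : ℝ, s ≤ κ / (ρ * L) → ∀ h h' : Fin 3 → ℝ, ‖h‖ ≤ s → ‖h'‖ ≤ s → ∀ x : ℝ,
        |qh σ₀ δ₀ α₀ L ν ρ m h x - qh σ₀ δ₀ α₀ L ν ρ m h' x - SS σ₀ δ₀ α₀ L ν ρ m (h - h') x| ≤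
          C * s * ‖h - h'‖ * bb σ₀ δ₀ α₀ L ν ρ x) := by
  obtain ⟨κ1, hκ1, hdom⟩ := dom_lemma hσ hδ h0 h2
  obtain ⟨κ2, C, hκ2, hC, hF⟩ := FC_main hσ hδ h0 h2
  have heta := eta_le h0
  have hE : 0 < α₀ - eta α₀ := by linarith
  set ct := CT (α₀ - eta α₀) with hct
  have hct0 : 0 < ct := CT_pos (by linarith)
  refine ⟨min (min κ1 (κ2 / 8)) (σ₀ / 128), ct * C + 65536 / σ₀ ^ 3, by positivity, by positivity, ?_⟩
  intro L ν ρ m hL hν hρ hm hmL hνρ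
  obtain ⟨f1, f2, f3⟩ := hF L ν ρ m hL hν hρ hm hmL hνρ
  have hl := lamL_pos L δ₀ α₀
  have hL0 : 0 < L := by linarith
  have hρL : 0 < ρ * L := by positivity
  set κ := min (min κ1 (κ2 / 8)) (σ₀ / 128) with hκ
  have l1 : κ ≤ κ1 := (min_le_left _ _).trans (min_le_left _ _)
  have l2 : κ ≤ κ2 / 8 := (min_le_left _ _).trans (min_le_right _ _)
  have l3 : κ ≤ σ₀ / 128 := min_le_right _ _
  have hdom' : ∀ h : Fin 3 → ℝ, ‖h‖ ≤ κ / (ρ * L) → 0 < sgR σ₀ ν h ∧ 0 < dlR δ₀ α₀ ρ m h ∧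
        0 < alR α₀ ρ h ∧ alR α₀ ρ h < 2 := fun h hh =>
    hdom L ν ρ m hL hν hρ hm hmL hνρ h (hh.trans (by gcongr))
  have IDF : ∀ d : Fin 3 → ℂ, IntegrableOn (fun r => DFC σ₀ δ₀ α₀ L ν ρ m r d) (Ioi 0) := fun d =>
    KI_of_bound (by linarith) (DFC_meas _ _ _ _ _ _ _ _).aestronglyMeasurable (f2 d)
  refine ⟨hdom', ?_, IDF, ?_, ?_⟩
  · intro d x
    have := TT_bound (by linarith) (f2 (fun j => ((d j : ℝ) : ℂ))) x
    rw [norm_ofReal_vec] at this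
    refine this.trans ?_
    rw [← hct]
    have e : ct * (C * lamL L δ₀ α₀ * (ρ * L) * ‖d‖) = (ct * C) * lamL L δ₀ α₀ * (ρ * L) * ‖d‖ := by ring
    rw [e]
    have : ct * C ≤ ct * C + 65536 / σ₀ ^ 3 := by
      have : 0 < 65536 / σ₀ ^ 3 := by positivity
      linarith
    gcongr
  · intro d
    exact TT_integrable hE (DFC_meas _ _ _ _ _ _ _ _).aestronglyMeasurable (f2 d)
  · intro s hs h h' hh hh' x
    obtain ⟨a, b, c, d⟩ := hdom' h (hh.trans hs)
    obtain ⟨a', b', c', d'⟩ := hdom' h' (hh'.trans hs)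
    have hs0 : 0 ≤ s := (norm_nonneg h).trans hh
    rw [qh_eq a b c d, qh_eq a' b' c' d']
    have hsκ : s * (ρ * L) ≤ κ := by rwa [le_div_iff₀ hρL] at hs
    have hs' : s ≤ κ2 / (ρ * L) / 4 := by
      rw [div_right_comm, le_div_iff₀ hρL]; linarith
    have hlt : s < κ2 / (ρ * L) := by
      rw [lt_div_iff₀ hρL]; linarith
    have I1 : ∀ h : Fin 3 → ℝ, ‖h‖ ≤ s → IntegrableOn (fun r => FC σ₀ δ₀ α₀ L ν ρ m r (fun j => (h j : ℂ))) (Ioi 0) :=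
      fun h hh => KI_of_bound (by linarith) (FC_meas _ _ _ _ _ _ _ _).aestronglyMeasurable
        (f1 _ (by rw [norm_ofReal_vec]; exact hh.trans_lt hlt))
    have e1 : TT (fun r => FC σ₀ δ₀ α₀ L ν ρ m r (fun j => (h j : ℂ)) - FC σ₀ δ₀ α₀ L ν ρ m r (fun j => (h' j : ℂ)) -
        DFC σ₀ δ₀ α₀ L ν ρ m r (fun j => ((h - h') j : ℂ))) x =
        TT (fun r => FC σ₀ δ₀ α₀ L ν ρ m r (fun j => (h j : ℂ))) x -
        TT (fun r => FC σ₀ δ₀ α₀ L ν ρ m r (fun j => (h' j : ℂ))) x -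
        TT (fun r => DFC σ₀ δ₀ α₀ L ν ρ m r (fun j => ((h - h') j : ℂ))) x := by
      rw [TT_sub _ (IDF _), TT_sub (I1 h hh) (I1 h' hh')]
      exact (I1 h hh).sub (I1 h' hh')
    have b1 := TT_bound (by linarith) (fun r hr => f3 s hs' (fun j => (h j : ℂ)) (fun j => (h' j : ℂ))
      (by rw [norm_ofReal_vec]; exact hh) (by rw [norm_ofReal_vec]; exact hh') r hr) x
    have ev : (fun j => (h j : ℂ)) - (fun j => (h' j : ℂ)) = fun j => ((h - h') j : ℂ) := by
      ext j; simp
    rw [ev, norm_ofReal_vec, e1, ← hct] at b1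
    have hνs : ν * s ≤ σ₀ / 128 := by nlinarith
    have c (h : Fin 3 → ℝ) (hh : ‖h‖ ≤ s) : |ν * h 0| ≤ ν * s := by
      rw [abs_mul, abs_of_nonneg hν]
      exact mul_le_mul_of_nonneg_left ((norm_le_pi_norm h 0).trans hh) hν
    have b2 := phi_second hσ x hνs (c h hh) (c h' hh')
    have e3 : |ν * h 0 - ν * h' 0| ≤ ν * ‖h - h'‖ := by
      rw [← mul_sub, abs_mul, abs_of_nonneg hν]
      exact mul_le_mul_of_nonneg_left (norm_le_pi_norm (h - h') 0) hν
    have hG : 0 < GG σ₀ x := Real.exp_pos _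
    have hn := norm_nonneg (h - h')
    have b3 : 65536 / σ₀ ^ 3 * GG σ₀ x * (ν * s) * |ν * h 0 - ν * h' 0| ≤
      65536 / σ₀ ^ 3 * GG σ₀ x * (ν * s) * (ν * ‖h - h'‖) := by gcongr
    set P : ℝ := (1 + |x|) ^ (-(1 + (α₀ - eta α₀))) with hP
    have hP0 : 0 ≤ P := by positivity
    unfold SS bb sgR
    rw [← hP]
    set X1 := TT (fun r => FC σ₀ δ₀ α₀ L ν ρ m r (fun j => (h j : ℂ))) x
    set X2 := TT (fun r => FC σ₀ δ₀ α₀ L ν ρ m r (fun j => (h' j : ℂ))) x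
    set X3 := TT (fun r => DFC σ₀ δ₀ α₀ L ν ρ m r (fun j => ((h - h') j : ℂ))) x
    have split : phiS (σ₀ + ν * h 0) x + X1 - (phiS (σ₀ + ν * h' 0) x + X2) - (dphi σ₀ x * (ν * (h - h') 0) + X3)
      = (phiS (σ₀ + ν * h 0) x - phiS (σ₀ + ν * h' 0) x - dphi σ₀ x * (ν * h 0 - ν * h' 0)) + (X1 - X2 - X3) := by
      simp only [Pi.sub_apply]; ring
    rw [split]
    refine (abs_add_le _ _).trans ((add_le_add (b2.trans b3) b1).trans ?_)
    have y1 : 0 ≤ ct * C * s * ‖h - h'‖ * (ν ^ 2 * GG σ₀ x) := by positivity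
    have y2 : 0 ≤ 65536 / σ₀ ^ 3 * s * ‖h - h'‖ * (lamL L δ₀ α₀ * (ρ * L) ^ 2 * P) := by positivity
    have e9 : (ct * C + 65536 / σ₀ ^ 3) * s * ‖h - h'‖ * (ν ^ 2 * GG σ₀ x + lamL L δ₀ α₀ * (ρ * L) ^ 2 * P) =
      65536 / σ₀ ^ 3 * GG σ₀ x * (ν * s) * (ν * ‖h - h'‖) +
      ct * (C * lamL L δ₀ α₀ * (ρ * L) ^ 2 * s * ‖h - h'‖) * P +
      (ct * C * s * ‖h - h'‖ * (ν ^ 2 * GG σ₀ x) +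
        65536 / σ₀ ^ 3 * s * ‖h - h'‖ * (lamL L δ₀ α₀ * (ρ * L) ^ 2 * P)) := by ring
    rw [e9]
    linarith

end PartD3

section PartE1
lemma lg_norm_le {ε r : ℝ} (hε : 0 < ε) (hr : 0 < r) : ‖lg r‖ ≤ (1 / ε + 1) * (r ^ ε + r ^ (-ε)) := by
  have h1 : ‖lg r‖ ≤ |Real.log r| + Real.pi / 6 := by
    unfold lg
    refine (norm_add_le _ _).trans ?_
    rw [norm_mul, Complex.norm_I, Complex.norm_real, Complex.norm_real, mul_one, Real.norm_eq_abs, Real.norm_eq_abs,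
      abs_of_pos (by positivity : 0 < Real.pi / 6)]
  have h2 := exp_abs_log_le (η := ε) hr
  have h3 : ε * |Real.log r| + 1 ≤ Real.exp (ε * |Real.log r|) := Real.add_one_le_exp _
  have h4 : |Real.log r| ≤ 1 / ε * (r ^ ε + r ^ (-ε)) := by
    rw [div_mul_eq_mul_div, le_div_iff₀ hε]; linarith
  have h5 : 1 ≤ r ^ ε + r ^ (-ε) := by
    have := mul_nonneg hε.le (abs_nonneg (Real.log r))
    linarith
  have := Real.pi_lt_d2
  nlinarith

def K0 (α : ℝ) (r : ℝ) : ℂ := -Complex.exp (α * lg r)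
def K1 (α : ℝ) (r : ℝ) : ℂ := -(Complex.exp (α * lg r) * lg r)
def C0 (α : ℝ) : ℝ := TT (K0 α) 1
def C1 (α : ℝ) : ℝ := TT (K1 α) 1

lemma K0_meas (α : ℝ) : Measurable (K0 α) := by
  have := exp_alg_meas α
  unfold K0; fun_prop
lemma K1_meas (α : ℝ) : Measurable (K1 α) := by
  have := exp_alg_meas α
  have := lg_meas
  unfold K1; fun_prop

lemma C0_eq {α : ℝ} (h0 : 0 < α) : C0 α = Real.Gamma (α + 1) * Real.sin (Real.pi * α / 2) / Real.pi := by
  have hF : Differentiable ℂ (fun w : ℂ => Complex.exp (Complex.I * Complex.exp w) * Complex.exp (α * w)) := by fun_prop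
  have hpi := Real.pi_pos
  have hex : ∀ r : ℝ, 0 < r → ∀ y : ℝ, Complex.exp (Real.log r + y * Complex.I) = r * Complex.exp (y * Complex.I) := by
    intro r hr y
    rw [Complex.exp_add, ← Complex.ofReal_exp, Real.exp_log hr]
  have key := ray_rotate hF (a := Real.pi / 6) (b := Real.pi / 2) (by linarith) (C := 1) (p := α) (c := 1 / 2)
    (by linarith) (by norm_num) (by
      intro r hr y hy
      rw [hex r hr y, norm_mul, Complex.norm_exp, Complex.norm_exp, Complex.exp_mul_I]
      have e1 : (Complex.I * (↑r * (Complex.cos ↑y + Complex.sin ↑y * Complex.I))).re = -(r * Real.sin y) := by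
        rw [← Complex.ofReal_cos, ← Complex.ofReal_sin]
        simp [-Complex.ofReal_cos, -Complex.ofReal_sin]
      have e2 : ((α:ℂ) * (↑(Real.log r) + ↑y * Complex.I)).re = α * Real.log r := by simp
      rw [e1, e2, one_mul, Real.rpow_def_of_pos hr, mul_comm α, mul_comm (Real.exp (Real.log r * α))]
      have hs : 1 / 2 ≤ Real.sin y := by
        rw [← Real.sin_pi_div_six]
        exact Real.sin_le_sin_of_le_of_le_pi_div_two (by linarith) hy.2 hy.1
      have : Real.exp (-(r * Real.sin y)) ≤ Real.exp (-(1 / 2) * r) := Real.exp_le_exp.2 (by nlinarith)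
      gcongr)
  have e0 : C0 α = -(1 / Real.pi) * (∫ r in Ioi (0:ℝ), Complex.exp ((Real.pi / 6 : ℝ) * Complex.I) *
      (Complex.exp (Complex.I * Complex.exp (Real.log r + (Real.pi / 6 : ℝ) * Complex.I)) *
        Complex.exp (α * (Real.log r + (Real.pi / 6 : ℝ) * Complex.I)))).re := by
    unfold C0 TT
    have : ∫ r in Ioi (0:ℝ), om * Complex.exp (Complex.I * |(1:ℝ)| * (om * r)) * K0 α r =
      -∫ r in Ioi (0:ℝ), Complex.exp ((Real.pi / 6 : ℝ) * Complex.I) *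
      (Complex.exp (Complex.I * Complex.exp (Real.log r + (Real.pi / 6 : ℝ) * Complex.I)) *
        Complex.exp (α * (Real.log r + (Real.pi / 6 : ℝ) * Complex.I))) := by
      rw [← integral_neg]
      refine setIntegral_congr_fun measurableSet_Ioi fun r hr => ?_
      have := exp_lg hr
      unfold lg at this
      simp only [K0, lg]
      rw [this]
      simp only [om]
      simp only [abs_one, Complex.ofReal_one, mul_one]
      ring
    rw [this, Complex.neg_re]; ring
  rw [e0, key]
  have e1 : ∫ r in Ioi (0:ℝ), Complex.exp ((Real.pi / 2 : ℝ) * Complex.I) *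
      (Complex.exp (Complex.I * Complex.exp (Real.log r + (Real.pi / 2 : ℝ) * Complex.I)) *
        Complex.exp (α * (Real.log r + (Real.pi / 2 : ℝ) * Complex.I))) =
      ∫ r in Ioi (0:ℝ), (Complex.I * Complex.exp ((Real.pi * α / 2 : ℝ) * Complex.I)) *
        ((Real.exp (-r) * r ^ (α + 1 - 1) : ℝ) : ℂ) := by
    refine setIntegral_congr_fun measurableSet_Ioi fun r hr => ?_
    have hr : 0 < r := hr
    have e : Complex.exp ((Real.pi / 2 : ℝ) * Complex.I) = Complex.I := by
      push_cast; exact Complex.exp_pi_div_two_mul_I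
    rw [hex r hr, e, add_sub_cancel_right, Real.rpow_def_of_pos hr, ← Real.exp_add, Complex.ofReal_exp, ← Complex.exp_add,
      mul_assoc, ← Complex.exp_add]
    congr 2
    have : Complex.I * (r * Complex.I) = -r := by
      have := Complex.I_mul_I
      linear_combination (r:ℂ) * this
    rw [this]
    push_cast; ring
  rw [e1, integral_const_mul, integral_complex_ofReal, ← Real.Gamma_eq_integral (by linarith)]
  rw [Complex.exp_mul_I, ← Complex.ofReal_cos, ← Complex.ofReal_sin]
  simp [-Complex.ofReal_cos, -Complex.ofReal_sin]
  ring

lemma C0_cAlpha {α : ℝ} (h0 : 0 < α) (h2 : α < 2) : cAlpha α = C0 α := by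
  rw [C0_eq h0]
  unfold cAlpha
  split_ifs with h
  · subst h; norm_num [Real.Gamma_two]
  · have hpi := Real.pi_pos
    have hsin : 0 < Real.sin (Real.pi * α / 2) := Real.sin_pos_of_pos_of_lt_pi (by positivity) (by nlinarith)
    have hcos : Real.cos (Real.pi * α / 2) ≠ 0 := by
      rcases lt_or_gt_of_ne h with h | h
      · exact (Real.cos_pos_of_mem_Ioo ⟨by nlinarith, by nlinarith⟩).ne'
      · exact (Real.cos_neg_of_pi_div_two_lt_of_lt (by nlinarith) (by nlinarith)).ne
    have hG := Real.Gamma_mul_Gamma_one_sub α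
    have e1 : Real.Gamma (2 - α) = (1 - α) * Real.Gamma (1 - α) := by
      rw [← Real.Gamma_add_one (by intro h'; apply h; linarith)]; congr 1; ring
    have e2 : Real.Gamma (α + 1) = α * Real.Gamma α := Real.Gamma_add_one h0.ne'
    have e3 : Real.sin (Real.pi * α) = 2 * Real.sin (Real.pi * α / 2) * Real.cos (Real.pi * α / 2) := by
      rw [← Real.sin_two_mul]; congr 1; ring
    have hG2 : 0 < Real.Gamma (2 - α) := Real.Gamma_pos_of_pos (by linarith)
    have hΓ : Real.Gamma (1 - α) ≠ 0 := by
      intro h'; rw [e1, h'] at hG2; simp at hG2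
    have hα : 1 - α ≠ 0 := by intro h'; apply h; linarith
    rw [e3] at hG
    rw [e2, e1]
    have e4 : Real.Gamma α = Real.pi / (2 * Real.sin (Real.pi * α / 2) * Real.cos (Real.pi * α / 2)) / Real.Gamma (1 - α) := by
      rw [← hG]; field_simp
    rw [e4]
    generalize Real.sin (Real.pi * α / 2) = S at *
    generalize Real.cos (Real.pi * α / 2) = c at *
    have := hsin.ne'
    field_simp
    ring

lemma cAlpha_pos {α : ℝ} (h0 : 0 < α) (h2 : α < 2) : 0 < cAlpha α := by
  rw [C0_cAlpha h0 h2, C0_eq h0]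
  have hpi := Real.pi_pos
  have hsin : 0 < Real.sin (Real.pi * α / 2) := Real.sin_pos_of_pos_of_lt_pi (by positivity) (by nlinarith)
  have : 0 < Real.Gamma (α + 1) := Real.Gamma_pos_of_pos (by linarith)
  positivity

/-- integrability with the oscillating factor -/
def TTi (K : ℝ → ℂ) (x : ℝ) : Prop :=
  IntegrableOn (fun r : ℝ => om * Complex.exp (Complex.I * |x| * (om * r)) * K r) (Ioi 0)

lemma TTi_of_bound {K : ℝ → ℂ} (hm : Measurable K) {C a x : ℝ} (hx : x ≠ 0) (ha : -1 < a)
    (h : ∀ r : ℝ, 0 < r → ‖K r‖ ≤ C * r ^ a) : TTi K x := by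
  have hx0 : 0 < |x| := abs_pos.2 hx
  refine Integrable.mono' ((rexp_int ha (c := |x| / 2) (by positivity)).const_mul C) (by fun_prop) ?_
  filter_upwards [ae_restrict_mem measurableSet_Ioi] with r hr
  rw [norm_mul, norm_mul, om_norm, norm_exp_xom, one_mul]
  have := mul_le_mul_of_nonneg_left (h r hr) (Real.exp_pos (-(|x| * r) / 2)).le
  refine this.trans (le_of_eq ?_)
  rw [show -(|x| / 2) * r = -(|x| * r) / 2 by ring]; ring

lemma TT_bound' {K : ℝ → ℂ} {C a x : ℝ} (hx : 0 < x) (ha : -1 < a)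
    (h : ∀ r : ℝ, 0 < r → ‖K r‖ ≤ C * r ^ a) : |TT K x| ≤ CT a * C * x ^ (-(1 + a)) := by
  have h1 := TT_abs_le K (x := x) ((rexp_int ha (c := x / 2) (by positivity)).const_mul C) (by
    intro r hr
    rw [abs_of_pos hx]
    have := mul_le_mul_of_nonneg_left (h r hr) (Real.exp_pos (-(x * r) / 2)).le
    refine this.trans (le_of_eq ?_)
    rw [show -(x / 2) * r = -(x * r) / 2 by ring]; ring)
  refine h1.trans (le_of_eq ?_)
  rw [integral_const_mul]
  have := Real.integral_rpow_mul_exp_neg_mul_Ioi (a := a + 1) (r := x / 2) (by linarith) (by positivity)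
  rw [add_sub_cancel_right] at this
  simp_rw [neg_mul]
  rw [this, CT, one_div_div, Real.div_rpow (by norm_num) hx.le, Real.rpow_neg hx.le, add_comm 1 a]
  ring

lemma TT_add' {K K' : ℝ → ℂ} {x : ℝ} (hK : TTi K x) (hK' : TTi K' x) :
    TT (fun r => K r + K' r) x = TT K x + TT K' x := by
  unfold TT
  rw [← mul_add, ← Complex.add_re, ← integral_add hK hK']
  simp_rw [mul_add]

lemma TTi_add {K K' : ℝ → ℂ} {x : ℝ} (hK : TTi K x) (hK' : TTi K' x) : TTi (fun r => K r + K' r) x := by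
  unfold TTi
  simp_rw [mul_add]
  exact Integrable.add hK hK'

lemma TT_scale (K : ℝ → ℂ) {x : ℝ} (hx : 0 < x) : TT K x = x⁻¹ * TT (fun τ => K (τ / x)) 1 := by
  unfold TT
  have := integral_comp_mul_left_Ioi (fun τ : ℝ => om * Complex.exp (Complex.I * |(1:ℝ)| * (om * τ)) * K (τ / x)) 0 hx
  rw [mul_zero] at this
  have e : ∫ r in Ioi (0:ℝ), om * Complex.exp (Complex.I * |x| * (om * r)) * K r =
    ∫ r in Ioi (0:ℝ), (fun τ : ℝ => om * Complex.exp (Complex.I * |(1:ℝ)| * (om * τ)) * K (τ / x)) (x * r) := by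
    refine setIntegral_congr_fun measurableSet_Ioi fun r hr => ?_
    simp only [abs_one, abs_of_pos hx, mul_div_cancel_left₀ r hx.ne']
    congr 3
    push_cast; ring
  rw [e, this, Complex.real_smul, Complex.re_ofReal_mul]
  ring

lemma K0_norm {α r : ℝ} (hr : 0 < r) : ‖K0 α r‖ = r ^ α := by
  unfold K0; rw [norm_neg, norm_exp_alg hr]

lemma K1_norm {α ε r : ℝ} (hε : 0 < ε) (hr : 0 < r) :
    ‖K1 α r‖ ≤ (1 / ε + 1) * (r ^ (α + ε) + r ^ (α - ε)) := by
  unfold K1; rw [norm_neg, norm_mul, norm_exp_alg hr]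
  have := mul_le_mul_of_nonneg_left (lg_norm_le hε hr) (Real.rpow_nonneg hr.le α)
  refine this.trans (le_of_eq ?_)
  rw [Real.rpow_add hr, sub_eq_add_neg, Real.rpow_add hr]; ring

/-- two-power version -/
lemma TTi_of_bound2 {K : ℝ → ℂ} (hm : Measurable K) {C a b x : ℝ} (hx : x ≠ 0) (ha : -1 < a) (hb : -1 < b)
    (h : ∀ r : ℝ, 0 < r → ‖K r‖ ≤ C * (r ^ a + r ^ b)) : TTi K x := by
  have hx0 : 0 < |x| := abs_pos.2 hx
  have I : Integrable (fun r : ℝ => C * (r ^ a * Real.exp (-(|x| / 2) * r) + r ^ b * Real.exp (-(|x| / 2) * r)))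
      (volume.restrict (Ioi 0)) := ((rexp_int ha (c := |x| / 2) (by positivity)).add (rexp_int hb (c := |x| / 2) (by positivity))).const_mul C
  refine Integrable.mono' I (by fun_prop) ?_
  filter_upwards [ae_restrict_mem measurableSet_Ioi] with r hr
  rw [norm_mul, norm_mul, om_norm, norm_exp_xom, one_mul]
  have := mul_le_mul_of_nonneg_left (h r hr) (Real.exp_pos (-(|x| * r) / 2)).le
  refine this.trans (le_of_eq ?_)
  rw [show -(|x| / 2) * r = -(|x| * r) / 2 by ring]; ring

lemma TT_bound2' {K : ℝ → ℂ} {C a b x : ℝ} (hx : 0 < x) (ha : -1 < a) (hb : -1 < b)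
    (h : ∀ r : ℝ, 0 < r → ‖K r‖ ≤ C * (r ^ a + r ^ b)) :
    |TT K x| ≤ CT a * C * x ^ (-(1 + a)) + CT b * C * x ^ (-(1 + b)) := by
  have I : IntegrableOn (fun r : ℝ => C * (r ^ a * Real.exp (-(x / 2) * r) + r ^ b * Real.exp (-(x / 2) * r)))
      (Ioi 0) := ((rexp_int ha (c := x / 2) (by positivity)).add (rexp_int hb (c := x / 2) (by positivity))).const_mul C
  have h1 := TT_abs_le K (x := x) I (by
    intro r hr
    rw [abs_of_pos hx]
    have := mul_le_mul_of_nonneg_left (h r hr) (Real.exp_pos (-(x * r) / 2)).le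
    refine this.trans (le_of_eq ?_)
    rw [show -(x / 2) * r = -(x * r) / 2 by ring]; ring)
  refine h1.trans (le_of_eq ?_)
  rw [integral_const_mul, integral_add (rexp_int ha (c := x / 2) (by positivity)) (rexp_int hb (c := x / 2) (by positivity))]
  have ta := Real.integral_rpow_mul_exp_neg_mul_Ioi (a := a + 1) (r := x / 2) (by linarith) (by positivity)
  have tb := Real.integral_rpow_mul_exp_neg_mul_Ioi (a := b + 1) (r := x / 2) (by linarith) (by positivity)
  rw [add_sub_cancel_right] at ta tb
  simp_rw [neg_mul]
  rw [ta, tb, CT, CT, one_div_div, Real.div_rpow (by norm_num) hx.le, Real.div_rpow (by norm_num) hx.le,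
    Real.rpow_neg hx.le, Real.rpow_neg hx.le, add_comm 1 a, add_comm 1 b]
  ring

lemma C0_hasDeriv {α : ℝ} (h0 : 0 < α) : HasDerivAt C0 (C1 α) α := by
  set F : ℝ → ℝ → ℂ := fun a r => om * Complex.exp (Complex.I * |(1:ℝ)| * (om * r)) * K0 a r with hF
  set F' : ℝ → ℝ → ℂ := fun a r => om * Complex.exp (Complex.I * |(1:ℝ)| * (om * r)) * K1 a r with hF'
  have i0 : ∀ a : ℝ, 0 < a → TTi (K0 a) 1 := fun a ha =>
    TTi_of_bound (K0_meas a) one_ne_zero (by linarith) (C := 1) (fun r hr => by rw [K0_norm hr, one_mul])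
  set bd : ℝ → ℝ := fun r => (1 / (α / 4) + 1) * 2 * ((r ^ (2 * α) + r ^ (α / 4)) * Real.exp (-(1 / 2) * r)) with hbd
  have hbi : IntegrableOn bd (Ioi 0) := by
    have : IntegrableOn (fun r : ℝ => (1 / (α / 4) + 1) * 2 * (r ^ (2 * α) * Real.exp (-(1 / 2) * r) + r ^ (α / 4) * Real.exp (-(1 / 2) * r))) (Ioi 0) := 
      ((rexp_int (a := 2 * α) (by linarith) (c := 1 / 2) (by norm_num)).add
      (rexp_int (a := α / 4) (by linarith) (c := 1 / 2) (by norm_num))).const_mul _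
    refine this.congr_fun (fun r _ => ?_) measurableSet_Ioi
    simp only [hbd]; ring
  have key := hasDerivAt_integral_of_dominated_loc_of_deriv_le (μ := volume.restrict (Ioi (0:ℝ))) (F := F) (F' := F')
    (x₀ := α) (s := Ioo (α / 2) (3 * α / 2)) (bound := bd) (Ioo_mem_nhds (by linarith) (by linarith))
    (Eventually.of_forall fun a => by
      have := K0_meas a
      apply Measurable.aestronglyMeasurable
      simp only [hF]; fun_prop) (i0 α h0)
    (by
      have := K1_meas α
      apply Measurable.aestronglyMeasurable
      simp only [hF']; fun_prop)
    (by
      filter_upwards [ae_restrict_mem measurableSet_Ioi] with r hr a ha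
      have hr : 0 < r := hr
      simp only [hF', hbd]
      rw [norm_mul, norm_mul, om_norm, norm_exp_xom, one_mul]
      have k := K1_norm (α := a) (ε := α / 4) (by linarith) hr
      have pw : ∀ b : ℝ, α / 4 ≤ b → b ≤ 2 * α → r ^ b ≤ r ^ (2 * α) + r ^ (α / 4) := by
        intro b h1 h2
        rcases le_total 1 r with h | h
        · have := Real.rpow_le_rpow_of_exponent_le h h2
          have : 0 ≤ r ^ (α / 4) := by positivity
          linarith
        · have := Real.rpow_le_rpow_of_exponent_ge hr h h1
          have : 0 ≤ r ^ (2 * α) := by positivity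
          linarith
      have k2 : r ^ (a + α / 4) + r ^ (a - α / 4) ≤ 2 * (r ^ (2 * α) + r ^ (α / 4)) := by
        have := pw (a + α / 4) (by linarith [ha.1]) (by linarith [ha.2])
        have := pw (a - α / 4) (by linarith [ha.1]) (by linarith [ha.2])
        linarith
      have k3 := k.trans (mul_le_mul_of_nonneg_left k2 (by positivity : 0 ≤ 1 / (α / 4) + 1))
      have := mul_le_mul_of_nonneg_left k3 (Real.exp_pos (-(|(1:ℝ)| * r) / 2)).le
      refine this.trans (le_of_eq ?_)
      rw [abs_one, show -(1 / 2) * r = -(1 * r) / 2 by ring]; ring) hbi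
    (by
      filter_upwards with r a ha
      simp only [hF, hF']
      apply HasDerivAt.const_mul
      unfold K0 K1
      apply HasDerivAt.neg
      have h1 : HasDerivAt (fun z : ℂ => Complex.exp (z * lg r)) (Complex.exp (a * lg r) * lg r) (a:ℂ) := by
        have := ((hasDerivAt_id (a:ℂ)).mul_const (lg r)).cexp
        simpa using this
      exact h1.comp_ofReal)
  have h2 := key.2
  have h3 := (Complex.reCLM.hasFDerivAt.comp_hasDerivAt α h2).const_mul (1 / Real.pi)
  exact h3

lemma deriv_cAlpha {α : ℝ} (h0 : 0 < α) (h2 : α < 2) : deriv cAlpha α = C1 α := by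
  have : cAlpha =ᶠ[𝓝 α] C0 := by
    filter_upwards [Ioo_mem_nhds h0 h2] with a ha
    exact C0_cAlpha ha.1 ha.2
  rw [this.deriv_eq, (C0_hasDeriv h0).deriv]

end PartE1

section PartE2
lemma rpow_le_two {r lo b hi : ℝ} (hr : 0 < r) (h1 : lo ≤ b) (h2 : b ≤ hi) : r ^ b ≤ r ^ lo + r ^ hi := by
  rcases le_total 1 r with h | h
  · have := Real.rpow_le_rpow_of_exponent_le h h2
    have : 0 ≤ r ^ lo := by positivity
    linarith
  · have := Real.rpow_le_rpow_of_exponent_ge hr h h1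
    have : 0 ≤ r ^ hi := by positivity
    linarith

lemma lg_div {τ x : ℝ} (hτ : 0 < τ) (hx : 0 < x) : lg (τ / x) = lg τ - Real.log x := by
  unfold lg; rw [Real.log_div hτ.ne' hx.ne']; push_cast; ring

lemma exp_alg_div {α τ x : ℝ} (hτ : 0 < τ) (hx : 0 < x) :
    Complex.exp (α * lg (τ / x)) = ((x ^ (-α) : ℝ) : ℂ) * Complex.exp (α * lg τ) := by
  rw [lg_div hτ hx, Real.rpow_def_of_pos hx, Complex.ofReal_exp, ← Complex.exp_add]
  congr 1; push_cast; ring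

lemma TT_K0 {α x : ℝ} (hx : 0 < x) : TT (K0 α) x = x ^ (-(1 + α)) * C0 α := by
  rw [TT_scale _ hx, TT_congr (K' := fun r => ((x ^ (-α) : ℝ) : ℂ) * K0 α r), TT_smul]
  · rw [← mul_assoc, neg_add, Real.rpow_add hx, Real.rpow_neg_one]; rfl
  · intro r hr
    unfold K0
    rw [exp_alg_div hr hx]; ring

lemma TTi_K0 {α x : ℝ} (h0 : 0 < α) (hx : x ≠ 0) : TTi (K0 α) x :=
  TTi_of_bound (K0_meas α) hx (by linarith) (C := 1) (fun r hr => by rw [K0_norm hr, one_mul])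

lemma TTi_K1 {α x : ℝ} (h0 : 0 < α) (hx : x ≠ 0) : TTi (K1 α) x :=
  TTi_of_bound2 (K1_meas α) hx (by linarith) (by linarith) (fun r hr => K1_norm (ε := α / 2) (by linarith) hr)

lemma TTi_smul {K : ℝ → ℂ} {x : ℝ} (c : ℂ) (h : TTi K x) : TTi (fun r => c * K r) x := by
  unfold TTi at *
  have : IntegrableOn (fun r : ℝ => c * (om * Complex.exp (Complex.I * |x| * (om * r)) * K r)) (Ioi 0) := h.const_mul c
  refine this.congr_fun (fun r _ => ?_) measurableSet_Ioi
  simp only; ring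

lemma TT_K1 {α x : ℝ} (h0 : 0 < α) (hx : 0 < x) : TT (K1 α) x = x ^ (-(1 + α)) * (C1 α - Real.log x * C0 α) := by
  rw [TT_scale _ hx, TT_congr (K' := fun r => ((x ^ (-α) : ℝ) : ℂ) * (K1 α r + ((-Real.log x : ℝ) : ℂ) * K0 α r)), TT_smul,
    TT_add' (TTi_K1 h0 one_ne_zero) (TTi_smul _ (TTi_K0 h0 one_ne_zero)), TT_smul]
  · rw [← mul_assoc, neg_add, Real.rpow_add hx, Real.rpow_neg_one]
    unfold C0 C1; ring
  · intro r hr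
    unfold K0 K1
    rw [exp_alg_div hr hx, lg_div hr hx]; push_cast; ring

/-- the damping factor -/
def EE (σ lam α : ℝ) (r : ℝ) : ℂ := Complex.exp (-(AA σ r)) * Complex.exp (-(lam * Complex.exp (α * lg r)))
def T0 (σ lam α x : ℝ) : ℝ := TT (fun r => K0 α r * EE σ lam α r) x
def T1 (σ lam α x : ℝ) : ℝ := TT (fun r => K1 α r * EE σ lam α r) x

lemma EE_meas (σ lam α : ℝ) : Measurable (EE σ lam α) := by
  have := exp_alg_meas α
  have := (AA_cont σ).measurable
  unfold EE; fun_prop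

lemma EE_norm {σ lam α r : ℝ} (hlam : 0 ≤ lam) (h0 : 0 < α) (h2 : α < 2) (hr : 0 < r) : ‖EE σ lam α r‖ ≤ 1 := by
  unfold EE
  rw [norm_mul, norm_exp_AA, Complex.norm_exp]
  have := V_re_nonneg hlam h0 h2 hr
  have a : Real.exp (-(σ ^ 2 / 4 * r ^ 2)) ≤ 1 := by rw [Real.exp_le_one_iff]; have : 0 ≤ σ ^ 2 / 4 * r ^ 2 := by positivity
                                                     linarith
  have b : Real.exp (-(lam * Complex.exp (α * lg r))).re ≤ 1 := by
    rw [Real.exp_le_one_iff, Complex.neg_re]; linarith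
  exact mul_le_one₀ a (Real.exp_pos _).le b

lemma AA_norm (σ r : ℝ) : ‖AA σ r‖ = σ ^ 2 / 2 * r ^ 2 := by
  unfold AA
  simp [om_norm]

lemma V_norm {lam α r : ℝ} (hlam : 0 ≤ lam) (hr : 0 < r) : ‖(lam : ℂ) * Complex.exp (α * lg r)‖ = lam * r ^ α := by
  rw [norm_mul, norm_exp_alg hr, Complex.norm_real, Real.norm_of_nonneg hlam]

lemma EA_sub_one {σ r : ℝ} : ‖Complex.exp (-(AA σ r)) - 1‖ ≤ σ ^ 2 / 2 * r ^ 2 := by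
  rw [← AA_norm]
  refine norm_exp_neg_sub_one_le ?_
  rw [AA_re]; positivity

lemma EE_sub_one {σ lam α r : ℝ} (hlam : 0 ≤ lam) (h0 : 0 < α) (h2 : α < 2) (hr : 0 < r) :
    ‖EE σ lam α r - 1‖ ≤ σ ^ 2 / 2 * r ^ 2 + lam * r ^ α := by
  unfold EE
  have e : Complex.exp (-(AA σ r)) * Complex.exp (-(lam * Complex.exp (α * lg r))) - 1 =
    (Complex.exp (-(AA σ r)) - 1) + Complex.exp (-(AA σ r)) * (Complex.exp (-(lam * Complex.exp (α * lg r))) - 1) := by ring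
  rw [e]
  refine (norm_add_le _ _).trans (add_le_add EA_sub_one ?_)
  rw [norm_mul, norm_exp_AA, ← V_norm hlam hr]
  have a : Real.exp (-(σ ^ 2 / 4 * r ^ 2)) ≤ 1 := by
    rw [Real.exp_le_one_iff]; have : 0 ≤ σ ^ 2 / 4 * r ^ 2 := by positivity
    linarith
  have b := norm_exp_neg_sub_one_le (V_re_nonneg hlam h0 h2 hr)
  calc _ ≤ 1 * ‖(lam : ℂ) * Complex.exp (α * lg r)‖ := by gcongr
    _ = _ := one_mul _

lemma exp_second {z : ℂ} (hz : 0 ≤ z.re) : ‖Complex.exp (-z) - 1 + z‖ ≤ 2 * ‖z‖ ^ 2 := by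
  rcases le_total ‖z‖ 1 with h | h
  · have := Complex.norm_exp_sub_one_sub_id_le (x := -z) (by rwa [norm_neg])
    rw [sub_neg_eq_add, norm_neg] at this
    nlinarith [sq_nonneg ‖z‖]
  · have h1 := norm_exp_neg_sub_one_le hz
    refine (norm_add_le _ _).trans ?_
    nlinarith

lemma x_pow_err {α x : ℝ} (h0 : 0 < α) (h2 : α < 2) (hx : 1 ≤ x) :
    x ^ (-(1 + (2 * α - eta α))) ≤ x ^ (-(1 + α)) * x ^ (-(α / 2)) ∧
    x ^ (-(1 + (2 + α + eta α))) ≤ x ^ (-(1 + α)) * x ^ (-(α / 2)) := by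
  have := eta_le h0
  have := eta_pos h0 h2
  rw [← Real.rpow_add (by linarith)]
  constructor <;> exact Real.rpow_le_rpow_of_exponent_le hx (by linarith)

lemma TT_err {α C x : ℝ} {K : ℝ → ℂ} (h0 : 0 < α) (h2 : α < 2) (hx : 1 ≤ x) (hC : 0 ≤ C)
    (h : ∀ r : ℝ, 0 < r → ‖K r‖ ≤ C * (r ^ (2 * α - eta α) + r ^ (2 + α + eta α))) :
    |TT K x| ≤ ((CT (2 * α - eta α) + CT (2 + α + eta α)) * C) * (x ^ (-(1 + α)) * x ^ (-(α / 2))) := by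
  have e1 := eta_le h0
  have e2 := eta_pos h0 h2
  have := TT_bound2' (by linarith : 0 < x) (by linarith) (by linarith) h
  obtain ⟨a, b⟩ := x_pow_err h0 h2 hx
  have c1 := (CT_pos (by linarith : -1 < 2 * α - eta α)).le
  have c2 := (CT_pos (by linarith : -1 < 2 + α + eta α)).le
  refine this.trans ?_
  rw [add_mul, add_mul]
  gcongr

lemma asymp {σ α M : ℝ} (hσ : 0 < σ) (h0 : 0 < α) (h2 : α < 2) (hM : 0 < M) :
    ∃ C : ℝ, 0 < C ∧ ∀ lam : ℝ, 0 < lam → lam ≤ M → ∀ x : ℝ, 1 ≤ x →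
      |T0 σ lam α x - x ^ (-(1 + α)) * C0 α| ≤ C * (x ^ (-(1 + α)) * x ^ (-(α / 2))) ∧
      |T1 σ lam α x - x ^ (-(1 + α)) * (C1 α - Real.log x * C0 α)| ≤ C * (x ^ (-(1 + α)) * x ^ (-(α / 2))) ∧
      |qf σ lam α x - phiS σ x - lam * (x ^ (-(1 + α)) * C0 α)| ≤ lam * (C * (x ^ (-(1 + α)) * x ^ (-(α / 2)))) := by
  have e1 := eta_le h0
  have e2 := eta_pos h0 h2
  set η := eta α with hη
  set ct := CT (2 * α - η) + CT (2 + α + η) with hct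
  have c1 := (CT_pos (by linarith : -1 < 2 * α - η))
  have c2 := (CT_pos (by linarith : -1 < 2 + α + η))
  set Cm := σ ^ 2 / 2 + 2 * M with hCm
  have hCm0 : 0 < Cm := by positivity
  have hct0 : 0 < ct := by positivity
  refine ⟨ct * (Cm * (2 * (1 / η + 1) * 2)), by positivity, ?_⟩
  intro lam hl hlM x hx
  have hx0 : 0 < x := by linarith
  have hxne := hx0.ne'
  set X := x ^ (-(1 + α)) * x ^ (-(α / 2)) with hX
  have hX0 : 0 ≤ X := by positivity
  have two : ∀ r : ℝ, 0 < r → ∀ b, 2 * α - η ≤ b → b ≤ 2 + α + η → r ^ b ≤ r ^ (2 * α - η) + r ^ (2 + α + η) :=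
    fun r hr b h1 h2 => rpow_le_two hr h1 h2
  have hEE : ∀ r : ℝ, 0 < r → ‖EE σ lam α r - 1‖ ≤ Cm * (r ^ (2:ℝ) + r ^ α) := by
    intro r hr
    refine (EE_sub_one hl.le h0 h2 hr).trans ?_
    rw [Real.rpow_two]
    have : 0 ≤ r ^ α := by positivity
    have : 0 ≤ r ^ 2 := by positivity
    have : lam * r ^ α ≤ M * r ^ α := by gcongr
    have : 0 ≤ M * r ^ α := by positivity
    have : 0 ≤ M * r ^ 2 := by positivity
    have : 0 ≤ σ ^ 2 / 2 * r ^ α := by positivity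
    rw [hCm]; nlinarith
  have big1 : 1 ≤ (1 / η + 1) := by have : 0 < 1 / η := by positivity
                                    linarith
  have fin : ∀ c, 0 ≤ c → c ≤ 2 * (1 / η + 1) * 2 → ct * (Cm * c) * X ≤ ct * (Cm * (2 * (1 / η + 1) * 2)) * X := by
    intro c hc hc'
    gcongr
  have mEE := EE_meas σ lam α
  refine ⟨?_, ?_, ?_⟩
  · have iE : TTi (fun r => K0 α r * EE σ lam α r) x := by
      refine TTi_of_bound (by have := K0_meas α; fun_prop) hxne (a := α) (C := 1) (by linarith) fun r hr => ?_
      rw [norm_mul, K0_norm hr, one_mul]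
      exact mul_le_of_le_one_right (by positivity) (EE_norm hl.le h0 h2 hr)
    have e : T0 σ lam α x - x ^ (-(1 + α)) * C0 α = TT (fun r => K0 α r * (EE σ lam α r - 1)) x := by
      rw [← TT_K0 hx0]
      have : TT (fun r => K0 α r * (EE σ lam α r - 1)) x =
        TT (fun r => K0 α r * EE σ lam α r + ((-1 : ℝ) : ℂ) * K0 α r) x := TT_congr (fun r hr => by push_cast; ring) x
      rw [this, TT_add' iE (TTi_smul _ (TTi_K0 h0 hxne)), TT_smul]
      unfold T0; ring
    rw [e]
    refine (TT_err (C := Cm * 2) h0 h2 hx (by positivity) fun r hr => ?_).trans (fin 2 (by norm_num) (by linarith))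
    rw [norm_mul, K0_norm hr]
    have := mul_le_mul_of_nonneg_left (hEE r hr) (by positivity : 0 ≤ r ^ α)
    refine this.trans ?_
    have t1 := two r hr (2 + α) (by linarith) (by linarith)
    have t2 := two r hr (2 * α) (by linarith) (by linarith)
    have e3 : r ^ α * (Cm * (r ^ (2:ℝ) + r ^ α)) = Cm * (r ^ (2 + α) + r ^ (2 * α)) := by
      rw [Real.rpow_add hr, two_mul α, Real.rpow_add hr]; ring
    rw [e3, mul_assoc]
    gcongr
    linarith
  · have iE : TTi (fun r => K1 α r * EE σ lam α r) x := by
      refine TTi_of_bound2 (by have := K1_meas α; fun_prop) hxne (a := α + α / 2) (b := α - α / 2) (C := 1 / (α / 2) + 1) (by linarith) (by linarith) fun r hr => ?_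
      rw [norm_mul]
      exact (mul_le_of_le_one_right (norm_nonneg _) (EE_norm hl.le h0 h2 hr)).trans (K1_norm (by linarith) hr)
    have e : T1 σ lam α x - x ^ (-(1 + α)) * (C1 α - Real.log x * C0 α) = TT (fun r => K1 α r * (EE σ lam α r - 1)) x := by
      rw [← TT_K1 h0 hx0]
      have : TT (fun r => K1 α r * (EE σ lam α r - 1)) x =
        TT (fun r => K1 α r * EE σ lam α r + ((-1 : ℝ) : ℂ) * K1 α r) x := TT_congr (fun r hr => by push_cast; ring) x
      rw [this, TT_add' iE (TTi_smul _ (TTi_K1 h0 hxne)), TT_smul]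
      unfold T1; ring
    rw [e]
    refine (TT_err (C := Cm * (2 * (1 / η + 1) * 2)) h0 h2 hx (by positivity) fun r hr => ?_).trans (le_of_eq rfl)
    rw [norm_mul]
    have := mul_le_mul (K1_norm (α := α) e2 hr) (hEE r hr) (norm_nonneg _) (by positivity)
    refine this.trans ?_
    have t1 := two r hr (2 + (α + η)) (by linarith) (by linarith)
    have t2 := two r hr (2 + (α - η)) (by linarith) (by linarith)
    have t3 := two r hr (α + (α + η)) (by linarith) (by linarith)
    have t4 := two r hr (α + (α - η)) (by linarith) (by linarith)
    have e3 : (1 / η + 1) * (r ^ (α + η) + r ^ (α - η)) * (Cm * (r ^ (2:ℝ) + r ^ α)) =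
      (Cm * (1 / η + 1)) * (r ^ (2 + (α + η)) + r ^ (2 + (α - η)) + r ^ (α + (α + η)) + r ^ (α + (α - η))) := by
      rw [Real.rpow_add hr 2, Real.rpow_add hr 2, Real.rpow_add hr α (α + η), Real.rpow_add hr α (α - η)]; ring
    rw [e3]
    rw [show Cm * (2 * (1 / η + 1) * 2) = (Cm * (1 / η + 1)) * 4 by ring, mul_assoc _ 4]
    gcongr
    linarith
  · have e : qf σ lam α x - phiS σ x - lam * (x ^ (-(1 + α)) * C0 α) =
        lam * TT (fun r => ((lam⁻¹ : ℝ) : ℂ) * (KD σ lam α r + ((-lam : ℝ) : ℂ) * K0 α r)) x := by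
      rw [TT_smul, TT_add' (TT_int (KD_int hσ hl.le h0 h2) x) (TTi_smul _ (TTi_K0 h0 hxne)), TT_smul, TT_K0 hx0,
        qf_eq hσ hl.le h0 h2]
      field_simp
      ring
    rw [e, abs_mul, abs_of_pos hl]
    apply mul_le_mul_of_nonneg_left _ hl.le
    refine (TT_err (C := Cm * 2) h0 h2 hx (by positivity) fun r hr => ?_).trans (fin 2 (by norm_num) (by linarith))
    set V : ℂ := lam * Complex.exp (α * lg r) with hV
    have e4 : KD σ lam α r + ((-lam : ℝ) : ℂ) * K0 α r = Complex.exp (-(AA σ r)) * (Complex.exp (-V) - 1 + V) -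
        (Complex.exp (-(AA σ r)) - 1) * V := by
      unfold KD K0; rw [← hV, hV]; push_cast; ring
    have hVn : ‖V‖ = lam * r ^ α := V_norm hl.le hr
    have a : Real.exp (-(σ ^ 2 / 4 * r ^ 2)) ≤ 1 := by
      rw [Real.exp_le_one_iff]; have : 0 ≤ σ ^ 2 / 4 * r ^ 2 := by positivity
      linarith
    have b := exp_second (V_re_nonneg hl.le h0 h2 hr)
    rw [← hV] at b
    have n1 : ‖KD σ lam α r + ((-lam : ℝ) : ℂ) * K0 α r‖ ≤ 2 * ‖V‖ ^ 2 + σ ^ 2 / 2 * r ^ 2 * ‖V‖ := by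
      rw [e4]
      refine (norm_sub_le _ _).trans (add_le_add ?_ ?_)
      · rw [norm_mul, norm_exp_AA]
        calc _ ≤ 1 * (2 * ‖V‖ ^ 2) := by gcongr
          _ = _ := one_mul _
      · rw [norm_mul]
        exact mul_le_mul_of_nonneg_right EA_sub_one (norm_nonneg _)
    rw [norm_mul, Complex.norm_real, Real.norm_of_nonneg (by positivity)]
    have n2 := mul_le_mul_of_nonneg_left n1 (by positivity : 0 ≤ lam⁻¹)
    refine n2.trans ?_
    rw [hVn]
    have e5 : lam⁻¹ * (2 * (lam * r ^ α) ^ 2 + σ ^ 2 / 2 * r ^ 2 * (lam * r ^ α)) =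
       2 * lam * r ^ (2 * α) + σ ^ 2 / 2 * r ^ (2 + α) := by
      rw [Real.rpow_add hr, Real.rpow_two, two_mul α, Real.rpow_add hr]; field_simp
    rw [e5]
    have t1 := two r hr (2 + α) (by linarith) (by linarith)
    have t2 := two r hr (2 * α) (by linarith) (by linarith)
    calc 2 * lam * r ^ (2 * α) + σ ^ 2 / 2 * r ^ (2 + α) ≤ (2 * M) * (r ^ (2 * α - η) + r ^ (2 + α + η)) + σ ^ 2 / 2 * (r ^ (2 * α - η) + r ^ (2 + α + η)) := by gcongr
      _ = Cm * (r ^ (2 * α - η) + r ^ (2 + α + η)) := by rw [hCm]; ring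
      _ ≤ Cm * 2 * (r ^ (2 * α - η) + r ^ (2 + α + η)) := by gcongr; linarith

/-- score pieces -/
lemma SS_one {σ δ α L ν ρ m x : ℝ} (hδ : 0 < δ) :
    SS σ δ α L ν ρ m (Pi.single 1 1) x = ρ * (α / δ) * lamL L δ α * T0 σ (lamL L δ α) α x := by
  unfold SS T0
  rw [← TT_smul]
  simp only [Pi.single_apply]
  simp only [show (0 : Fin 3) ≠ 1 by decide, if_false, mul_zero, zero_add]
  refine TT_congr (fun r hr => ?_) x
  unfold DFC K0 EE
  rw [Vc_real hδ]
  simp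
  ring

lemma SS_two {σ δ α L ν ρ m x : ℝ} (hδ : 0 < δ) (h0 : 0 < α) (h2 : α < 2) (hx : 0 < x) :
    SS σ δ α L ν ρ m (Pi.single 2 1) x = ρ * lamL L δ α *
      ((Real.log δ + (L - m) / 2) * T0 σ (lamL L δ α) α x + T1 σ (lamL L δ α) α x) := by
  have hl := lamL_pos L δ α
  set lam := lamL L δ α with hlam
  have mEE := EE_meas σ lam α
  have hxne := hx.ne'
  have i0 : TTi (fun r => K0 α r * EE σ lam α r) x := by
    refine TTi_of_bound (by have := K0_meas α; fun_prop) hxne (a := α) (C := 1) (by linarith) fun r hr => ?_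
    rw [norm_mul, K0_norm hr, one_mul]
    exact mul_le_of_le_one_right (by positivity) (EE_norm hl.le h0 h2 hr)
  have i1 : TTi (fun r => K1 α r * EE σ lam α r) x := by
    refine TTi_of_bound2 (by have := K1_meas α; fun_prop) hxne (a := α + α / 2) (b := α - α / 2) (C := 1 / (α / 2) + 1) (by linarith) (by linarith) fun r hr => ?_
    rw [norm_mul]
    exact (mul_le_of_le_one_right (norm_nonneg _) (EE_norm hl.le h0 h2 hr)).trans (K1_norm (by linarith) hr)
  unfold SS T0 T1
  rw [← TT_smul, ← TT_add' (TTi_smul _ i0) i1, ← TT_smul]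
  simp only [Pi.single_apply]
  simp only [show (0 : Fin 3) ≠ 2 by decide, if_false, mul_zero, zero_add]
  refine TT_congr (fun r hr => ?_) x
  unfold DFC K0 K1 EE
  rw [Vc_real hδ]
  simp [← hlam]
  ring

lemma SS_zero {σ δ α L ν ρ m : ℝ} (hσ : 0 < σ) (hδ : 0 < δ) (h0 : 0 < α) (h2 : α < 2) (hν : 0 ≤ ν) (x : ℝ) :
    |SS σ δ α L ν ρ m (Pi.single 0 1) x - ν * dphi σ x| ≤
      ν * (CT (2 + α) * (σ * Real.exp (1 / (4 * σ ^ 2))) * lamL L δ α * (1 + |x|) ^ (-(3 + α))) := by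
  have hl := lamL_pos L δ α
  set lam := lamL L δ α with hlam
  have e : SS σ δ α L ν ρ m (Pi.single 0 1) x - ν * dphi σ x =
    ν * TT (fun r => -((σ * (om * r) ^ 2) * KD σ lam α r)) x := by
    unfold SS
    rw [← TT_smul]
    simp only [Pi.single_apply]
    have : ∀ a b : ℝ, dphi σ x * (ν * if True then 1 else 0) + a - ν * dphi σ x = a := by
      intro a b; simp; ring
    rw [this _ 0]
    refine TT_congr (fun r hr => ?_) x
    unfold DFC KD
    rw [Vc_real hδ]
    simp [← hlam]
    ring
  rw [e, abs_mul, abs_of_nonneg hν]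
  apply mul_le_mul_of_nonneg_left _ hν
  have := TT_bound (K := fun r => -((σ * (om * r) ^ 2) * KD σ lam α r)) (a := 2 + α)
    (C := σ * Real.exp (1 / (4 * σ ^ 2)) * lam) (by linarith) (fun r hr => by
      rw [norm_neg, norm_mul, norm_mul, norm_pow, norm_mul, om_norm, Complex.norm_real, Complex.norm_real,
        Real.norm_of_nonneg hσ.le, Real.norm_of_nonneg hr.le, one_mul]
      have := mul_le_mul_of_nonneg_left (KD_bound hσ hl.le h0 h2 hr) (by positivity : 0 ≤ σ * r ^ 2)
      refine this.trans (le_of_eq ?_)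
      rw [Real.rpow_add hr, Real.rpow_two]; ring) x
  refine this.trans (le_of_eq ?_)
  rw [show -(1 + (2 + α)) = -(3 + α) by ring]; ring

end PartE2

section PartE3
lemma phiS_abs (σ x : ℝ) : phiS σ |x| = phiS σ x := by unfold phiS; rw [sq_abs]

lemma phiS_anti {σ x y : ℝ} (hσ : 0 < σ) (h : |x| ≤ y) : phiS σ y ≤ phiS σ x := by
  unfold phiS
  have : x ^ 2 ≤ y ^ 2 := by rw [← sq_abs]; gcongr
  gcongr

lemma q_sub_phi {σ lam α : ℝ} (hσ : 0 < σ) (hlam : 0 ≤ lam) (h0 : 0 < α) (h2 : α < 2) (x : ℝ) :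
    |qf σ lam α x - phiS σ x| ≤ CT α * Real.exp (1 / (4 * σ ^ 2)) * lam * (1 + |x|) ^ (-(1 + α)) := by
  rw [qf_eq hσ hlam h0 h2, add_sub_cancel_left]
  have := TT_bound (by linarith) (fun r hr => KD_bound hσ hlam h0 h2 hr) x
  rwa [mul_assoc (CT α)]

lemma pw_le_one {a x : ℝ} (ha : 0 ≤ a) : (1 + |x|) ^ (-a) ≤ 1 := by
  apply Real.rpow_le_one_of_one_le_of_nonpos
  · linarith [abs_nonneg x]
  · linarith

lemma q_lower {σ α : ℝ} (hσ : 0 < σ) (h0 : 0 < α) (h2 : α < 2) :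
    ∃ c l0 : ℝ, 0 < c ∧ 0 < l0 ∧ l0 ≤ 1 ∧ ∀ lam : ℝ, 0 < lam → lam ≤ l0 → ∀ x : ℝ,
      phiS σ x / 2 ≤ qf σ lam α x ∧ c * lam * (1 + |x|) ^ (-(1 + α)) ≤ qf σ lam α x := by
  obtain ⟨C, hC, hasy⟩ := asymp hσ h0 h2 one_pos
  have hc0 : 0 < C0 α := by rw [← C0_cAlpha h0 h2]; exact cAlpha_pos h0 h2
  have hlim : Tendsto (fun x : ℝ => C * x ^ (-(α / 2))) atTop (𝓝 0) := by
    simpa using (tendsto_rpow_neg_atTop (by linarith : 0 < α / 2)).const_mul C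
  obtain ⟨x0, hx0⟩ := ((hlim.eventually (gt_mem_nhds (half_pos hc0))).and (eventually_ge_atTop 1)).exists_forall_of_atTop
  set x1 := max x0 1 with hx1
  have hx1' : 1 ≤ x1 := le_max_right _ _
  set f0 := phiS σ x1 with hf0
  have hf0p : 0 < f0 := phiS_pos hσ _
  set C2 := CT α * Real.exp (1 / (4 * σ ^ 2)) with hC2
  have hC2p : 0 < C2 := mul_pos (CT_pos (by linarith)) (Real.exp_pos _)
  refine ⟨min (C0 α / 2) (f0 / 2), min 1 (f0 / 2 / C2), by positivity, by positivity, min_le_left _ _, ?_⟩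
  intro lam hl hll x
  have hl1 : lam ≤ 1 := hll.trans (min_le_left _ _)
  have hl2 : C2 * lam ≤ f0 / 2 := by
    have := hll.trans (min_le_right _ _)
    rw [le_div_iff₀ hC2p] at this; linarith
  have hφ := phiS_pos hσ x
  have hp1 := pw_le_one (x := x) (a := 1 + α) (by linarith)
  have hp0 : 0 ≤ (1 + |x|) ^ (-(1 + α)) := by positivity
  rcases le_total |x| x1 with h | h
  · have h1 := q_sub_phi hσ hl.le h0 h2 x
    have h3 := phiS_anti hσ h
    rw [← hf0] at h3
    have h4 : C2 * lam * (1 + |x|) ^ (-(1 + α)) ≤ f0 / 2 := by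
      refine le_trans ?_ hl2
      exact mul_le_of_le_one_right (by positivity) hp1
    rw [abs_le] at h1
    refine ⟨by linarith [h1.1], ?_⟩
    calc min (C0 α / 2) (f0 / 2) * lam * (1 + |x|) ^ (-(1 + α)) ≤ (f0 / 2) * 1 * 1 := by
          gcongr
          exact min_le_right _ _
      _ ≤ _ := by linarith [h1.1]
  · have hxp : 1 ≤ |x| := hx1'.trans h
    have ha := (hasy lam hl hl1 |x| hxp).2.2
    have hb := (hx0 |x| ((le_max_left _ _).trans h)).1
    rw [qf_abs, phiS_abs] at ha
    rw [abs_le] at ha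
    have hX : 0 < |x| ^ (-(1 + α)) := by positivity
    have : C * (|x| ^ (-(1 + α)) * |x| ^ (-(α / 2))) ≤ |x| ^ (-(1 + α)) * (C0 α / 2) := by
      calc _ = |x| ^ (-(1 + α)) * (C * |x| ^ (-(α / 2))) := by ring
        _ ≤ _ := by gcongr
    have h5 := mul_le_mul_of_nonneg_left this hl.le
    have h6 : phiS σ x + lam * (|x| ^ (-(1 + α)) * (C0 α / 2)) ≤ qf σ lam α x := by nlinarith [ha.1]
    have h7 : 0 ≤ lam * (|x| ^ (-(1 + α)) * (C0 α / 2)) := by positivity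
    refine ⟨by linarith, ?_⟩
    have h8 : (1 + |x|) ^ (-(1 + α)) ≤ |x| ^ (-(1 + α)) :=
      Real.rpow_le_rpow_of_nonpos (by linarith) (by linarith) (by linarith)
    calc min (C0 α / 2) (f0 / 2) * lam * (1 + |x|) ^ (-(1 + α)) ≤ (C0 α / 2) * lam * |x| ^ (-(1 + α)) := by
          gcongr
          exact min_le_left _ _
      _ ≤ _ := by linarith

lemma polylog (k : ℝ) {a : ℝ} (ha : 0 < a) :
    Tendsto (fun n : ℕ => Real.log n ^ k * (n : ℝ) ^ (-a)) atTop (𝓝 0) := by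
  have h := (isLittleO_log_rpow_rpow_atTop k ha).tendsto_div_nhds_zero
  have h2 := h.comp tendsto_natCast_atTop_atTop
  refine h2.congr fun n => ?_
  simp only [Function.comp]
  rw [Real.rpow_neg (Nat.cast_nonneg n), div_eq_mul_inv]

lemma poly_gauss_int {c : ℝ} (hc : 0 < c) (k : ℕ) : Integrable (fun x : ℝ => (1 + x ^ 2) ^ k * Real.exp (-(x ^ 2 / c))) := by
  set ε : ℝ := 1 / (2 * c * (k + 1)) with hε
  have hε0 : 0 < ε := by positivity
  have I := (exp_sq_int (c := 2 * c) (by positivity)).const_mul (ε⁻¹ ^ k * Real.exp (k * ε))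
  refine I.mono' (by fun_prop) (Eventually.of_forall fun x => ?_)
  rw [Real.norm_of_nonneg (by positivity)]
  have h1 : 1 + x ^ 2 ≤ ε⁻¹ * Real.exp (ε * (1 + x ^ 2)) := by
    rw [← div_le_iff₀' (by positivity), div_inv_eq_mul, mul_comm]
    linarith [Real.add_one_le_exp (ε * (1 + x ^ 2))]
  have h2 : (1 + x ^ 2) ^ k ≤ ε⁻¹ ^ k * Real.exp (k * (ε * (1 + x ^ 2))) := by
    rw [Real.exp_nat_mul, ← mul_pow]
    gcongr
  calc (1 + x ^ 2) ^ k * Real.exp (-(x ^ 2 / c)) ≤ ε⁻¹ ^ k * Real.exp (k * (ε * (1 + x ^ 2))) * Real.exp (-(x ^ 2 / c)) := by gcongr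
    _ ≤ ε⁻¹ ^ k * (Real.exp (k * ε) * Real.exp (-(x ^ 2 / (2 * c)))) := by
        rw [mul_assoc, ← Real.exp_add, ← Real.exp_add]
        refine mul_le_mul_of_nonneg_left (Real.exp_le_exp.2 ?_) (by positivity)
        have : (k:ℝ) * ε * x ^ 2 ≤ x ^ 2 / (2 * c) := by
          have : (k:ℝ) * ε ≤ 1 / (2 * c) := by
            rw [hε, mul_one_div, div_le_div_iff₀ (by positivity) (by positivity)]
            nlinarith
          calc (k:ℝ) * ε * x ^ 2 ≤ 1 / (2 * c) * x ^ 2 := by gcongr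
            _ = _ := by ring
        have e : x ^ 2 / c = 2 * (x ^ 2 / (2 * c)) := by field_simp
        rw [e]
        nlinarith
    _ = _ := by ring

lemma phiS_integral {σ : ℝ} (hσ : 0 < σ) : ∫ x, phiS σ x = 1 := by
  have := qf_integral hσ le_rfl (by norm_num : (0:ℝ) < 1) (by norm_num : (1:ℝ) < 2)
  simp_rw [qf_zero hσ] at this
  exact this

lemma poly_phi_int {σ : ℝ} (hσ : 0 < σ) (k : ℕ) : Integrable (fun x : ℝ => (1 + x ^ 2) ^ k * phiS σ x) := by
  have := (poly_gauss_int (c := 2 * σ ^ 2) (by positivity) k).const_mul ((Real.sqrt (2 * Real.pi) * σ)⁻¹)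
  refine this.congr (Eventually.of_forall fun x => ?_)
  simp only [phiS]; ring

lemma fisher_gauss {σ : ℝ} (hσ : 0 < σ) : ∫ x, dphi σ x ^ 2 / phiS σ x = 2 / σ ^ 2 := by
  have e1 : ∀ x, dphi σ x ^ 2 / phiS σ x = (1 / σ ^ 2) * (((x ^ 2 / σ ^ 2 - 1) ^ 2 - 2) * phiS σ x) + 2 / σ ^ 2 * phiS σ x := by
    intro x
    have := (phiS_pos hσ x).ne'
    unfold dphi; field_simp; ring
  set B : ℝ := 1 + 1 / σ ^ 2 with hB
  have hB0 : 0 < B := by positivity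
  have i1 : Integrable (fun x => ((x ^ 2 / σ ^ 2 - 1) ^ 2 - 2) * phiS σ x) := by
    refine ((poly_phi_int hσ 2).const_mul (B ^ 2 + 2)).mono' (by have := phiS_cont σ; fun_prop) (Eventually.of_forall fun x => ?_)
    have hφ := phiS_pos hσ x
    rw [norm_mul, Real.norm_of_nonneg hφ.le, ← mul_assoc]
    gcongr
    rw [Real.norm_eq_abs, abs_le]
    have a1 : |x ^ 2 / σ ^ 2 - 1| ≤ B * (1 + x ^ 2) := by
      have e : x ^ 2 / σ ^ 2 = (1 / σ ^ 2) * x ^ 2 := by ring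
      have q1 : 0 < 1 / σ ^ 2 := by positivity
      have q2 : 0 ≤ 1 / σ ^ 2 * x ^ 2 := by positivity
      rw [e, hB, abs_le]
      constructor <;> nlinarith [sq_nonneg x]
    have a2 : (x ^ 2 / σ ^ 2 - 1) ^ 2 ≤ (B * (1 + x ^ 2)) ^ 2 := by rw [← sq_abs]; gcongr
    have a3 : 1 ≤ (1 + x ^ 2) ^ 2 := by nlinarith [sq_nonneg x]
    constructor <;> nlinarith [sq_nonneg (x ^ 2 / σ ^ 2 - 1), sq_nonneg (B * (1 + x ^ 2))]
  have z : ∫ x, ((x ^ 2 / σ ^ 2 - 1) ^ 2 - 2) * phiS σ x = 0 := by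
    have i2 : Integrable (fun x => (-(x ^ 3 / σ ^ 2) - x) * phiS σ x) := by
      refine ((poly_phi_int hσ 2).const_mul B).mono' (by have := phiS_cont σ; fun_prop) (Eventually.of_forall fun x => ?_)
      have hφ := phiS_pos hσ x
      rw [norm_mul, Real.norm_of_nonneg hφ.le, ← mul_assoc]
      gcongr
      have e : -(x ^ 3 / σ ^ 2) - x = -(1 / σ ^ 2 * x ^ 3) - x := by ring
      have q1 : 0 < 1 / σ ^ 2 := by positivity
      rw [e, hB, Real.norm_eq_abs]
      generalize 1 / σ ^ 2 = s at *
      have c1 : |x ^ 3| ≤ (1 + x ^ 2) ^ 2 := by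
        rw [abs_le]; constructor <;> nlinarith [sq_nonneg (x ^ 2 + x), sq_nonneg (x ^ 2 - x), sq_nonneg x, sq_nonneg (x^2)]
      have c2 : |x| ≤ (1 + x ^ 2) ^ 2 := by
        rw [abs_le]; constructor <;> nlinarith [sq_nonneg (x + 1), sq_nonneg (x - 1), sq_nonneg x, sq_nonneg (x^2)]
      rw [abs_le] at c1 c2 ⊢
      constructor <;> nlinarith [c1.1, c1.2, c2.1, c2.2]
    refine integral_eq_zero_of_hasDerivAt_of_integrable (f := fun x => (-(x ^ 3 / σ ^ 2) - x) * phiS σ x) (fun x => ?_) i1 i2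
    unfold phiS
    have h1 : HasDerivAt (fun x : ℝ => -(x ^ 3 / σ ^ 2) - x) (-(3 * x ^ 2 / σ ^ 2) - 1) x := by
      have := ((hasDerivAt_pow 3 x).div_const (σ ^ 2)).neg.sub (hasDerivAt_id x)
      exact this.congr_deriv (by simp)
    have h2 : HasDerivAt (fun x : ℝ => -(x ^ 2 / (2 * σ ^ 2))) (-(x / σ ^ 2)) x := by
      have := ((hasDerivAt_pow 2 x).div_const (2 * σ ^ 2)).neg
      refine this.congr_deriv ?_
      field_simp
      push_cast; ring
    refine (h1.mul (h2.exp.const_mul ((Real.sqrt (2 * Real.pi) * σ)⁻¹))).congr_deriv ?_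
    generalize Real.exp (-(x ^ 2 / (2 * σ ^ 2))) = e
    generalize (√(2 * Real.pi) * σ)⁻¹ = k
    field_simp
    ring
  simp_rw [e1]
  rw [integral_add (i1.const_mul _) ((phiS_int hσ).const_mul _), integral_const_mul, integral_const_mul, z, phiS_integral hσ]
  ring

end PartE3

section PartF1
def lamN (δ α : ℝ) (n : ℕ) : ℝ := lamL (Real.log n) δ α
def mN (n : ℕ) : ℝ := Real.log n - Real.log (Real.log n)
def tauN (α : ℝ) (n : ℕ) : ℝ := rate n α * Real.log n
def nuN (n : ℕ) : ℝ := 1 / Real.sqrt n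
def qN (σ δ α : ℝ) (n : ℕ) (x : ℝ) : ℝ := qf σ (lamN δ α n) α x
def sN (σ δ α : ℝ) (n : ℕ) (j : Fin 3) (x : ℝ) : ℝ :=
  SS σ δ α (Real.log n) (nuN n) (rate n α) (mN n) (Pi.single j 1) x

lemma ev_log_ge (M : ℝ) : ∀ᶠ n : ℕ in atTop, M ≤ Real.log n :=
  (Real.tendsto_log_atTop.comp tendsto_natCast_atTop_atTop).eventually_ge_atTop M

lemma ev_n_ge (M : ℝ) : ∀ᶠ n : ℕ in atTop, M ≤ (n : ℝ) :=
  tendsto_natCast_atTop_atTop.eventually_ge_atTop M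

lemma lamN_eq {δ α : ℝ} (hδ : 0 < δ) {n : ℕ} (hn : 0 < n) : lamN δ α n = δ ^ α * (n:ℝ) ^ (α / 2 - 1) :=
  lamL_eq hn hδ

lemma rate_eq (n : ℕ) (α : ℝ) : rate n α = Real.log n ^ (α / 4) * (n : ℝ) ^ (-(α / 4)) := by
  unfold rate
  rw [Real.rpow_neg (Nat.cast_nonneg n), div_eq_mul_inv]

lemma nuN_eq (n : ℕ) : nuN n = (n : ℝ) ^ (-(1 / 2) : ℝ) := by
  unfold nuN
  rw [Real.rpow_neg (Nat.cast_nonneg n), Real.sqrt_eq_rpow, one_div]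

lemma tauN_eq {n : ℕ} (hL : 1 ≤ Real.log n) (α : ℝ) :
    tauN α n = Real.log n ^ (α / 4 + 1) * (n : ℝ) ^ (-(α / 4)) := by
  unfold tauN
  rw [rate_eq, Real.rpow_add (by linarith), Real.rpow_one]; ring

lemma tau_tendsto {α : ℝ} (h0 : 0 < α) : Tendsto (tauN α) atTop (𝓝 0) := by
  refine (polylog (α / 4 + 1) (a := α / 4) (by positivity)).congr' ?_
  filter_upwards [ev_log_ge 1] with n hL
  rw [tauN_eq hL]

lemma lamN_tendsto {δ α : ℝ} (hδ : 0 < δ) (h2 : α < 2) : Tendsto (lamN δ α) atTop (𝓝 0) := by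
  have := (polylog 0 (a := 1 - α / 2) (by linarith)).const_mul (δ ^ α)
  rw [mul_zero] at this
  refine this.congr' ?_
  filter_upwards [eventually_gt_atTop 0] with n hn
  rw [lamN_eq hδ hn, Real.rpow_zero, one_mul]; congr 2; ring

/-- Basic eventual facts. -/
structure Basic (δ α : ℝ) (n : ℕ) : Prop where
  npos : 0 < n
  L1 : 1 ≤ Real.log n
  rho : 0 < rate n α
  m0 : 0 ≤ mN n
  mL : mN n ≤ Real.log n
  nu0 : 0 < nuN n
  nutau : nuN n ≤ tauN α n
  lam0 : 0 < lamN δ α n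

lemma basic_of {δ α : ℝ} (hδ : 0 < δ) (h0 : 0 < α) (h2 : α < 2) {n : ℕ} (hn : 0 < n) (hL : 1 ≤ Real.log n) : Basic δ α n := by
  have hn' : (0:ℝ) < n := by exact_mod_cast hn
  have hn1 : (1:ℝ) ≤ n := by exact_mod_cast hn
  have hL0 : 0 < Real.log n := by linarith
  refine ⟨hn, hL, ?_, ?_, ?_, ?_, ?_, ?_⟩
  · unfold rate; positivity
  · unfold mN; linarith [Real.log_le_self hL0.le]
  · unfold mN; linarith [Real.log_nonneg hL]
  · unfold nuN; positivity
  · rw [nuN_eq, tauN_eq hL]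
    have a1 : (1:ℝ) ≤ Real.log n ^ (α / 4 + 1) := Real.one_le_rpow hL (by positivity)
    have a2 : (n:ℝ) ^ (-(1/2):ℝ) ≤ (n:ℝ) ^ (-(α/4)) := Real.rpow_le_rpow_of_exponent_le hn1 (by linarith)
    have a3 : 0 < (n:ℝ) ^ (-(α/4)) := by positivity
    nlinarith
  · rw [lamN_eq hδ hn]; positivity

lemma ev_basic {δ α : ℝ} (hδ : 0 < δ) (h0 : 0 < α) (h2 : α < 2) : ∀ᶠ n in atTop, Basic δ α n := by
  filter_upwards [eventually_gt_atTop 0, ev_log_ge 1] with n a b using basic_of hδ h0 h2 a b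

lemma Basic.tau0 {δ α : ℝ} {n : ℕ} (h : Basic δ α n) : 0 < tauN α n := by
  unfold tauN; have := h.rho; have := h.L1; positivity

/-- generic: `c L^k n^{-a} → 0` -/
lemma polylog_c (c k : ℝ) {a : ℝ} (ha : 0 < a) :
    Tendsto (fun n : ℕ => c * (Real.log n ^ k * (n : ℝ) ^ (-a))) atTop (𝓝 0) := by
  simpa using (polylog k ha).const_mul c

/-- `n ν τ lam^{3/4} → 0`. -/
lemma seq_a {δ α : ℝ} (hδ : 0 < δ) (h0 : 0 < α) (h2 : α < 2) :
    Tendsto (fun n : ℕ => n * nuN n * tauN α n * lamN δ α n ^ (3 / 4 : ℝ)) atTop (𝓝 0) := by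
  refine (polylog_c ((δ ^ α) ^ (3 / 4 : ℝ)) (α / 4 + 1) (a := (2 - α) / 8) (by linarith)).congr' ?_
  filter_upwards [ev_basic hδ h0 h2] with n hb
  have hn' : (0:ℝ) < n := by exact_mod_cast hb.npos
  rw [tauN_eq hb.L1, nuN_eq, lamN_eq hδ hb.npos, Real.mul_rpow (by positivity) (by positivity), ← Real.rpow_mul hn'.le]
  have e : (n:ℝ) ^ (-((2 - α) / 8)) = (n:ℝ) ^ (1:ℝ) * (n:ℝ) ^ (-(1/2):ℝ) * (n:ℝ) ^ (-(α/4)) * (n:ℝ) ^ ((α / 2 - 1) * (3/4)) := by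
    rw [← Real.rpow_add hn', ← Real.rpow_add hn', ← Real.rpow_add hn']; congr 1; ring
  rw [e, Real.rpow_one]; ring

lemma seq_rho {δ α : ℝ} (hδ : 0 < δ) (h0 : 0 < α) (h2 : α < 2) {n : ℕ} (hb : Basic δ α n) :
    n * rate n α ^ 2 * lamN δ α n = δ ^ α * Real.log n ^ (α / 2) := by
  have hn' : (0:ℝ) < n := by exact_mod_cast hb.npos
  have hL := hb.L1
  rw [rate_eq, lamN_eq hδ hb.npos]
  have e : (n:ℝ) ^ (1:ℝ) * (n:ℝ) ^ (-(α/4)) * (n:ℝ) ^ (-(α/4)) * (n:ℝ) ^ (α / 2 - 1) = 1 := by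
    rw [← Real.rpow_add hn', ← Real.rpow_add hn', ← Real.rpow_add hn', ← Real.rpow_zero (n:ℝ)]; congr 1; ring
  have e2 : Real.log n ^ (α / 2) = Real.log n ^ (α / 4) * Real.log n ^ (α / 4) := by
    rw [← Real.rpow_add (by linarith)]; congr 1; ring
  rw [Real.rpow_one] at e
  rw [e2]
  linear_combination (δ ^ α * Real.log n ^ (α / 4) * Real.log n ^ (α / 4)) * e

/-- `L^k n lam τ^4 → 0`. -/
lemma seq_b {δ α : ℝ} (hδ : 0 < δ) (h0 : 0 < α) (h2 : α < 2) (k : ℝ) :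
    Tendsto (fun n : ℕ => Real.log n ^ k * (n * lamN δ α n * tauN α n ^ 4)) atTop (𝓝 0) := by
  refine (polylog_c (δ ^ α) (k + α / 2 + 4 + α / 2) (a := α / 2) (by linarith)).congr' ?_
  filter_upwards [ev_basic hδ h0 h2] with n hb
  have hn' : (0:ℝ) < n := by exact_mod_cast hb.npos
  have hL := hb.L1
  have e0 := seq_rho hδ h0 h2 hb
  have e1 : n * lamN δ α n * tauN α n ^ 4 = (n * rate n α ^ 2 * lamN δ α n) * (rate n α ^ 2 * Real.log n ^ 4) := by
    unfold tauN; ring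
  rw [e1, e0, rate_eq]
  have e2 : Real.log n ^ (k + α / 2 + 4 + α / 2) = Real.log n ^ k * Real.log n ^ (α / 2) * Real.log n ^ 4 * (Real.log n ^ (α / 4))^2 := by
    rw [Real.rpow_add (by linarith), Real.rpow_add (by linarith), Real.rpow_add (by linarith), ← Real.rpow_natCast (_ ^ (α/4)), ← Real.rpow_mul (by linarith)]
    norm_num
    left; ring_nf
  have e3 : (n:ℝ) ^ (-(α/2)) = ((n:ℝ) ^ (-(α/4)))^2 := by
    rw [← Real.rpow_natCast, ← Real.rpow_mul hn'.le]; congr 1; push_cast; ring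
  rw [e2, e3]; ring

/-- `L^k n ν^4 → 0`. -/
lemma seq_c (k : ℝ) : Tendsto (fun n : ℕ => Real.log n ^ k * (n * nuN n ^ 4)) atTop (𝓝 0) := by
  refine (polylog k (a := 1) one_pos).congr' ?_
  filter_upwards [eventually_gt_atTop 0] with n hn
  have hn' : (0:ℝ) < n := by exact_mod_cast hn
  have : nuN n ^ 4 = (1 / n) ^ 2 := by
    unfold nuN
    rw [show (1 / √(n:ℝ)) ^ 4 = (1 / (√(n:ℝ)) ^ 2) ^ 2 by ring, Real.sq_sqrt hn'.le]
  rw [this, Real.rpow_neg_one]; field_simp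

lemma nu_sq {n : ℕ} (hn : 0 < n) : (n:ℝ) * nuN n ^ 2 = 1 := by
  have hn' : (0:ℝ) < n := by exact_mod_cast hn
  unfold nuN
  rw [div_pow, Real.sq_sqrt hn'.le]; field_simp

lemma SS_lin {σ δ α L ν ρ m : ℝ} (hI : ∀ d : Fin 3 → ℂ, IntegrableOn (fun r => DFC σ δ α L ν ρ m r d) (Ioi 0))
    (d : Fin 3 → ℝ) (x : ℝ) :
    SS σ δ α L ν ρ m d x = ∑ j, d j * SS σ δ α L ν ρ m (Pi.single j 1) x := by
  have e : ∀ r, DFC σ δ α L ν ρ m r (fun j => (d j : ℂ)) =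
      ((d 0 : ℂ) * DFC σ δ α L ν ρ m r (fun j => ((Pi.single 0 1 : Fin 3 → ℝ) j : ℂ)) +
      (d 1 : ℂ) * DFC σ δ α L ν ρ m r (fun j => ((Pi.single 1 1 : Fin 3 → ℝ) j : ℂ))) +
      (d 2 : ℂ) * DFC σ δ α L ν ρ m r (fun j => ((Pi.single 2 1 : Fin 3 → ℝ) j : ℂ)) := by
    intro r
    unfold DFC; simp; ring
  unfold SS
  simp_rw [e]
  have i0 := hI (fun j => ((Pi.single 0 1 : Fin 3 → ℝ) j : ℂ))
  have i1 := hI (fun j => ((Pi.single 1 1 : Fin 3 → ℝ) j : ℂ))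
  have i2 := hI (fun j => ((Pi.single 2 1 : Fin 3 → ℝ) j : ℂ))
  have i01 : IntegrableOn (fun r => (d 0 : ℂ) * DFC σ δ α L ν ρ m r (fun j => ((Pi.single 0 1 : Fin 3 → ℝ) j : ℂ)) +
      (d 1 : ℂ) * DFC σ δ α L ν ρ m r (fun j => ((Pi.single 1 1 : Fin 3 → ℝ) j : ℂ))) (Ioi 0) :=
    (i0.const_mul _).add (i1.const_mul _)
  rw [TT_add i01 (i2.const_mul _), TT_add (i0.const_mul _) (i1.const_mul _),
    TT_smul, TT_smul, TT_smul, Fin.sum_univ_three]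
  simp
  ring

end PartF1

section PartF2
def pw (a x : ℝ) : ℝ := (1 + |x|) ^ (-a)
lemma pw_pos (a x : ℝ) : 0 < pw a x := by unfold pw; positivity
lemma pw_le1 {a : ℝ} (ha : 0 ≤ a) (x : ℝ) : pw a x ≤ 1 := pw_le_one ha
lemma pw_mono {a b : ℝ} (h : a ≤ b) (x : ℝ) : pw b x ≤ pw a x := by
  unfold pw
  exact Real.rpow_le_rpow_of_exponent_le (by linarith [abs_nonneg x]) (by linarith)
lemma pw_mul (a b x : ℝ) : pw a x * pw b x = pw (a + b) x := by
  unfold pw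
  rw [← Real.rpow_add (by positivity)]; congr 1; ring
lemma pw_rpow (a b x : ℝ) : pw a x ^ b = pw (a * b) x := by
  unfold pw
  rw [← Real.rpow_mul (by positivity)]; congr 1; ring
lemma pw_pow (a : ℝ) (k : ℕ) (x : ℝ) : pw a x ^ k = pw (a * k) x := by
  rw [← Real.rpow_natCast, pw_rpow]
lemma pw_integrable {a : ℝ} (ha : 1 < a) : Integrable (pw a) := pw_int ha
lemma pw_cont (a : ℝ) : Continuous (pw a) := by
  unfold pw
  exact Continuous.rpow_const (by fun_prop) fun x => Or.inl (by positivity)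

/-- uniform bounds -/
structure Bd (σ α c C lam ν τ : ℝ) (q : ℝ → ℝ) (S : Fin 3 → ℝ → ℝ) : Prop where
  σ0 : 0 < σ
  α0 : 0 < α
  α2 : α < 2
  c0 : 0 < c
  C0 : 0 < C
  lam0 : 0 < lam
  lam1 : lam ≤ 1
  ν0 : 0 < ν
  τ0 : 0 < τ
  qc : Continuous q
  Sc : ∀ j, Continuous (S j)
  q1 : ∀ x, phiS σ x / 2 ≤ q x
  q2 : ∀ x, c * lam * pw (1 + α) x ≤ q x
  s0 : ∀ x, |S 0 x - ν * dphi σ x| ≤ ν * (C * lam * pw (3 + α) x)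
  sj : ∀ j, j ≠ 0 → ∀ x, |S j x| ≤ C * lam * τ * pw (1 + (α - eta α)) x

lemma dphi_cont (σ : ℝ) : Continuous (dphi σ) := by
  unfold dphi; have := phiS_cont σ; fun_prop

lemma ev_Bd {σ δ α : ℝ} (hσ : 0 < σ) (hδ : 0 < δ) (h0 : 0 < α) (h2 : α < 2) :
    ∃ c C : ℝ, ∀ᶠ n in atTop, Bd σ α c C (lamN δ α n) (nuN n) (tauN α n) (qN σ δ α n) (sN σ δ α n) := by
  obtain ⟨c, l0, hc, hl0, hl1, hlow⟩ := q_lower hσ h0 h2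
  obtain ⟨κ, C, hκ, hC, hm⟩ := q_main hσ hδ h0 h2
  set D := CT (2 + α) * (σ * Real.exp (1 / (4 * σ ^ 2))) with hD
  have hD0 : 0 < D := by have := CT_pos (a := 2 + α) (by linarith); positivity
  refine ⟨c, C + D, ?_⟩
  filter_upwards [ev_basic hδ h0 h2, (lamN_tendsto hδ h2).eventually (ge_mem_nhds hl0)] with n hb hl
  obtain ⟨-, m1, m2, -, -⟩ := hm (Real.log n) (nuN n) (rate n α) (mN n) hb.L1 hb.nu0.le hb.rho hb.m0 hb.mL hb.nutau
  refine ⟨hσ, h0, h2, hc, by positivity, hb.lam0, hl.trans hl1, hb.nu0, hb.tau0, qf_cont hσ hb.lam0.le h0 h2, ?_,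
    fun x => (hlow _ hb.lam0 hl x).1, fun x => (hlow _ hb.lam0 hl x).2, ?_, ?_⟩
  · intro j
    unfold sN SS
    exact ((dphi_cont σ).mul continuous_const).add (TT_cont (m2 _))
  · intro x
    refine (SS_zero hσ hδ h0 h2 hb.nu0.le x).trans ?_
    refine mul_le_mul_of_nonneg_left ?_ hb.nu0.le
    rw [← hD]
    change D * lamN δ α n * pw (3 + α) x ≤ _
    have := pw_pos (3 + α) x
    have := hb.lam0
    gcongr; linarith
  · intro j hj x
    have := m1 (Pi.single j 1) x
    have hn : ‖(Pi.single j (1:ℝ) : Fin 3 → ℝ)‖ = 1 := by rw [Pi.norm_single]; simp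
    rw [hn, mul_one] at this
    have e : sN σ δ α n j x = TT (fun r => DFC σ δ α (Real.log n) (nuN n) (rate n α) (mN n) r
        (fun i => (((Pi.single j 1 : Fin 3 → ℝ) i : ℝ) : ℂ))) x := by
      unfold sN SS
      rw [Pi.single_eq_of_ne hj.symm]; simp
    rw [e]
    refine this.trans ?_
    change C * lamN δ α n * tauN α n * pw _ x ≤ _
    have := pw_pos (1 + (α - eta α)) x
    have := hb.lam0
    have := hb.tau0
    gcongr; linarith

lemma dphi_le {σ : ℝ} (hσ : 0 < σ) (x : ℝ) : |dphi σ x| ≤ ((1 + 1 / σ ^ 2) / σ) * (phiS σ x * (1 + x ^ 2)) := by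
  have hφ := phiS_pos hσ x
  unfold dphi
  rw [abs_div, abs_mul, abs_of_pos hφ, abs_of_pos hσ]
  have e : x ^ 2 / σ ^ 2 = (1 / σ ^ 2) * x ^ 2 := by ring
  have a1 : |x ^ 2 / σ ^ 2 - 1| ≤ (1 + 1 / σ ^ 2) * (1 + x ^ 2) := by
    have q1 : 0 < 1 / σ ^ 2 := by positivity
    have q2 : 0 ≤ 1 / σ ^ 2 * x ^ 2 := by positivity
    rw [e, abs_le]
    constructor <;> nlinarith [sq_nonneg x]
  calc phiS σ x * |x ^ 2 / σ ^ 2 - 1| / σ ≤ phiS σ x * ((1 + 1 / σ ^ 2) * (1 + x ^ 2)) / σ := by gcongr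
    _ = _ := by ring

section
variable {σ α c C lam ν τ : ℝ} {q : ℝ → ℝ} {S : Fin 3 → ℝ → ℝ}

lemma Bd.qpos (b : Bd σ α c C lam ν τ q S) (x : ℝ) : 0 < q x := by
  linarith [b.q1 x, phiS_pos b.σ0 x]

def DD (σ C : ℝ) : ℝ := (1 + 1 / σ ^ 2) / σ + C

lemma Bd.D0 (b : Bd σ α c C lam ν τ q S) : 0 < DD σ C := by
  have := b.σ0; have := b.C0; unfold DD; positivity

lemma Bd.s0' (b : Bd σ α c C lam ν τ q S) (x : ℝ) :
    |S 0 x| ≤ ν * (DD σ C * (phiS σ x * (1 + x ^ 2) + lam * pw (3 + α) x)) := by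
  have h1 := b.s0 x
  have h2 := dphi_le b.σ0 x
  have hν := b.ν0
  have h3 : |S 0 x| ≤ |S 0 x - ν * dphi σ x| + ν * |dphi σ x| := by
    have := abs_add_le (S 0 x - ν * dphi σ x) (ν * dphi σ x)
    rw [abs_mul, abs_of_pos hν] at this
    simpa using this
  have h4 : C * lam * pw (3 + α) x + |dphi σ x| ≤ DD σ C * (phiS σ x * (1 + x ^ 2) + lam * pw (3 + α) x) := by
    have hφ : 0 ≤ phiS σ x * (1 + x ^ 2) := by have := phiS_pos b.σ0 x; positivity
    have hp : 0 ≤ lam * pw (3 + α) x := by have := pw_pos (3+α) x; have := b.lam0; positivity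
    have hs : 0 ≤ (1 + 1 / σ ^ 2) / σ := by have := b.σ0; positivity
    unfold DD
    nlinarith [mul_nonneg hs hp, mul_nonneg b.C0.le hφ]
  calc |S 0 x| ≤ ν * (C * lam * pw (3 + α) x + |dphi σ x|) := by linarith
    _ ≤ _ := by gcongr

lemma Bd.m40 (b : Bd σ α c C lam ν τ q S) (x : ℝ) :
    |S 0 x ^ 4 / q x ^ 3| ≤ ν ^ 4 * (8 * DD σ C ^ 4 * (8 * ((1 + x ^ 2) ^ 4 * phiS σ x) + (c ^ 3)⁻¹ * pw (3 + α) x)) := by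
  have hq := b.qpos x
  have hφ := phiS_pos b.σ0 x
  have hl := b.lam0; have hc := b.c0; have hD := b.D0; have hν := b.ν0
  have hp := pw_pos (1 + α) x; have hp' := pw_pos (3 + α) x
  have k1 : phiS σ x ^ 3 ≤ 8 * q x ^ 3 := by
    have : (phiS σ x / 2) ^ 3 ≤ q x ^ 3 := by gcongr; exact b.q1 x
    nlinarith
  have k2 : (c * lam * pw (1 + α) x) ^ 3 ≤ q x ^ 3 := by gcongr; exact b.q2 x
  rw [abs_of_nonneg (by positivity), div_le_iff₀ (by positivity)]
  have e : S 0 x ^ 4 ≤ (ν * (DD σ C * (phiS σ x * (1 + x ^ 2) + lam * pw (3 + α) x))) ^ 4 := by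
    rw [← (show Even 4 by decide).pow_abs]; gcongr; exact b.s0' x
  refine e.trans ?_
  have e2 : ∀ u v : ℝ, 0 ≤ u → 0 ≤ v → (u + v) ^ 4 ≤ 8 * (u ^ 4 + v ^ 4) := by
    intro u v _ _
    have := add_pow_le (‹0 ≤ u›) (‹0 ≤ v›) 4
    norm_num at this; linarith
  have e3 := e2 (phiS σ x * (1 + x ^ 2)) (lam * pw (3 + α) x) (by positivity) (by positivity)
  have e4 : (phiS σ x * (1 + x ^ 2)) ^ 4 ≤ 8 * ((1 + x ^ 2) ^ 4 * phiS σ x) * q x ^ 3 := by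
    calc (phiS σ x * (1 + x ^ 2)) ^ 4 = ((1 + x ^ 2) ^ 4 * phiS σ x) * phiS σ x ^ 3 := by ring
      _ ≤ ((1 + x ^ 2) ^ 4 * phiS σ x) * (8 * q x ^ 3) := by gcongr
      _ = _ := by ring
  have e5 : (lam * pw (3 + α) x) ^ 4 ≤ (c ^ 3)⁻¹ * pw (3 + α) x * q x ^ 3 := by
    have hpp : pw (3 + α) x ≤ pw (1 + α) x := pw_mono (by linarith) x
    have hl1 := b.lam1
    calc (lam * pw (3 + α) x) ^ 4 = pw (3 + α) x * (lam * (lam * pw (3 + α) x) ^ 3) := by ring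
      _ ≤ pw (3 + α) x * (1 * (lam * pw (1 + α) x) ^ 3) := by gcongr
      _ = (c ^ 3)⁻¹ * pw (3 + α) x * (c * lam * pw (1 + α) x) ^ 3 := by field_simp
      _ ≤ _ := by gcongr
  calc (ν * (DD σ C * (phiS σ x * (1 + x ^ 2) + lam * pw (3 + α) x))) ^ 4
      = ν ^ 4 * (DD σ C ^ 4 * (phiS σ x * (1 + x ^ 2) + lam * pw (3 + α) x) ^ 4) := by ring
    _ ≤ ν ^ 4 * (DD σ C ^ 4 * (8 * (8 * ((1 + x ^ 2) ^ 4 * phiS σ x) * q x ^ 3 + (c ^ 3)⁻¹ * pw (3 + α) x * q x ^ 3))) := by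
        gcongr; exact e3.trans (by linarith)
    _ = _ := by ring

lemma Bd.m4j (b : Bd σ α c C lam ν τ q S) {j : Fin 3} (hj : j ≠ 0) (x : ℝ) :
    |S j x ^ 4 / q x ^ 3| ≤ lam * τ ^ 4 * (C ^ 4 * (c ^ 3)⁻¹ * pw (1 + α / 2) x) := by
  have hq := b.qpos x
  have hl := b.lam0; have hc := b.c0; have hC := b.C0; have hτ := b.τ0
  have hp := pw_pos (1 + α) x; have hp' := pw_pos (1 + α / 2) x; have hp2 := pw_pos (1 + (α - eta α)) x
  have k2 : (c * lam * pw (1 + α) x) ^ 3 ≤ q x ^ 3 := by gcongr; exact b.q2 x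
  rw [abs_of_nonneg (by positivity), div_le_iff₀ (by positivity)]
  have e : S j x ^ 4 ≤ (C * lam * τ * pw (1 + (α - eta α)) x) ^ 4 := by
    rw [← (show Even 4 by decide).pow_abs]; gcongr; exact b.sj j hj x
  refine e.trans ?_
  have e1 : pw (1 + (α - eta α)) x ^ 4 ≤ pw (1 + α / 2) x * pw (1 + α) x ^ 3 := by
    rw [pw_pow, pw_pow, pw_mul]
    apply pw_mono
    have := eta_le b.α0; push_cast; linarith
  calc (C * lam * τ * pw (1 + (α - eta α)) x) ^ 4 = C ^ 4 * lam ^ 4 * τ ^ 4 * pw (1 + (α - eta α)) x ^ 4 := by ring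
    _ ≤ C ^ 4 * lam ^ 4 * τ ^ 4 * (pw (1 + α / 2) x * pw (1 + α) x ^ 3) := by gcongr
    _ = lam * τ ^ 4 * (C ^ 4 * (c ^ 3)⁻¹ * pw (1 + α / 2) x) * (c * lam * pw (1 + α) x) ^ 3 := by field_simp
    _ ≤ _ := by gcongr

lemma Bd.cross (b : Bd σ α c C lam ν τ q S) {j : Fin 3} (hj : j ≠ 0) (x : ℝ) :
    |S 0 x * S j x / q x| ≤ ν * τ * lam ^ (3 / 4 : ℝ) *
      (DD σ C * C * (2 * (c ^ (1 / 4 : ℝ))⁻¹ * ((1 + x ^ 2) * phiS σ x ^ (1 / 4 : ℝ)) + c⁻¹ * pw (1 + α) x)) := by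
  have hq := b.qpos x
  have hφ := phiS_pos b.σ0 x
  have hα := b.α0
  have hl := b.lam0; have hc := b.c0; have hC := b.C0; have hτ := b.τ0; have hν := b.ν0; have hD := b.D0
  have hp := pw_pos (1 + α) x; have hp' := pw_pos (3 + α) x; have hp2 := pw_pos (1 + (α - eta α)) x
  have he := eta_le b.α0
  rw [abs_div, abs_of_pos hq, div_le_iff₀ hq, abs_mul]
  have hll : lam ≤ lam ^ (3 / 4 : ℝ) := by
    conv_lhs => rw [← Real.rpow_one lam]
    exact Real.rpow_le_rpow_of_exponent_ge hl b.lam1 (by norm_num)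
  have a1 : lam * phiS σ x * pw (1 + (α - eta α)) x ≤ lam ^ (3 / 4 : ℝ) * (2 * (c ^ (1 / 4 : ℝ))⁻¹ * phiS σ x ^ (1 / 4 : ℝ)) * q x := by
    have g1 : (phiS σ x / 2) ^ (3 / 4 : ℝ) * (c * lam * pw (1 + α) x) ^ (1 / 4 : ℝ) ≤ q x := by
      calc (phiS σ x / 2) ^ (3 / 4 : ℝ) * (c * lam * pw (1 + α) x) ^ (1 / 4 : ℝ) ≤ q x ^ (3 / 4 : ℝ) * q x ^ (1 / 4 : ℝ) := by
            gcongr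
            · exact b.q1 x
            · exact b.q2 x
        _ = q x := by rw [← Real.rpow_add hq]; norm_num
    rw [Real.div_rpow hφ.le (by norm_num), Real.mul_rpow (by positivity) hp.le, Real.mul_rpow hc.le hl.le] at g1
    have g2 : (2:ℝ) ^ (3 / 4 : ℝ) ≤ 2 := by
      conv_rhs => rw [← Real.rpow_one 2]
      exact Real.rpow_le_rpow_of_exponent_le (by norm_num) (by norm_num)
    have g3 : pw (1 + (α - eta α)) x ≤ pw (1 + α) x ^ (1 / 4 : ℝ) := by
      rw [pw_rpow]; apply pw_mono; linarith
    have g4 : lam = lam ^ (3 / 4 : ℝ) * lam ^ (1 / 4 : ℝ) := by rw [← Real.rpow_add hl]; norm_num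
    have g5 : phiS σ x = phiS σ x ^ (3 / 4 : ℝ) * phiS σ x ^ (1 / 4 : ℝ) := by rw [← Real.rpow_add hφ]; norm_num
    calc lam * phiS σ x * pw (1 + (α - eta α)) x
        = (lam ^ (3 / 4 : ℝ) * lam ^ (1 / 4 : ℝ)) * (phiS σ x ^ (3 / 4 : ℝ) * phiS σ x ^ (1 / 4 : ℝ)) * pw (1 + (α - eta α)) x := by rw [← g4, ← g5]
      _ ≤ (lam ^ (3 / 4 : ℝ) * lam ^ (1 / 4 : ℝ)) * (phiS σ x ^ (3 / 4 : ℝ) * phiS σ x ^ (1 / 4 : ℝ)) * pw (1 + α) x ^ (1 / 4 : ℝ) := by gcongr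
      _ = lam ^ (3 / 4 : ℝ) * (2 ^ (3 / 4 : ℝ) * (c ^ (1 / 4 : ℝ))⁻¹ * phiS σ x ^ (1 / 4 : ℝ)) *
          (phiS σ x ^ (3 / 4 : ℝ) / 2 ^ (3 / 4 : ℝ) * (c ^ (1 / 4 : ℝ) * lam ^ (1 / 4 : ℝ) * pw (1 + α) x ^ (1 / 4 : ℝ))) := by
          have u1 : (2:ℝ) ^ (3 / 4 : ℝ) ≠ 0 := by positivity
          have u2 : c ^ (1 / 4 : ℝ) ≠ 0 := by positivity
          generalize (2:ℝ) ^ (3 / 4 : ℝ) = t at *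
          generalize c ^ (1 / 4 : ℝ) = t2 at *
          field_simp
      _ ≤ lam ^ (3 / 4 : ℝ) * (2 * (c ^ (1 / 4 : ℝ))⁻¹ * phiS σ x ^ (1 / 4 : ℝ)) * q x := by gcongr
  have a2 : lam * (lam * pw (3 + α) x) * pw (1 + (α - eta α)) x ≤ lam ^ (3 / 4 : ℝ) * (c⁻¹ * pw (1 + α) x) * q x := by
    have : pw (3 + α) x * pw (1 + (α - eta α)) x ≤ pw (1 + α) x * pw (1 + α) x := by
      rw [pw_mul, pw_mul]; apply pw_mono; linarith [b.α2]
    calc lam * (lam * pw (3 + α) x) * pw (1 + (α - eta α)) x = lam * lam * (pw (3 + α) x * pw (1 + (α - eta α)) x) := by ring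
      _ ≤ lam ^ (3 / 4 : ℝ) * lam * (pw (1 + α) x * pw (1 + α) x) := by gcongr
      _ = lam ^ (3 / 4 : ℝ) * (c⁻¹ * pw (1 + α) x) * (c * lam * pw (1 + α) x) := by field_simp
      _ ≤ _ := by gcongr; exact b.q2 x
  calc |S 0 x| * |S j x| ≤ (ν * (DD σ C * (phiS σ x * (1 + x ^ 2) + lam * pw (3 + α) x))) * (C * lam * τ * pw (1 + (α - eta α)) x) := by
        gcongr
        · exact b.s0' x
        · exact b.sj j hj x
    _ = ν * τ * (DD σ C * C * ((1 + x ^ 2) * (lam * phiS σ x * pw (1 + (α - eta α)) x) + lam * (lam * pw (3 + α) x) * pw (1 + (α - eta α)) x)) := by ring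
    _ ≤ ν * τ * (DD σ C * C * ((1 + x ^ 2) * (lam ^ (3 / 4 : ℝ) * (2 * (c ^ (1 / 4 : ℝ))⁻¹ * phiS σ x ^ (1 / 4 : ℝ)) * q x) + lam ^ (3 / 4 : ℝ) * (c⁻¹ * pw (1 + α) x) * q x)) := by gcongr
    _ = _ := by ring

end

end PartF2

section PartF3
lemma phi_quarter_int {σ : ℝ} (hσ : 0 < σ) : Integrable (fun x : ℝ => (1 + x ^ 2) * phiS σ x ^ (1 / 4 : ℝ)) := by
  have := (poly_gauss_int (c := 8 * σ ^ 2) (by positivity) 1).const_mul ((Real.sqrt (2 * Real.pi) * σ)⁻¹ ^ (1 / 4 : ℝ))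
  refine this.congr (Eventually.of_forall fun x => ?_)
  simp only [phiS]
  rw [Real.mul_rpow (by positivity) (by positivity), ← Real.exp_mul, pow_one]
  rw [show -(x ^ 2 / (2 * σ ^ 2)) * (1 / 4) = -(x ^ 2 / (8 * σ ^ 2)) by field_simp; ring]
  ring

/-- squeeze for integrals bounded by `a n * g`. -/
lemma int_squeeze {f : ℕ → ℝ → ℝ} {a : ℕ → ℝ} {g : ℝ → ℝ} (hg : Integrable g)
    (hb : ∀ᶠ n in atTop, ∀ x, |f n x| ≤ a n * g x) (ha : Tendsto (fun n : ℕ => n * a n) atTop (𝓝 0)) :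
    Tendsto (fun n : ℕ => n * ∫ x, f n x) atTop (𝓝 0) := by
  have h1 : Tendsto (fun n : ℕ => (n * a n) * ∫ x, g x) atTop (𝓝 0) := by simpa using ha.mul_const (∫ x, g x)
  refine squeeze_zero_norm' ?_ h1
  filter_upwards [hb] with n hn
  rw [norm_mul, Real.norm_of_nonneg (Nat.cast_nonneg n), mul_assoc, ← integral_const_mul]
  gcongr
  exact norm_integral_le_of_norm_le (hg.const_mul _) (Eventually.of_forall hn)

variable {σ δ α : ℝ}

lemma g40_int (hσ : 0 < σ) (h0 : 0 < α) (A B : ℝ) : Integrable (fun x : ℝ => A * (8 * ((1 + x ^ 2) ^ 4 * phiS σ x) + B * pw (3 + α) x)) :=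
  (((poly_phi_int hσ 4).const_mul 8).add ((pw_integrable (by linarith)).const_mul B)).const_mul A

lemma lim_m40 (hσ : 0 < σ) (hδ : 0 < δ) (h0 : 0 < α) (h2 : α < 2) :
    Tendsto (fun n : ℕ => n * ∫ x, sN σ δ α n 0 x ^ 4 / qN σ δ α n x ^ 3) atTop (𝓝 0) := by
  obtain ⟨c, C, hB⟩ := ev_Bd hσ hδ h0 h2
  refine int_squeeze (g40_int hσ h0 _ _) (hB.mono fun n b x => b.m40 x) ?_
  simpa using seq_c 0

lemma lim_m4j (hσ : 0 < σ) (hδ : 0 < δ) (h0 : 0 < α) (h2 : α < 2) {j : Fin 3} (hj : j ≠ 0) :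
    Tendsto (fun n : ℕ => n * ∫ x, sN σ δ α n j x ^ 4 / qN σ δ α n x ^ 3) atTop (𝓝 0) := by
  obtain ⟨c, C, hB⟩ := ev_Bd hσ hδ h0 h2
  refine int_squeeze ((pw_integrable (a := 1 + α / 2) (by linarith)).const_mul (C ^ 4 * (c ^ 3)⁻¹)) (hB.mono fun n b x => b.m4j hj x) ?_
  have := seq_b hδ h0 h2 0
  refine this.congr fun n => ?_
  rw [Real.rpow_zero]; ring

lemma lim_m4 (hσ : 0 < σ) (hδ : 0 < δ) (h0 : 0 < α) (h2 : α < 2) (j : Fin 3) :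
    Tendsto (fun n : ℕ => n * ∫ x, sN σ δ α n j x ^ 4 / qN σ δ α n x ^ 3) atTop (𝓝 0) := by
  by_cases hj : j = 0
  · rw [hj]; exact lim_m40 hσ hδ h0 h2
  · exact lim_m4j hσ hδ h0 h2 hj

lemma m4_int {c C lam ν τ : ℝ} {q : ℝ → ℝ} {S : Fin 3 → ℝ → ℝ} (b : Bd σ α c C lam ν τ q S) (j : Fin 3) :
    Integrable (fun x => S j x ^ 4 / q x ^ 3) := by
  have hc : Continuous (fun x => S j x ^ 4 / q x ^ 3) :=
    ((b.Sc j).pow 4).div (b.qc.pow 3) fun x => (pow_pos (b.qpos x) 3).ne'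
  by_cases hj : j = 0
  · subst hj
    exact ((g40_int b.σ0 b.α0 _ _).const_mul (ν ^ 4)).mono' hc.aestronglyMeasurable (Eventually.of_forall fun x => b.m40 x)
  · exact (((pw_integrable (a := 1 + α / 2) (by linarith [b.α0])).const_mul (C ^ 4 * (c ^ 3)⁻¹)).const_mul (lam * τ ^ 4)).mono' hc.aestronglyMeasurable
      (Eventually.of_forall fun x => b.m4j hj x)

lemma lim_cross (hσ : 0 < σ) (hδ : 0 < δ) (h0 : 0 < α) (h2 : α < 2) {j : Fin 3} (hj : j ≠ 0) :
    Tendsto (fun n : ℕ => n * ∫ x, sN σ δ α n 0 x * sN σ δ α n j x / qN σ δ α n x) atTop (𝓝 0) := by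
  obtain ⟨c, C, hB⟩ := ev_Bd hσ hδ h0 h2
  refine int_squeeze ((((phi_quarter_int hσ).const_mul _).add ((pw_integrable (a := 1 + α) (by linarith)).const_mul _)).const_mul _)
    (hB.mono fun n b x => b.cross hj x) ?_
  refine (seq_a hδ h0 h2).congr fun n => ?_
  ring

lemma lim_00 (hσ : 0 < σ) (hδ : 0 < δ) (h0 : 0 < α) (h2 : α < 2) :
    Tendsto (fun n : ℕ => n * ∫ x, sN σ δ α n 0 x * sN σ δ α n 0 x / qN σ δ α n x) atTop (𝓝 (2 / σ ^ 2)) := by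
  obtain ⟨c, C, hB⟩ := ev_Bd hσ hδ h0 h2
  rw [← fisher_gauss hσ]
  simp_rw [← integral_const_mul]
  refine tendsto_integral_filter_of_dominated_convergence
    (fun x => DD σ C ^ 2 * 2 * (2 * ((1 + x ^ 2) ^ 2 * phiS σ x) + c⁻¹ * pw (3 + α) x)) ?_ ?_ ?_ ?_
  · filter_upwards [hB] with n b
    exact (continuous_const.mul (((b.Sc 0).mul (b.Sc 0)).div b.qc fun x => (b.qpos x).ne')).aestronglyMeasurable
  · filter_upwards [hB, eventually_gt_atTop 0] with n b hn
    refine Eventually.of_forall fun x => ?_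
    have hq := b.qpos x
    have hφ := phiS_pos hσ x
    have hl := b.lam0; have hc := b.c0; have hD := b.D0; have hν := b.ν0
    have hp := pw_pos (1 + α) x; have hp' := pw_pos (3 + α) x
    have hl1 := b.lam1
    rw [Real.norm_of_nonneg (mul_nonneg (Nat.cast_nonneg n) (div_nonneg (mul_self_nonneg _) hq.le)), ← mul_div_assoc, div_le_iff₀ hq]
    have e := b.s0' x
    have e' : sN σ δ α n 0 x * sN σ δ α n 0 x ≤ (nuN n * (DD σ C * (phiS σ x * (1 + x ^ 2) + lamN δ α n * pw (3 + α) x))) ^ 2 := by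
      rw [← sq, ← sq_abs]; gcongr
    have k1 : (phiS σ x * (1 + x ^ 2)) ^ 2 ≤ 2 * ((1 + x ^ 2) ^ 2 * phiS σ x) * qN σ δ α n x := by
      have := b.q1 x
      calc (phiS σ x * (1 + x ^ 2)) ^ 2 = 2 * ((1 + x ^ 2) ^ 2 * phiS σ x) * (phiS σ x / 2) := by ring
        _ ≤ _ := by gcongr
    have k2 : (lamN δ α n * pw (3 + α) x) ^ 2 ≤ c⁻¹ * pw (3 + α) x * qN σ δ α n x := by
      have hpp : pw (3 + α) x ≤ pw (1 + α) x := pw_mono (by linarith) x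
      calc (lamN δ α n * pw (3 + α) x) ^ 2 = pw (3 + α) x * (lamN δ α n * (lamN δ α n * pw (3 + α) x)) := by ring
        _ ≤ pw (3 + α) x * (1 * (lamN δ α n * pw (1 + α) x)) := by gcongr
        _ = c⁻¹ * pw (3 + α) x * (c * lamN δ α n * pw (1 + α) x) := by field_simp
        _ ≤ _ := by gcongr; exact b.q2 x
    calc (n:ℝ) * (sN σ δ α n 0 x * sN σ δ α n 0 x)
        ≤ n * (nuN n * (DD σ C * (phiS σ x * (1 + x ^ 2) + lamN δ α n * pw (3 + α) x))) ^ 2 := by gcongr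
      _ = (n * nuN n ^ 2) * (DD σ C ^ 2 * (phiS σ x * (1 + x ^ 2) + lamN δ α n * pw (3 + α) x) ^ 2) := by ring
      _ = DD σ C ^ 2 * (phiS σ x * (1 + x ^ 2) + lamN δ α n * pw (3 + α) x) ^ 2 := by rw [nu_sq hn, one_mul]
      _ ≤ DD σ C ^ 2 * (2 * ((phiS σ x * (1 + x ^ 2)) ^ 2 + (lamN δ α n * pw (3 + α) x) ^ 2)) := by
          gcongr; exact add_sq_le
      _ ≤ DD σ C ^ 2 * (2 * (2 * ((1 + x ^ 2) ^ 2 * phiS σ x) * qN σ δ α n x + c⁻¹ * pw (3 + α) x * qN σ δ α n x)) := by gcongr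
      _ = _ := by ring
  · exact (((poly_phi_int hσ 2).const_mul 2).add ((pw_integrable (by linarith)).const_mul _)).const_mul _
  · refine Eventually.of_forall fun x => ?_
    have hφ := phiS_pos hσ x
    have hlam := lamN_tendsto hδ h2
    have q1 : Tendsto (fun n => qN σ δ α n x) atTop (𝓝 (phiS σ x)) := by
      rw [tendsto_iff_norm_sub_tendsto_zero]
      have : Tendsto (fun n => CT α * Real.exp (1 / (4 * σ ^ 2)) * lamN δ α n * (1 + |x|) ^ (-(1 + α))) atTop (𝓝 0) := by
        have := (hlam.const_mul (CT α * Real.exp (1 / (4 * σ ^ 2)))).mul_const ((1 + |x|) ^ (-(1 + α)))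
        rwa [mul_zero, zero_mul] at this
      refine squeeze_zero' (Eventually.of_forall fun n => norm_nonneg _) ?_ this
      filter_upwards [hB] with n b
      exact q_sub_phi hσ b.lam0.le h0 h2 x
    have q2 : Tendsto (fun n => (nuN n)⁻¹ * sN σ δ α n 0 x) atTop (𝓝 (dphi σ x)) := by
      rw [tendsto_iff_norm_sub_tendsto_zero]
      have : Tendsto (fun n => C * lamN δ α n * pw (3 + α) x) atTop (𝓝 0) := by
        simpa using (hlam.const_mul C).mul_const (pw (3 + α) x)
      refine squeeze_zero' (Eventually.of_forall fun n => norm_nonneg _) ?_ this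
      filter_upwards [hB] with n b
      have hν := b.ν0
      have := b.s0 x
      rw [show (nuN n)⁻¹ * sN σ δ α n 0 x - dphi σ x = (nuN n)⁻¹ * (sN σ δ α n 0 x - nuN n * dphi σ x) by field_simp,
        norm_mul, Real.norm_of_nonneg (by positivity), inv_mul_le_iff₀ hν]
      exact this
    have := (q2.pow 2).div q1 hφ.ne'
    refine this.congr' ?_
    filter_upwards [hB, eventually_gt_atTop 0] with n b hn
    have hν := b.ν0
    have e : (nuN n)⁻¹ ^ 2 = n := by
      have := nu_sq hn
      rw [inv_pow]; field_simp; linarith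
    simp only [Pi.div_apply]
    rw [mul_pow, e]; ring

/-- bounds for `bb`. -/
lemma bb_eq (n : ℕ) (x : ℝ) : bb σ δ α (Real.log n) (nuN n) (rate n α) x =
    nuN n ^ 2 * GG σ x + lamN δ α n * tauN α n ^ 2 * pw (1 + (α - eta α)) x := rfl

lemma GG_int (hσ : 0 < σ) : Integrable (GG σ) := by
  refine (exp_sq_int (c := 8 * σ ^ 2 / 3) (by positivity)).congr (Eventually.of_forall fun x => ?_)
  simp only [GG]; congr 2; field_simp

def GGq (σ x : ℝ) : ℝ := 2 * (Real.sqrt (2 * Real.pi) * σ) * Real.exp (-(x ^ 2 / (4 * σ ^ 2)))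

lemma GGq_int (hσ : 0 < σ) : Integrable (GGq σ) := (exp_sq_int (by positivity)).const_mul _

lemma GG_sq (hσ : 0 < σ) (x : ℝ) : GG σ x ^ 2 = GGq σ x * (phiS σ x / 2) := by
  unfold GG GGq phiS
  rw [← Real.exp_nat_mul]
  have : Real.exp ((2:ℕ) * -(3 * x ^ 2 / (8 * σ ^ 2))) = Real.exp (-(x ^ 2 / (4 * σ ^ 2))) * Real.exp (-(x ^ 2 / (2 * σ ^ 2))) := by
    rw [← Real.exp_add]; congr 1; push_cast; field_simp; ring
  rw [this]; field_simp

lemma GG_cont (σ : ℝ) : Continuous (GG σ) := by unfold GG; fun_prop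

lemma bb_nonneg {c C : ℝ} {n : ℕ} (b : Bd σ α c C (lamN δ α n) (nuN n) (tauN α n) (qN σ δ α n) (sN σ δ α n)) (x : ℝ) :
    0 ≤ bb σ δ α (Real.log n) (nuN n) (rate n α) x := by
  rw [bb_eq]
  have := b.lam0; have := pw_pos (1 + (α - eta α)) x; unfold GG; positivity

lemma bb_cont (n : ℕ) : Continuous (bb σ δ α (Real.log n) (nuN n) (rate n α)) := by
  have : bb σ δ α (Real.log n) (nuN n) (rate n α) = fun x => nuN n ^ 2 * GG σ x + lamN δ α n * tauN α n ^ 2 * pw (1 + (α - eta α)) x := by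
    funext x; exact bb_eq n x
  rw [this]
  have := GG_cont σ; have := pw_cont (1 + (α - eta α))
  fun_prop

lemma bb_int (hσ : 0 < σ) (h0 : 0 < α) (n : ℕ) : Integrable (bb σ δ α (Real.log n) (nuN n) (rate n α)) :=
  ((GG_int hσ).const_mul _).add ((pw_integrable (by linarith [eta_le h0])).const_mul _)

lemma bb_integral (hσ : 0 < σ) (h0 : 0 < α) (n : ℕ) : ∫ x, bb σ δ α (Real.log n) (nuN n) (rate n α) x =
    nuN n ^ 2 * (∫ x, GG σ x) + lamN δ α n * tauN α n ^ 2 * ∫ x, pw (1 + (α - eta α)) x := by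
  simp_rw [bb_eq]
  rw [integral_add ((GG_int hσ).const_mul _) ((pw_integrable (by linarith [eta_le h0])).const_mul _), integral_const_mul, integral_const_mul]

lemma bb_sq {c C : ℝ} {n : ℕ} (b : Bd σ α c C (lamN δ α n) (nuN n) (tauN α n) (qN σ δ α n) (sN σ δ α n)) (x : ℝ) :
    |bb σ δ α (Real.log n) (nuN n) (rate n α) x ^ 2 / qN σ δ α n x| ≤
      (nuN n ^ 4 + lamN δ α n * tauN α n ^ 4) * (2 * GGq σ x + 2 * c⁻¹ * pw (1 + α / 2) x) := by
  have hq := b.qpos x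
  have hφ := phiS_pos b.σ0 x
  have hl := b.lam0; have hc := b.c0; have hτ := b.τ0; have hν := b.ν0
  have hp := pw_pos (1 + α) x; have hp' := pw_pos (1 + α / 2) x; have hp2 := pw_pos (1 + (α - eta α)) x
  have hG : 0 ≤ GGq σ x := by unfold GGq; have := b.σ0; positivity
  rw [abs_of_nonneg (by positivity), div_le_iff₀ hq, bb_eq]
  have e1 : pw (1 + (α - eta α)) x ^ 2 ≤ pw (1 + α / 2) x * pw (1 + α) x := by
    rw [pw_pow, pw_mul]
    apply pw_mono
    have := eta_le b.α0; have := b.α0; push_cast; linarith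
  have k1 : GG σ x ^ 2 ≤ GGq σ x * qN σ δ α n x := by
    rw [GG_sq b.σ0]; gcongr; exact b.q1 x
  have k2 : lamN δ α n * pw (1 + (α - eta α)) x ^ 2 ≤ c⁻¹ * pw (1 + α / 2) x * qN σ δ α n x := by
    calc lamN δ α n * pw (1 + (α - eta α)) x ^ 2 ≤ lamN δ α n * (pw (1 + α / 2) x * pw (1 + α) x) := by gcongr
      _ = c⁻¹ * pw (1 + α / 2) x * (c * lamN δ α n * pw (1 + α) x) := by field_simp
      _ ≤ _ := by gcongr; exact b.q2 x
  have hlt : 0 ≤ lamN δ α n * tauN α n ^ 4 := by positivity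
  have hX : 0 ≤ 2 * GGq σ x * qN σ δ α n x := by positivity
  have hY : 0 ≤ 2 * c⁻¹ * pw (1 + α / 2) x * qN σ δ α n x := by positivity
  calc (nuN n ^ 2 * GG σ x + lamN δ α n * tauN α n ^ 2 * pw (1 + (α - eta α)) x) ^ 2
      ≤ 2 * ((nuN n ^ 2 * GG σ x) ^ 2 + (lamN δ α n * tauN α n ^ 2 * pw (1 + (α - eta α)) x) ^ 2) := add_sq_le
    _ = nuN n ^ 4 * (2 * GG σ x ^ 2) + lamN δ α n * tauN α n ^ 4 * (2 * (lamN δ α n * pw (1 + (α - eta α)) x ^ 2)) := by ring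
    _ ≤ nuN n ^ 4 * (2 * (GGq σ x * qN σ δ α n x)) + lamN δ α n * tauN α n ^ 4 * (2 * (c⁻¹ * pw (1 + α / 2) x * qN σ δ α n x)) := by gcongr
    _ ≤ _ := by nlinarith [mul_nonneg hlt hX, mul_nonneg (pow_nonneg hν.le 4) hY]

lemma bbq_int' (hσ : 0 < σ) (h0 : 0 < α) (c : ℝ) : Integrable (fun x => 2 * GGq σ x + 2 * c⁻¹ * pw (1 + α / 2) x) :=
  ((GGq_int hσ).const_mul _).add ((pw_integrable (by linarith)).const_mul _)

lemma bb_sq_int {c C : ℝ} {n : ℕ} (b : Bd σ α c C (lamN δ α n) (nuN n) (tauN α n) (qN σ δ α n) (sN σ δ α n)) :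
    Integrable (fun x => bb σ δ α (Real.log n) (nuN n) (rate n α) x ^ 2 / qN σ δ α n x) := by
  refine ((bbq_int' b.σ0 b.α0 c).const_mul _).mono' ?_ (Eventually.of_forall fun x => bb_sq b x)
  exact (((bb_cont n).pow 2).div b.qc fun x => (b.qpos x).ne').aestronglyMeasurable

lemma lim_bb2 (hσ : 0 < σ) (hδ : 0 < δ) (h0 : 0 < α) (h2 : α < 2) (k : ℝ) :
    Tendsto (fun n : ℕ => Real.log n ^ k * (n * ∫ x, bb σ δ α (Real.log n) (nuN n) (rate n α) x ^ 2 / qN σ δ α n x)) atTop (𝓝 0) := by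
  obtain ⟨c, C, hB⟩ := ev_Bd hσ hδ h0 h2
  have h := int_squeeze (f := fun n x => Real.log n ^ k * (bb σ δ α (Real.log n) (nuN n) (rate n α) x ^ 2 / qN σ δ α n x))
    (a := fun n => Real.log n ^ k * (nuN n ^ 4 + lamN δ α n * tauN α n ^ 4)) (bbq_int' hσ h0 c) ?_ ?_
  · refine h.congr fun n => ?_
    rw [integral_const_mul]; ring
  · filter_upwards [hB, ev_log_ge 1] with n b hL x
    have : 0 < Real.log n ^ k := by positivity
    rw [abs_mul, abs_of_pos this, mul_assoc]
    gcongr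
    exact bb_sq b x
  · have := (seq_c k).add (seq_b hδ h0 h2 k)
    rw [add_zero] at this
    refine this.congr fun n => ?_
    ring

/-- `n ∫ bb ≤ K L^3`. -/
lemma bb1_le (hσ : 0 < σ) (hδ : 0 < δ) (h0 : 0 < α) (h2 : α < 2) : ∃ K : ℝ, ∀ᶠ n : ℕ in atTop,
    n * ∫ x, bb σ δ α (Real.log n) (nuN n) (rate n α) x ≤ K * Real.log n ^ (3:ℝ) := by
  refine ⟨(∫ x, GG σ x) + δ ^ α * ∫ x, pw (1 + (α - eta α)) x, ?_⟩
  filter_upwards [ev_basic hδ h0 h2] with n b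
  have hG : 0 ≤ ∫ x, GG σ x := integral_nonneg fun x => by unfold GG; positivity
  have hP : 0 ≤ ∫ x, pw (1 + (α - eta α)) x := integral_nonneg fun x => (pw_pos _ x).le
  have hL := b.L1
  have e1 := nu_sq b.npos
  have e2 : n * (lamN δ α n * tauN α n ^ 2) = δ ^ α * (Real.log n ^ (α / 2) * Real.log n ^ 2) := by
    rw [← mul_assoc (δ ^ α), ← seq_rho hδ h0 h2 b]; unfold tauN; ring
  have e3 : Real.log n ^ (α / 2) * Real.log n ^ 2 ≤ Real.log n ^ (3:ℝ) := by
    rw [← Real.rpow_natCast, ← Real.rpow_add (by linarith)]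
    exact Real.rpow_le_rpow_of_exponent_le hL (by push_cast; linarith)
  have e4 : 1 ≤ Real.log n ^ (3:ℝ) := Real.one_le_rpow hL (by norm_num)
  rw [bb_integral hσ h0]
  have hd : 0 < δ ^ α := by positivity
  calc (n:ℝ) * (nuN n ^ 2 * (∫ x, GG σ x) + lamN δ α n * tauN α n ^ 2 * ∫ x, pw (1 + (α - eta α)) x)
      = (n * nuN n ^ 2) * (∫ x, GG σ x) + (n * (lamN δ α n * tauN α n ^ 2)) * ∫ x, pw (1 + (α - eta α)) x := by ring
    _ = (∫ x, GG σ x) * 1 + δ ^ α * (Real.log n ^ (α / 2) * Real.log n ^ 2) * ∫ x, pw (1 + (α - eta α)) x := by rw [e1, e2]; ring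
    _ ≤ (∫ x, GG σ x) * Real.log n ^ (3:ℝ) + δ ^ α * Real.log n ^ (3:ℝ) * ∫ x, pw (1 + (α - eta α)) x := by gcongr
    _ = _ := by ring

end PartF3

section PartF4
def uu (δ α : ℝ) (j : Fin 3) (y : ℝ) : ℝ := if j = 1 then α / δ else Real.log δ - Real.log y + C1 α / C0 α

def sq (n : ℕ) : ℝ := Real.sqrt (Real.log n)
def Xn (α : ℝ) (n : ℕ) (y : ℝ) : ℝ := (sq n * y) ^ (-(1 + α))
def epsN (α : ℝ) (n : ℕ) : ℝ := (1 + Real.log (sq n)) * sq n ^ (-(α / 2))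
def Psi (σ δ α : ℝ) (n : ℕ) (j : Fin 3) (y : ℝ) : ℝ := sN σ δ α n j (sq n * y) / (rate n α * lamN δ α n * Xn α n y)
def WW (σ δ α : ℝ) (n : ℕ) (y : ℝ) : ℝ := lamN δ α n * Xn α n y / qN σ δ α n (sq n * y)

lemma sq_tendsto : Tendsto sq atTop atTop :=
  Real.tendsto_sqrt_atTop.comp (Real.tendsto_log_atTop.comp tendsto_natCast_atTop_atTop)

lemma C0_pos {α : ℝ} (h0 : 0 < α) (h2 : α < 2) : 0 < C0 α := by
  rw [← C0_cAlpha h0 h2]; exact cAlpha_pos h0 h2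

lemma eps_tendsto {α : ℝ} (h0 : 0 < α) : Tendsto (epsN α) atTop (𝓝 0) := by
  have a1 : Tendsto (fun s : ℝ => s ^ (-(α / 2))) atTop (𝓝 0) := tendsto_rpow_neg_atTop (by positivity)
  have a2 : Tendsto (fun s : ℝ => Real.log s * s ^ (-(α / 2))) atTop (𝓝 0) := by
    have := (isLittleO_log_rpow_atTop (r := α / 2) (by positivity)).tendsto_div_nhds_zero
    refine this.congr' ?_
    filter_upwards [eventually_gt_atTop 0] with s hs
    rw [Real.rpow_neg hs.le, div_eq_mul_inv]
  have := (a1.add a2).comp sq_tendsto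
  rw [add_zero] at this
  refine this.congr fun n => ?_
  simp only [Function.comp, epsN]; ring

variable {σ δ α : ℝ}

lemma Psi_main (hσ : 0 < σ) (hδ : 0 < δ) (h0 : 0 < α) (h2 : α < 2) {a : ℝ} (ha : 0 < a) :
    ∃ D : ℝ, 0 < D ∧ ∀ᶠ n in atTop, ∀ y, a ≤ y → ∀ j : Fin 3, j ≠ 0 →
      |Psi σ δ α n j y - C0 α * uu δ α j y| ≤ D * epsN α n := by
  obtain ⟨C, hC, hA⟩ := asymp (M := 1) hσ h0 h2 one_pos
  have hC0 := C0_pos h0 h2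
  set ap := a ^ (-(α / 2)) with hap
  have hap0 : 0 < ap := by positivity
  set D := C * ap * (α / δ + |Real.log δ| + 2) with hD
  have hD0 : 0 < D := by positivity
  refine ⟨D, hD0, ?_⟩
  filter_upwards [ev_basic hδ h0 h2, (lamN_tendsto hδ h2).eventually (ge_mem_nhds one_pos),
    sq_tendsto.eventually_ge_atTop (1 / a), sq_tendsto.eventually_ge_atTop 1] with n hb hl hs hs1 y hy j hj
  have hs0 : 0 < sq n := by linarith
  have hy0 : 0 < y := by linarith
  have hx1 : 1 ≤ sq n * y := by
    rw [div_le_iff₀ ha] at hs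
    exact hs.trans (by gcongr)
  obtain ⟨t0, t1, -⟩ := hA _ hb.lam0 hl _ hx1
  have hx0 : 0 < sq n * y := by linarith
  have hX : 0 < Xn α n y := by unfold Xn; positivity
  have hρ := hb.rho; have hlam := hb.lam0
  change |_ - Xn α n y * C0 α| ≤ C * (Xn α n y * _) at t0
  change |_ - Xn α n y * _| ≤ C * (Xn α n y * _) at t1
  set T0' := T0 σ (lamN δ α n) α (sq n * y) with hT0
  set T1' := T1 σ (lamN δ α n) α (sq n * y) with hT1
  set X := Xn α n y with hXX
  have hz : (sq n * y) ^ (-(α / 2)) ≤ sq n ^ (-(α / 2)) * ap := by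
    rw [Real.mul_rpow hs0.le hy0.le]
    gcongr
    exact Real.rpow_le_rpow_of_nonpos ha hy (by linarith)
  set z := sq n ^ (-(α / 2)) with hzz
  have hz0 : 0 < z := by positivity
  have hls : 0 ≤ Real.log (sq n) := Real.log_nonneg hs1
  have b0 : |T0' / X - C0 α| ≤ C * (z * ap) := by
    rw [show T0' / X - C0 α = (T0' - X * C0 α) / X by field_simp, abs_div, abs_of_pos hX, div_le_iff₀ hX]
    calc _ ≤ _ := t0
      _ ≤ C * (X * (z * ap)) := by gcongr
      _ = _ := by ring
  have b1 : |T1' / X - (C1 α - Real.log (sq n * y) * C0 α)| ≤ C * (z * ap) := by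
    rw [show T1' / X - (C1 α - Real.log (sq n * y) * C0 α) = (T1' - X * (C1 α - Real.log (sq n * y) * C0 α)) / X by field_simp, abs_div, abs_of_pos hX, div_le_iff₀ hX]
    calc _ ≤ _ := t1
      _ ≤ C * (X * (z * ap)) := by gcongr
      _ = _ := by ring
  have heps : epsN α n = (1 + Real.log (sq n)) * z := rfl
  have hk0 : 0 ≤ C * (z * ap) := by positivity
  have hj' : j = 1 ∨ j = 2 := by fin_cases j <;> simp_all
  rcases hj' with rfl | rfl
  · have e : Psi σ δ α n 1 y - C0 α * uu δ α 1 y = (α / δ) * (T0' / X - C0 α) := by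
      unfold Psi uu sN
      rw [SS_one hδ]
      change rate n α * (α / δ) * lamN δ α n * T0' / (rate n α * lamN δ α n * X) - _ = _
      simp only [if_true]
      field_simp
    rw [e, abs_mul, abs_of_pos (by positivity : 0 < α / δ), heps, hD]
    calc α / δ * |T0' / X - C0 α| ≤ α / δ * (C * (z * ap)) := by gcongr
      _ = (C * (z * ap)) * (α / δ) * 1 := by ring
      _ ≤ (C * (z * ap)) * (α / δ + |Real.log δ| + 2) * (1 + Real.log (sq n)) := by
          gcongr
          · linarith [abs_nonneg (Real.log δ)]
          · linarith
      _ = _ := by ring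
  · have e : Psi σ δ α n 2 y - C0 α * uu δ α 2 y = (Real.log δ + Real.log (sq n)) * (T0' / X - C0 α) +
        (T1' / X - (C1 α - Real.log (sq n * y) * C0 α)) := by
      unfold Psi uu sN
      rw [SS_two hδ h0 h2 hx0]
      change rate n α * lamN δ α n * ((Real.log δ + (Real.log n - mN n) / 2) * T0' + T1') / (rate n α * lamN δ α n * X) - _ = _
      have : (Real.log n - mN n) / 2 = Real.log (sq n) := by
        unfold mN sq
        rw [Real.log_sqrt (by linarith [hb.L1])]; ring
      rw [this, Real.log_mul hs0.ne' hy0.ne', if_neg (by decide)]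
      field_simp
      ring
    rw [e, heps, hD]
    calc _ ≤ |Real.log δ + Real.log (sq n)| * |T0' / X - C0 α| + |T1' / X - (C1 α - Real.log (sq n * y) * C0 α)| := by
          rw [← abs_mul]; exact abs_add_le _ _
      _ ≤ (|Real.log δ| + Real.log (sq n)) * (C * (z * ap)) + C * (z * ap) := by
          gcongr
          have := abs_add_le (Real.log δ) (Real.log (sq n))
          rwa [abs_of_nonneg hls] at this
      _ = (C * (z * ap)) * (|Real.log δ| + Real.log (sq n) + 1) := by ring
      _ ≤ (C * (z * ap)) * ((α / δ + |Real.log δ| + 2) * (1 + Real.log (sq n))) := by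
          refine mul_le_mul_of_nonneg_left ?_ hk0
          have : 0 ≤ α / δ := by positivity
          nlinarith [abs_nonneg (Real.log δ), mul_nonneg this hls, mul_nonneg (abs_nonneg (Real.log δ)) hls]
      _ = _ := by ring

lemma abs_log_le {b a : ℝ} (hb : 0 < b) (ha : 0 < a) : ∃ K : ℝ, 0 < K ∧ ∀ y, a ≤ y → 1 + |Real.log y| ≤ K * y ^ b := by
  refine ⟨(1 + |Real.log a|) * a ^ (-b) + 1 / b, by positivity, fun y hy => ?_⟩
  have hy0 : 0 < y := by linarith
  have h1 : Real.log y ≤ y ^ b / b := Real.log_le_rpow_div hy0.le hb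
  have h2 : Real.log a ≤ Real.log y := Real.log_le_log ha hy
  have h3 : a ^ b ≤ y ^ b := Real.rpow_le_rpow ha.le hy hb.le
  have h4 : 1 ≤ a ^ (-b) * y ^ b := by
    rw [Real.rpow_neg ha.le]
    have : 0 < a ^ b := by positivity
    rw [inv_mul_eq_div, le_div_iff₀ this]; linarith
  have h5 : (1 + |Real.log a|) * 1 ≤ (1 + |Real.log a|) * (a ^ (-b) * y ^ b) := by gcongr
  have h6 : |Real.log y| ≤ |Real.log a| + y ^ b / b := by
    have : 0 < y ^ b / b := by positivity
    rw [abs_le]; constructor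
    · linarith [neg_abs_le (Real.log a)]
    · linarith [abs_nonneg (Real.log a)]
  calc 1 + |Real.log y| ≤ (1 + |Real.log a|) * (a ^ (-b) * y ^ b) + y ^ b / b := by linarith
    _ = _ := by ring

lemma uu_bound (hδ : 0 < δ) (h0 : 0 < α) {a : ℝ} (ha : 0 < a) : ∃ K : ℝ, 0 < K ∧ ∀ y, a ≤ y → ∀ j, 1 + |uu δ α j y| ≤ K * y ^ (α / 4) := by
  obtain ⟨K, hK, h⟩ := abs_log_le (b := α / 4) (by positivity) ha
  refine ⟨(1 + α / δ + |Real.log δ| + |C1 α / C0 α|) * K, by positivity, fun y hy j => ?_⟩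
  have h1 := h y hy
  have hl := abs_nonneg (Real.log y)
  have hp : 0 < α / δ := by positivity
  rw [mul_assoc]
  refine le_trans ?_ (mul_le_mul_of_nonneg_left h1 (by positivity))
  unfold uu
  split_ifs
  · rw [abs_of_pos hp]
    nlinarith [abs_nonneg (Real.log δ), abs_nonneg (C1 α / C0 α), mul_nonneg hl hp.le, mul_nonneg hl (abs_nonneg (Real.log δ)), mul_nonneg hl (abs_nonneg (C1 α / C0 α))]
  · have : |Real.log δ - Real.log y + C1 α / C0 α| ≤ |Real.log δ| + |Real.log y| + |C1 α / C0 α| :=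
      (abs_add_le _ _).trans (by gcongr; exact abs_sub _ _)
    nlinarith [abs_nonneg (Real.log δ), abs_nonneg (C1 α / C0 α), mul_nonneg hl hp.le, mul_nonneg hl (abs_nonneg (Real.log δ)), mul_nonneg hl (abs_nonneg (C1 α / C0 α))]

lemma int_id (hδ : 0 < δ) (h0 : 0 < α) (h2 : α < 2) {n : ℕ} (hb : Basic δ α n) {y : ℝ} (hy : 0 < y) (j k : Fin 3)
    (hq : 0 < qN σ δ α n (sq n * y)) :
    n * (sq n * (sN σ δ α n j (sq n * y) * sN σ δ α n k (sq n * y) / qN σ δ α n (sq n * y))) =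
      δ ^ α * (y ^ (-(1 + α)) * (Psi σ δ α n j y * Psi σ δ α n k y * WW σ δ α n y)) := by
  have hL := hb.L1
  have hs0 : 0 < sq n := by unfold sq; positivity
  have hX : 0 < Xn α n y := by unfold Xn; positivity
  have hρ := hb.rho; have hlam := hb.lam0
  have e1 := seq_rho hδ h0 h2 hb
  have e2 : Real.log n ^ (α / 2) * sq n * Xn α n y = y ^ (-(1 + α)) := by
    unfold Xn
    rw [Real.mul_rpow hs0.le hy.le]
    have : Real.log n ^ (α / 2) = sq n ^ α := by
      unfold sq; rw [Real.sqrt_eq_rpow, ← Real.rpow_mul (by linarith)]; congr 1; ring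
    rw [this]
    have e3 : sq n ^ α * sq n ^ (1:ℝ) * sq n ^ (-(1 + α)) = 1 := by
      rw [← Real.rpow_add hs0, ← Real.rpow_add hs0, ← Real.rpow_zero (sq n)]; congr 1; ring
    rw [Real.rpow_one] at e3
    rw [← mul_assoc, e3, one_mul]
  unfold Psi WW
  have e4 : (n:ℝ) * rate n α ^ 2 * lamN δ α n * sq n * Xn α n y = δ ^ α * y ^ (-(1 + α)) := by
    rw [e1, ← e2]; ring
  rw [← mul_assoc (δ ^ α), ← e4]
  field_simp

end PartF4

section PartF5
variable {σ δ α : ℝ}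

lemma phi_sq {n : ℕ} (hn : 0 < n) (hL : 1 ≤ Real.log n) (σ y : ℝ) :
    phiS σ (sq n * y) = (Real.sqrt (2 * Real.pi) * σ)⁻¹ * (n:ℝ) ^ (-(y ^ 2 / (2 * σ ^ 2))) := by
  have hn' : (0:ℝ) < n := by exact_mod_cast hn
  unfold phiS sq
  rw [Real.rpow_def_of_pos hn', mul_pow, Real.sq_sqrt (by linarith)]
  congr 2; ring

def ystar (σ α : ℝ) : ℝ := σ * Real.sqrt (2 - α)
lemma ystar_pos (hσ : 0 < σ) (h2 : α < 2) : 0 < ystar σ α := by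
  have : 0 < 2 - α := by linarith
  unfold ystar; positivity
lemma ystar_sq (hσ : 0 < σ) (h2 : α < 2) : ystar σ α ^ 2 / (2 * σ ^ 2) = (2 - α) / 2 := by
  unfold ystar; rw [mul_pow, Real.sq_sqrt (by linarith)]; field_simp

lemma ratio_eq (hσ : 0 < σ) (hδ : 0 < δ) {n : ℕ} (hb : Basic δ α n) {y : ℝ} (hy : 0 < y) :
    phiS σ (sq n * y) / (lamN δ α n * Xn α n y) = (((Real.sqrt (2 * Real.pi) * σ)⁻¹ / δ ^ α) * y ^ (1 + α)) *
      (Real.log n ^ ((1 + α) / 2) * (n:ℝ) ^ (-(y ^ 2 / (2 * σ ^ 2) - (2 - α) / 2))) := by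
  have hn' : (0:ℝ) < n := by exact_mod_cast hb.npos
  have hL := hb.L1
  have hs0 : 0 < sq n := by unfold sq; positivity
  rw [phi_sq hb.npos hb.L1, lamN_eq hδ hb.npos]
  unfold Xn
  have e1 : (sq n * y) ^ (-(1 + α)) = (Real.log n ^ ((1 + α) / 2) * y ^ (1 + α))⁻¹ := by
    rw [Real.rpow_neg (by positivity), Real.mul_rpow hs0.le hy.le]
    congr 2
    unfold sq
    rw [Real.sqrt_eq_rpow, ← Real.rpow_mul (by linarith)]; congr 1; ring
  have e2 : (n:ℝ) ^ (-(y ^ 2 / (2 * σ ^ 2) - (2 - α) / 2)) = (n:ℝ) ^ (-(y ^ 2 / (2 * σ ^ 2))) / (n:ℝ) ^ (α / 2 - 1) := by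
    rw [← Real.rpow_sub hn']; congr 1; ring
  rw [e1, e2]
  have : 0 < (n:ℝ) ^ (α / 2 - 1) := by positivity
  have : 0 < Real.log n ^ ((1 + α) / 2) := by positivity
  have : 0 < y ^ (1 + α) := by positivity
  have : 0 < δ ^ α := by positivity
  field_simp

lemma WW_gt (hσ : 0 < σ) (hδ : 0 < δ) (h0 : 0 < α) (h2 : α < 2) {y : ℝ} (hy : ystar σ α < y) :
    Tendsto (fun n => WW σ δ α n y) atTop (𝓝 (C0 α)⁻¹) := by
  obtain ⟨C, hC, hA⟩ := asymp (M := 1) hσ h0 h2 one_pos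
  have hC0 := C0_pos h0 h2
  have hys := ystar_pos hσ h2
  have hy0 : 0 < y := by linarith
  have hexp : 0 < y ^ 2 / (2 * σ ^ 2) - (2 - α) / 2 := by
    rw [← ystar_sq hσ h2, sub_pos]; gcongr
  have r1 : Tendsto (fun n => phiS σ (sq n * y) / (lamN δ α n * Xn α n y)) atTop (𝓝 0) := by
    refine (polylog_c (((Real.sqrt (2 * Real.pi) * σ)⁻¹ / δ ^ α) * y ^ (1 + α)) ((1 + α) / 2) hexp).congr' ?_
    filter_upwards [ev_basic hδ h0 h2] with n hb
    rw [ratio_eq hσ hδ hb hy0]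
  have r2 : Tendsto (fun n => qN σ δ α n (sq n * y) / (lamN δ α n * Xn α n y) -
      phiS σ (sq n * y) / (lamN δ α n * Xn α n y) - C0 α) atTop (𝓝 0) := by
    have t : Tendsto (fun n => C * (sq n * y) ^ (-(α / 2))) atTop (𝓝 0) := by
      have := ((tendsto_rpow_neg_atTop (y := α / 2) (by positivity)).comp (sq_tendsto.atTop_mul_const hy0)).const_mul C
      simpa using this
    refine squeeze_zero_norm' ?_ t
    filter_upwards [ev_basic hδ h0 h2, (lamN_tendsto hδ h2).eventually (ge_mem_nhds one_pos),
      (sq_tendsto.atTop_mul_const hy0).eventually_ge_atTop 1] with n hb hl hx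
    obtain ⟨-, -, t⟩ := hA _ hb.lam0 hl _ hx
    have hX : 0 < Xn α n y := by unfold Xn; have : 0 < sq n * y := (by linarith); positivity
    change |qN σ δ α n (sq n * y) - phiS σ (sq n * y) - lamN δ α n * (Xn α n y * C0 α)| ≤ lamN δ α n * (C * (Xn α n y * _)) at t
    have hlam := hb.lam0
    rw [show qN σ δ α n (sq n * y) / (lamN δ α n * Xn α n y) -
      phiS σ (sq n * y) / (lamN δ α n * Xn α n y) - C0 α = (qN σ δ α n (sq n * y) - phiS σ (sq n * y) - lamN δ α n * (Xn α n y * C0 α)) / (lamN δ α n * Xn α n y) by field_simp,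
      Real.norm_eq_abs, abs_div, abs_of_pos (by positivity : 0 < lamN δ α n * Xn α n y), div_le_iff₀ (by positivity)]
    refine t.trans (le_of_eq (by ring))
  have r3 : Tendsto (fun n => qN σ δ α n (sq n * y) / (lamN δ α n * Xn α n y)) atTop (𝓝 (C0 α)) := by
    have := (r2.add r1).add_const (C0 α)
    simp only [zero_add, add_zero] at this
    refine this.congr fun n => ?_
    ring
  refine (r3.inv₀ hC0.ne').congr fun n => ?_
  unfold WW; rw [inv_div]

lemma WW_lt (hσ : 0 < σ) (hδ : 0 < δ) (h0 : 0 < α) (h2 : α < 2) {y : ℝ} (hy0 : 0 < y) (hy : y < ystar σ α) :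
    Tendsto (fun n => WW σ δ α n y) atTop (𝓝 0) := by
  obtain ⟨c, C, hB⟩ := ev_Bd hσ hδ h0 h2
  have hexp : 0 < (2 - α) / 2 - y ^ 2 / (2 * σ ^ 2) := by
    rw [← ystar_sq hσ h2, sub_pos]; gcongr
  have r1 : Tendsto (fun n => 2 * (phiS σ (sq n * y) / (lamN δ α n * Xn α n y))⁻¹) atTop (𝓝 0) := by
    refine (polylog_c (2 * (((Real.sqrt (2 * Real.pi) * σ)⁻¹ / δ ^ α) * y ^ (1 + α))⁻¹) (-((1 + α) / 2)) hexp).congr' ?_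
    filter_upwards [ev_basic hδ h0 h2] with n hb
    have hn' : (0:ℝ) < n := by exact_mod_cast hb.npos
    rw [ratio_eq hσ hδ hb hy0]
    generalize (Real.sqrt (2 * Real.pi) * σ)⁻¹ / δ ^ α * y ^ (1 + α) = A
    rw [mul_inv A, mul_inv (Real.log n ^ ((1 + α) / 2)), ← Real.rpow_neg (by linarith [hb.L1]), ← Real.rpow_neg hn'.le, neg_neg, neg_sub, mul_assoc]
  refine squeeze_zero' ?_ ?_ r1
  · filter_upwards [hB, ev_basic hδ h0 h2] with n b hb
    have := b.qpos (sq n * y); have := b.lam0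
    have : 0 ≤ Xn α n y := by unfold Xn sq; positivity
    unfold WW; positivity
  · filter_upwards [hB, ev_basic hδ h0 h2] with n b hb
    have h1 := b.q1 (sq n * y); have := b.lam0
    have hφ := phiS_pos hσ (sq n * y)
    have : 0 ≤ Xn α n y := by unfold Xn sq; positivity
    unfold WW
    rw [inv_div]
    calc lamN δ α n * Xn α n y / qN σ δ α n (sq n * y) ≤ lamN δ α n * Xn α n y / (phiS σ (sq n * y) / 2) := by gcongr
      _ = _ := by field_simp

lemma sN_abs (n : ℕ) {j : Fin 3} (hj : j ≠ 0) (x : ℝ) : sN σ δ α n j |x| = sN σ δ α n j x := by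
  unfold sN SS
  rw [Pi.single_eq_of_ne hj.symm]
  simp [TT]

/-- near part -/
lemma near_part (hσ : 0 < σ) (hδ : 0 < δ) (h0 : 0 < α) (h2 : α < 2) {j k : Fin 3} (hj : j ≠ 0) (hk : k ≠ 0) :
    Tendsto (fun n : ℕ => n * ∫ x in Ioc 0 (sq n * (ystar σ α / 2)), sN σ δ α n j x * sN σ δ α n k x / qN σ δ α n x) atTop (𝓝 0) := by
  obtain ⟨c, C, hB⟩ := ev_Bd hσ hδ h0 h2
  set a := ystar σ α / 2 with ha
  have ha0 : 0 < a := by have := ystar_pos hσ h2; positivity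
  have hexp : a ^ 2 / (2 * σ ^ 2) = (2 - α) / 8 := by
    have := ystar_sq hσ h2
    rw [ha, div_pow, div_right_comm, this]; ring
  set kk := (Real.sqrt (2 * Real.pi) * σ)⁻¹ with hkk
  have hkk0 : 0 < kk := by positivity
  have t := polylog_c (C ^ 2 * 2 * a / kk * δ ^ α * δ ^ α) (α / 2 + 2 + 1) (a := (2 - α) * 3 / 8) (by linarith)
  refine squeeze_zero_norm' ?_ t
  filter_upwards [hB, ev_basic hδ h0 h2] with n b hb
  have hn' : (0:ℝ) < n := by exact_mod_cast hb.npos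
  have hL := hb.L1
  have hs0 : 0 < sq n := by unfold sq; positivity
  have hlam := b.lam0; have hτ := b.τ0; have hC := b.C0
  have hφ := phiS_pos hσ (sq n * a)
  have bound : ∀ x ∈ Ioc 0 (sq n * a), ‖sN σ δ α n j x * sN σ δ α n k x / qN σ δ α n x‖ ≤
      (C * lamN δ α n * tauN α n) ^ 2 * (2 / phiS σ (sq n * a)) := by
    intro x hx
    have hq := b.qpos x
    have s1 : ∀ i : Fin 3, i ≠ 0 → |sN σ δ α n i x| ≤ C * lamN δ α n * tauN α n := fun i hi => by
      refine (b.sj i hi x).trans ?_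
      have := pw_le1 (a := 1 + (α - eta α)) (by linarith [eta_le h0]) x
      exact mul_le_of_le_one_right (by positivity) this
    have hq' : phiS σ (sq n * a) / 2 ≤ qN σ δ α n x := by
      have := phiS_anti hσ (x := x) (y := sq n * a) (by rw [abs_of_pos hx.1]; exact hx.2)
      linarith [b.q1 x]
    rw [norm_div, norm_mul, Real.norm_of_nonneg hq.le]
    calc ‖sN σ δ α n j x‖ * ‖sN σ δ α n k x‖ / qN σ δ α n x ≤
        (C * lamN δ α n * tauN α n) * (C * lamN δ α n * tauN α n) / (phiS σ (sq n * a) / 2) := by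
          gcongr
          · exact s1 j hj
          · exact s1 k hk
      _ = _ := by field_simp
  have := norm_setIntegral_le_of_norm_le_const (μ := volume) (s := Ioc 0 (sq n * a)) (by simp) bound
  rw [norm_mul, Real.norm_of_nonneg hn'.le]
  have hv : volume.real (Ioc 0 (sq n * a)) = sq n * a := by
    rw [Real.volume_real_Ioc_of_le (by positivity)]; simp
  rw [hv] at this
  refine (mul_le_mul_of_nonneg_left this hn'.le).trans ?_
  have e2 : n * (lamN δ α n * tauN α n ^ 2) = δ ^ α * (Real.log n ^ (α / 2) * Real.log n ^ 2) := by
    rw [← mul_assoc (δ ^ α), ← seq_rho hδ h0 h2 hb]; unfold tauN; ring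
  have e3 : lamN δ α n / phiS σ (sq n * a) = δ ^ α / kk * (n:ℝ) ^ (-((2 - α) * 3 / 8)) := by
    rw [phi_sq hb.npos hb.L1, lamN_eq hδ hb.npos, hexp]
    have : (n:ℝ) ^ (-((2 - α) * 3 / 8)) = (n:ℝ) ^ (α / 2 - 1) / (n:ℝ) ^ (-((2 - α) / 8)) := by
      rw [← Real.rpow_sub hn']; congr 1; ring
    rw [this]
    have : 0 < (n:ℝ) ^ (-((2 - α) / 8)) := by positivity
    rw [← hkk]
    field_simp
  have hsL : sq n ≤ Real.log n := by
    unfold sq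
    exact Real.sqrt_le_iff.2 ⟨by linarith, by nlinarith⟩
  have e5 : Real.log n ^ (α / 2 + 2 + 1) = Real.log n ^ (α / 2) * Real.log n ^ 2 * Real.log n := by
    rw [Real.rpow_add (by linarith), Real.rpow_add (by linarith), Real.rpow_one]; norm_num
  calc (n:ℝ) * ((C * lamN δ α n * tauN α n) ^ 2 * (2 / phiS σ (sq n * a)) * (sq n * a))
      = C ^ 2 * 2 * a * (n * (lamN δ α n * tauN α n ^ 2)) * (lamN δ α n / phiS σ (sq n * a)) * sq n := by ring
    _ = C ^ 2 * 2 * a * (δ ^ α * (Real.log n ^ (α / 2) * Real.log n ^ 2)) * (δ ^ α / kk * (n:ℝ) ^ (-((2 - α) * 3 / 8))) * sq n := by rw [e2, e3]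
    _ ≤ C ^ 2 * 2 * a * (δ ^ α * (Real.log n ^ (α / 2) * Real.log n ^ 2)) * (δ ^ α / kk * (n:ℝ) ^ (-((2 - α) * 3 / 8))) * Real.log n := by gcongr
    _ = _ := by rw [e5]; ring

lemma far_part (hσ : 0 < σ) (hδ : 0 < δ) (h0 : 0 < α) (h2 : α < 2) {j k : Fin 3} (hj : j ≠ 0) (hk : k ≠ 0) :
    Tendsto (fun n : ℕ => n * ∫ x in Ioi (sq n * (ystar σ α / 2)), sN σ δ α n j x * sN σ δ α n k x / qN σ δ α n x) atTop
      (𝓝 (δ ^ α * (C0 α * ∫ y in Ioi (ystar σ α), y ^ (-(1 + α)) * (uu δ α j y * uu δ α k y)))) := by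
  obtain ⟨c, C, hB⟩ := ev_Bd hσ hδ h0 h2
  set a := ystar σ α / 2 with ha
  have hys := ystar_pos hσ h2
  have ha0 : 0 < a := by positivity
  have hC0 := C0_pos h0 h2
  obtain ⟨D, hD, hPsi⟩ := Psi_main hσ hδ h0 h2 ha0
  obtain ⟨K, hK, huu⟩ := uu_bound hδ h0 ha0
  have heps := eps_tendsto h0
  have heps1 : ∀ᶠ n in atTop, epsN α n ≤ 1 := heps.eventually (ge_mem_nhds one_pos)
  -- rewriting
  have e1 : (fun n : ℕ => δ ^ α * ∫ y in Ioi a, y ^ (-(1 + α)) * (Psi σ δ α n j y * Psi σ δ α n k y * WW σ δ α n y)) =ᶠ[atTop]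
      (fun n : ℕ => n * ∫ x in Ioi (sq n * a), sN σ δ α n j x * sN σ δ α n k x / qN σ δ α n x) := by
    filter_upwards [hB, ev_basic hδ h0 h2] with n b hb
    have hL := hb.L1
    have hs0 : 0 < sq n := by unfold sq; positivity
    have := integral_comp_mul_left_Ioi (fun x => sN σ δ α n j x * sN σ δ α n k x / qN σ δ α n x) a hs0
    have h' : ∫ x in Ioi (sq n * a), sN σ δ α n j x * sN σ δ α n k x / qN σ δ α n x =
        sq n * ∫ y in Ioi a, sN σ δ α n j (sq n * y) * sN σ δ α n k (sq n * y) / qN σ δ α n (sq n * y) := by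
      rw [this, smul_eq_mul, ← mul_assoc, mul_inv_cancel₀ hs0.ne', one_mul]
    rw [h', ← integral_const_mul, ← integral_const_mul, ← integral_const_mul]
    refine setIntegral_congr_fun measurableSet_Ioi fun y hy => ?_
    have hy0 : 0 < y := lt_trans ha0 hy
    exact (int_id hδ h0 h2 hb hy0 j k (b.qpos _)).symm
  refine Tendsto.congr' e1 (Tendsto.const_mul _ ?_)
  have e2 : C0 α * ∫ y in Ioi (ystar σ α), y ^ (-(1 + α)) * (uu δ α j y * uu δ α k y) =
      ∫ y in Ioi a, (Ioi (ystar σ α)).indicator (fun y => y ^ (-(1 + α)) * ((C0 α * uu δ α j y) * (C0 α * uu δ α k y) * (C0 α)⁻¹)) y := by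
    rw [setIntegral_indicator measurableSet_Ioi, Set.inter_eq_self_of_subset_right (Ioi_subset_Ioi (by rw [ha]; linarith)), ← integral_const_mul]
    refine setIntegral_congr_fun measurableSet_Ioi fun y _ => ?_
    field_simp
  rw [e2]
  refine tendsto_integral_filter_of_dominated_convergence
    (fun y => ((C0 α * K + D * K) ^ 2 * (c⁻¹ * 2 ^ (1 + α))) * y ^ (-(1 + α / 2))) ?_ ?_ ?_ ?_
  · filter_upwards [hB, ev_basic hδ h0 h2] with n b hb
    have hL := hb.L1
    have hs0 : 0 < sq n := by unfold sq; positivity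
    have hm : Continuous (fun y : ℝ => sq n * y) := by fun_prop
    have m1 : ∀ i, Measurable (fun y => Psi σ δ α n i y) := fun i => by
      unfold Psi Xn
      exact ((b.Sc i).comp hm).measurable.div (measurable_const.mul (hm.measurable.pow_const _))
    have m2 : Measurable (fun y => WW σ δ α n y) := by
      unfold WW Xn
      exact (measurable_const.mul (hm.measurable.pow_const _)).div (b.qc.comp hm).measurable
    exact ((measurable_id.pow_const _).mul (((m1 j).mul (m1 k)).mul m2)).aestronglyMeasurable
  · filter_upwards [hB, ev_basic hδ h0 h2, hPsi, heps1, sq_tendsto.eventually_ge_atTop (1 / a)] with n b hb hP he hs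
    filter_upwards [ae_restrict_mem measurableSet_Ioi] with y hy
    have hy0 : 0 < y := lt_trans ha0 hy
    have hya : a ≤ y := le_of_lt hy
    have hx1 : 1 ≤ sq n * y := by
      rw [div_le_iff₀ ha0] at hs
      have : 0 ≤ sq n := by unfold sq; positivity
      exact hs.trans (by gcongr)
    have hx0 : 0 < sq n * y := by linarith
    have p1 : ∀ i : Fin 3, i ≠ 0 → |Psi σ δ α n i y| ≤ (C0 α * K + D * K) * y ^ (α / 4) := fun i hi => by
      have h1 := hP y hya i hi
      have h2 := huu y hya i
      have h3 : |Psi σ δ α n i y| ≤ |Psi σ δ α n i y - C0 α * uu δ α i y| + C0 α * |uu δ α i y| := by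
        have := abs_add_le (Psi σ δ α n i y - C0 α * uu δ α i y) (C0 α * uu δ α i y)
        rw [abs_mul, abs_of_pos hC0] at this; simpa using this
      have h4 : D * epsN α n ≤ D * (K * y ^ (α / 4)) := by
        gcongr; linarith [abs_nonneg (uu δ α i y)]
      have h5 : C0 α * |uu δ α i y| ≤ C0 α * (K * y ^ (α / 4)) := by gcongr; linarith
      calc _ ≤ _ := h3
        _ ≤ D * (K * y ^ (α / 4)) + C0 α * (K * y ^ (α / 4)) := by linarith
        _ = _ := by ring
    have w1 : |WW σ δ α n y| ≤ c⁻¹ * 2 ^ (1 + α) := by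
      have hq := b.qpos (sq n * y); have hlam := b.lam0; have hc := b.c0
      have hX : 0 < Xn α n y := by unfold Xn; positivity
      unfold WW
      rw [abs_of_nonneg (by positivity), div_le_iff₀ hq]
      have hX2 : Xn α n y ≤ 2 ^ (1 + α) * pw (1 + α) (sq n * y) := by
        unfold Xn pw
        rw [abs_of_pos hx0, Real.rpow_neg hx0.le, Real.rpow_neg (by linarith), ← div_eq_mul_inv, le_div_iff₀ (by positivity), inv_mul_le_iff₀ (by positivity), ← Real.mul_rpow hx0.le (by norm_num)]
        gcongr; linarith
      calc lamN δ α n * Xn α n y ≤ lamN δ α n * (2 ^ (1 + α) * pw (1 + α) (sq n * y)) := by gcongr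
        _ = c⁻¹ * 2 ^ (1 + α) * (c * lamN δ α n * pw (1 + α) (sq n * y)) := by field_simp
        _ ≤ _ := by gcongr; exact b.q2 _
    have ey : y ^ (-(1 + α / 2)) = y ^ (-(1 + α)) * (y ^ (α / 4) * y ^ (α / 4)) := by
      rw [← Real.rpow_add hy0, ← Real.rpow_add hy0]; congr 1; ring
    rw [norm_mul, norm_mul, norm_mul, Real.norm_of_nonneg (by positivity : 0 ≤ y ^ (-(1 + α)))]
    calc _ ≤ y ^ (-(1 + α)) * (((C0 α * K + D * K) * y ^ (α / 4)) * ((C0 α * K + D * K) * y ^ (α / 4)) * (c⁻¹ * 2 ^ (1 + α))) := by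
          gcongr
          · exact p1 j hj
          · exact p1 k hk
          · exact w1
      _ = _ := by rw [ey]; ring
  · exact (integrableOn_Ioi_rpow_of_lt (by linarith) ha0).const_mul _
  · have hne : ∀ᵐ y ∂(volume.restrict (Ioi a)), y ≠ ystar σ α :=
      ae_restrict_of_ae (by simp [ae_iff])
    filter_upwards [ae_restrict_mem measurableSet_Ioi, hne] with y hy hyn
    have hy0 : 0 < y := lt_trans ha0 hy
    have hP : ∀ i : Fin 3, i ≠ 0 → Tendsto (fun n => Psi σ δ α n i y) atTop (𝓝 (C0 α * uu δ α i y)) := fun i hi => by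
      rw [tendsto_iff_norm_sub_tendsto_zero]
      have t : Tendsto (fun n => D * epsN α n) atTop (𝓝 0) := by simpa using heps.const_mul D
      refine squeeze_zero' (Eventually.of_forall fun n => norm_nonneg _) ?_ t
      filter_upwards [hPsi] with n h using h y (le_of_lt hy) i hi
    rcases lt_or_gt_of_ne hyn with h | h
    · rw [indicator_of_notMem (by simpa using h.le)]
      have := ((((hP j hj).mul (hP k hk)).mul (WW_lt hσ hδ h0 h2 hy0 h))).const_mul (y ^ (-(1 + α)))
      simpa using this
    · rw [indicator_of_mem (by simpa using h)]
      exact ((((hP j hj).mul (hP k hk)).mul (WW_gt hσ hδ h0 h2 h))).const_mul (y ^ (-(1 + α)))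

end PartF5

section PartF6
variable {σ δ α : ℝ}

lemma qN_int (hσ : 0 < σ) (h0 : 0 < α) (h2 : α < 2) {n : ℕ} (hl : 0 < lamN δ α n) : Integrable (qN σ δ α n) :=
  qf_int hσ hl.le h0 h2

lemma cov_int {c C lam ν τ : ℝ} {q : ℝ → ℝ} {S : Fin 3 → ℝ → ℝ} (b : Bd σ α c C lam ν τ q S) (hq : Integrable q) (j k : Fin 3) :
    Integrable (fun x => S j x * S k x / q x) := by
  have i : Integrable (fun x => S j x ^ 4 / q x ^ 3 + S k x ^ 4 / q x ^ 3 + q x) := ((m4_int b j).add (m4_int b k)).add hq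
  refine i.mono' ?_ (Eventually.of_forall fun x => ?_)
  · exact ((b.Sc j).mul (b.Sc k)).div b.qc (fun x => (b.qpos x).ne') |>.aestronglyMeasurable
  · have h := b.qpos x
    obtain ⟨t, ht⟩ : ∃ t, S j x = t * q x := ⟨S j x / q x, by field_simp⟩
    obtain ⟨s, hs⟩ : ∃ s, S k x = s * q x := ⟨S k x / q x, by field_simp⟩
    rw [ht, hs]
    have e : ∀ u : ℝ, (u * q x) ^ 4 / q x ^ 3 = u ^ 4 * q x := fun u => by field_simp
    rw [e, e, show t * q x * (s * q x) / q x = t * s * q x by field_simp, norm_mul, Real.norm_of_nonneg h.le]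
    have : ‖t * s‖ ≤ t ^ 4 + s ^ 4 + 1 := by
      rw [Real.norm_eq_abs, abs_le]
      constructor <;> nlinarith [sq_nonneg (t - s), sq_nonneg (t + s), sq_nonneg (t ^ 2 - 1), sq_nonneg (s ^ 2 - 1), sq_nonneg (t ^ 2), sq_nonneg (s ^ 2)]
    calc _ ≤ (t ^ 4 + s ^ 4 + 1) * q x := by gcongr
      _ = _ := by ring

lemma lim_jk0 (hσ : 0 < σ) (hδ : 0 < δ) (h0 : 0 < α) (h2 : α < 2) {j k : Fin 3} (hj : j ≠ 0) (hk : k ≠ 0) :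
    Tendsto (fun n : ℕ => n * ∫ x, sN σ δ α n j x * sN σ δ α n k x / qN σ δ α n x) atTop
      (𝓝 (2 * (δ ^ α * (C0 α * ∫ y in Ioi (ystar σ α), y ^ (-(1 + α)) * (uu δ α j y * uu δ α k y))))) := by
  obtain ⟨c, C, hB⟩ := ev_Bd hσ hδ h0 h2
  have t := ((near_part hσ hδ h0 h2 hj hk).add (far_part hσ hδ h0 h2 hj hk)).const_mul 2
  rw [zero_add] at t
  refine t.congr' ?_
  filter_upwards [hB] with n b
  set g : ℝ → ℝ := fun x => sN σ δ α n j x * sN σ δ α n k x / qN σ δ α n x with hg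
  have hs : 0 ≤ sq n * (ystar σ α / 2) := by
    have := ystar_pos hσ h2; unfold sq; positivity
  have ev : ∀ x, g x = g |x| := fun x => by
    simp only [hg]; rw [sN_abs n hj, sN_abs n hk]; unfold qN; rw [qf_abs]
  have hi : Integrable g := by
    exact cov_int b (qN_int hσ h0 h2 b.lam0) j k
  have e1 : ∫ x, g x = 2 * ∫ x in Ioi (0:ℝ), g x := by
    rw [← integral_comp_abs (f := g)]; exact integral_congr_ae (Eventually.of_forall ev)
  have e2 : ∫ x in Ioi (0:ℝ), g x = (∫ x in Ioc 0 (sq n * (ystar σ α / 2)), g x) + ∫ x in Ioi (sq n * (ystar σ α / 2)), g x := by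
    rw [← setIntegral_union (Ioc_disjoint_Ioi le_rfl) measurableSet_Ioi hi.integrableOn hi.integrableOn, Ioc_union_Ioi_eq_Ioi hs]
  rw [e1, e2]; ring

/-- the limit integral -/
lemma ftc_int (hδ : 0 < δ) (h0 : 0 < α) {a : ℝ} (ha : 0 < a) (k A B D : ℝ) :
    ∫ y in Ioi a, y ^ (-(1 + α)) * (A + B * (Real.log δ - Real.log y + k) + D * (Real.log δ - Real.log y + k) ^ 2) =
      a ^ (-α) / α * (A + B * ((Real.log δ - Real.log a + k) - 1 / α) +
        D * ((Real.log δ - Real.log a + k - 1 / α) ^ 2 + 1 / α ^ 2)) := by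
  set F : ℝ → ℝ := fun y => -(y ^ (-α) / α * (A + B * ((Real.log δ - Real.log y + k) - 1 / α) +
        D * ((Real.log δ - Real.log y + k - 1 / α) ^ 2 + 1 / α ^ 2))) with hF
  have hd : ∀ y, 0 < y → HasDerivAt F (y ^ (-(1 + α)) * (A + B * (Real.log δ - Real.log y + k) + D * (Real.log δ - Real.log y + k) ^ 2)) y := by
    intro y hy
    have d1 : HasDerivAt (fun y : ℝ => y ^ (-α)) (-α * y ^ (-α - 1)) y := Real.hasDerivAt_rpow_const (Or.inl hy.ne')
    have d2 : HasDerivAt (fun y : ℝ => Real.log δ - Real.log y + k - 1 / α) (-y⁻¹) y :=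
      (((Real.hasDerivAt_log hy.ne').const_sub (Real.log δ)).add_const k).sub_const _
    have d3 := ((d1.div_const α).mul (((d2.const_mul B).const_add A).add (((d2.pow 2).add_const (1 / α ^ 2)).const_mul D))).neg
    refine d3.congr_deriv ?_
    have e : y ^ (-α) = y ^ (-(1 + α)) * y := by
      rw [← Real.rpow_add_one hy.ne']; congr 1; ring
    rw [show -α - 1 = -(1 + α) by ring]
    simp only [Pi.add_apply, Pi.mul_apply, Pi.pow_apply]
    rw [e]
    have hα : α * α⁻¹ = 1 := mul_inv_cancel₀ h0.ne'
    have hyy : y * y⁻¹ = 1 := mul_inv_cancel₀ hy.ne'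
    simp only [div_eq_mul_inv, one_mul, mul_inv, ← inv_pow, Nat.cast_ofNat, Nat.add_one_sub_one, pow_one, Nat.reduceSub]
    generalize α⁻¹ = ai at *
    generalize y⁻¹ = yi at *
    generalize Real.log y = ly
    generalize Real.log δ = ld
    generalize y ^ (-(1 + α)) = Y
    generalize hv : ld - ly + k = v
    linear_combination (Y * (A + B * (v - ai) + D * ((v - ai) ^ 2 + ai ^ 2)) ) * hα + (Y * ai * (B + 2 * D * (v - ai))) * hyy
  have hpos : 0 < α / 2 := by positivity
  have lim : Tendsto F atTop (𝓝 0) := by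
    have l0 : Tendsto (fun y : ℝ => y ^ (-α)) atTop (𝓝 0) := tendsto_rpow_neg_atTop h0
    have lk : ∀ m : ℝ, Tendsto (fun y : ℝ => Real.log y ^ m * y ^ (-α)) atTop (𝓝 0) := by
      intro m
      refine ((isLittleO_log_rpow_rpow_atTop m h0).tendsto_div_nhds_zero).congr' ?_
      filter_upwards [eventually_gt_atTop 0] with s hs
      rw [Real.rpow_neg hs.le, div_eq_mul_inv]
    have l1 := lk 1
    have l2 := lk 2
    simp only [Real.rpow_one, Real.rpow_two] at l1 l2
    set u := Real.log δ + k - 1 / α with hu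
    have t := ((l0.const_mul (-(1 / α) * (A + B * u + D * (u ^ 2 + 1 / α ^ 2)))).add (l1.const_mul ((1 / α) * (B + 2 * D * u)))).add (l2.const_mul (-(1 / α) * D))
    simp only [mul_zero, add_zero] at t
    refine t.congr fun y => ?_
    simp only [hF, hu]; ring
  have hIntg : IntegrableOn (fun y => y ^ (-(1 + α)) * (A + B * (Real.log δ - Real.log y + k) + D * (Real.log δ - Real.log y + k) ^ 2)) (Ioi a) := by
    obtain ⟨K, hK, h⟩ := abs_log_le (b := α / 4) (by positivity) ha
    set M := 1 + |Real.log δ| + |k| with hM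
    have hM1 : 1 ≤ M := by have := abs_nonneg (Real.log δ); have := abs_nonneg k; linarith
    have i := (integrableOn_Ioi_rpow_of_lt (a := -(1 + α / 2)) (by linarith) ha).const_mul ((|A| + |B| + |D|) * (M * K) ^ 2)
    refine i.mono' ?_ ?_
    · exact Measurable.aestronglyMeasurable (by fun_prop)
    · filter_upwards [ae_restrict_mem measurableSet_Ioi] with y hy
      have hy0 : 0 < y := lt_trans ha hy
      have h1 := h y (le_of_lt hy)
      have ey : y ^ (-(1 + α / 2)) = y ^ (-(1 + α)) * (y ^ (α / 4)) ^ 2 := by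
        rw [← Real.rpow_natCast, ← Real.rpow_mul hy0.le, ← Real.rpow_add hy0]; congr 1; push_cast; ring
      have hw : |Real.log δ - Real.log y + k| ≤ M * (K * y ^ (α / 4)) := by
        calc _ ≤ |Real.log δ| + |Real.log y| + |k| := (abs_add_le _ _).trans (by gcongr; exact abs_sub _ _)
          _ ≤ M * (1 + |Real.log y|) := by
            rw [hM]; nlinarith [abs_nonneg (Real.log δ), abs_nonneg k, abs_nonneg (Real.log y), mul_nonneg (abs_nonneg (Real.log δ)) (abs_nonneg (Real.log y)), mul_nonneg (abs_nonneg k) (abs_nonneg (Real.log y))]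
          _ ≤ _ := by gcongr
      have hw1 : 1 ≤ M * (K * y ^ (α / 4)) := by
        have : 1 ≤ K * y ^ (α / 4) := by linarith [abs_nonneg (Real.log y)]
        nlinarith
      set w := M * (K * y ^ (α / 4)) with hwdef
      set v := Real.log δ - Real.log y + k with hv
      have hv2 : |v| ^ 2 ≤ w ^ 2 := by gcongr
      have hw2 : w ≤ w ^ 2 := by nlinarith
      rw [norm_mul, Real.norm_of_nonneg (by positivity), ey]
      calc y ^ (-(1 + α)) * ‖A + B * v + D * v ^ 2‖ ≤ y ^ (-(1 + α)) * (|A| * w ^ 2 + |B| * w ^ 2 + |D| * w ^ 2) := by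
            gcongr
            refine (norm_add₃_le).trans ?_
            rw [norm_mul, norm_mul, norm_pow]
            simp only [Real.norm_eq_abs]
            gcongr
            · exact le_mul_of_one_le_right (abs_nonneg _) (by nlinarith)
            · linarith
        _ = _ := by rw [hwdef]; ring
  have := integral_Ioi_of_hasDerivAt_of_tendsto (f := F) (hd a ha).continuousAt.continuousWithinAt (fun y hy => hd y (lt_trans ha hy)) hIntg lim
  rw [this]
  simp only [hF]; ring

lemma kap (hσ : 0 < σ) (hδ : 0 < δ) (h0 : 0 < α) (h2 : α < 2) :
    2 * (δ ^ α * (C0 α * (ystar σ α ^ (-α) / α))) = kappa0 σ δ α := by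
  unfold kappa0 ystar
  have h : 0 < 2 - α := by linarith
  rw [C0_cAlpha h0 h2, Real.mul_rpow hσ.le (by positivity), Real.div_rpow hδ.le hσ.le, Real.rpow_neg hσ.le, Real.rpow_neg (by positivity),
    Real.sqrt_eq_rpow, ← Real.rpow_mul h.le]
  rw [show 1 / 2 * α = α / 2 by ring]
  have : 0 < (2 - α) ^ (α / 2) := by positivity
  have : 0 < σ ^ α := by positivity
  field_simp

lemma kap1 (hσ : 0 < σ) (hδ : 0 < δ) (h0 : 0 < α) (h2 : α < 2) :
    Real.log δ - Real.log (ystar σ α) + C1 α / C0 α - 1 / α = kappa1 σ δ α := by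
  unfold kappa1 ystar
  have h : 0 < 2 - α := by linarith
  rw [C0_cAlpha h0 h2, deriv_cAlpha h0 h2, Real.log_mul hσ.ne' (by positivity), Real.log_div hδ.ne' hσ.ne', Real.log_sqrt h.le]
  ring

lemma lim_cov (hσ : 0 < σ) (hδ : 0 < δ) (h0 : 0 < α) (h2 : α < 2) (j k : Fin 3) :
    Tendsto (fun n : ℕ => n * ∫ x, sN σ δ α n j x * sN σ δ α n k x / qN σ δ α n x) atTop (𝓝 (Imat ![σ, δ, α] j k)) := by
  have hys := ystar_pos hσ h2
  have key : ∀ (A B D : ℝ), 2 * (δ ^ α * (C0 α * (ystar σ α ^ (-α) / α * (A + B * ((Real.log δ - Real.log (ystar σ α) + C1 α / C0 α) - 1 / α) +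
        D * ((Real.log δ - Real.log (ystar σ α) + C1 α / C0 α - 1 / α) ^ 2 + 1 / α ^ 2))))) =
        kappa0 σ δ α * (A + B * kappa1 σ δ α + D * (kappa1 σ δ α ^ 2 + 1 / α ^ 2)) := by
    intro A B D
    rw [kap1 hσ hδ h0 h2, ← kap hσ hδ h0 h2]; ring
  have c11 : Tendsto (fun n : ℕ => n * ∫ x, sN σ δ α n 1 x * sN σ δ α n 1 x / qN σ δ α n x) atTop (𝓝 (α ^ 2 / δ ^ 2 * kappa0 σ δ α)) := by
    have := lim_jk0 hσ hδ h0 h2 (j := 1) (k := 1) (by decide) (by decide)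
    have e : ∀ y, uu δ α 1 y * uu δ α 1 y = α ^ 2 / δ ^ 2 + 0 * (Real.log δ - Real.log y + C1 α / C0 α) + 0 * (Real.log δ - Real.log y + C1 α / C0 α) ^ 2 := by
      intro y; unfold uu; simp; ring
    simp_rw [e] at this
    rw [ftc_int hδ h0 hys, key] at this
    convert this using 2; ring
  have c12 : Tendsto (fun n : ℕ => n * ∫ x, sN σ δ α n 1 x * sN σ δ α n 2 x / qN σ δ α n x) atTop (𝓝 (α / δ * kappa0 σ δ α * kappa1 σ δ α)) := by
    have := lim_jk0 hσ hδ h0 h2 (j := 1) (k := 2) (by decide) (by decide)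
    have e : ∀ y, uu δ α 1 y * uu δ α 2 y = 0 + (α / δ) * (Real.log δ - Real.log y + C1 α / C0 α) + 0 * (Real.log δ - Real.log y + C1 α / C0 α) ^ 2 := by
      intro y; unfold uu; simp
    simp_rw [e] at this
    rw [ftc_int hδ h0 hys, key] at this
    convert this using 2; ring
  have c22 : Tendsto (fun n : ℕ => n * ∫ x, sN σ δ α n 2 x * sN σ δ α n 2 x / qN σ δ α n x) atTop (𝓝 (kappa0 σ δ α * (kappa1 σ δ α ^ 2 + 1 / α ^ 2))) := by
    have := lim_jk0 hσ hδ h0 h2 (j := 2) (k := 2) (by decide) (by decide)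
    have e : ∀ y, uu δ α 2 y * uu δ α 2 y = 0 + 0 * (Real.log δ - Real.log y + C1 α / C0 α) + 1 * (Real.log δ - Real.log y + C1 α / C0 α) ^ 2 := by
      intro y; unfold uu; simp; ring
    simp_rw [e] at this
    rw [ftc_int hδ h0 hys, key] at this
    convert this using 2; ring
  have sym : ∀ j k : Fin 3, (fun n : ℕ => (n : ℝ) * ∫ x, sN σ δ α n j x * sN σ δ α n k x / qN σ δ α n x) =
      fun n : ℕ => (n : ℝ) * ∫ x, sN σ δ α n k x * sN σ δ α n j x / qN σ δ α n x := by
    intro j k; funext n; simp_rw [mul_comm (sN σ δ α n j _)]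
  have c00 := lim_00 hσ hδ h0 h2
  have c01 := lim_cross hσ hδ h0 h2 (j := 1) (by decide)
  have c02 := lim_cross hσ hδ h0 h2 (j := 2) (by decide)
  fin_cases j <;> fin_cases k
  · simpa [Imat] using c00
  · simpa [Imat] using c01
  · simpa [Imat] using c02
  · simpa [Imat, sym 1 0] using c01
  · simpa [Imat] using c11
  · simpa [Imat] using c12
  · simpa [Imat, sym 2 0] using c02
  · simpa [Imat, sym 2 1] using c12
  · simpa [Imat] using c22

end PartF6

section PartG1
/-- the rescaled law -/
def muR (r : ℝ) (q : ℝ → ℝ) : Measure ℝ := volume.withDensity fun y => ENNReal.ofReal (r * q (r * y))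

structure Loc (R C : ℝ) (q : ℝ → ℝ) (S : Fin 3 → ℝ → ℝ) (Q : (Fin 3 → ℝ) → ℝ → ℝ) (b : ℝ → ℝ) : Prop where
  R1 : 1 ≤ R
  C0 : 0 < C
  qpos : ∀ x, 0 < q x
  qc : Continuous q
  Sc : ∀ j, Continuous (S j)
  Qc : ∀ h, ‖h‖ ≤ R → Continuous (Q h)
  Qi : ∀ h, ‖h‖ ≤ R → Integrable (Q h)
  Q1 : ∀ h, ‖h‖ ≤ R → ∫ x, Q h x = 1
  Q0 : Q 0 = q
  quad : ∀ s ≤ R, ∀ h h' : Fin 3 → ℝ, ‖h‖ ≤ s → ‖h'‖ ≤ s → ∀ x,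
    |Q h x - Q h' x - ∑ j, (h - h') j * S j x| ≤ C * s * ‖h - h'‖ * b x
  b0 : ∀ x, 0 ≤ b x
  bc : Continuous b
  bi : Integrable b
  b2 : Integrable fun x => b x ^ 2 / q x
  m4 : ∀ j, Integrable fun x => S j x ^ 4 / q x ^ 3

def sR (r : ℝ) (q : ℝ → ℝ) (S : Fin 3 → ℝ → ℝ) (j : Fin 3) (y : ℝ) : ℝ := S j (r * y) / q (r * y)
open Classical in
def eR (R r : ℝ) (q : ℝ → ℝ) (S : Fin 3 → ℝ → ℝ) (Q : (Fin 3 → ℝ) → ℝ → ℝ) (h : Fin 3 → ℝ) (y : ℝ) : ℝ :=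
  if ‖h‖ ≤ R then (Q h (r * y) - q (r * y) - ∑ j, h j * S j (r * y)) / q (r * y) else 0
def bR (R C r : ℝ) (q b : ℝ → ℝ) (y : ℝ) : ℝ := C * R * (b (r * y) / q (r * y))

variable {R C r : ℝ} {q : ℝ → ℝ} {S : Fin 3 → ℝ → ℝ} {Q : (Fin 3 → ℝ) → ℝ → ℝ} {b : ℝ → ℝ}

lemma muR_meas (hq : Continuous q) : Measurable fun y => ENNReal.ofReal (r * q (r * y)) := by fun_prop

lemma muR_integral (hr : 0 < r) (hq : Continuous q) (hq0 : ∀ x, 0 < q x) (f : ℝ → ℝ) :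
    ∫ y, f (r * y) ∂(muR r q) = ∫ x, f x * q x := by
  unfold muR
  rw [integral_withDensity_eq_integral_toReal_smul (muR_meas hq) (by simp)]
  have e : ∀ y, (ENNReal.ofReal (r * q (r * y))).toReal • f (r * y) = (fun x => r * (f x * q x)) (r * y) := by
    intro y
    rw [ENNReal.toReal_ofReal (by have := hq0 (r * y); positivity)]; simp; ring
  simp_rw [e]
  rw [Measure.integral_comp_mul_left (fun x => r * (f x * q x)), integral_const_mul, abs_of_pos (by positivity), smul_eq_mul]
  field_simp

lemma muR_integrable (hr : 0 < r) (hq : Continuous q) (hq0 : ∀ x, 0 < q x) {f : ℝ → ℝ}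
    (hf : Integrable fun x => f x * q x) : Integrable (fun y => f (r * y)) (muR r q) := by
  unfold muR
  rw [integrable_withDensity_iff_integrable_smul' (muR_meas hq) (by simp)]
  have e : ∀ y, (ENNReal.ofReal (r * q (r * y))).toReal • f (r * y) = (fun x => r * (f x * q x)) (r * y) := by
    intro y
    rw [ENNReal.toReal_ofReal (by have := hq0 (r * y); positivity)]; simp; ring
  simp_rw [e]
  exact (hf.const_mul r).comp_mul_left' hr.ne'

lemma Loc.prob (H : Loc R C q S Q b) (hr : 0 < r) : IsProbabilityMeasure (muR r q) := by
  have hR0 : ‖(0 : Fin 3 → ℝ)‖ ≤ R := by rw [norm_zero]; linarith [H.R1]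
  have i : Integrable fun y => r * q (r * y) := by
    have := H.Qi 0 hR0; rw [H.Q0] at this
    exact (this.comp_mul_left' hr.ne').const_mul r
  constructor
  unfold muR
  rw [withDensity_apply _ MeasurableSet.univ, Measure.restrict_univ,
    ← ofReal_integral_eq_lintegral_ofReal i (Eventually.of_forall fun y => by have := H.qpos (r * y); positivity)]
  rw [integral_const_mul, Measure.integral_comp_mul_left, ← H.Q0, H.Q1 0 hR0, abs_of_pos (by positivity)]
  simp [hr.ne']

lemma Loc.Si (H : Loc R C q S Q b) (j : Fin 3) : Integrable (S j) := by
  have hR0 : ‖(0 : Fin 3 → ℝ)‖ ≤ R := by rw [norm_zero]; linarith [H.R1]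
  have iq := H.Qi 0 hR0; rw [H.Q0] at iq
  refine ((H.m4 j).add iq).mono' (H.Sc j).aestronglyMeasurable (Eventually.of_forall fun x => ?_)
  have h := H.qpos x
  obtain ⟨t, ht⟩ : ∃ t, S j x = t * q x := ⟨S j x / q x, by field_simp⟩
  simp only [Pi.add_apply]
  rw [ht, show (t * q x) ^ 4 / q x ^ 3 = t ^ 4 * q x by field_simp, norm_mul, Real.norm_of_nonneg h.le]
  have : ‖t‖ ≤ t ^ 4 + 1 := by
    rw [Real.norm_eq_abs, abs_le]
    constructor <;> nlinarith [sq_nonneg (t ^ 2 - 1), sq_nonneg (t - 1), sq_nonneg (t + 1)]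
  calc _ ≤ (t ^ 4 + 1) * q x := by gcongr
    _ = _ := by ring

lemma Loc.S0 (H : Loc R C q S Q b) (j : Fin 3) : ∫ x, S j x = 0 := by
  have hR0 : ‖(0 : Fin 3 → ℝ)‖ ≤ R := by rw [norm_zero]; linarith [H.R1]
  have iq := H.Qi 0 hR0
  have key : ∀ t : ℝ, 0 < t → t ≤ 1 → |∫ x, S j x| ≤ t * (C * ∫ x, b x) := by
    intro t ht ht1
    set h : Fin 3 → ℝ := Pi.single j t with hh
    have hn : ‖h‖ = t := by rw [hh, Pi.norm_single, Real.norm_of_nonneg ht.le]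
    have hR : ‖h‖ ≤ R := by rw [hn]; linarith [H.R1]
    have hs : ∀ x, ∑ k, (h - 0) k * S k x = t * S j x := by
      intro x; rw [Finset.sum_eq_single j] <;> simp +contextual [hh]
    have e : t * ∫ x, S j x = -∫ x, (Q h x - Q 0 x - ∑ k, (h - 0) k * S k x) := by
      simp_rw [hs]
      have i0 : Integrable (fun x => Q h x - Q 0 x) := (H.Qi h hR).sub iq
      rw [integral_sub i0 ((H.Si j).const_mul t), integral_sub (H.Qi h hR) iq, H.Q1 h hR, H.Q1 0 hR0, integral_const_mul]; ring
    have b1 : |∫ x, (Q h x - Q 0 x - ∑ k, (h - 0) k * S k x)| ≤ ∫ x, C * t * t * b x := by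
      rw [← Real.norm_eq_abs]
      refine norm_integral_le_of_norm_le (H.bi.const_mul _) (Eventually.of_forall fun x => ?_)
      have := H.quad t (by linarith [H.R1]) h 0 hn.le (by simp [ht.le]) x
      rw [Real.norm_eq_abs]; simpa [hn] using this
    rw [integral_const_mul] at b1
    have : t * |∫ x, S j x| ≤ t * (t * (C * ∫ x, b x)) := by
      rw [← abs_of_pos ht, ← abs_mul, abs_of_pos ht, e, abs_neg]
      refine b1.trans (le_of_eq (by ring))
    exact le_of_mul_le_mul_left this ht
  have t1 : Tendsto (fun t : ℝ => t * (C * ∫ x, b x)) (𝓝[>] 0) (𝓝 0) := by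
    have : Tendsto (fun t : ℝ => t * (C * ∫ x, b x)) (𝓝 0) (𝓝 (0 * (C * ∫ x, b x))) := tendsto_id.mul_const _
    rw [zero_mul] at this; exact this.mono_left nhdsWithin_le_nhds
  have : |∫ x, S j x| ≤ 0 := by
    refine ge_of_tendsto t1 ?_
    filter_upwards [Ioc_mem_nhdsGT (zero_lt_one (α := ℝ))] with t ht using key t ht.1 ht.2
  exact abs_nonpos_iff.mp this

lemma Loc.row (H : Loc R C q S Q b) (hr : 0 < r) : Row (muR r q) (sR r q S) where
  prob := H.prob hr
  meas j := by
    unfold sR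
    exact ((H.Sc j).measurable.comp (measurable_const_mul r)).div (H.qc.measurable.comp (measurable_const_mul r))
  int4 j := by
    have := muR_integrable hr H.qc H.qpos (f := fun x => (S j x / q x) ^ 4)
      ((H.m4 j).congr (Eventually.of_forall fun x => by have := H.qpos x; field_simp))
    exact this
  mean j := by
    have := muR_integral hr H.qc H.qpos (fun x => S j x / q x)
    unfold sR; rw [this]
    rw [← H.S0 j]
    exact integral_congr_ae (Eventually.of_forall fun x => by have := H.qpos x; field_simp)

lemma Loc.cov (H : Loc R C q S Q b) (hr : 0 < r) (j k : Fin 3) :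
    ∫ y, sR r q S j y * sR r q S k y ∂(muR r q) = ∫ x, S j x * S k x / q x := by
  have := muR_integral hr H.qc H.qpos (fun x => S j x / q x * (S k x / q x))
  unfold sR; rw [this]
  exact integral_congr_ae (Eventually.of_forall fun x => by have := H.qpos x; field_simp)

lemma Loc.m4' (H : Loc R C q S Q b) (hr : 0 < r) (j : Fin 3) :
    ∫ y, sR r q S j y ^ 4 ∂(muR r q) = ∫ x, S j x ^ 4 / q x ^ 3 := by
  have := muR_integral hr H.qc H.qpos (fun x => (S j x / q x) ^ 4)
  unfold sR; rw [this]
  exact integral_congr_ae (Eventually.of_forall fun x => by have := H.qpos x; field_simp)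

lemma Loc.B1 (H : Loc R C q S Q b) (hr : 0 < r) :
    ∫ y, bR R C r q b y ∂(muR r q) = C * R * ∫ x, b x := by
  have := muR_integral hr H.qc H.qpos (fun x => C * R * (b x / q x))
  unfold bR; rw [this, ← integral_const_mul]
  exact integral_congr_ae (Eventually.of_forall fun x => by have := H.qpos x; field_simp)

lemma Loc.B2 (H : Loc R C q S Q b) (hr : 0 < r) :
    ∫ y, bR R C r q b y ^ 2 ∂(muR r q) = (C * R) ^ 2 * ∫ x, b x ^ 2 / q x := by
  have := muR_integral hr H.qc H.qpos (fun x => (C * R * (b x / q x)) ^ 2)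
  unfold bR; rw [this, ← integral_const_mul]
  exact integral_congr_ae (Eventually.of_forall fun x => by have := H.qpos x; field_simp)

lemma Loc.rowE (H : Loc R C q S Q b) (hr : 0 < r) : RowE R (muR r q) (eR R r q S Q) (bR R C r q b) where
  meas h := by
    unfold eR
    split_ifs with hh
    · have mr := measurable_const_mul r
      have m1 := (H.Qc h hh).measurable.comp mr
      have m2 := H.qc.measurable.comp mr
      have m3 : ∀ j, Measurable (fun y => S j (r * y)) := fun j => (H.Sc j).measurable.comp mr
      exact ((m1.sub m2).sub (Finset.measurable_sum _ fun j _ => (m3 j).const_mul (h j))).div m2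
    · exact measurable_const
  zero y := by
    unfold eR; split_ifs <;> simp [H.Q0]
  mean h hh := by
    have := muR_integral hr H.qc H.qpos (fun x => (Q h x - q x - ∑ j, h j * S j x) / q x)
    simp only [eR, hh, if_true]; rw [this]
    have hR0 : ‖(0 : Fin 3 → ℝ)‖ ≤ R := by rw [norm_zero]; linarith [H.R1]
    have iq := H.Qi 0 hR0
    have q1 := H.Q1 0 hR0
    rw [H.Q0] at iq q1
    have e : ∫ x, (Q h x - q x - ∑ j, h j * S j x) / q x * q x = ∫ x, (Q h x - q x - ∑ j, h j * S j x) :=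
      integral_congr_ae (Eventually.of_forall fun x => by have := H.qpos x; field_simp)
    have is : ∀ j, Integrable (fun x => h j * S j x) := fun j => (H.Si j).const_mul _
    have i0 : Integrable (fun x => Q h x - q x) := (H.Qi h hh).sub iq
    rw [e, integral_sub i0 (integrable_finsetSum _ fun j _ => is j), integral_sub (H.Qi h hh) iq, H.Q1 h hh, q1,
      integral_finsetSum _ fun j _ => is j]
    simp_rw [integral_const_mul, H.S0]; simp
  lip h h' hh hh' y := by
    simp only [eR, hh, hh', if_true, bR]
    have hq := H.qpos (r * y)
    rw [← sub_div, abs_div, abs_of_pos hq, div_le_iff₀ hq]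
    have := H.quad R le_rfl h h' hh hh' (r * y)
    have e : ‖h - h'‖ * (C * R * (b (r * y) / q (r * y))) * q (r * y) = C * R * ‖h - h'‖ * b (r * y) := by field_simp
    rw [e]
    refine le_trans (le_of_eq ?_) this
    congr 1
    simp only [Pi.sub_apply, sub_mul, Finset.sum_sub_distrib]; ring
  nonneg y := by
    unfold bR; have := H.b0 (r * y); have := H.qpos (r * y); have := H.R1; have := H.C0; positivity
  int := muR_integrable hr H.qc H.qpos (f := fun x => C * R * (b x / q x))
      ((H.bi.const_mul (C * R)).congr (Eventually.of_forall fun x => by have := H.qpos x; field_simp))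
  int2 := muR_integrable hr H.qc H.qpos (f := fun x => (C * R * (b x / q x)) ^ 2)
      ((H.b2.const_mul ((C * R) ^ 2)).congr (Eventually.of_forall fun x => by have := H.qpos x; field_simp))

/-- derivative of the log-density -/
lemma Loc.hasFDeriv (H : Loc R C q S Q b) (x : ℝ) :
    HasFDerivAt (fun h => Q h x) (∑ j, S j x • (ContinuousLinearMap.proj j : (Fin 3 → ℝ) →L[ℝ] ℝ)) 0 := by
  rw [hasFDerivAt_iff_isLittleO_nhds_zero]
  have hO : (fun h : Fin 3 → ℝ => Q (0 + h) x - Q 0 x - (∑ j, S j x • (ContinuousLinearMap.proj j : (Fin 3 → ℝ) →L[ℝ] ℝ)) h) =O[𝓝 0]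
      fun h => ‖h‖ ^ 2 := by
    refine Asymptotics.IsBigO.of_bound (C * b x) ?_
    filter_upwards [Metric.closedBall_mem_nhds (0 : Fin 3 → ℝ) (zero_lt_one (α := ℝ))] with h hh
    have hh1 : ‖h‖ ≤ 1 := by simpa using hh
    have := H.quad ‖h‖ (by linarith [H.R1]) h 0 le_rfl (by simp) x
    rw [Real.norm_eq_abs, zero_add, Real.norm_of_nonneg (by positivity)]
    simp only [sub_zero] at this
    refine le_trans (le_of_eq ?_) (this.trans (le_of_eq (by ring)))
    congr 2
    simp [mul_comm]
  exact hO.trans_isLittleO (Asymptotics.isLittleO_norm_pow_id one_lt_two)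

lemma Loc.hasFDeriv_log (H : Loc R C q S Q b) (hr : 0 < r) {n : ℕ} (x : Fin n → ℝ) :
    HasFDerivAt (fun h => ∑ i, Real.log (r * Q h (r * x i)))
      (∑ j, (∑ i, sR r q S j (x i)) • (ContinuousLinearMap.proj j : (Fin 3 → ℝ) →L[ℝ] ℝ)) 0 := by
  have h1 : ∀ i ∈ Finset.univ, HasFDerivAt (fun h => Real.log (r * Q h (r * x i)))
      ((r * Q 0 (r * x i))⁻¹ • (r • ∑ j, S j (r * x i) • (ContinuousLinearMap.proj j : (Fin 3 → ℝ) →L[ℝ] ℝ))) 0 := by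
    intro i _
    refine ((H.hasFDeriv (r * x i)).const_mul r).log ?_
    rw [H.Q0]; have := H.qpos (r * x i); positivity
  have := HasFDerivAt.fun_sum h1
  refine this.congr_fderiv ?_
  ext v
  simp only [_root_.sum_apply, _root_.smul_apply, ContinuousLinearMap.proj_apply, smul_eq_mul, Finset.sum_mul, Finset.mul_sum]
  rw [Finset.sum_comm]
  refine Finset.sum_congr rfl fun j _ => Finset.sum_congr rfl fun i _ => ?_
  unfold sR; rw [H.Q0]; have := H.qpos (r * x i); field_simp

end PartG1

section PartG2
variable {σ δ α : ℝ}

def QN (σ δ α : ℝ) (n : ℕ) (h : Fin 3 → ℝ) (x : ℝ) : ℝ :=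
  qh σ δ α (Real.log n) (nuN n) (rate n α) (mN n) h x
def bN (σ δ α : ℝ) (n : ℕ) (x : ℝ) : ℝ := bb σ δ α (Real.log n) (nuN n) (rate n α) x

structure Good (σ δ α R C : ℝ) (n : ℕ) : Prop where
  bas : Basic δ α n
  loc : Loc R C (qN σ δ α n) (sN σ δ α n) (QN σ δ α n) (bN σ δ α n)
  dom : ∀ h : Fin 3 → ℝ, ‖h‖ ≤ R → 0 < sgR σ (nuN n) h ∧ 0 < dlR δ α (rate n α) (mN n) h ∧
        0 < alR α (rate n α) h ∧ alR α (rate n α) h < 2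

lemma ev_Good (hσ : 0 < σ) (hδ : 0 < δ) (h0 : 0 < α) (h2 : α < 2) {R : ℝ} (hR : 1 ≤ R) :
    ∃ C : ℝ, ∀ᶠ n in atTop, Good σ δ α R C n := by
  obtain ⟨c, C', hB⟩ := ev_Bd hσ hδ h0 h2
  obtain ⟨κ, C, hκ, hC, hm⟩ := q_main hσ hδ h0 h2
  refine ⟨C, ?_⟩
  have hsmall : ∀ᶠ n in atTop, tauN α n < κ / R := (tau_tendsto h0).eventually_lt_const (by positivity)
  filter_upwards [hB, ev_basic hδ h0 h2, hsmall] with n b ba hs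
  obtain ⟨d1, -, d3, -, d5⟩ := hm (Real.log n) (nuN n) (rate n α) (mN n) ba.L1 ba.nu0.le ba.rho ba.m0 ba.mL ba.nutau
  have ht := ba.tau0
  have hRk : R ≤ κ / (rate n α * Real.log n) := by
    change R ≤ κ / tauN α n
    rw [le_div_iff₀ ht]
    rw [lt_div_iff₀ (by linarith)] at hs
    linarith
  have dom := fun (h : Fin 3 → ℝ) (hh : ‖h‖ ≤ R) => d1 h (hh.trans hRk)
  refine ⟨ba, ?_, dom⟩
  have qq0 : QN σ δ α n 0 = qN σ δ α n := by
    funext x; simp [QN, qN, qh, sgR, dlR, alR, lamN]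
  refine ⟨hR, hC, b.qpos, b.qc, b.Sc, ?_, ?_, ?_, qq0, ?_, bb_nonneg b, bb_cont n, bb_int hσ h0 n, bb_sq_int b, m4_int b⟩
  · intro h hh
    obtain ⟨a1, a2, a3, a4⟩ := dom h hh
    exact qf_cont a1 (lamL_pos _ _ _).le a3 a4
  · intro h hh
    obtain ⟨a1, a2, a3, a4⟩ := dom h hh
    exact qf_int a1 (lamL_pos _ _ _).le a3 a4
  · intro h hh
    obtain ⟨a1, a2, a3, a4⟩ := dom h hh
    exact qf_integral_one a1 (lamL_pos _ _ _).le a3 (qf_int a1 (lamL_pos _ _ _).le a3 a4)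
  · intro s hs h h' hh hh' x
    have := d5 s (hs.trans hRk) h h' hh hh' x
    rw [SS_lin d3] at this
    exact this

lemma un_vec (σ δ α : ℝ) (n : ℕ) (h : Fin 3 → ℝ) : ![σ, δ, α] + (un n ![σ, δ, α]).mulVec h =
    ![sgR σ (nuN n) h, dlR δ α (rate n α) (mN n) h, alR α (rate n α) h] := by
  ext i
  fin_cases i
  · simp [un, Matrix.mulVec, dotProduct, Fin.sum_univ_three, sgR, nuN]
  · simp [un, Matrix.mulVec, dotProduct, Fin.sum_univ_three, dlR, mN]; ring
  · simp [un, Matrix.mulVec, dotProduct, Fin.sum_univ_three, alR]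

variable {R C : ℝ} {n : ℕ}

lemma Good.r0 (G : Good σ δ α R C n) : 0 < Real.sqrt n := by
  have : (0:ℝ) < n := by exact_mod_cast G.bas.npos
  positivity

lemma Good.pd (G : Good σ δ α R C n) {h : Fin 3 → ℝ} (hh : ‖h‖ ≤ R) (y : ℝ) :
    pdens n (![σ, δ, α] + (un n ![σ, δ, α]).mulVec h) y = Real.sqrt n * QN σ δ α n h (Real.sqrt n * y) := by
  obtain ⟨a1, a2, a3, a4⟩ := G.dom h hh
  rw [un_vec, pdens_eq G.bas.npos (by simpa using a1) (by simpa using a2) (by simpa using a3)]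
  unfold QN qh
  rw [lamL_eq G.bas.npos a2]
  simp

lemma Good.pd0 (G : Good σ δ α R C n) (y : ℝ) :
    pdens n ![σ, δ, α] y = Real.sqrt n * qN σ δ α n (Real.sqrt n * y) := by
  have := G.pd (h := 0) (by rw [norm_zero]; linarith [G.loc.R1]) y
  rw [Matrix.mulVec_zero, add_zero, G.loc.Q0] at this
  exact this

lemma Good.pn (G : Good σ δ α R C n) :
    Pn n ![σ, δ, α] = Measure.pi fun _ : Fin n => muR (Real.sqrt n) (qN σ δ α n) := by
  unfold Pn muR
  simp_rw [G.pd0]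

lemma un_inv (h : Basic δ α n) : un n ![σ, δ, α] * (un n ![σ, δ, α])⁻¹ = 1 ∧ (un n ![σ, δ, α])⁻¹ * un n ![σ, δ, α] = 1 := by
  have hn : (0:ℝ) < n := by exact_mod_cast h.npos
  have : IsUnit (un n ![σ, δ, α]).det := by
    rw [isUnit_iff_ne_zero, Matrix.det_fin_three]
    have := h.rho
    have h1 : (un n ![σ, δ, α]) 0 0 = 1 / Real.sqrt n := rfl
    simp [un]
    exact ⟨h.npos.ne', this.ne'⟩
  exact ⟨Matrix.mul_nonsing_inv _ this, Matrix.nonsing_inv_mul _ this⟩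

lemma Good.score (G : Good σ δ α R C n) (x : Fin n → ℝ) :
    (un n ![σ, δ, α])ᵀ.mulVec (scoreVec n ![σ, δ, α] x) = fun j => ∑ i, sR (Real.sqrt n) (qN σ δ α n) (sN σ δ α n) j (x i) := by
  set U := un n ![σ, δ, α] with hU
  obtain ⟨u1, u2⟩ := un_inv (σ := σ) G.bas
  set D : (Fin 3 → ℝ) →L[ℝ] ℝ := ∑ j, (∑ i, sR (Real.sqrt n) (qN σ δ α n) (sN σ δ α n) j (x i)) • (ContinuousLinearMap.proj j : (Fin 3 → ℝ) →L[ℝ] ℝ) with hD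
  have hF := G.loc.hasFDeriv_log G.r0 x
  rw [← hD] at hF
  have hsc : ∀ j, scoreVec n ![σ, δ, α] x j = D (U⁻¹.mulVec (Pi.single j 1)) := by
    intro j
    unfold scoreVec pderiv
    set θ : Fin 3 → ℝ := ![σ, δ, α] with hθ
    have l1 : HasDerivAt (fun t : ℝ => (t - θ j) • U⁻¹.mulVec (Pi.single j 1)) (U⁻¹.mulVec (Pi.single j 1)) (θ j) := by
      have := ((hasDerivAt_id (θ j)).sub_const (θ j)).smul_const (U⁻¹.mulVec (Pi.single j (1:ℝ)))
      simpa using this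
    have hF' : HasFDerivAt (fun h => ∑ i, Real.log (Real.sqrt n * QN σ δ α n h (Real.sqrt n * x i))) D
        ((fun t : ℝ => (t - θ j) • U⁻¹.mulVec (Pi.single j 1)) (θ j)) := by
      simpa using hF
    have l2 := hF'.comp_hasDerivAt (θ j) l1
    refine HasDerivAt.deriv (l2.congr_of_eventuallyEq ?_)
    have hcont : ContinuousAt (fun t : ℝ => (t - θ j) • U⁻¹.mulVec (Pi.single j 1)) (θ j) := l1.continuousAt
    have hball : ∀ᶠ t in 𝓝 (θ j), ‖(t - θ j) • U⁻¹.mulVec (Pi.single j 1)‖ < R := by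
      have := hcont.norm.eventually_lt_const (u := R) (by simp; linarith [G.loc.R1])
      exact this
    filter_upwards [hball] with t ht
    have e : Function.update θ j t = θ + U.mulVec ((t - θ j) • U⁻¹.mulVec (Pi.single j 1)) := by
      rw [Matrix.mulVec_smul, Matrix.mulVec_mulVec, u1, Matrix.one_mulVec]
      ext k
      by_cases hk : k = j
      · subst hk; simp
      · simp [hk]
    simp only [Function.comp_apply]
    rw [e]
    unfold logLik
    refine Finset.sum_congr rfl fun i _ => ?_
    rw [hU, G.pd ht.le]
  funext k
  have e1 : (Uᵀ.mulVec (scoreVec n ![σ, δ, α] x)) k = D (∑ j, U j k • U⁻¹.mulVec (Pi.single j 1)) := by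
    rw [map_sum]
    simp only [Matrix.mulVec, dotProduct, Matrix.transpose_apply, map_smul, smul_eq_mul]
    refine Finset.sum_congr rfl fun j _ => ?_
    rw [hsc]
  have e2 : (∑ j, U j k • U⁻¹.mulVec (Pi.single j 1)) = Pi.single k 1 := by
    have : ∑ j, U j k • U⁻¹.mulVec (Pi.single j (1:ℝ)) = U⁻¹.mulVec (∑ j, U j k • Pi.single j (1:ℝ)) := by
      rw [Matrix.mulVec_sum]; simp_rw [Matrix.mulVec_smul]
    rw [this]
    have e3 : (∑ j, U j k • (Pi.single j (1:ℝ) : Fin 3 → ℝ)) = U.mulVec (Pi.single k 1) := by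
      ext l; simp [Finset.sum_apply, Pi.single_apply]
    rw [e3, Matrix.mulVec_mulVec, u2, Matrix.one_mulVec]
  rw [e1, e2, hD]
  simp [_root_.sum_apply, Pi.single_apply]

lemma Good.loglik (G : Good σ δ α R C n) {h : Fin 3 → ℝ} (hh : ‖h‖ ≤ R) (x : Fin n → ℝ)
    (hpos : ∀ i, 0 < QN σ δ α n h (Real.sqrt n * x i)) :
    logLik n (![σ, δ, α] + (un n ![σ, δ, α]).mulVec h) x - logLik n ![σ, δ, α] x =
      ∑ i, Real.log (1 + (∑ j, h j * sR (Real.sqrt n) (qN σ δ α n) (sN σ δ α n) j (x i)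
        + eR R (Real.sqrt n) (qN σ δ α n) (sN σ δ α n) (QN σ δ α n) h (x i))) := by
  unfold logLik
  rw [← Finset.sum_sub_distrib]
  refine Finset.sum_congr rfl fun i _ => ?_
  have hq := G.loc.qpos (Real.sqrt n * x i)
  have hr := G.r0
  have hp := hpos i
  rw [G.pd hh, G.pd0, ← Real.log_div (by positivity) (by positivity)]
  congr 1
  simp only [eR, hh, if_true, sR]
  have : ∑ j, h j * (sN σ δ α n j (Real.sqrt n * x i) / qN σ δ α n (Real.sqrt n * x i)) =
      (∑ j, h j * sN σ δ α n j (Real.sqrt n * x i)) / qN σ δ α n (Real.sqrt n * x i) := by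
    rw [Finset.sum_div]; exact Finset.sum_congr rfl fun j _ => by ring
  rw [this]
  field_simp
  ring

/-- pointwise smallness gives positivity -/
lemma Good.pos (G : Good σ δ α R C n) {h : Fin 3 → ℝ} (hh : ‖h‖ ≤ R) (y : ℝ)
    (hs : ∑ j, sR (Real.sqrt n) (qN σ δ α n) (sN σ δ α n) j y ^ 4 + bR R C (Real.sqrt n) (qN σ δ α n) (bN σ δ α n) y ^ 2 < (1 / (8 * R)) ^ 4) :
    0 < QN σ δ α n h (Real.sqrt n * y) := by
  have hR := G.loc.R1
  have hE := G.loc.rowE G.r0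
  set s := fun j => sR (Real.sqrt n) (qN σ δ α n) (sN σ δ α n) j y with hsd
  set B := bR R C (Real.sqrt n) (qN σ δ α n) (bN σ δ α n) y with hB
  set a := 1 / (8 * R) with ha
  have ha0 : 0 < a := by positivity
  have ha1 : a ≤ 1 := by rw [ha, div_le_one (by positivity)]; linarith
  have hB0 : 0 ≤ B := hE.nonneg y
  have h4 : ∀ j, |s j| ≤ a := by
    intro j
    have : s j ^ 4 ≤ ∑ j, s j ^ 4 := Finset.single_le_sum (f := fun j => s j ^ 4) (fun i _ => by positivity) (Finset.mem_univ j)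
    have h5 : |s j| ^ 4 ≤ a ^ 4 := by
      rw [← abs_pow, abs_of_nonneg (by positivity)]; nlinarith [sq_nonneg B]
    exact le_of_pow_le_pow_left₀ (by norm_num) ha0.le h5
  have hBa : B ≤ a := by
    have h1 : 0 ≤ ∑ j, s j ^ 4 := Finset.sum_nonneg fun i _ => by positivity
    have h2 : B ^ 2 ≤ a ^ 2 := by
      have : a ^ 4 ≤ a ^ 2 := pow_le_pow_of_le_one ha0.le ha1 (by norm_num)
      have h3 : B ^ 2 ≤ a ^ 4 := by linarith
      linarith
    exact le_of_pow_le_pow_left₀ (by norm_num) ha0.le h2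
  have hEb : |eR R (Real.sqrt n) (qN σ δ α n) (sN σ δ α n) (QN σ δ α n) h y| ≤ R * a := by
    have := hE.lip h 0 hh (by rw [norm_zero]; linarith) y
    rw [hE.zero, sub_zero, sub_zero] at this
    calc _ ≤ ‖h‖ * B := this
      _ ≤ _ := by gcongr
  have hsum : |∑ j, h j * s j| ≤ 3 * (R * a) := by
    calc |∑ j, h j * s j| ≤ ∑ j, |h j * s j| := Finset.abs_sum_le_sum_abs _ _
      _ ≤ ∑ _j : Fin 3, R * a := Finset.sum_le_sum fun j _ => by
        rw [abs_mul]
        have : |h j| ≤ R := (norm_le_pi_norm h j).trans hh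
        gcongr; exact h4 j
      _ = _ := by simp
  have hRa : R * a = 1 / 8 := by rw [ha]; field_simp
  rw [hRa] at hEb hsum
  have hq := G.loc.qpos (Real.sqrt n * y)
  have e : QN σ δ α n h (Real.sqrt n * y) = qN σ δ α n (Real.sqrt n * y) * (1 + (∑ j, h j * s j
        + eR R (Real.sqrt n) (qN σ δ α n) (sN σ δ α n) (QN σ δ α n) h y)) := by
    simp only [eR, hh, if_true, hsd, sR]
    have : ∑ j, h j * (sN σ δ α n j (Real.sqrt n * y) / qN σ δ α n (Real.sqrt n * y)) =
        (∑ j, h j * sN σ δ α n j (Real.sqrt n * y)) / qN σ δ α n (Real.sqrt n * y) := by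
      rw [Finset.sum_div]; exact Finset.sum_congr rfl fun j _ => by ring
    rw [this]
    field_simp
    ring
  rw [e]
  apply mul_pos hq
  have := abs_le.mp hEb; have := abs_le.mp hsum
  linarith

end PartG2

section PartG3
variable {σ δ α : ℝ}

lemma Imat_posDef (hσ : 0 < σ) (hδ : 0 < δ) (h0 : 0 < α) (h2 : α < 2) : (Imat ![σ, δ, α]).PosDef := by
  have hk : 0 < kappa0 σ δ α := by
    unfold kappa0
    have := cAlpha_pos h0 h2
    have : 0 < 2 - α := by linarith
    positivity
  refine Matrix.PosDef.of_dotProduct_mulVec_pos ?_ ?_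
  · ext i j
    fin_cases i <;> fin_cases j <;> simp [Imat]
  · intro v hv
    have e : star v ⬝ᵥ (Imat ![σ, δ, α]).mulVec v = 2 / σ ^ 2 * v 0 ^ 2 +
        kappa0 σ δ α * ((α / δ * v 1 + kappa1 σ δ α * v 2) ^ 2 + (1 / α ^ 2) * v 2 ^ 2) := by
      simp [Imat, Matrix.mulVec, dotProduct, Fin.sum_univ_three]; ring
    rw [e]
    by_contra hneg
    push Not at hneg
    have p1 : 0 ≤ 2 / σ ^ 2 * v 0 ^ 2 := by positivity
    have p3 : 0 ≤ (1 / α ^ 2) * v 2 ^ 2 := by positivity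
    have p2 : 0 ≤ (α / δ * v 1 + kappa1 σ δ α * v 2) ^ 2 := sq_nonneg _
    have p4 : 0 ≤ kappa0 σ δ α * ((α / δ * v 1 + kappa1 σ δ α * v 2) ^ 2 + (1 / α ^ 2) * v 2 ^ 2) := by positivity
    have z0 : 2 / σ ^ 2 * v 0 ^ 2 = 0 := by linarith
    have z1 : (α / δ * v 1 + kappa1 σ δ α * v 2) ^ 2 + (1 / α ^ 2) * v 2 ^ 2 = 0 := by
      have : kappa0 σ δ α * ((α / δ * v 1 + kappa1 σ δ α * v 2) ^ 2 + (1 / α ^ 2) * v 2 ^ 2) = 0 := by linarith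
      exact (mul_eq_zero.mp this).resolve_left hk.ne'
    have v0 : v 0 = 0 := by
      have := (mul_eq_zero.mp z0).resolve_left (by positivity)
      exact pow_eq_zero_iff (by norm_num) |>.mp this
    have v2 : v 2 = 0 := by
      have : (1 / α ^ 2) * v 2 ^ 2 = 0 := by linarith
      have := (mul_eq_zero.mp this).resolve_left (by positivity)
      exact pow_eq_zero_iff (by norm_num) |>.mp this
    have v1 : v 1 = 0 := by
      have : (α / δ * v 1 + kappa1 σ δ α * v 2) ^ 2 = 0 := by linarith
      have := pow_eq_zero_iff (by norm_num) |>.mp this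
      rw [v2, mul_zero, add_zero] at this
      exact (mul_eq_zero.mp this).resolve_left (by positivity)
    apply hv
    ext i; fin_cases i <;> simp [v0, v1, v2]

abbrev mu (σ δ α : ℝ) (n : ℕ) : Measure ℝ := muR (Real.sqrt n) (qN σ δ α n)
abbrev sF (σ δ α : ℝ) (n : ℕ) : Fin 3 → ℝ → ℝ := sR (Real.sqrt n) (qN σ δ α n) (sN σ δ α n)

lemma cov_lim (hσ : 0 < σ) (hδ : 0 < δ) (h0 : 0 < α) (h2 : α < 2) (j k : Fin 3) :
    Tendsto (fun n : ℕ => n * ∫ y, sF σ δ α n j y * sF σ δ α n k y ∂(mu σ δ α n)) atTop (𝓝 (Imat ![σ, δ, α] j k)) := by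
  obtain ⟨C, hG⟩ := ev_Good hσ hδ h0 h2 (le_refl (1:ℝ))
  refine (lim_cov hσ hδ h0 h2 j k).congr' ?_
  filter_upwards [hG] with n G
  rw [G.loc.cov G.r0]

lemma m4_lim (hσ : 0 < σ) (hδ : 0 < δ) (h0 : 0 < α) (h2 : α < 2) (j : Fin 3) :
    Tendsto (fun n : ℕ => n * ∫ y, sF σ δ α n j y ^ 4 ∂(mu σ δ α n)) atTop (𝓝 0) := by
  obtain ⟨C, hG⟩ := ev_Good hσ hδ h0 h2 (le_refl (1:ℝ))
  refine (lim_m4 hσ hδ h0 h2 j).congr' ?_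
  filter_upwards [hG] with n G
  rw [G.loc.m4' G.r0]

lemma row_ev (hσ : 0 < σ) (hδ : 0 < δ) (h0 : 0 < α) (h2 : α < 2) :
    ∀ᶠ n : ℕ in atTop, Row (mu σ δ α n) (sF σ δ α n) := by
  obtain ⟨C, hG⟩ := ev_Good hσ hδ h0 h2 (le_refl (1:ℝ))
  filter_upwards [hG] with n G
  exact G.loc.row G.r0

lemma part_ii (hσ : 0 < σ) (hδ : 0 < δ) (h0 : 0 < α) (h2 : α < 2) (B : Matrix (Fin 3) (Fin 3) ℝ)
    (hB : B * Bᵀ = Imat ![σ, δ, α]) (F : BoundedContinuousFunction (Fin 3 → ℝ) ℝ) :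
    Tendsto (fun n : ℕ => ∫ x, F ((un n ![σ, δ, α])ᵀ.mulVec (scoreVec n ![σ, δ, α] x)) ∂ Pn n ![σ, δ, α])
      atTop (𝓝 (∫ v, F v ∂ stdGauss3.map B.mulVec)) := by
  obtain ⟨C, hG⟩ := ev_Good hσ hδ h0 h2 (le_refl (1:ℝ))
  refine (clt_main (row_ev hσ hδ h0 h2) (cov_lim hσ hδ h0 h2) (m4_lim hσ hδ h0 h2) B hB F).congr' ?_
  filter_upwards [hG] with n G
  rw [G.pn]
  simp_rw [G.score]

def mm (n : ℕ) : ℕ := ⌈Real.log n ^ 4⌉₊ + 1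

lemma mm_ge (n : ℕ) : Real.log n ^ 4 ≤ mm n := by
  unfold mm; push_cast; linarith [Nat.le_ceil (Real.log n ^ 4)]

lemma mm_le {n : ℕ} (h : 1 ≤ Real.log n) : (mm n : ℝ) + 1 ≤ 4 * Real.log n ^ 4 := by
  unfold mm; push_cast
  have := Nat.ceil_lt_add_one (a := Real.log n ^ 4) (by positivity)
  have : 1 ≤ Real.log n ^ 4 := one_le_pow₀ h
  linarith

abbrev bF (σ δ α R C : ℝ) (n : ℕ) : ℝ → ℝ := bR R C (Real.sqrt n) (qN σ δ α n) (bN σ δ α n)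
abbrev eF (σ δ α R : ℝ) (n : ℕ) : (Fin 3 → ℝ) → ℝ → ℝ := eR R (Real.sqrt n) (qN σ δ α n) (sN σ δ α n) (QN σ δ α n)

lemma B2_lim (hσ : 0 < σ) (hδ : 0 < δ) (h0 : 0 < α) (h2 : α < 2) {R C : ℝ} (hG : ∀ᶠ n in atTop, Good σ δ α R C n) :
    Tendsto (fun n : ℕ => ((mm n : ℝ) + 1) ^ 3 * (n * ∫ y, bF σ δ α R C n y ^ 2 ∂(mu σ δ α n))) atTop (𝓝 0) := by
  have l := (lim_bb2 hσ hδ h0 h2 12).const_mul (64 * (C * R) ^ 2)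
  rw [mul_zero] at l
  refine squeeze_zero' ?_ ?_ l
  · exact Eventually.of_forall fun n => mul_nonneg (by positivity) (mul_nonneg (by positivity) (integral_nonneg fun y => sq_nonneg _))
  · filter_upwards [hG] with n G
    rw [G.loc.B2 G.r0]
    have hm := mm_le G.bas.L1
    have e : Real.log n ^ (12:ℝ) = Real.log n ^ 12 := by rw [← Real.rpow_natCast]; norm_num
    rw [e]
    have hI : 0 ≤ ∫ x, bN σ δ α n x ^ 2 / qN σ δ α n x := integral_nonneg fun x => by have := G.loc.qpos x; positivity
    calc ((mm n : ℝ) + 1) ^ 3 * (n * ((C * R) ^ 2 * ∫ x, bN σ δ α n x ^ 2 / qN σ δ α n x))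
        ≤ (4 * Real.log n ^ 4) ^ 3 * (n * ((C * R) ^ 2 * ∫ x, bN σ δ α n x ^ 2 / qN σ δ α n x)) := by gcongr
      _ = _ := by simp only [bN]; ring

lemma B1_lim (hσ : 0 < σ) (hδ : 0 < δ) (h0 : 0 < α) (h2 : α < 2) {R C : ℝ} (hG : ∀ᶠ n in atTop, Good σ δ α R C n) :
    Tendsto (fun n : ℕ => (n * ∫ y, bF σ δ α R C n y ∂(mu σ δ α n)) / mm n) atTop (𝓝 0) := by
  obtain ⟨K, hK⟩ := bb1_le hσ hδ h0 h2
  have l : Tendsto (fun n : ℕ => (C * R * K) * (Real.log n)⁻¹) atTop (𝓝 ((C * R * K) * 0)) :=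
    (tendsto_inv_atTop_zero.comp (Real.tendsto_log_atTop.comp tendsto_natCast_atTop_atTop)).const_mul _
  rw [mul_zero] at l
  refine squeeze_zero' ?_ ?_ l
  · filter_upwards [hG] with n G
    have := (G.loc.rowE G.r0).nonneg
    exact div_nonneg (mul_nonneg (by positivity) (integral_nonneg this)) (by positivity)
  · filter_upwards [hG, hK] with n G hK
    rw [G.loc.B1 G.r0]
    have hR := G.loc.R1; have hC := G.loc.C0; have hL := G.bas.L1
    have e : Real.log n ^ (3:ℝ) = Real.log n ^ 3 := by rw [← Real.rpow_natCast]; norm_num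
    rw [e] at hK
    have hm := mm_ge n
    have hm0 : (0:ℝ) < mm n := lt_of_lt_of_le (by positivity) hm
    have hI : 0 ≤ ∫ x, bN σ δ α n x := integral_nonneg G.loc.b0
    rw [div_le_iff₀ hm0]
    have hK0 : 0 ≤ K := by
      have : 0 ≤ K * Real.log n ^ 3 := le_trans (mul_nonneg (by positivity) hI) hK
      by_contra hneg; push Not at hneg
      have : K * Real.log n ^ 3 < 0 := mul_neg_of_neg_of_pos hneg (by positivity)
      linarith
    calc n * (C * R * ∫ x, bN σ δ α n x) = C * R * (n * ∫ x, bN σ δ α n x) := by ring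
      _ ≤ C * R * (K * Real.log n ^ 3) := mul_le_mul_of_nonneg_left hK (by positivity)
      _ = C * R * K * (Real.log n)⁻¹ * Real.log n ^ 4 := by field_simp
      _ ≤ _ := by gcongr

lemma part_i (hσ : 0 < σ) (hδ : 0 < δ) (h0 : 0 < α) (h2 : α < 2) {K : Set (Fin 3 → ℝ)} (hK : IsCompact K) :
    (∀ᶠ n : ℕ in atTop, ∀ h ∈ K,
          0 < (![σ, δ, α] + (un n ![σ, δ, α]).mulVec h) 0 ∧
          0 < (![σ, δ, α] + (un n ![σ, δ, α]).mulVec h) 1 ∧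
          (![σ, δ, α] + (un n ![σ, δ, α]).mulVec h) 2 ∈ Set.Ioo (0 : ℝ) 2) ∧
      (∀ ε > (0 : ℝ),
        Tendsto
          (fun n : ℕ => Pn n ![σ, δ, α]
            {x | ε < ⨆ h ∈ K,
              |logLik n (![σ, δ, α] + (un n ![σ, δ, α]).mulVec h) x
                - logLik n ![σ, δ, α] x
                - ∑ j, h j * ((un n ![σ, δ, α])ᵀ.mulVec (scoreVec n ![σ, δ, α] x)) j
                + 1 / 2 * ∑ i, ∑ j, h i * Imat ![σ, δ, α] i j * h j|})
          atTop (𝓝 0)) := by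
  obtain ⟨R, hR, hKR⟩ : ∃ R : ℝ, 1 ≤ R ∧ ∀ h ∈ K, ‖h‖ ≤ R := by
    obtain ⟨R, hR⟩ := hK.isBounded.exists_norm_le
    exact ⟨max R 1, le_max_right _ _, fun h hh => (hR h hh).trans (le_max_left _ _)⟩
  obtain ⟨C, hG⟩ := ev_Good hσ hδ h0 h2 hR
  constructor
  · filter_upwards [hG] with n G h hh
    obtain ⟨a1, a2, a3, a4⟩ := G.dom h (hKR h hh)
    rw [un_vec]
    exact ⟨by simpa using a1, by simpa using a2, by simpa using a3, by simpa using a4⟩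
  · intro ε hε
    have hrowE : ∀ᶠ n in atTop, RowE R (mu σ δ α n) (eF σ δ α R n) (bF σ δ α R C n) := by
      filter_upwards [hG] with n G using G.loc.rowE G.r0
    have T1 := lan_prob hR (row_ev hσ hδ h0 h2) (cov_lim hσ hδ h0 h2) (m4_lim hσ hδ h0 h2) hrowE (m := mm) (fun n => Nat.succ_pos _)
      (B2_lim hσ hδ h0 h2 hG) (B1_lim hσ hδ h0 h2 hG) hε
    set a := (1 / (8 * R)) ^ 4 with ha
    have ha0 : 0 < a := by positivity
    have B2' : Tendsto (fun n : ℕ => n * ∫ y, bF σ δ α R C n y ^ 2 ∂(mu σ δ α n)) atTop (𝓝 0) := by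
      refine squeeze_zero' ?_ ?_ (B2_lim hσ hδ h0 h2 hG)
      · exact Eventually.of_forall fun n => mul_nonneg (by positivity) (integral_nonneg fun y => sq_nonneg _)
      · refine Eventually.of_forall fun n => le_mul_of_one_le_left (mul_nonneg (by positivity) (integral_nonneg fun y => sq_nonneg _)) ?_
        exact one_le_pow₀ (by linarith [Nat.cast_nonneg (α := ℝ) (mm n)])
    have T2 : TP (mu σ δ α) (fun n => {x | a ≤ ∑ i, (∑ j, sF σ δ α n j (x i) ^ 4 + bF σ δ α R C n (x i) ^ 2)}) := by
      have l := ((tendsto_finsetSum Finset.univ fun j _ => m4_lim hσ hδ h0 h2 j).add B2').div_const a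
      simp only [Finset.sum_const_zero, add_zero, zero_div] at l
      refine TP.of_le _ l ?_
      filter_upwards [hG] with n G
      have Hr := G.loc.row G.r0
      have He := G.loc.rowE G.r0
      have := Hr.prob
      have i1 : Integrable (fun y => ∑ j, sF σ δ α n j y ^ 4) (mu σ δ α n) := integrable_finsetSum _ fun j _ => Hr.int4 j
      have i2 : Integrable (fun y => bF σ δ α R C n y ^ 2) (mu σ δ α n) := He.int2
      refine (pi_markov n (fun y => ∑ j, sF σ δ α n j y ^ 4 + bF σ δ α R C n y ^ 2) (i1.add i2)
        (fun y => add_nonneg (Finset.sum_nonneg fun j _ => by positivity) (sq_nonneg _)) ha0).trans (le_of_eq ?_)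
      rw [integral_add i1 i2, integral_finsetSum _ fun j _ => Hr.int4 j, mul_add, Finset.mul_sum]
    have T3 := T1.union T2
    have T4 : TP (mu σ δ α) (fun n => {x | ε < ⨆ h ∈ K,
              |logLik n (![σ, δ, α] + (un n ![σ, δ, α]).mulVec h) x
                - logLik n ![σ, δ, α] x
                - ∑ j, h j * ((un n ![σ, δ, α])ᵀ.mulVec (scoreVec n ![σ, δ, α] x)) j
                + 1 / 2 * ∑ i, ∑ j, h i * Imat ![σ, δ, α] i j * h j|}) := by
      refine T3.mono ?_
      filter_upwards [hG] with n G x hx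
      by_contra hno
      rw [Set.mem_union, not_or] at hno
      obtain ⟨n1, n2⟩ := hno
      simp only [Set.mem_ofPred_eq, not_exists, not_and, not_le] at n1 n2 hx
      refine absurd hx (not_lt.mpr ?_)
      refine Real.iSup_le (fun h => Real.iSup_le (fun hh => ?_) hε.le) hε.le
      have hhR := hKR h hh
      have := n1 h hhR
      rw [G.score, G.loglik hhR x]
      · exact this.le
      · intro i
        refine G.pos hhR (x i) (lt_of_le_of_lt ?_ n2)
        exact Finset.single_le_sum (f := fun i => ∑ j, sF σ δ α n j (x i) ^ 4 + bF σ δ α R C n (x i) ^ 2)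
          (fun i _ => add_nonneg (Finset.sum_nonneg fun j _ => by positivity) (sq_nonneg _)) (Finset.mem_univ i)
    unfold TP at T4
    refine T4.congr' ?_
    filter_upwards [hG] with n G
    rw [G.pn]

end PartG3

/-- the LAN property at `θ₀` with rate `u_n(θ₀)` and information `I(θ₀)`. -/
theorem statement3 (σ₀ δ₀ α₀ : ℝ) (hσ : 0 < σ₀) (hδ : 0 < δ₀) (hα : α₀ ∈ Set.Ioo (0 : ℝ) 2) :
    (∀ K : Set (Fin 3 → ℝ), IsCompact K →
      (∀ᶠ n : ℕ in atTop, ∀ h ∈ K,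
          0 < (![σ₀, δ₀, α₀] + (un n ![σ₀, δ₀, α₀]).mulVec h) 0 ∧
          0 < (![σ₀, δ₀, α₀] + (un n ![σ₀, δ₀, α₀]).mulVec h) 1 ∧
          (![σ₀, δ₀, α₀] + (un n ![σ₀, δ₀, α₀]).mulVec h) 2 ∈ Set.Ioo (0 : ℝ) 2) ∧
      (∀ ε > (0 : ℝ),
        Tendsto
          (fun n : ℕ => Pn n ![σ₀, δ₀, α₀]
            {x | ε < ⨆ h ∈ K,
              |logLik n (![σ₀, δ₀, α₀] + (un n ![σ₀, δ₀, α₀]).mulVec h) x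
                - logLik n ![σ₀, δ₀, α₀] x
                - ∑ j, h j * ((un n ![σ₀, δ₀, α₀])ᵀ.mulVec (scoreVec n ![σ₀, δ₀, α₀] x)) j
                + 1 / 2 * ∑ i, ∑ j, h i * Imat ![σ₀, δ₀, α₀] i j * h j|})
          atTop (𝓝 0))) ∧
    (Imat ![σ₀, δ₀, α₀]).PosDef ∧
    (∀ B : Matrix (Fin 3) (Fin 3) ℝ, B * Bᵀ = Imat ![σ₀, δ₀, α₀] →
      ∀ F : BoundedContinuousFunction (Fin 3 → ℝ) ℝ,
        Tendsto
          (fun n : ℕ =>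
            ∫ x, F ((un n ![σ₀, δ₀, α₀])ᵀ.mulVec (scoreVec n ![σ₀, δ₀, α₀] x))
              ∂ Pn n ![σ₀, δ₀, α₀])
          atTop (𝓝 (∫ v, F v ∂ stdGauss3.map B.mulVec))) := by
  exact ⟨fun K hK => part_i hσ hδ hα.1 hα.2 hK, Imat_posDef hσ hδ hα.1 hα.2,
    fun B hB F => part_ii hσ hδ hα.1 hα.2 B hB F⟩

end LevyLAN
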